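/- Uniformly on every compact subset of 𝔸_ρ ∖ (B ∪ ⋃_{k=1}^m a_k·(ρ,1/ρ)), the monic orthogonal polynomials satisfy Φ_n(z) = z^n (D_e(W;z)/D_e(W;∞)) (1 + (1/n) Σ_{k=1}^m a_k β_k²/(a_k − z) + O(1/n²)) + (D_i(W;0)/D_i(W;z)) ((1/n) Σ_{k=1}^m β_k ϑ_k a_k^{n+1}/(a_k − z) + O(1/n²)) as n → ∞. -/

import Mathlib

open scoped Real
open Filter MeasureTheory Metric Set Polynomial

/-- Differentiation under the integral sign for holomorphic integrands. -/
theorem hasDerivAt_integral_of_holomorphic {α : Type*} [MeasurableSpace α] {μ : Measure α}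
    {U : Set ℂ} {K : α → ℂ → ℂ} {z : ℂ} (hz : z ∈ interior U)
    (hK : ∀ᵐ a ∂μ, DifferentiableOn ℂ (K a) U)
    (hmeas : ∀ x ∈ U, AEStronglyMeasurable (fun a => K a x) μ)
    {b : α → ℝ} (hb : Integrable b μ) (hdom : ∀ᵐ a ∂μ, ∀ x ∈ U, ‖K a x‖ ≤ b a) :
    Integrable (fun a => deriv (K a) z) μ ∧
      HasDerivAt (fun x => ∫ a, K a x ∂μ) (∫ a, deriv (K a) z ∂μ) z := by
  obtain ⟨r, hr, hrU⟩ := Metric.mem_nhds_iff.1 (mem_interior_iff_mem_nhds.1 hz)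
  have hsub : ∀ x ∈ ball z (r / 2), closedBall x (r / 4) ⊆ ball z r := by
    intro x hx y hy
    rw [mem_ball] at hx ⊢
    rw [mem_closedBall] at hy
    linarith [dist_triangle y x z]
  have hmem : ∀ x ∈ ball z r, U ∈ nhds x := fun x hx =>
    mem_of_superset (isOpen_ball.mem_nhds hx) hrU
  have hzU : z ∈ U := interior_subset hz
  refine hasDerivAt_integral_of_dominated_loc_of_deriv_le
    (F' := fun x a => deriv (K a) x) (bound := fun a => b a / (r / 4))
    (ball_mem_nhds z (half_pos hr)) ?_ ?_ ?_ ?_ (hb.div_const _) ?_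
  · filter_upwards [mem_interior_iff_mem_nhds.1 hz] with x hx using hmeas x hx
  · exact hb.mono' (hmeas z hzU) (hdom.mono fun a ha => ha z hzU)
  · -- the derivative is a limit of difference quotients
    obtain ⟨u, -, hu0, hu⟩ := exists_seq_strictAnti_tendsto' (show (0 : ℝ) < r by exact hr)
    have hlim : ∀ᵐ a ∂μ, Tendsto (fun n : ℕ => ((u n : ℂ))⁻¹ • (K a (z + u n) - K a z)) atTop
        (nhds (deriv (K a) z)) := by
      filter_upwards [hK] with a ha
      have h1 : HasDerivAt (K a) (deriv (K a) z) z :=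
        (ha.differentiableAt (hmem z (mem_ball_self hr))).hasDerivAt
      refine h1.tendsto_slope_zero.comp ?_
      rw [tendsto_nhdsWithin_iff]
      refine ⟨?_, Eventually.of_forall fun n => ?_⟩
      · have : Tendsto (fun n => ((u n : ℝ) : ℂ)) atTop (nhds ((0 : ℝ) : ℂ)) :=
          (Complex.continuous_ofReal.tendsto 0).comp hu
        simpa using this
      · simpa using (hu0 n).1.ne'
    refine aestronglyMeasurable_of_tendsto_ae atTop (fun n => ?_) hlim
    refine ((hmeas (z + u n) (hrU ?_)).sub (hmeas z hzU)).const_smul ((u n : ℂ)⁻¹)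
    rw [mem_ball, dist_eq_norm, add_sub_cancel_left, Complex.norm_real, Real.norm_eq_abs,
      abs_of_pos (hu0 n).1]
    exact (hu0 n).2
  · filter_upwards [hK, hdom] with a ha hd x hx
    refine Complex.norm_deriv_le_of_forall_mem_sphere_norm_le (by positivity) ?_ ?_
    · refine DifferentiableOn.diffContOnCl ?_
      rw [closure_ball _ (by positivity)]
      exact ha.mono ((hsub x hx).trans hrU)
    · intro y hy
      exact hd y (hrU (hsub x hx (sphere_subset_closedBall hy)))
  · filter_upwards [hK] with a ha x hx
    exact (ha.differentiableAt (hmem x (ball_subset_ball (by linarith) hx))).hasDerivAt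

theorem differentiableOn_integral_of_holomorphic {α : Type*} [MeasurableSpace α] {μ : Measure α}
    {U : Set ℂ} (hU : IsOpen U) {K : α → ℂ → ℂ}
    (hK : ∀ᵐ a ∂μ, DifferentiableOn ℂ (K a) U)
    (hmeas : ∀ x ∈ U, AEStronglyMeasurable (fun a => K a x) μ)
    (hdom : ∀ z ∈ U, ∃ V ∈ nhds z, ∃ b : α → ℝ, Integrable b μ ∧
      ∀ᵐ a ∂μ, ∀ x ∈ V, ‖K a x‖ ≤ b a) :
    DifferentiableOn ℂ (fun x => ∫ a, K a x ∂μ) U := by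
  intro z hz
  obtain ⟨V, hV, b, hb, hd⟩ := hdom z hz
  refine (hasDerivAt_integral_of_holomorphic (U := U ∩ V) (z := z) (K := K) (b := b) ?_ ?_ ?_ hb
    ?_).2.differentiableAt.differentiableWithinAt
  · exact mem_interior_iff_mem_nhds.2 (inter_mem (hU.mem_nhds hz) hV)
  · exact hK.mono fun a ha => ha.mono inter_subset_left
  · exact fun x hx => hmeas x hx.1
  · exact hd.mono fun a ha x hx => ha x hx.2

/-- A holomorphic function on a disc which is controlled on the boundary circle by an inverse power
of the distance to the vertical diameter is bounded on the disc of half the radius. -/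
theorem norm_le_of_norm_mul_abs_re_pow_le {h : ℂ → ℂ} {c : ℂ} {R B : ℝ} {k : ℕ} (hR : 0 < R)
    (hh : DiffContOnCl ℂ h (ball c R))
    (hB : ∀ z ∈ sphere c R, ‖h z‖ * |(z - c).re| ^ k ≤ B) :
    ∀ z ∈ closedBall c (R / 2), ‖h z‖ ≤ B * (3 / R) ^ k := by
  intro z hz
  set g : ℂ → ℂ := fun z => h z * ((z - c) ^ 2 + (R : ℂ) ^ 2) ^ k
  have hg : DiffContOnCl ℂ g (ball c R) := by
    have : DiffContOnCl ℂ (fun z : ℂ => ((z - c) ^ 2 + (R : ℂ) ^ 2) ^ k) (ball c R) :=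
      Differentiable.diffContOnCl (by fun_prop)
    exact hh.smul this
  have hbd : ∀ y ∈ frontier (ball c R), ‖g y‖ ≤ B * (2 * R) ^ k := by
    intro y hy
    rw [frontier_ball _ hR.ne'] at hy
    have hnorm : ‖y - c‖ = R := by simpa [dist_eq_norm] using hy
    have hq : ‖(y - c) ^ 2 + (R : ℂ) ^ 2‖ = 2 * R * |(y - c).re| := by
      have h1 : (R : ℂ) ^ 2 = (y - c) * (starRingEnd ℂ) (y - c) := by
        rw [Complex.mul_conj, Complex.normSq_eq_norm_sq, hnorm]; push_cast; rfl
      have h2 : (y - c) ^ 2 + (R : ℂ) ^ 2 = (y - c) * ((2 * (y - c).re : ℝ) : ℂ) := by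
        rw [h1, ← Complex.add_conj]; ring
      rw [h2, norm_mul, hnorm, Complex.norm_real, Real.norm_eq_abs, abs_mul]
      norm_num; ring
    simp only [g, norm_mul, norm_pow, hq]
    calc ‖h y‖ * (2 * R * |(y - c).re|) ^ k = (‖h y‖ * |(y - c).re| ^ k) * (2 * R) ^ k := by
          rw [mul_pow]; ring
      _ ≤ B * (2 * R) ^ k := by
          gcongr
          exact hB y hy
  have hz' : ‖z - c‖ ≤ R / 2 := by simpa [dist_eq_norm] using hz
  have hmax := Complex.norm_le_of_forall_mem_frontier_norm_le isBounded_ball hg hbd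
    (subset_closure (show z ∈ ball c R by rw [mem_ball, dist_eq_norm]; linarith))
  have hlow : 3 / 4 * R ^ 2 ≤ ‖(z - c) ^ 2 + (R : ℂ) ^ 2‖ := by
    have h1 : ‖(R : ℂ) ^ 2‖ = R ^ 2 := by
      rw [norm_pow, Complex.norm_real, Real.norm_eq_abs, sq_abs]
    have h2 : ‖(z - c) ^ 2‖ ≤ (R / 2) ^ 2 := by
      rw [norm_pow]; gcongr
    have h3 : ‖(R : ℂ) ^ 2‖ ≤ ‖(z - c) ^ 2 + (R : ℂ) ^ 2‖ + ‖(z - c) ^ 2‖ := by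
      calc ‖(R : ℂ) ^ 2‖ = ‖((z - c) ^ 2 + (R : ℂ) ^ 2) - (z - c) ^ 2‖ := by ring_nf
        _ ≤ _ := norm_sub_le _ _
    nlinarith
  have hB0 : 0 ≤ B := by
    have := hB (c + R) (by simp [abs_of_pos hR])
    exact le_trans (by positivity) this
  have hpos : 0 < (3 / 4 * R ^ 2) ^ k := by positivity
  have h4 : ‖h z‖ * (3 / 4 * R ^ 2) ^ k ≤ B * (2 * R) ^ k := by
    refine le_trans ?_ hmax
    simp only [g, norm_mul, norm_pow]
    gcongr
  have h5 : (2 * R) ^ k ≤ (3 / R) ^ k * (3 / 4 * R ^ 2) ^ k := by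
    rw [← mul_pow]
    have : 3 / R * (3 / 4 * R ^ 2) = 9 / 4 * R := by field_simp; ring
    rw [this]
    gcongr
    norm_num
  refine le_of_mul_le_mul_right (h4.trans ?_) hpos
  rw [mul_assoc]
  gcongr

/-- The version of `norm_le_of_norm_mul_abs_re_pow_le` for the horizontal diameter. -/
theorem norm_le_of_norm_mul_abs_im_pow_le {h : ℂ → ℂ} {c : ℂ} {R B : ℝ} {k : ℕ} (hR : 0 < R)
    (hh : DiffContOnCl ℂ h (ball c R))
    (hB : ∀ z ∈ sphere c R, ‖h z‖ * |(z - c).im| ^ k ≤ B) :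
    ∀ z ∈ closedBall c (R / 2), ‖h z‖ ≤ B * (3 / R) ^ k := by
  intro z hz
  set e : ℂ → ℂ := fun z => c + Complex.I * (z - c)
  have he : ∀ y, dist (e y) c = dist y c := fun y => by
    simp [e, dist_eq_norm]
  have hcomp : DiffContOnCl ℂ (h ∘ e) (ball c R) :=
    hh.comp (Differentiable.diffContOnCl (by fun_prop)) fun y hy => by
      rw [mem_ball, he]; exact hy
  have := norm_le_of_norm_mul_abs_re_pow_le (h := h ∘ e) (k := k) (B := B) hR hcomp ?_
    (c - Complex.I * (z - c)) ?_
  · have h2 : e (c - Complex.I * (z - c)) = z := by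
      simp only [e]
      linear_combination (-(z - c)) * Complex.I_mul_I
    simpa [h2] using this
  · intro y hy
    have h1 : (e y - c).im = (y - c).re := by simp [e]
    rw [← h1]
    exact hB _ (by rw [mem_sphere, he]; exact hy)
  · simpa [dist_eq_norm] using hz

/-- Removable singularity theorem for functions `o (1 / |Re z|)`. -/
theorem exists_differentiableOn_ball_of_norm_mul_abs_re_lt {h : ℂ → ℂ} {r : ℝ} (hr : 0 < r)
    (hh : DifferentiableOn ℂ h (ball 0 r \ {0}))
    (hlim : ∀ ε > 0, ∃ s > 0, ∀ z : ℂ, z.re ≠ 0 → ‖z‖ < s → ‖h z‖ * |z.re| ≤ ε) :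
    ∃ g : ℂ → ℂ, DifferentiableOn ℂ g (ball 0 r) ∧ ∀ z ∈ ball (0 : ℂ) r \ {0}, g z = h z := by
  have hbound : ∀ ε > 0, ∃ s > 0, ∀ z : ℂ, z ≠ 0 → ‖z‖ < s → ‖h z‖ ≤ ε * ‖z‖⁻¹ := by
    intro ε hε
    obtain ⟨s, hs, hsε⟩ := hlim (ε / 6) (by positivity)
    refine ⟨min (s / 2) (r / 2), by positivity, fun z hz hzs => ?_⟩
    have hz0 : 0 < ‖z‖ := norm_pos_iff.2 hz
    have hzs1 : ‖z‖ < s / 2 := hzs.trans_le (min_le_left _ _)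
    have hzs2 : ‖z‖ < r / 2 := hzs.trans_le (min_le_right _ _)
    rcases le_or_gt (‖z‖ / 4) |z.re| with hre | hre
    · have hne : z.re ≠ 0 := fun h0 => by rw [h0, abs_zero] at hre; linarith
      have h1 := hsε z hne (by linarith)
      have h2 : ‖h z‖ * (‖z‖ / 4) ≤ ε / 6 := le_trans (by gcongr) h1
      rw [← div_eq_mul_inv, le_div_iff₀ hz0]
      linarith
    · set c : ℂ := Complex.I * z.im
      have hzc : ‖z - c‖ = |z.re| := by
        have : z - c = (z.re : ℂ) := by
          apply Complex.ext <;> simp [c]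
        rw [this, Complex.norm_real, Real.norm_eq_abs]
      have hc1 : ‖z‖ * (3 / 4) ≤ ‖c‖ := by
        have := norm_le_norm_add_norm_sub c z
        rw [norm_sub_rev] at hzc
        linarith
      have hc2 : ‖c‖ ≤ ‖z‖ := by
        simp only [c, norm_mul, Complex.norm_I, one_mul, Complex.norm_real, Real.norm_eq_abs]
        exact Complex.abs_im_le_norm z
      have hsub : closedBall c (‖z‖ / 2) ⊆ ball 0 r \ {0} := by
        intro y hy
        have hy' : ‖y - c‖ ≤ ‖z‖ / 2 := by simpa [dist_eq_norm] using hy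
        constructor
        · rw [mem_ball, dist_zero_right]
          have : ‖y‖ ≤ ‖y - c‖ + ‖c‖ := by simpa using norm_add_le (y - c) c
          linarith
        · rintro rfl
          simp at hy'
          linarith
      have hd : DiffContOnCl ℂ h (ball c (‖z‖ / 2)) := by
        refine DifferentiableOn.diffContOnCl ?_
        rw [closure_ball _ (by positivity)]
        exact hh.mono hsub
      have := norm_le_of_norm_mul_abs_re_pow_le (k := 1) (B := ε / 6) (half_pos hz0) hd ?_ z ?_
      · refine this.trans (le_of_eq ?_)
        field_simp
        norm_num
      · intro y hy
        have hy' : ‖y - c‖ = ‖z‖ / 2 := by simpa [dist_eq_norm] using hy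
        have hre' : (y - c).re = y.re := by simp [c]
        rw [hre', pow_one]
        by_cases h0 : y.re = 0
        · rw [h0, abs_zero, mul_zero]; positivity
        · refine hsε y h0 ?_
          have : ‖y‖ ≤ ‖y - c‖ + ‖c‖ := by simpa using norm_add_le (y - c) c
          linarith
      · rw [mem_closedBall, dist_eq_norm, hzc]
        linarith
  have ho : (fun z => h z - h 0) =o[nhdsWithin 0 {0}ᶜ] fun z => (z - 0)⁻¹ := by
    refine Asymptotics.IsLittleO.sub ?_ ?_
    · rw [Asymptotics.isLittleO_iff]
      intro ε hε
      obtain ⟨s, hs, hb⟩ := hbound ε hε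
      have : ball (0 : ℂ) s ∈ nhdsWithin (0 : ℂ) {0}ᶜ := mem_nhdsWithin_of_mem_nhds (ball_mem_nhds _ hs)
      filter_upwards [this, self_mem_nhdsWithin] with z hz hz0
      rw [sub_zero, norm_inv]
      exact hb z hz0 (by simpa using hz)
    · rw [Asymptotics.isLittleO_const_left]
      right
      simp only [sub_zero, Function.comp_def, norm_inv]
      exact (tendsto_norm_nhdsNE_zero (E := ℂ)).inv_tendsto_nhdsGT_zero
  refine ⟨_, Complex.differentiableOn_update_limUnder_of_isLittleO (ball_mem_nhds _ hr) hh ho, ?_⟩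
  intro z hz
  rw [Function.update_of_ne hz.2]

/-- Circle integrals around a common centre differ by at most the size of the antiholomorphic
derivative times the difference of the radii. -/
theorem norm_circle_integral_sub_le {h : ℂ → ℂ} (hh : ContDiff ℝ 1 h) {z : ℂ} {r R M : ℝ}
    (hr : 0 < r) (hrR : r ≤ R)
    (hM : ∀ y, r ≤ ‖y - z‖ → ‖y - z‖ ≤ R → ∀ v,
      ‖fderiv ℝ h y v + Complex.I * fderiv ℝ h y (Complex.I * v)‖ ≤ M * ‖v‖) :
    ‖(∫ θ in (0 : ℝ)..(2 * π), h (z + R * Complex.exp (θ * Complex.I))) -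
      ∫ θ in (0 : ℝ)..(2 * π), h (z + r * Complex.exp (θ * Complex.I))‖ ≤
      2 * π * M * (R - r) := by
  have hR : 0 < R := hr.trans_le hrR
  set f : ℂ → ℂ := fun s => h (z + Complex.exp s)
  have hexp : ContDiff ℝ 1 Complex.exp :=
    ContDiff.restrict_scalars (𝕜 := ℝ) (𝕜' := ℂ) Complex.contDiff_exp
  have hf : ContDiff ℝ 1 f := hh.comp (contDiff_const.add hexp)
  have hfd : ∀ s, HasFDerivAt f (fderiv ℝ f s) s := fun s =>
    (hf.differentiable (by norm_num) s).hasFDerivAt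
  have hfderiv : ∀ s v, fderiv ℝ f s v = fderiv ℝ h (z + Complex.exp s) (Complex.exp s * v) := by
    intro s v
    have h1 : HasFDerivAt (fun s => z + Complex.exp s)
        ((Complex.exp s • (1 : ℂ →L[ℂ] ℂ)).restrictScalars ℝ) s :=
      (((Complex.hasDerivAt_exp s).complexToReal_fderiv).const_add z)
    have h2 := ((hh.differentiable (by norm_num) (z + Complex.exp s)).hasFDerivAt).comp s h1
    have h3 := h2.fderiv
    change fderiv ℝ (h ∘ fun s => z + Complex.exp s) s v = _
    rw [h3]
    simp
  have hcont : Continuous fun s => Complex.I • fderiv ℝ f s 1 - fderiv ℝ f s Complex.I := by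
    have := hf.continuous_fderiv (by norm_num)
    fun_prop
  have key := Complex.integral_boundary_rect_of_hasFDerivAt_real_off_countable f (fderiv ℝ f)
    (Real.log r) (Real.log R + (2 * π : ℝ) * Complex.I) ∅ countable_empty
    hf.continuous.continuousOn (fun x _ => hfd x)
    (hcont.continuousOn.integrableOn_compact (isCompact_uIcc.reProdIm isCompact_uIcc))
  have e1 : ∀ x : ℝ, f (x + (((Real.log R + (2 * π : ℝ) * Complex.I : ℂ)).im : ℝ) * Complex.I) =
      f (x + (((Real.log r : ℝ) : ℂ).im : ℝ) * Complex.I) := by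
    intro x
    simp only [f]
    congr 2
    rw [Complex.exp_add, Complex.exp_add]
    simp [Complex.exp_two_pi_mul_I]
  simp only [e1] at key
  simp only [sub_self, zero_add] at key
  have e2 : ∀ (x : ℝ), 0 < x → ∀ y : ℝ, f ((Real.log x : ℝ) + y * Complex.I) =
      h (z + x * Complex.exp (y * Complex.I)) := by
    intro x hx y
    simp only [f, Complex.exp_add]
    rw [← Complex.ofReal_exp, Real.exp_log hx]
  have re1 : (Real.log R + (2 * π : ℝ) * Complex.I : ℂ).re = Real.log R := by simp
  have im1 : (Real.log R + (2 * π : ℝ) * Complex.I : ℂ).im = 2 * π := by simp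
  rw [re1, im1, Complex.ofReal_re, Complex.ofReal_im] at key
  simp only [e2 R hR, e2 r hr] at key
  rw [← smul_sub] at key
  have hnorm := congrArg norm key
  rw [norm_smul, Complex.norm_I, one_mul] at hnorm
  rw [hnorm]
  have hlog : Real.log r ≤ Real.log R := Real.log_le_log hr hrR
  have hpi : (0 : ℝ) ≤ 2 * π := by positivity
  have hin : ∀ x ∈ Set.Icc (Real.log r) (Real.log R), ∀ y : ℝ,
      ‖Complex.I • fderiv ℝ f (x + y * Complex.I) 1 - fderiv ℝ f (x + y * Complex.I) Complex.I‖ ≤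
        M * Real.exp x := by
    intro x hx y
    set s : ℂ := x + y * Complex.I
    have hs : ‖Complex.exp s‖ = Real.exp x := by
      rw [Complex.norm_exp]; simp [s]
    have h1 : r ≤ Real.exp x := by
      rw [← Real.exp_log hr]; exact Real.exp_le_exp.2 hx.1
    have h2 : Real.exp x ≤ R := by
      rw [← Real.exp_log hR]; exact Real.exp_le_exp.2 hx.2
    have := hM (z + Complex.exp s) (by simpa [hs] using h1) (by simpa [hs] using h2)
      (Complex.exp s)
    rw [hs] at this
    refine le_trans (le_of_eq ?_) this
    rw [hfderiv, hfderiv, mul_one, smul_eq_mul, mul_comm (Complex.exp s)]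
    set A := fderiv ℝ h (z + Complex.exp s) (Complex.exp s)
    set B := fderiv ℝ h (z + Complex.exp s) (Complex.I * Complex.exp s)
    have : Complex.I * A - B = Complex.I * (A + Complex.I * B) := by
      linear_combination (-B) * Complex.I_mul_I
    rw [this, norm_mul, Complex.norm_I, one_mul]
  have hout : ∀ x ∈ Set.Icc (Real.log r) (Real.log R),
      ‖∫ y in (0 : ℝ)..(2 * π), (Complex.I • fderiv ℝ f (x + y * Complex.I) 1 -
        fderiv ℝ f (x + y * Complex.I) Complex.I)‖ ≤ 2 * π * M * Real.exp x := by
    intro x hx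
    refine (intervalIntegral.norm_integral_le_of_norm_le_const (C := M * Real.exp x)
      fun y _ => hin x hx y).trans (le_of_eq ?_)
    rw [sub_zero, abs_of_nonneg hpi]; ring
  refine (intervalIntegral.norm_integral_le_of_norm_le (g := fun x => 2 * π * M * Real.exp x) hlog
    (Eventually.of_forall fun x hx => hout x ⟨hx.1.le, hx.2⟩)
    (Continuous.intervalIntegrable (by fun_prop) _ _)).trans (le_of_eq ?_)
  rw [intervalIntegral.integral_const_mul, integral_exp, Real.exp_log hR, Real.exp_log hr]

theorem norm_circle_integral_sub_const_le {h : ℂ → ℂ} (hh : Continuous h) {z c : ℂ} {r ε : ℝ}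
    (hr : 0 ≤ r) (hε : ∀ y, ‖y - z‖ = r → ‖h y - c‖ ≤ ε) :
    ‖(∫ θ in (0 : ℝ)..(2 * π), h (z + r * Complex.exp (θ * Complex.I))) - 2 * π * c‖ ≤
      2 * π * ε := by
  have hpi : (0 : ℝ) ≤ 2 * π := by positivity
  have : (2 * π * c : ℂ) = ∫ θ in (0 : ℝ)..(2 * π), c := by
    rw [intervalIntegral.integral_const, sub_zero, Complex.real_smul]; push_cast; ring
  rw [this, ← intervalIntegral.integral_sub (Continuous.intervalIntegrable (by fun_prop) _ _)
    (by simp)]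
  refine (intervalIntegral.norm_integral_le_of_norm_le_const (C := ε) fun θ _ => ?_).trans
    (le_of_eq ?_)
  · refine hε _ ?_
    rw [add_sub_cancel_left, norm_mul, Complex.norm_exp_ofReal_mul_I, mul_one, Complex.norm_real,
      Real.norm_eq_abs, abs_of_nonneg hr]
  · rw [sub_zero, abs_of_nonneg hpi]; ring

/-- Approximate Liouville theorem: holomorphic functions on the members of a finite open cover of
the plane which nearly agree on overlaps are all nearly equal to the value at infinity. -/
theorem exists_norm_sub_le_of_cover {ι : Type*} [Fintype ι] {U : ι → Set ℂ}
    (hU : ∀ i, IsOpen (U i)) (hcov : ∀ z, ∃ i, z ∈ U i) (i₀ : ι) {R₀ : ℝ} (hR₀ : 0 < R₀)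
    (hb : ∀ i, i ≠ i₀ → U i ⊆ ball 0 R₀) {D : Set ℂ} (hD : Dense D) :
    ∃ C : ℝ, 0 < C ∧ ∀ ε : ℝ, 0 ≤ ε → ∀ f : ι → ℂ → ℂ, (∀ i, DifferentiableOn ℂ (f i) (U i)) →
      (∀ i j, ∀ z ∈ U i ∩ U j ∩ D, ‖f i z - f j z‖ ≤ ε) →
      ∀ c, Tendsto (f i₀) (Bornology.cobounded ℂ) (nhds c) →
      ∀ i, ∀ z ∈ U i, ‖z‖ < R₀ → ‖f i z - c‖ ≤ C * ε := by
  classical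
  obtain ⟨χ, hχ⟩ := SmoothPartitionOfUnity.exists_isSubordinate (modelWithCornersSelf ℝ ℂ)
    isClosed_univ U hU (fun z _ => mem_iUnion.2 (hcov z))
  set ch : ι → ℂ → ℂ := fun i x => ((χ i x : ℝ) : ℂ)
  have hch : ∀ i, ContDiff ℝ 1 (ch i) := fun i =>
    Complex.ofRealCLM.contDiff.comp (((χ i).contMDiff.contDiff).of_le (by exact_mod_cast le_top))
  have hsum : ∀ x, ∑ i, ch i x = 1 := by
    intro x
    have := χ.sum_eq_one (mem_univ x)
    rw [finsum_eq_sum_of_fintype] at this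
    simp only [ch]
    exact_mod_cast this
  have hzero : ∀ i x, x ∉ U i → ch i =ᶠ[nhds x] fun _ => 0 := by
    intro i x hx
    have h1 : x ∉ tsupport (χ i) := fun h => hx (hχ i h)
    have h2 := notMem_tsupport_iff_eventuallyEq.1 h1
    filter_upwards [h2] with y hy
    simp [ch, hy]
  have hLzero : ∀ i x, x ∉ U i → fderiv ℝ (ch i) x = 0 := by
    intro i x hx
    rw [(hzero i x hx).fderiv_eq]; simp
  have hLsum : ∀ x, ∑ i, fderiv ℝ (ch i) x = 0 := by
    intro x
    rw [← fderiv_fun_sum fun i _ => (hch i).differentiable (by norm_num) x]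
    simp [hsum]
  obtain ⟨M, hM⟩ := (isCompact_closedBall (0 : ℂ) R₀).exists_bound_of_continuousOn
    (f := fun x => ∑ i, ‖fderiv ℝ (ch i) x‖)
    (continuous_finsetSum _ fun i _ =>
      ((hch i).continuous_fderiv (by norm_num)).norm).continuousOn
  have hM0 : 0 ≤ M := (norm_nonneg _).trans (hM 0 (by simp [hR₀.le]))
  refine ⟨1 + 4 * M * R₀, by positivity, fun ε hε f hf hfD c hc => ?_⟩
  have hfU : ∀ i j, ∀ z ∈ U i ∩ U j, ‖f i z - f j z‖ ≤ ε := by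
    intro i j z hz
    have hopen : IsOpen (U i ∩ U j) := (hU i).inter (hU j)
    have hcl : z ∈ closure (U i ∩ U j ∩ D) := hD.open_subset_closure_inter hopen hz
    have hcont : ContinuousWithinAt (fun z => ‖f i z - f j z‖) (U i ∩ U j ∩ D) z :=
      ((((hf i).continuousOn z hz.1).mono (fun y hy => hy.1.1)).sub
        (((hf j).continuousOn z hz.2).mono (fun y hy => hy.1.2))).norm
    exact hcont.closure_le hcl continuousWithinAt_const fun y hy => hfD i j y hy
  set h : ℂ → ℂ := fun y => ∑ i, ch i y * f i y
  have hterm : ∀ i, ContDiff ℝ 1 fun y => ch i y * f i y := by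
    intro i
    rw [contDiff_iff_contDiffAt]
    intro y
    by_cases hy : y ∈ U i
    · have : ContDiffAt ℂ 1 (f i) y :=
        ((hf i).analyticAt ((hU i).mem_nhds hy)).contDiffAt
      exact (hch i).contDiffAt.mul (ContDiffAt.restrict_scalars (𝕜 := ℝ) (𝕜' := ℂ) this)
    · refine (contDiffAt_const (c := (0 : ℂ))).congr_of_eventuallyEq ?_
      filter_upwards [hzero i y hy] with x hx
      rw [hx, zero_mul]
  have hh : ContDiff ℝ 1 h := ContDiff.sum fun i _ => hterm i
  have hterm' : ∀ i y v, fderiv ℝ (fun y => ch i y * f i y) y v =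
      ch i y * (deriv (f i) y * v) + f i y * fderiv ℝ (ch i) y v := by
    intro i y v
    by_cases hy : y ∈ U i
    · have h1 : HasFDerivAt (f i) ((deriv (f i) y • (1 : ℂ →L[ℂ] ℂ)).restrictScalars ℝ) y :=
        ((hf i).differentiableAt ((hU i).mem_nhds hy)).hasDerivAt.complexToReal_fderiv
      have h2 := ((hch i).differentiable (by norm_num) y).hasFDerivAt.mul h1
      have h3 := h2.fderiv
      change fderiv ℝ (ch i * f i) y v = _
      rw [h3]
      simp
    · have h1 : (fun y => ch i y * f i y) =ᶠ[nhds y] fun _ => 0 := by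
        filter_upwards [hzero i y hy] with x hx
        rw [hx, zero_mul]
      rw [h1.fderiv_eq, hLzero i y hy, (hzero i y hy).self_of_nhds]
      simp
  have hfd : ∀ y v, fderiv ℝ h y v =
      ∑ i, (ch i y * (deriv (f i) y * v) + f i y * fderiv ℝ (ch i) y v) := by
    intro y v
    simp only [h]
    rw [fderiv_fun_sum fun i _ => (hterm i).differentiable (by norm_num) y]
    simp only [_root_.sum_apply, hterm']
  set B : ι → ℂ → ℂ → ℂ := fun i y v =>
    fderiv ℝ (ch i) y v + Complex.I * fderiv ℝ (ch i) y (Complex.I * v)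
  have hBsum : ∀ y v, ∑ i, B i y v = 0 := by
    intro y v
    simp only [B, Finset.sum_add_distrib, ← Finset.mul_sum]
    rw [← _root_.sum_apply, ← _root_.sum_apply, hLsum]
    simp
  have hBzero : ∀ i y v, y ∉ U i → B i y v = 0 := by
    intro i y v hy
    simp [B, hLzero i y hy]
  have hbar : ∀ y v, fderiv ℝ h y v + Complex.I * fderiv ℝ h y (Complex.I * v) =
      ∑ i, f i y * B i y v := by
    intro y v
    rw [hfd, hfd, Finset.mul_sum, ← Finset.sum_add_distrib]
    refine Finset.sum_congr rfl fun i _ => ?_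
    simp only [B]
    linear_combination (ch i y * deriv (f i) y * v) * Complex.I_mul_I
  have hfar : ∀ y v, R₀ ≤ ‖y‖ →
      fderiv ℝ h y v + Complex.I * fderiv ℝ h y (Complex.I * v) = 0 := by
    intro y v hy
    have h0 : ∀ i, i ≠ i₀ → B i y v = 0 := fun i hi => hBzero i y v fun hyi => by
      have := hb i hi hyi
      rw [mem_ball, dist_zero_right] at this
      linarith
    have h1 := hBsum y v
    rw [Finset.sum_eq_single i₀ (fun i _ hi => h0 i hi) (by simp)] at h1
    rw [hbar, Finset.sum_eq_single i₀ (fun i _ hi => by rw [h0 i hi, mul_zero]) (by simp), h1,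
      mul_zero]
  have hnear : ∀ y v, ‖fderiv ℝ h y v + Complex.I * fderiv ℝ h y (Complex.I * v)‖ ≤
      2 * M * ε * ‖v‖ := by
    intro y v
    rcases le_or_gt R₀ ‖y‖ with hy | hy
    · rw [hfar y v hy, norm_zero]; positivity
    obtain ⟨j, hj⟩ := hcov y
    have h1 : ∑ i, f i y * B i y v = ∑ i, (f i y - f j y) * B i y v := by
      simp only [sub_mul, Finset.sum_sub_distrib, ← Finset.mul_sum, hBsum, mul_zero, sub_zero]
    have h2 : ∀ i, ‖(f i y - f j y) * B i y v‖ ≤ ‖fderiv ℝ (ch i) y‖ * (2 * ε * ‖v‖) := by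
      intro i
      by_cases hi : y ∈ U i
      · have hB : ‖B i y v‖ ≤ ‖fderiv ℝ (ch i) y‖ * (2 * ‖v‖) := by
          refine (norm_add_le _ _).trans ?_
          rw [norm_mul, Complex.norm_I, one_mul]
          have ha := (fderiv ℝ (ch i) y).le_opNorm v
          have hb := (fderiv ℝ (ch i) y).le_opNorm (Complex.I * v)
          rw [norm_mul, Complex.norm_I, one_mul] at hb
          linarith
        rw [norm_mul]
        calc _ ≤ ε * (‖fderiv ℝ (ch i) y‖ * (2 * ‖v‖)) := by
              gcongr
              exact hfU i j y ⟨hi, hj⟩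
          _ = _ := by ring
      · rw [hBzero i y v hi, mul_zero, norm_zero]; positivity
    rw [hbar, h1]
    refine (norm_sum_le _ _).trans ((Finset.sum_le_sum fun i _ => h2 i).trans ?_)
    rw [← Finset.sum_mul]
    have h3 := hM y (by simpa using hy.le)
    rw [Real.norm_of_nonneg (Finset.sum_nonneg fun i _ => norm_nonneg _)] at h3
    calc _ ≤ M * (2 * ε * ‖v‖) := by gcongr
      _ = _ := by ring
  have hfi₀ : ∀ y, R₀ ≤ ‖y‖ → h y = f i₀ y := by
    intro y hy
    have h0 : ∀ i, i ≠ i₀ → ch i y = 0 := fun i hi => (hzero i y fun hyi => by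
      have := hb i hi hyi
      rw [mem_ball, dist_zero_right] at this
      linarith).self_of_nhds
    have h1 := hsum y
    rw [Finset.sum_eq_single i₀ (fun i _ hi => h0 i hi) (by simp)] at h1
    simp only [h]
    rw [Finset.sum_eq_single i₀ (fun i _ hi => by rw [h0 i hi, zero_mul]) (by simp), h1, one_mul]
  have hpi : 0 < 2 * π := by positivity
  have hmain : ∀ z, ‖z‖ < R₀ → ‖h z - c‖ ≤ 4 * M * R₀ * ε := by
    intro z hz
    refine le_of_forall_pos_le_add fun e he => ?_
    obtain ⟨s, hs, hsε⟩ := Metric.continuous_iff.1 hh.continuous z (e / 2) (by positivity)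
    set r := min (s / 2) R₀
    have hr : 0 < r := by positivity
    have hrs : r < s := (min_le_left _ _).trans_lt (by linarith)
    have hrR : r ≤ 2 * R₀ := (min_le_right _ _).trans (by linarith)
    have hc' : ∀ᶠ y in Bornology.cobounded ℂ, ‖f i₀ y - c‖ ≤ e / 2 := by
      filter_upwards [hc (closedBall_mem_nhds c (half_pos he))] with y hy
      simpa [dist_eq_norm] using hy
    rw [(hasBasis_cobounded_norm).eventually_iff] at hc'
    obtain ⟨T, -, hT⟩ := hc'
    set R := max (2 * R₀) (R₀ + |T|)
    have hR1 : 2 * R₀ ≤ R := le_max_left _ _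
    have hR2 : R₀ + |T| ≤ R := le_max_right _ _
    have tri : ∀ y, ‖y - z‖ - R₀ ≤ ‖y‖ := fun y => by
      have := norm_sub_le y z
      linarith
    have b1 := norm_circle_integral_sub_le hh (z := z) (M := 0) (by positivity : 0 < 2 * R₀) hR1
      (fun y hy _ v => by
        rw [hfar y v (by linarith [tri y])]; simp)
    have b2 := norm_circle_integral_sub_le hh (z := z) (M := 2 * M * ε) hr hrR
      (fun y _ _ v => hnear y v)
    have b3 := norm_circle_integral_sub_const_le hh.continuous (z := z) (c := h z) hr.le
      (ε := e / 2) (fun y hy => by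
        have := hsε y (by rw [dist_eq_norm, hy]; exact hrs)
        rw [dist_eq_norm] at this
        exact this.le)
    have b4 := norm_circle_integral_sub_const_le hh.continuous (z := z) (c := c) (r := R)
      (by linarith) (ε := e / 2) (fun y hy => by
        have h1 := tri y
        rw [hfi₀ y (by linarith)]
        refine hT ?_
        change T ≤ ‖y‖
        linarith [le_abs_self T])
    set m1 := ∫ θ in (0 : ℝ)..(2 * π), h (z + R * Complex.exp (θ * Complex.I))
    set m2 := ∫ θ in (0 : ℝ)..(2 * π), h (z + (2 * R₀ : ℝ) * Complex.exp (θ * Complex.I))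
    set m3 := ∫ θ in (0 : ℝ)..(2 * π), h (z + r * Complex.exp (θ * Complex.I))
    have tot : ‖2 * π * (h z - c)‖ ≤ 2 * π * (4 * M * R₀ * ε + e) := by
      have e1 : 2 * π * (h z - c) = (m1 - 2 * π * c) - (m1 - m2) - (m2 - m3) -
          (m3 - 2 * π * h z) := by ring
      rw [e1]
      refine (norm_sub_le _ _).trans ?_
      have t1 := norm_sub_le (m1 - 2 * π * c - (m1 - m2)) (m2 - m3)
      have t2 := norm_sub_le (m1 - 2 * π * c) (m1 - m2)
      have b2' : 2 * π * (2 * M * ε) * (2 * R₀ - r) ≤ 2 * π * (4 * M * R₀ * ε) := by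
        have : 0 ≤ 2 * π * (2 * M * ε) * r := by positivity
        nlinarith
      linarith
    rw [norm_mul] at tot
    have e2 : ‖(2 * π : ℂ)‖ = 2 * π := by
      rw [norm_mul, Complex.norm_real, Real.norm_of_nonneg Real.pi_pos.le]; simp
    rw [e2] at tot
    exact le_of_mul_le_mul_left tot hpi
  intro i z hzi hz
  have hdiff : ‖f i z - h z‖ ≤ ε := by
    have e1 : f i z - h z = ∑ j, ch j z * (f i z - f j z) := by
      simp only [mul_sub, Finset.sum_sub_distrib, ← Finset.sum_mul, hsum, one_mul, h]
    rw [e1]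
    refine (norm_sum_le _ _).trans ?_
    have : ∀ j, ‖ch j z * (f i z - f j z)‖ ≤ χ j z * ε := by
      intro j
      rw [norm_mul]
      have h1 : ‖ch j z‖ = χ j z := by
        simp only [ch, Complex.norm_real]
        exact Real.norm_of_nonneg (χ.nonneg j z)
      rw [h1]
      by_cases hj : z ∈ U j
      · exact mul_le_mul_of_nonneg_left (hfU i j z ⟨hzi, hj⟩) (χ.nonneg j z)
      · have : ‖ch j z‖ = 0 := by rw [(hzero j z hj).self_of_nhds]; simp
        rw [h1] at this
        simp [this]
    refine (Finset.sum_le_sum fun j _ => this j).trans ?_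
    rw [← Finset.sum_mul]
    have : ∑ j, χ j z = 1 := by
      have := hsum z
      simp only [ch] at this
      exact_mod_cast this
    rw [this, one_mul]
  calc ‖f i z - c‖ ≤ ‖f i z - h z‖ + ‖h z - c‖ := norm_sub_le_norm_sub_add_norm_sub _ _ _
    _ ≤ ε + 4 * M * R₀ * ε := add_le_add hdiff (hmain z hz)
    _ = _ := by ring

theorem integrableOn_rpow_mul_exp_neg_mul_one_add_pow {b : ℝ} (hb : -1 < b) (N : ℕ) :
    IntegrableOn (fun σ : ℝ => σ ^ b * Real.exp (-σ) * (1 + σ) ^ N) (Ioi 0) := by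
  have h1 : ∀ c : ℝ, -1 < c → IntegrableOn (fun σ : ℝ => σ ^ c * Real.exp (-σ)) (Ioi 0) := by
    intro c hc
    have := Real.GammaIntegral_convergent (s := c + 1) (by linarith)
    simpa [mul_comm] using this
  have h2 : IntegrableOn (fun σ : ℝ => 2 ^ (N - 1) * (σ ^ b * Real.exp (-σ) +
      σ ^ (b + N) * Real.exp (-σ))) (Ioi 0) :=
    ((h1 b hb).add (h1 (b + N) (by have := N.cast_nonneg (α := ℝ); linarith))).const_mul _
  refine Integrable.mono' h2 ?_ ?_
  · exact ((h1 b hb).aestronglyMeasurable).mul (by fun_prop)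
  · filter_upwards [ae_restrict_mem measurableSet_Ioi] with σ hσ
    have hσ' : (0 : ℝ) < σ := hσ
    rw [Real.norm_of_nonneg (by positivity), Real.rpow_add hσ', Real.rpow_natCast]
    have := add_pow_le (zero_le_one (α := ℝ)) hσ'.le N
    rw [one_pow] at this
    calc _ ≤ σ ^ b * Real.exp (-σ) * (2 ^ (N - 1) * (1 + σ ^ N)) := by gcongr
      _ = _ := by ring

theorem norm_one_add_div_ge {ζ : ℂ} (hζ : ζ ≠ 0) (σ : ℝ) : |ζ.im| / ‖ζ‖ ≤ ‖1 + σ / ζ‖ := by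
  have h : (1 + σ / ζ : ℂ) = (ζ + σ) / ζ := by field_simp
  rw [h, norm_div]
  gcongr
  have := Complex.abs_im_le_norm (ζ + σ)
  simpa using this

theorem norm_le_norm_add_ofReal {ζ : ℂ} (hre : 0 ≤ ζ.re) {σ : ℝ} (hσ : 0 ≤ σ) :
    ‖ζ‖ ≤ ‖ζ + σ‖ ∧ σ ≤ ‖ζ + σ‖ := by
  constructor
  · rw [Complex.norm_def, Complex.norm_def]
    apply Real.sqrt_le_sqrt
    simp only [Complex.normSq_apply, Complex.add_re, Complex.add_im, Complex.ofReal_re,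
      Complex.ofReal_im]
    nlinarith [mul_nonneg hre hσ]
  · have := Complex.re_le_norm (ζ + σ)
    simp at this
    linarith

theorem one_le_norm_one_add_div {ζ : ℂ} (hζ : ζ ≠ 0) (hre : 0 ≤ ζ.re) {σ : ℝ} (hσ : 0 ≤ σ) :
    1 ≤ ‖1 + σ / ζ‖ ∧ σ / ‖ζ‖ ≤ ‖1 + σ / ζ‖ := by
  have h : (1 + σ / ζ : ℂ) = (ζ + σ) / ζ := by field_simp
  have h0 : 0 < ‖ζ‖ := norm_pos_iff.2 hζ
  obtain ⟨h1, h2⟩ := norm_le_norm_add_ofReal hre hσ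
  rw [h, norm_div]
  refine ⟨?_, by gcongr⟩
  rwa [one_le_div h0]

theorem norm_one_add_div_le (ζ : ℂ) {σ : ℝ} (hσ : 0 ≤ σ) : ‖1 + σ / ζ‖ ≤ 1 + σ / ‖ζ‖ := by
  refine (norm_add_le _ _).trans (le_of_eq ?_)
  rw [norm_one, norm_div, Complex.norm_real, Real.norm_of_nonneg hσ]

theorem rpow_le_div_pow {x c Y q : ℝ} {N : ℕ} (hc : 0 < c) (hcx : c ≤ x) (hxY : x ≤ Y)
    (hc1 : c ≤ 1) (hY1 : 1 ≤ Y) (hq : |q| ≤ N) : x ^ q ≤ (Y / c) ^ N := by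
  have hx : 0 < x := hc.trans_le hcx
  have hYc : 1 ≤ Y / c := by rw [one_le_div hc]; linarith
  have h1 : x ≤ Y / c := hxY.trans (by rw [le_div_iff₀ hc]; nlinarith)
  have h2 : (Y / c)⁻¹ ≤ x := by
    rw [inv_div]
    exact le_trans (by rw [div_le_iff₀ (by linarith)]; nlinarith) hcx
  have h3 : x ^ q ≤ (Y / c) ^ |q| := by
    rcases le_total 0 q with h | h
    · rw [abs_of_nonneg h]
      exact Real.rpow_le_rpow hx.le h1 h
    · rw [abs_of_nonpos h, Real.rpow_neg (by linarith), ← Real.inv_rpow (by linarith)]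
      exact Real.rpow_le_rpow_of_nonpos (by positivity) h2 h
  refine h3.trans ?_
  rw [← Real.rpow_natCast]
  exact Real.rpow_le_rpow_of_exponent_le hYc hq

theorem one_add_div_mem_slitPlane {ζ : ℂ} (hζ : ζ ∈ Complex.slitPlane) {σ : ℝ} (hσ : 0 ≤ σ) :
    (1 + σ / ζ : ℂ) ∈ Complex.slitPlane := by
  rcases hσ.eq_or_lt with rfl | hσ
  · simp
  have h1 : (σ / ζ : ℂ) ∈ Complex.slitPlane := by
    rw [div_eq_mul_inv, Complex.mem_slitPlane_iff] at *
    have h0 : ζ ≠ 0 := by rintro rfl; simp at hζ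
    have h2 : 0 < Complex.normSq ζ := Complex.normSq_pos.2 h0
    simp only [Complex.re_ofReal_mul, Complex.im_ofReal_mul, Complex.inv_re, Complex.inv_im]
    rcases hζ with h | h
    · left; positivity
    · right
      simp [hσ.ne', h, h0]
  rw [Complex.mem_slitPlane_iff] at *
  simp only [Complex.add_re, Complex.add_im, Complex.one_re, Complex.one_im, zero_add]
  rcases h1 with h | h
  · left; linarith
  · right; exact h

/-- An unnormalised integral representation of the confluent hypergeometric function. -/
noncomputable def conflInt (b q : ℝ) (ζ : ℂ) : ℂ :=
  ∫ σ in Ioi (0 : ℝ), ((σ ^ b * Real.exp (-σ) : ℝ) : ℂ) * (1 + σ / ζ) ^ (q : ℂ)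

theorem norm_cpow_one_add_div {ζ : ℂ} (hζ : ζ ∈ Complex.slitPlane) {σ : ℝ} (hσ : 0 ≤ σ) (q : ℝ) :
    ‖(1 + σ / ζ : ℂ) ^ (q : ℂ)‖ = ‖(1 + σ / ζ : ℂ)‖ ^ q := by
  have h := Complex.slitPlane_ne_zero (one_add_div_mem_slitPlane hζ hσ)
  rw [Complex.norm_cpow_of_ne_zero h]
  simp

theorem aestronglyMeasurable_conflInt (b q : ℝ) {ζ : ℂ} (hζ : ζ ∈ Complex.slitPlane) :
    AEStronglyMeasurable (fun σ : ℝ => ((σ ^ b * Real.exp (-σ) : ℝ) : ℂ) * (1 + σ / ζ) ^ (q : ℂ))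
      (volume.restrict (Ioi 0)) := by
  refine ContinuousOn.aestronglyMeasurable (fun σ hσ => ContinuousAt.continuousWithinAt ?_)
    measurableSet_Ioi
  have hσ' : (0 : ℝ) < σ := hσ
  refine ContinuousAt.mul ?_ ?_
  · refine Complex.continuous_ofReal.continuousAt.comp ?_
    exact (Real.continuousAt_rpow_const _ _ (Or.inl hσ'.ne')).mul (by fun_prop)
  · exact ContinuousAt.cpow (by fun_prop) continuousAt_const
      (one_add_div_mem_slitPlane hζ hσ'.le)

theorem exists_nhds_bounds_one_add_div {ζ₀ : ℂ} (hζ₀ : ζ₀ ∈ Complex.slitPlane) :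
    ∃ V ∈ nhds ζ₀, ∃ c : ℝ, 0 < c ∧ c ≤ 1 ∧ ∃ M : ℝ, 1 ≤ M ∧ ∀ ζ ∈ V, ∀ σ : ℝ, 0 ≤ σ →
      c ≤ ‖1 + σ / ζ‖ ∧ ‖1 + σ / ζ‖ ≤ M * (1 + σ) := by
  have upper : ∀ m : ℝ, 0 < m → ∀ ζ : ℂ, m ≤ ‖ζ‖ → ∀ σ : ℝ, 0 ≤ σ →
      ‖1 + σ / ζ‖ ≤ (1 + 1 / m) * (1 + σ) := by
    intro m hm ζ hζ σ hσ
    refine (norm_one_add_div_le ζ hσ).trans ?_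
    have : σ / ‖ζ‖ ≤ σ / m := by gcongr
    have h2 : 0 ≤ 1 / m := by positivity
    have h3 : σ / m = 1 / m * σ := by ring
    nlinarith
  rw [Complex.mem_slitPlane_iff] at hζ₀
  rcases hζ₀ with h | h
  · refine ⟨ball ζ₀ (ζ₀.re / 2), ball_mem_nhds _ (by positivity), 1, one_pos, le_rfl,
      1 + 1 / (ζ₀.re / 2), by simp; positivity, fun ζ hζ σ hσ => ?_⟩
    rw [mem_ball, dist_eq_norm] at hζ
    have h1 := (Complex.abs_re_le_norm (ζ - ζ₀)).trans hζ.le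
    rw [Complex.sub_re, abs_le] at h1
    have h2 : ζ₀.re / 2 ≤ ζ.re := by linarith
    have h3 : ζ₀.re / 2 ≤ ‖ζ‖ := h2.trans (Complex.re_le_norm ζ)
    have h4 : ζ ≠ 0 := norm_pos_iff.1 (by linarith)
    exact ⟨(one_le_norm_one_add_div h4 (by linarith) hσ).1, upper _ (by positivity) _ h3 σ hσ⟩
  · have h0 : 0 < |ζ₀.im| := abs_pos.2 h
    have hn : |ζ₀.im| ≤ ‖ζ₀‖ := Complex.abs_im_le_norm ζ₀
    refine ⟨ball ζ₀ (|ζ₀.im| / 2), ball_mem_nhds _ (by positivity), (|ζ₀.im| / 2) / (2 * ‖ζ₀‖),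
      div_pos (by positivity) (by linarith), ?_, 1 + 1 / (|ζ₀.im| / 2), by simp; positivity, fun ζ hζ σ hσ => ?_⟩
    · rw [div_le_one (by linarith)]; linarith
    · rw [mem_ball, dist_eq_norm] at hζ
      have h1 := (Complex.abs_im_le_norm (ζ - ζ₀)).trans hζ.le
      rw [Complex.sub_im] at h1
      have h2 : |ζ₀.im| / 2 ≤ |ζ.im| := by
        have := abs_sub_abs_le_abs_sub ζ₀.im ζ.im
        rw [abs_sub_comm] at this
        linarith
      have h3 : |ζ₀.im| / 2 ≤ ‖ζ‖ := h2.trans (Complex.abs_im_le_norm ζ)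
      have h4 : ‖ζ‖ ≤ 2 * ‖ζ₀‖ := by
        have := norm_le_norm_add_norm_sub' ζ ζ₀
        linarith
      have h5 : ζ ≠ 0 := norm_pos_iff.1 (by linarith)
      refine ⟨le_trans ?_ (norm_one_add_div_ge h5 σ), upper _ (by positivity) _ h3 σ hσ⟩
      have : 0 < ‖ζ‖ := by linarith
      gcongr

/-- The integrand of `conflInt` is locally dominated by an integrable function. -/
theorem exists_nhds_norm_conflInt_le {b : ℝ} (hb : -1 < b) (q : ℝ) {ζ₀ : ℂ}
    (hζ₀ : ζ₀ ∈ Complex.slitPlane) :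
    ∃ V ∈ nhds ζ₀, ∃ B : ℝ → ℝ, Integrable B (volume.restrict (Ioi 0)) ∧
      ∀ᵐ σ ∂(volume.restrict (Ioi (0 : ℝ))), ∀ ζ ∈ V ∩ Complex.slitPlane,
        ‖((σ ^ b * Real.exp (-σ) : ℝ) : ℂ) * (1 + σ / ζ) ^ (q : ℂ)‖ ≤ B σ := by
  obtain ⟨V, hV, c, hc, hc1, M, hM, hVb⟩ := exists_nhds_bounds_one_add_div hζ₀
  obtain ⟨N, hN⟩ := exists_nat_ge |q|
  refine ⟨V, hV, fun σ => (M / c) ^ N * (σ ^ b * Real.exp (-σ) * (1 + σ) ^ N),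
    (integrableOn_rpow_mul_exp_neg_mul_one_add_pow hb N).const_mul _, ?_⟩
  filter_upwards [ae_restrict_mem measurableSet_Ioi] with σ hσ ζ hζ
  have hσ' : (0 : ℝ) < σ := hσ
  rw [norm_mul, norm_cpow_one_add_div hζ.2 hσ'.le, Complex.norm_real,
    Real.norm_of_nonneg (by positivity)]
  obtain ⟨h1, h2⟩ := hVb ζ hζ.1 σ hσ'.le
  have := rpow_le_div_pow (N := N) (q := q) hc h1 h2 hc1 (by nlinarith) hN
  calc _ ≤ σ ^ b * Real.exp (-σ) * (M * (1 + σ) / c) ^ N := by gcongr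
    _ = _ := by rw [mul_div_right_comm, mul_pow]; ring

theorem hasDerivAt_one_add_div_cpow {ζ : ℂ} (hζ : ζ ∈ Complex.slitPlane) {σ : ℝ} (hσ : 0 ≤ σ)
    (q : ℝ) : HasDerivAt (fun ζ : ℂ => (1 + σ / ζ) ^ (q : ℂ))
      (-(q / ζ) * ((1 + σ / ζ) ^ (q : ℂ) - (1 + σ / ζ) ^ ((q - 1 : ℝ) : ℂ))) ζ := by
  have hs := one_add_div_mem_slitPlane hζ hσ
  have h0 := Complex.slitPlane_ne_zero hζ
  have h1 : HasDerivAt (fun ζ : ℂ => 1 + σ / ζ) (σ * (-(ζ ^ 2)⁻¹)) ζ := by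
    simpa [div_eq_mul_inv] using ((hasDerivAt_inv h0).const_mul (σ : ℂ)).const_add 1
  have h2 := h1.cpow_const (c := (q : ℂ)) hs
  convert h2 using 1
  have h3 : (1 + σ / ζ : ℂ) ^ (q : ℂ) = (1 + σ / ζ) ^ ((q : ℂ) - 1) * (1 + σ / ζ) := by
    rw [Complex.cpow_sub _ _ (Complex.slitPlane_ne_zero hs), Complex.cpow_one,
      div_mul_cancel₀ _ (Complex.slitPlane_ne_zero hs)]
  rw [h3]
  push_cast
  field_simp
  ring

theorem integrable_conflInt {b : ℝ} (hb : -1 < b) (q : ℝ) {ζ : ℂ} (hζ : ζ ∈ Complex.slitPlane) :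
    Integrable (fun σ : ℝ => ((σ ^ b * Real.exp (-σ) : ℝ) : ℂ) * (1 + σ / ζ) ^ (q : ℂ))
      (volume.restrict (Ioi 0)) := by
  obtain ⟨V, hV, B, hB, hle⟩ := exists_nhds_norm_conflInt_le hb q hζ
  exact hB.mono' (aestronglyMeasurable_conflInt b q hζ)
    (hle.mono fun σ h => h ζ ⟨mem_of_mem_nhds hV, hζ⟩)

theorem hasDerivAt_conflInt {b : ℝ} (hb : -1 < b) (q : ℝ) {ζ : ℂ} (hζ : ζ ∈ Complex.slitPlane) :
    HasDerivAt (conflInt b q) (-(q / ζ) * (conflInt b q ζ - conflInt b (q - 1) ζ)) ζ := by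
  obtain ⟨V, hV, B, hB, hle⟩ := exists_nhds_norm_conflInt_le hb q hζ
  have hd : ∀ σ : ℝ, σ ∈ Ioi 0 → ∀ ζ ∈ Complex.slitPlane,
      HasDerivAt (fun ζ : ℂ => ((σ ^ b * Real.exp (-σ) : ℝ) : ℂ) * (1 + σ / ζ) ^ (q : ℂ))
      (((σ ^ b * Real.exp (-σ) : ℝ) : ℂ) * (-(q / ζ) * ((1 + σ / ζ) ^ (q : ℂ) -
        (1 + σ / ζ) ^ ((q - 1 : ℝ) : ℂ)))) ζ := fun σ hσ ζ hζ =>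
    (hasDerivAt_one_add_div_cpow hζ (le_of_lt hσ) q).const_mul _
  have key := hasDerivAt_integral_of_holomorphic (U := V ∩ Complex.slitPlane) (z := ζ)
    (μ := volume.restrict (Ioi (0 : ℝ)))
    (K := fun (σ : ℝ) (ζ : ℂ) => ((σ ^ b * Real.exp (-σ) : ℝ) : ℂ) * (1 + σ / ζ) ^ (q : ℂ))
    (mem_interior_iff_mem_nhds.2 (inter_mem hV (Complex.isOpen_slitPlane.mem_nhds hζ)))
    (by
      filter_upwards [ae_restrict_mem measurableSet_Ioi] with σ hσ x hx
      exact (hd σ hσ x hx.2).differentiableAt.differentiableWithinAt)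
    (fun x hx => aestronglyMeasurable_conflInt b q hx.2) hB hle
  convert key.2 using 1
  · rfl
  unfold conflInt
  rw [← integral_sub (integrable_conflInt hb q hζ)
    (integrable_conflInt hb (q - 1) hζ), ← integral_const_mul]
  refine setIntegral_congr_fun measurableSet_Ioi fun σ hσ => ?_
  rw [(hd σ hσ ζ hζ).deriv]
  ring

/-- The entire function `∫₀¹ (s (1 - s)) ^ b exp (ζ s) ds`. -/
noncomputable def eulerInt (b : ℝ) (ζ : ℂ) : ℂ :=
  ∫ s in (0 : ℝ)..1, ((s ^ b * (1 - s) ^ b : ℝ) : ℂ) * Complex.exp (ζ * s)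

theorem intervalIntegrable_rpow_mul_one_sub_rpow {b : ℝ} (hb : -1 < b) :
    IntervalIntegrable (fun s : ℝ => s ^ b * (1 - s) ^ b) volume 0 1 := by
  have h := (Complex.betaIntegral_convergent (u := (b + 1 : ℝ)) (v := (b + 1 : ℝ))
    (by simp; linarith) (by simp; linarith)).norm
  rw [intervalIntegrable_iff_integrableOn_Ioo_of_le zero_le_one] at h ⊢
  refine h.congr_fun (fun s hs => ?_) measurableSet_Ioo
  have h1 : 0 < 1 - s := by linarith [hs.2]
  have e : ((b + 1 : ℝ) : ℂ) - 1 = (b : ℂ) := by push_cast; ring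
  have e2 : (1 - (s : ℂ)) = ((1 - s : ℝ) : ℂ) := by push_cast; rfl
  simp only [e, e2, norm_mul]
  rw [Complex.norm_cpow_eq_rpow_re_of_pos hs.1, Complex.norm_cpow_eq_rpow_re_of_pos h1]
  simp

theorem differentiable_eulerInt {b : ℝ} (hb : -1 < b) : Differentiable ℂ (eulerInt b) := by
  have hint := intervalIntegrable_rpow_mul_one_sub_rpow hb
  rw [intervalIntegrable_iff_integrableOn_Ioc_of_le zero_le_one] at hint
  rw [← differentiableOn_univ]
  have h := differentiableOn_integral_of_holomorphic (μ := volume.restrict (Ioc (0 : ℝ) 1))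
    (U := univ) isOpen_univ
    (K := fun (s : ℝ) (ζ : ℂ) => ((s ^ b * (1 - s) ^ b : ℝ) : ℂ) * Complex.exp (ζ * s))
    (Eventually.of_forall fun s => Differentiable.differentiableOn (by fun_prop))
    (fun ζ _ => (Complex.continuous_ofReal.comp_aestronglyMeasurable hint.aestronglyMeasurable).mul
      (by fun_prop)) (fun ζ₀ _ => ⟨ball ζ₀ 1, ball_mem_nhds _ one_pos,
        fun s => (s ^ b * (1 - s) ^ b) * Real.exp (‖ζ₀‖ + 1), hint.mul_const _, ?_⟩)
  · refine h.congr fun ζ _ => ?_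
    rw [eulerInt, intervalIntegral.integral_of_le zero_le_one]
  · filter_upwards [ae_restrict_mem measurableSet_Ioc] with s hs ζ hζ
    have h1 : 0 ≤ 1 - s := by linarith [hs.2]
    have h0 := hs.1.le
    rw [norm_mul, Complex.norm_real, Real.norm_of_nonneg (by positivity), Complex.norm_exp]
    gcongr
    rw [mem_ball, dist_eq_norm] at hζ
    have h2 : ‖ζ‖ ≤ ‖ζ₀‖ + 1 := by
      have := norm_le_norm_add_norm_sub' ζ ζ₀
      linarith
    calc (ζ * s).re ≤ ‖ζ * s‖ := Complex.re_le_norm _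
      _ = ‖ζ‖ * s := by rw [norm_mul, Complex.norm_real, Real.norm_of_nonneg h0]
      _ ≤ ‖ζ‖ * 1 := by gcongr; exact hs.2
      _ ≤ _ := by linarith

theorem eulerInt_neg (b : ℝ) (ζ : ℂ) : eulerInt b (-ζ) = Complex.exp (-ζ) * eulerInt b ζ := by
  have h := intervalIntegral.integral_comp_sub_left (a := 0) (b := 1)
    (fun s : ℝ => ((s ^ b * (1 - s) ^ b : ℝ) : ℂ) * Complex.exp (-ζ * s)) 1
  rw [eulerInt, eulerInt, ← intervalIntegral.integral_const_mul]
  simp only [sub_self, sub_zero] at h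
  rw [← h]
  refine intervalIntegral.integral_congr fun s _ => ?_
  simp only [sub_sub_cancel]
  have : Complex.exp (-ζ * ((1 - s : ℝ) : ℂ)) = Complex.exp (-ζ) * Complex.exp (ζ * s) := by
    rw [← Complex.exp_add]; push_cast; ring_nf
  rw [this]
  push_cast
  ring

theorem tendsto_intervalIntegral_of_integrableOn_Ioi {g : ℝ → ℂ} (hg : IntegrableOn g (Ioi 0))
    {u v : ℕ → ℝ} (hu0 : ∀ n, 0 < u n) (huv : ∀ n, u n ≤ v n) (hu : Tendsto u atTop (nhds 0))
    (hv : Tendsto v atTop atTop) :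
    Tendsto (fun n => ∫ y in (u n)..(v n), g y) atTop (nhds (∫ y in Ioi 0, g y)) := by
  have hc : AECover (volume.restrict (Ioi (0 : ℝ))) atTop fun n => Ioc (u n) (v n) :=
    { ae_eventually_mem := by
        filter_upwards [ae_restrict_mem measurableSet_Ioi] with x hx
        filter_upwards [hu.eventually_lt_const hx, hv.eventually_ge_atTop x] with n h1 h2
        exact ⟨h1, h2⟩
      measurableSet := fun n => measurableSet_Ioc }
  refine (hc.integral_tendsto_of_countably_generated hg).congr fun n => ?_
  rw [intervalIntegral.integral_of_le (huv n), Measure.restrict_restrict measurableSet_Ioc,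
    inter_eq_left.2]
  exact fun x hx => (hu0 n).trans hx.1

/-- The values of `conflInt` on the imaginary axis, after rescaling. -/
theorem conflInt_comp_mul {b η : ℝ} (hb : -1 < b) (hη : 0 < η) {ω : ℂ} (hω : ω.im ≠ 0) :
    IntegrableOn (fun y : ℝ => ((y ^ b * Real.exp (-(η * y)) : ℝ) : ℂ) * (1 + y / ω) ^ (b : ℂ))
      (Ioi 0) ∧
    ∫ y in Ioi (0 : ℝ), ((y ^ b * Real.exp (-(η * y)) : ℝ) : ℂ) * (1 + y / ω) ^ (b : ℂ) =
      ((η ^ (-b - 1) : ℝ) : ℂ) * conflInt b b (η * ω) := by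
  have hs : (η * ω : ℂ) ∈ Complex.slitPlane := by
    rw [Complex.mem_slitPlane_iff]; right; simp [hη.ne', hω]
  set g : ℝ → ℂ := fun σ => ((σ ^ b * Real.exp (-σ) : ℝ) : ℂ) * (1 + σ / (η * ω)) ^ (b : ℂ)
  have hg : IntegrableOn g (Ioi 0) := integrable_conflInt hb b hs
  have hcongr : ∀ y ∈ Ioi (0 : ℝ), ((y ^ b * Real.exp (-(η * y)) : ℝ) : ℂ) *
      (1 + y / ω) ^ (b : ℂ) = ((η ^ (-b) : ℝ) : ℂ) * g (η * y) := by
    intro y hy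
    have hy' : (0 : ℝ) < y := hy
    simp only [g]
    have hη' : (η : ℂ) ≠ 0 := by exact_mod_cast hη.ne'
    rw [Real.mul_rpow hη.le hy'.le]
    have : ((η * y : ℝ) / (η * ω) : ℂ) = y / ω := by
      push_cast; rw [mul_div_mul_left _ _ hη']
    rw [this]
    have h2 : ((η ^ (-b) : ℝ) : ℂ) * ((η ^ b : ℝ) : ℂ) = 1 := by
      rw [← Complex.ofReal_mul, ← Real.rpow_add hη]; simp
    push_cast
    linear_combination (-((y ^ b : ℝ) : ℂ) * Complex.exp (-(η * y)) * (1 + y / ω) ^ (b : ℂ)) * h2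
  constructor
  · refine IntegrableOn.congr_fun ?_ (fun y hy => (hcongr y hy).symm) measurableSet_Ioi
    refine Integrable.const_mul ?_ _
    have := (integrableOn_Ioi_comp_mul_left_iff g 0 hη).2 (by simpa using hg)
    exact this
  · rw [setIntegral_congr_fun measurableSet_Ioi hcongr, integral_const_mul,
      integral_comp_mul_left_Ioi g 0 hη, mul_zero, conflInt, Complex.real_smul, ← mul_assoc,
      ← Complex.ofReal_mul, Real.rpow_sub_one hη.ne', div_eq_mul_inv]

theorem norm_cpow_mul_one_sub_cpow_mul_exp_le {b η x y : ℝ} (hx0 : 0 < x) (hx1 : x < 1)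
    (hy : 0 ≤ y) :
    ‖((x + y * Complex.I : ℂ)) ^ (b : ℂ) * (1 - (x + y * Complex.I : ℂ)) ^ (b : ℂ) *
      Complex.exp (η * Complex.I * (x + y * Complex.I))‖ ≤
      (x ^ b * (1 - x) ^ b + ((1 + y) ^ |b|) ^ 2) * Real.exp (-(η * y)) := by
  have h0 : (x + y * Complex.I : ℂ) ≠ 0 := fun h => hx0.ne' (by simpa using congrArg Complex.re h)
  have h1 : (1 - (x + y * Complex.I) : ℂ) ≠ 0 := fun h => by
    have := congrArg Complex.re h
    simp at this
    linarith
  have hx1' : 0 < 1 - x := by linarith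
  rw [norm_mul, norm_mul, Complex.norm_cpow_of_ne_zero h0, Complex.norm_cpow_of_ne_zero h1,
    Complex.norm_exp]
  have e : (η * Complex.I * (x + y * Complex.I) : ℂ).re = -(η * y) := by simp
  simp only [e, Complex.ofReal_re, Complex.ofReal_im, mul_zero, Real.exp_zero, div_one]
  gcongr
  have lo1 : x ≤ ‖(x + y * Complex.I : ℂ)‖ := by
    have := Complex.re_le_norm (x + y * Complex.I : ℂ); simpa using this
  have lo2 : 1 - x ≤ ‖(1 - (x + y * Complex.I) : ℂ)‖ := by
    have := Complex.re_le_norm (1 - (x + y * Complex.I) : ℂ); simpa using this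
  have up1 : ‖(x + y * Complex.I : ℂ)‖ ≤ 1 + y := by
    refine (norm_add_le _ _).trans ?_
    rw [norm_mul, Complex.norm_I, Complex.norm_real, Complex.norm_real,
      Real.norm_of_nonneg hx0.le, Real.norm_of_nonneg hy]
    linarith
  have up2 : ‖(1 - (x + y * Complex.I) : ℂ)‖ ≤ 1 + y := by
    have : (1 - (x + y * Complex.I) : ℂ) = ((1 - x : ℝ) : ℂ) - y * Complex.I := by push_cast; ring
    rw [this]
    refine (norm_sub_le _ _).trans ?_
    rw [norm_mul, Complex.norm_I, Complex.norm_real, Complex.norm_real,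
      Real.norm_of_nonneg hx1'.le, Real.norm_of_nonneg hy]
    linarith
  rcases le_total b 0 with h | h
  · have a1 := Real.rpow_le_rpow_of_nonpos hx0 lo1 h
    have a2 := Real.rpow_le_rpow_of_nonpos hx1' lo2 h
    calc _ ≤ x ^ b * (1 - x) ^ b := by gcongr
      _ ≤ _ := le_add_of_nonneg_right (by positivity)
  · rw [abs_of_nonneg h]
    have a1 := Real.rpow_le_rpow (norm_nonneg _) up1 h
    have a2 := Real.rpow_le_rpow (norm_nonneg _) up2 h
    calc _ ≤ (1 + y) ^ b * (1 + y) ^ b := by gcongr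
      _ = ((1 + y) ^ b) ^ 2 := by ring
      _ ≤ _ := le_add_of_nonneg_left (by positivity)

theorem ofReal_mul_cpow {y : ℝ} (hy : 0 < y) {z : ℂ} (hz : z ≠ 0) (b : ℝ) :
    ((y : ℂ) * z) ^ (b : ℂ) = ((y ^ b : ℝ) : ℂ) * z ^ (b : ℂ) := by
  have hy' : (y : ℂ) ≠ 0 := by exact_mod_cast hy.ne'
  rw [Complex.ofReal_cpow hy.le, Complex.cpow_def_of_ne_zero (mul_ne_zero hy' hz),
    Complex.cpow_def_of_ne_zero hy', Complex.cpow_def_of_ne_zero hz, Complex.log_ofReal_mul hy hz,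
    ← Complex.exp_add, ← Complex.ofReal_log hy.le]
  ring_nf

theorem eulerInt_mul_I {b η : ℝ} (hb : -1 < b) (hη : 0 < η) :
    eulerInt b (η * Complex.I) =
      ((η ^ (-b - 1) : ℝ) : ℂ) *
        (Complex.I * Complex.I ^ (b : ℂ) * conflInt b b (η * Complex.I) -
          Complex.I * (-Complex.I) ^ (b : ℂ) * Complex.exp (η * Complex.I) *
            conflInt b b (η * -Complex.I)) := by
  set f : ℂ → ℂ := fun s => s ^ (b : ℂ) * (1 - s) ^ (b : ℂ) * Complex.exp (η * Complex.I * s)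
  obtain ⟨i1, v1⟩ := conflInt_comp_mul hb hη (ω := Complex.I) (by simp)
  obtain ⟨i2, v2⟩ := conflInt_comp_mul hb hη (ω := -Complex.I) (by simp)
  set g₁ : ℝ → ℂ := fun y =>
    ((y ^ b * Real.exp (-(η * y)) : ℝ) : ℂ) * (1 + y / Complex.I) ^ (b : ℂ)
  set g₂ : ℝ → ℂ := fun y =>
    ((y ^ b * Real.exp (-(η * y)) : ℝ) : ℂ) * (1 + y / -Complex.I) ^ (b : ℂ)
  have hexp : ∀ y : ℝ, Complex.exp (η * Complex.I * (y * Complex.I)) = Complex.exp (-(η * y)) := by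
    intro y
    congr 1
    linear_combination (η * y : ℂ) * Complex.I_mul_I
  have hleft : ∀ y : ℝ, 0 < y → f ((0 : ℝ) + y * Complex.I) = Complex.I ^ (b : ℂ) * g₁ y := by
    intro y hy
    have e : (1 - y * Complex.I : ℂ) = 1 + y / Complex.I := by simp; ring
    simp only [f, g₁]
    rw [Complex.ofReal_zero, zero_add, ofReal_mul_cpow hy Complex.I_ne_zero, hexp, e]
    push_cast
    ring
  have hright : ∀ y : ℝ, 0 < y → f ((1 : ℝ) + y * Complex.I) =
      Complex.exp (η * Complex.I) * (-Complex.I) ^ (b : ℂ) * g₂ y := by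
    intro y hy
    have e : (1 + y * Complex.I : ℂ) = 1 + y / -Complex.I := by rw [div_neg]; simp
    have e2 : (1 - (1 + y * Complex.I) : ℂ) = y * -Complex.I := by ring
    simp only [f, g₂]
    rw [Complex.ofReal_one, e2, ofReal_mul_cpow hy (neg_ne_zero.2 Complex.I_ne_zero), mul_add,
      Complex.exp_add, hexp, e, mul_one]
    push_cast
    ring
  have hdiff : ∀ s : ℂ, 0 < s.im → DifferentiableAt ℂ f s := by
    intro s hs
    have h1 : s ∈ Complex.slitPlane := Or.inr hs.ne'
    have h2 : 1 - s ∈ Complex.slitPlane := Or.inr (by simp; exact hs.ne')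
    have := DifferentiableAt.cpow_const (c := (b : ℂ)) (differentiableAt_id (x := s)) h1
    exact (this.mul (DifferentiableAt.cpow_const (c := (b : ℂ)) (f := fun s => 1 - s) (by fun_prop) h2)).mul (by fun_prop)
  set u : ℕ → ℝ := fun n => 1 / ((n : ℝ) + 1)
  set v : ℕ → ℝ := fun n => (n : ℝ) + 1
  have hu0 : ∀ n, 0 < u n := fun n => by positivity
  have hu1 : ∀ n, u n ≤ 1 := fun n => by
    simp only [u]; rw [div_le_one (by positivity)]; linarith [n.cast_nonneg (α := ℝ)]
  have hv1 : ∀ n, 1 ≤ v n := fun n => by simp [v]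
  have hu : Tendsto u atTop (nhds 0) := tendsto_one_div_add_atTop_nhds_zero_nat
  have hv : Tendsto v atTop atTop := tendsto_atTop_add_const_right _ _ tendsto_natCast_atTop_atTop
  have hrect : ∀ n, ((∫ x in (0 : ℝ)..1, f (x + u n * Complex.I)) -
      ∫ x in (0 : ℝ)..1, f (x + v n * Complex.I)) +
      Complex.I * (Complex.exp (η * Complex.I) * (-Complex.I) ^ (b : ℂ) *
        ∫ y in (u n)..(v n), g₂ y) - Complex.I * (Complex.I ^ (b : ℂ) *
        ∫ y in (u n)..(v n), g₁ y) = 0 := by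
    intro n
    have huv : u n ≤ v n := (hu1 n).trans (hv1 n)
    have h := Complex.integral_boundary_rect_eq_zero_of_differentiableOn f
      (u n * Complex.I) (1 + v n * Complex.I) (fun s hs => by
        refine (hdiff s ?_).differentiableWithinAt
        have := hs.2
        simp at this
        rw [uIcc_of_le huv] at this
        exact (hu0 n).trans_le this.1)
    have c1 : (u n * Complex.I : ℂ).re = 0 := by simp
    have c2 : (u n * Complex.I : ℂ).im = u n := by simp
    have c3 : (1 + v n * Complex.I : ℂ).re = 1 := by simp
    have c4 : (1 + v n * Complex.I : ℂ).im = v n := by simp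
    rw [c1, c2, c3, c4, smul_eq_mul, smul_eq_mul] at h
    have hR : ∫ y in (u n)..(v n), f ((1 : ℝ) + y * Complex.I) =
        Complex.exp (η * Complex.I) * (-Complex.I) ^ (b : ℂ) * ∫ y in (u n)..(v n), g₂ y := by
      rw [← intervalIntegral.integral_const_mul]
      refine intervalIntegral.integral_congr fun y hy => ?_
      rw [uIcc_of_le huv] at hy
      exact hright y ((hu0 n).trans_le hy.1)
    have hL : ∫ y in (u n)..(v n), f ((0 : ℝ) + y * Complex.I) =
        Complex.I ^ (b : ℂ) * ∫ y in (u n)..(v n), g₁ y := by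
      rw [← intervalIntegral.integral_const_mul]
      refine intervalIntegral.integral_congr fun y hy => ?_
      rw [uIcc_of_le huv] at hy
      exact hleft y ((hu0 n).trans_le hy.1)
    rw [hR, hL] at h
    exact h
  have hbd := (intervalIntegrable_rpow_mul_one_sub_rpow hb)
  have hmeas : ∀ t : ℝ, 0 < t → AEStronglyMeasurable (fun x : ℝ => f (x + t * Complex.I))
      (volume.restrict (uIoc (0 : ℝ) 1)) := by
    intro t ht
    refine Continuous.aestronglyMeasurable (continuous_iff_continuousAt.2 fun x => ?_)
    exact ContinuousAt.comp (f := fun x : ℝ => (x + t * Complex.I : ℂ)) (g := f)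
      (hdiff _ (by simpa using ht)).continuousAt (by fun_prop)
  have hne1 : ∀ᵐ x : ℝ, x ≠ 1 := by simp [ae_iff, measure_singleton]
  have hlow : Tendsto (fun n => ∫ x in (0 : ℝ)..1, f (x + u n * Complex.I)) atTop
      (nhds (eulerInt b (η * Complex.I))) := by
    refine intervalIntegral.tendsto_integral_filter_of_dominated_convergence
      (fun x => x ^ b * (1 - x) ^ b + ((1 + 1) ^ |b|) ^ 2)
      (Eventually.of_forall fun n => hmeas _ (hu0 n)) (Eventually.of_forall fun n => ?_)
      (hbd.add intervalIntegrable_const) ?_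
    · filter_upwards [hne1] with x hx1 hx
      rw [uIoc_of_le zero_le_one] at hx
      have hx1' := lt_of_le_of_ne hx.2 hx1
      have h1 : 0 ≤ 1 - x := by linarith
      refine (norm_cpow_mul_one_sub_cpow_mul_exp_le hx.1 hx1' (hu0 n).le).trans ?_
      refine (mul_le_of_le_one_right (by have := hx.1.le; positivity) ?_).trans ?_
      · rw [Real.exp_le_one_iff]
        have := mul_pos hη (hu0 n)
        linarith
      · have := hu1 n
        have := (hu0 n).le
        gcongr
    · filter_upwards [hne1] with x hx1 hx
      rw [uIoc_of_le zero_le_one] at hx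
      have hx1' := lt_of_le_of_ne hx.2 hx1
      have h1 : 0 < 1 - x := by linarith
      have hval : f (x + (0 : ℝ) * Complex.I) =
          ((x ^ b * (1 - x) ^ b : ℝ) : ℂ) * Complex.exp (η * Complex.I * x) := by
        simp only [f, Complex.ofReal_zero, zero_mul, add_zero]
        rw [Complex.ofReal_mul, Complex.ofReal_cpow hx.1.le, Complex.ofReal_cpow h1.le]
        push_cast
        rfl
      rw [← hval]
      refine ContinuousAt.tendsto (f := fun t : ℝ => f (x + t * Complex.I)) (x := 0) ?_ |>.comp hu
      have s1 : (x + (0 : ℝ) * Complex.I : ℂ) ∈ Complex.slitPlane := Or.inl (by simpa using hx.1)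
      have s2 : (1 - (x + (0 : ℝ) * Complex.I) : ℂ) ∈ Complex.slitPlane :=
        Or.inl (by simpa using hx1')
      simp only [f]
      exact ((ContinuousAt.cpow (f := fun t : ℝ => (x + t * Complex.I : ℂ)) (by fun_prop)
        continuousAt_const s1).mul (ContinuousAt.cpow
        (f := fun t : ℝ => (1 - (x + t * Complex.I) : ℂ)) (by fun_prop)
        continuousAt_const s2)).mul (by fun_prop)
  have hhigh : Tendsto (fun n => ∫ x in (0 : ℝ)..1, f (x + v n * Complex.I)) atTop (nhds 0) := by
    have hb2 : ∀ n, ‖∫ x in (0 : ℝ)..1, f (x + v n * Complex.I)‖ ≤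
        ∫ x in (0 : ℝ)..1, (x ^ b * (1 - x) ^ b + ((1 + v n) ^ |b|) ^ 2) * Real.exp (-(η * v n)) := by
      intro n
      refine intervalIntegral.norm_integral_le_of_norm_le zero_le_one ?_
        ((hbd.add intervalIntegrable_const).mul_const _)
      filter_upwards [hne1] with x hx1 hx
      exact norm_cpow_mul_one_sub_cpow_mul_exp_le hx.1 (lt_of_le_of_ne hx.2 hx1)
        (zero_le_one.trans (hv1 n))
    refine squeeze_zero_norm hb2 ?_
    have e : ∀ n, ∫ x in (0 : ℝ)..1, (x ^ b * (1 - x) ^ b + ((1 + v n) ^ |b|) ^ 2) *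
        Real.exp (-(η * v n)) = (∫ x in (0 : ℝ)..1, x ^ b * (1 - x) ^ b) * Real.exp (-(η * v n)) +
          (1 + v n) ^ (2 * |b|) * Real.exp (-(η * v n)) := by
      intro n
      rw [intervalIntegral.integral_mul_const, intervalIntegral.integral_add hbd
        intervalIntegrable_const, add_mul]
      have := zero_le_one.trans (hv1 n)
      simp
      rw [← Real.rpow_natCast, ← Real.rpow_mul (by positivity)]
      norm_num
      ring_nf
    simp only [e]
    have t1 : Tendsto (fun n => Real.exp (-(η * v n))) atTop (nhds 0) :=
      Real.tendsto_exp_neg_atTop_nhds_zero.comp (hv.const_mul_atTop hη)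
    have t2 := ((tendsto_rpow_mul_exp_neg_mul_atTop_nhds_zero (2 * |b|) η hη).comp
      (tendsto_atTop_add_const_left atTop 1 hv)).mul_const (Real.exp η)
    have := (t1.const_mul (∫ x in (0 : ℝ)..1, x ^ b * (1 - x) ^ b)).add t2
    simp only [mul_zero, zero_mul, add_zero] at this
    refine this.congr fun n => ?_
    simp only [Function.comp, mul_assoc, ← Real.exp_add]
    ring_nf
  have hlim := ((hlow.sub hhigh).add
    (((tendsto_intervalIntegral_of_integrableOn_Ioi i2 hu0 (fun n => (hu1 n).trans (hv1 n)) hu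
      hv).const_mul (Complex.exp (η * Complex.I) * (-Complex.I) ^ (b : ℂ))).const_mul
      Complex.I)).sub
    (((tendsto_intervalIntegral_of_integrableOn_Ioi i1 hu0 (fun n => (hu1 n).trans (hv1 n)) hu
      hv).const_mul (Complex.I ^ (b : ℂ))).const_mul Complex.I)
  have h0 := tendsto_nhds_unique hlim (tendsto_const_nhds.congr fun n => (hrect n).symm)
  rw [v1, v2] at h0
  linear_combination h0

theorem differentiableOn_conflInt {b : ℝ} (hb : -1 < b) (q : ℝ) :
    DifferentiableOn ℂ (conflInt b q) Complex.slitPlane := fun _ hζ =>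
  (hasDerivAt_conflInt hb q hζ).differentiableAt.differentiableWithinAt

theorem neg_I_cpow_mul_self (b : ℝ) :
    (-Complex.I) ^ (b : ℂ) * (-Complex.I) ^ (b : ℂ) = Complex.exp (-((π * b : ℝ) : ℂ) * Complex.I) := by
  rw [Complex.cpow_def_of_ne_zero (by simp), Complex.log_neg_I, ← Complex.exp_add]
  congr 1
  push_cast
  ring

theorem neg_I_cpow_mul_I_cpow (b : ℝ) : (-Complex.I) ^ (b : ℂ) * Complex.I ^ (b : ℂ) = 1 := by
  rw [Complex.cpow_def_of_ne_zero (by simp), Complex.cpow_def_of_ne_zero (by simp),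
    Complex.log_neg_I, Complex.log_I, ← Complex.exp_add, ← Complex.exp_zero]
  congr 1
  ring

/-- Connection formula for the confluent hypergeometric functions, upper half-plane. -/
theorem neg_cpow_mul_eulerInt_of_im_pos {b : ℝ} (hb : -1 < b) {ζ : ℂ} (hζ : 0 < ζ.im) :
    (-ζ) ^ ((b + 1 : ℝ) : ℂ) * eulerInt b ζ = conflInt b b ζ -
      Complex.exp (-((π * b : ℝ) : ℂ) * Complex.I) * Complex.exp ζ * conflInt b b (-ζ) := by
  have hopen : IsOpen {z : ℂ | 0 < z.im} := isOpen_lt continuous_const Complex.continuous_im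
  have hpre : IsPreconnected {z : ℂ | 0 < z.im} := (convex_halfSpace_im_gt 0).isPreconnected
  have hneg : ∀ z ∈ {z : ℂ | 0 < z.im}, -z ∈ Complex.slitPlane := fun z hz =>
    Or.inr (by simpa using (ne_of_gt hz))
  have hpos : ∀ z ∈ {z : ℂ | 0 < z.im}, z ∈ Complex.slitPlane := fun z hz => Or.inr (ne_of_gt hz)
  have hd := differentiableOn_conflInt hb b
  have hl : DifferentiableOn ℂ (fun ζ : ℂ => (-ζ) ^ ((b + 1 : ℝ) : ℂ) * eulerInt b ζ)
      {z : ℂ | 0 < z.im} := by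
    refine DifferentiableOn.mul (fun z hz => ?_) (differentiable_eulerInt hb).differentiableOn
    exact (DifferentiableAt.cpow_const (f := fun z : ℂ => -z) (by fun_prop)
      (hneg z hz)).differentiableWithinAt
  have hr : DifferentiableOn ℂ (fun ζ : ℂ => conflInt b b ζ -
      Complex.exp (-((π * b : ℝ) : ℂ) * Complex.I) * Complex.exp ζ * conflInt b b (-ζ))
      {z : ℂ | 0 < z.im} := by
    refine (hd.mono hpos).sub (DifferentiableOn.mul (by fun_prop) ?_)
    exact hd.comp (by fun_prop) hneg
  refine (hl.analyticOnNhd hopen).eqOn_of_preconnected_of_frequently_eq (hr.analyticOnNhd hopen)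
    hpre (z₀ := Complex.I) (by simp) ?_ hζ
  have ht : Tendsto (fun n : ℕ => ((1 + 1 / ((n : ℝ) + 1) : ℝ) : ℂ) * Complex.I) atTop
      (nhdsWithin Complex.I {Complex.I}ᶜ) := by
    refine tendsto_nhdsWithin_iff.2 ⟨?_, Eventually.of_forall fun n hn => ?_⟩
    · have h1 : Tendsto (fun n : ℕ => 1 + 1 / ((n : ℝ) + 1)) atTop (nhds (1 + 0)) :=
        tendsto_const_nhds.add tendsto_one_div_add_atTop_nhds_zero_nat
      have h2 : Continuous fun t : ℝ => (t : ℂ) * Complex.I := by fun_prop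
      simpa [Function.comp_def] using (h2.tendsto _).comp h1
    · have := congrArg Complex.im (mem_singleton_iff.1 hn)
      simp at this
      rcases this with h | h <;> exact Nat.cast_add_one_ne_zero n h
  refine ht.frequently (Eventually.frequently (Eventually.of_forall fun n => ?_))
  set η : ℝ := 1 + 1 / ((n : ℝ) + 1)
  have hη : 0 < η := by positivity
  have e : -((η : ℂ) * Complex.I) = η * -Complex.I := by ring
  have h2 : ((η ^ (b + 1) : ℝ) : ℂ) * ((η ^ (-b - 1) : ℝ) : ℂ) = 1 := by
    rw [← Complex.ofReal_mul, ← Real.rpow_add hη]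
    norm_num
  have h3 : (-Complex.I) ^ ((b + 1 : ℝ) : ℂ) = (-Complex.I) ^ (b : ℂ) * -Complex.I := by
    push_cast
    rw [Complex.cpow_add _ _ (by simp), Complex.cpow_one]
  rw [eulerInt_mul_I hb hη, e, ofReal_mul_cpow hη (by simp), h3, ← neg_I_cpow_mul_self]
  have h4 := neg_I_cpow_mul_I_cpow b
  generalize (-Complex.I) ^ (b : ℂ) = J at *
  generalize (Complex.I) ^ (b : ℂ) = J' at *
  generalize conflInt b b _ = c1
  generalize conflInt b b _ = c2
  generalize ((η ^ (b + 1) : ℝ) : ℂ) = y at *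
  generalize ((η ^ (-b - 1) : ℝ) : ℂ) = y' at *
  generalize Complex.exp _ = x
  linear_combination (c1 * J * J' - c2 * x * J * J) * h2 + c1 * h4 +
    (y * y' * (c2 * x * J * J - J * J' * c1)) * Complex.I_mul_I

theorem neg_cpow_mul_eulerInt_of_im_neg {b : ℝ} (hb : -1 < b) {ζ : ℂ} (hζ : ζ.im < 0) :
    (-ζ) ^ ((b + 1 : ℝ) : ℂ) * eulerInt b ζ = conflInt b b ζ -
      Complex.exp (((π * b : ℝ) : ℂ) * Complex.I) * Complex.exp ζ * conflInt b b (-ζ) := by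
  have h := neg_cpow_mul_eulerInt_of_im_pos hb (ζ := -ζ) (by simpa using hζ)
  have h0 : ζ ≠ 0 := fun h => by simp [h] at hζ
  have hlog : Complex.log (-ζ) = Complex.log ζ + π * Complex.I := by
    rw [Complex.log, Complex.log, norm_neg, Complex.arg_neg_eq_arg_add_pi_of_im_neg hζ]
    push_cast
    ring
  have hc : (-ζ) ^ ((b + 1 : ℝ) : ℂ) =
      -Complex.exp (((π * b : ℝ) : ℂ) * Complex.I) * ζ ^ ((b + 1 : ℝ) : ℂ) := by
    rw [Complex.cpow_def_of_ne_zero (neg_ne_zero.2 h0), Complex.cpow_def_of_ne_zero h0, hlog,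
      ← neg_one_mul (Complex.exp _), ← Complex.exp_pi_mul_I, ← Complex.exp_add, ← Complex.exp_add]
    congr 1
    push_cast
    ring
  rw [neg_neg, eulerInt_neg] at h
  rw [hc]
  have e1 : Complex.exp (-((π * b : ℝ) : ℂ) * Complex.I) *
    Complex.exp (((π * b : ℝ) : ℂ) * Complex.I) = 1 := by
    rw [← Complex.exp_add, ← Complex.exp_zero]; congr 1; ring
  have e2 : Complex.exp (-ζ) * Complex.exp ζ = 1 := by
    rw [← Complex.exp_add, ← Complex.exp_zero]; congr 1; ring
  set P := Complex.exp (((π * b : ℝ) : ℂ) * Complex.I)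
  set M := Complex.exp (-((π * b : ℝ) : ℂ) * Complex.I)
  set Z := Complex.exp ζ
  set Y := Complex.exp (-ζ)
  linear_combination (-P * Z) * h + (Y * Z * conflInt b b ζ) * e1 + (conflInt b b ζ + P * ζ ^ ((b + 1 : ℝ) : ℂ) * eulerInt b ζ) * e2

theorem hasDerivAt_one_add_mul_cpow {w : ℂ} {t : ℝ} (h : 1 + t * w ∈ Complex.slitPlane) (q : ℝ) :
    HasDerivAt (fun t : ℝ => (1 + t * w) ^ (q : ℂ))
      (q * w * (1 + t * w) ^ ((q - 1 : ℝ) : ℂ)) t := by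
  have h1 : HasDerivAt (fun t : ℂ => 1 + t * w) w (t : ℂ) := by
    simpa using ((hasDerivAt_id (t : ℂ)).mul_const w).const_add 1
  have h2 := (h1.cpow_const (c := (q : ℂ)) h).comp_ofReal
  convert h2 using 1
  push_cast
  ring

/-- First and second order Taylor estimates for `(1 + σ / ζ) ^ q`. -/
theorem norm_cpow_one_add_div_sub_le {ζ : ℂ} (hζ : ζ ∈ Complex.slitPlane) (h1 : 1 / 4 ≤ ‖ζ‖) {s : ℝ}
    (hs0 : 0 < s) (hs1 : s ≤ 1) (hs : ∀ σ : ℝ, 0 ≤ σ → s ≤ ‖1 + σ / ζ‖) {q : ℝ} {N : ℕ}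
    (hN : |q| + 2 ≤ N) {σ : ℝ} (hσ : 0 ≤ σ) :
    ‖(1 + σ / ζ) ^ (q : ℂ) - 1‖ ≤ |q| * (4 / s) ^ N * ‖ζ‖⁻¹ * (1 + σ) ^ (N + 1) ∧
    ‖(1 + σ / ζ) ^ (q : ℂ) - 1 - q * (σ / ζ)‖ ≤
      |q| * |q - 1| * (4 / s) ^ N * ‖ζ‖⁻¹ ^ 2 * (1 + σ) ^ (N + 2) := by
  have hz : 0 < ‖ζ‖ := by linarith
  have hw : ‖(σ / ζ : ℂ)‖ = σ * ‖ζ‖⁻¹ := by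
    rw [norm_div, Complex.norm_real, Real.norm_of_nonneg hσ, div_eq_mul_inv]
  have hinv : ‖ζ‖⁻¹ ≤ 4 := by
    rw [inv_le_comm₀ hz (by norm_num)]; linarith
  have hts : ∀ t : ℝ, 0 ≤ t → 1 + t * (σ / ζ) ∈ Complex.slitPlane := fun t ht => by
    have := one_add_div_mem_slitPlane hζ (mul_nonneg ht hσ)
    push_cast at this
    rwa [mul_div_assoc] at this
  have hbd : ∀ r : ℝ, |r| ≤ N → ∀ t : ℝ, 0 ≤ t → t ≤ 1 →
      ‖(1 + t * (σ / ζ)) ^ (r : ℂ)‖ ≤ (4 / s) ^ N * (1 + σ) ^ N := by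
    intro r hr t ht ht1
    have h2 := norm_cpow_one_add_div hζ (mul_nonneg ht hσ) r
    have h3 := norm_one_add_div_le ζ (mul_nonneg ht hσ)
    have h4 := hs _ (mul_nonneg ht hσ)
    push_cast at h2 h3 h4
    rw [mul_div_assoc] at h2 h3 h4
    rw [h2, ← mul_pow, show 4 / s * (1 + σ) = (4 * (1 + σ)) / s by ring]
    refine rpow_le_div_pow hs0 h4 ?_ hs1 (by linarith) hr
    refine h3.trans ?_
    have : t * (σ / ‖ζ‖) ≤ 1 * (σ * 4) := by
      rw [div_eq_mul_inv]; gcongr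
    rw [mul_div_assoc]
    linarith
  have aux : ∀ r : ℝ, |r - 1| ≤ N → ∀ t : ℝ, 0 ≤ t → t ≤ 1 →
      ‖(1 + t * (σ / ζ)) ^ (r : ℂ) - 1‖ ≤ |r| * (σ * ‖ζ‖⁻¹) * ((4 / s) ^ N * (1 + σ) ^ N) := by
    intro r hr t ht ht1
    have hder : ∀ x ∈ Icc (0 : ℝ) t, HasDerivWithinAt (fun t : ℝ => (1 + t * (σ / ζ)) ^ (r : ℂ))
        (r * (σ / ζ) * (1 + x * (σ / ζ)) ^ ((r - 1 : ℝ) : ℂ)) (Icc 0 t) x :=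
      fun x hx => (hasDerivAt_one_add_mul_cpow (hts x hx.1) r).hasDerivWithinAt
    have h5 := norm_image_sub_le_of_norm_deriv_le_segment' hder
      (C := |r| * (σ * ‖ζ‖⁻¹) * ((4 / s) ^ N * (1 + σ) ^ N)) (fun x hx => by
        rw [norm_mul, norm_mul, hw, Complex.norm_real, Real.norm_eq_abs]
        gcongr
        exact hbd _ hr x hx.1 (hx.2.le.trans ht1)) t ⟨ht, le_rfl⟩
    simp only [Complex.ofReal_zero, zero_mul, add_zero, Complex.one_cpow, sub_zero] at h5
    exact h5.trans (mul_le_of_le_one_right (by positivity) ht1)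
  have hq1 : |q - 1| ≤ N := by
    have := abs_sub q 1; rw [abs_one] at this; linarith
  have hq2 : |q - 1 - 1| ≤ N := by
    have h6 := abs_sub (q - 1) 1; have := abs_sub q 1; rw [abs_one] at this h6; linarith
  constructor
  · have h7 := aux q hq1 1 zero_le_one le_rfl
    rw [Complex.ofReal_one, one_mul] at h7
    refine h7.trans ?_
    calc |q| * (σ * ‖ζ‖⁻¹) * ((4 / s) ^ N * (1 + σ) ^ N)
        ≤ |q| * ((1 + σ) * ‖ζ‖⁻¹) * ((4 / s) ^ N * (1 + σ) ^ N) := by gcongr; linarith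
      _ = _ := by ring
  · have hder : ∀ x ∈ Icc (0 : ℝ) 1, HasDerivWithinAt
        (fun t : ℝ => (1 + t * (σ / ζ)) ^ (q : ℂ) - t * (q * (σ / ζ)))
        (q * (σ / ζ) * (1 + x * (σ / ζ)) ^ ((q - 1 : ℝ) : ℂ) - q * (σ / ζ)) (Icc 0 1) x := by
      intro x hx
      have h8 : HasDerivAt (fun t : ℝ => (t * (q * (σ / ζ)) : ℂ)) (q * (σ / ζ)) x := by
        simpa using (Complex.ofRealCLM.hasDerivAt (x := x)).mul_const (q * (σ / ζ) : ℂ)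
      exact ((hasDerivAt_one_add_mul_cpow (hts x hx.1) q).sub h8).hasDerivWithinAt
    have h5 := norm_image_sub_le_of_norm_deriv_le_segment' hder
      (C := |q| * (σ * ‖ζ‖⁻¹) * (|q - 1| * (σ * ‖ζ‖⁻¹) * ((4 / s) ^ N * (1 + σ) ^ N)))
      (fun x hx => by
        rw [← mul_sub_one, norm_mul, norm_mul, hw, Complex.norm_real, Real.norm_eq_abs]
        gcongr
        exact aux _ hq2 x hx.1 hx.2.le) 1 ⟨zero_le_one, le_rfl⟩
    simp only [Complex.ofReal_zero, zero_mul, add_zero, Complex.one_cpow, sub_zero,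
      Complex.ofReal_one, one_mul, mul_one] at h5
    rw [sub_right_comm] at h5
    refine h5.trans ?_
    calc |q| * (σ * ‖ζ‖⁻¹) * (|q - 1| * (σ * ‖ζ‖⁻¹) * ((4 / s) ^ N * (1 + σ) ^ N))
        ≤ |q| * ((1 + σ) * ‖ζ‖⁻¹) * (|q - 1| * ((1 + σ) * ‖ζ‖⁻¹) * ((4 / s) ^ N * (1 + σ) ^ N)) := by
          gcongr <;> linarith
      _ = _ := by ring

theorem integral_rpow_mul_exp_neg {b : ℝ} (hb : -1 < b) :
    ∫ σ in Ioi (0 : ℝ), σ ^ b * Real.exp (-σ) = Real.Gamma (b + 1) := by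
  rw [Real.Gamma_eq_integral (by linarith)]
  refine setIntegral_congr_fun measurableSet_Ioi fun σ _ => ?_
  simp [mul_comm]

/-- The first two terms of the asymptotic expansion of `conflInt`. -/
theorem exists_norm_conflInt_sub_le {b : ℝ} (hb : -1 < b) (q : ℝ) :
    ∃ C : ℝ, 0 < C ∧ ∃ N : ℕ, ∀ ζ ∈ Complex.slitPlane, 1 / 4 ≤ ‖ζ‖ → ∀ s : ℝ, 0 < s → s ≤ 1 →
      (∀ σ : ℝ, 0 ≤ σ → s ≤ ‖1 + σ / ζ‖) →
      ‖conflInt b q ζ - Real.Gamma (b + 1)‖ ≤ C * (1 / s) ^ N * ‖ζ‖⁻¹ ∧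
      ‖conflInt b q ζ - Real.Gamma (b + 1) - q * Real.Gamma (b + 2) / ζ‖ ≤
        C * (1 / s) ^ N * ‖ζ‖⁻¹ ^ 2 := by
  obtain ⟨N, hN⟩ := exists_nat_ge (|q| + 2)
  set J : ℕ → ℝ := fun k => ∫ σ in Ioi (0 : ℝ), σ ^ b * Real.exp (-σ) * (1 + σ) ^ k
  have hJ : ∀ k, 0 ≤ J k := fun k => setIntegral_nonneg measurableSet_Ioi fun σ hσ => by
    have : (0 : ℝ) < σ := hσ
    positivity
  refine ⟨|q| * 4 ^ N * J (N + 1) + |q| * |q - 1| * 4 ^ N * J (N + 2) + 1, by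
    have := hJ (N + 1); have := hJ (N + 2); positivity, N, fun ζ hζ h1 s hs0 hs1 hs => ?_⟩
  have hint := integrable_conflInt hb q hζ
  have hi0 : IntegrableOn (fun σ : ℝ => σ ^ b * Real.exp (-σ)) (Ioi 0) := by
    simpa using integrableOn_rpow_mul_exp_neg_mul_one_add_pow hb 0
  have hi1 : IntegrableOn (fun σ : ℝ => σ ^ (b + 1) * Real.exp (-σ)) (Ioi 0) := by
    simpa using integrableOn_rpow_mul_exp_neg_mul_one_add_pow (b := b + 1) (by linarith) 0
  have hi0c : IntegrableOn (fun σ : ℝ => ((σ ^ b * Real.exp (-σ) : ℝ) : ℂ)) (Ioi 0) := hi0.ofReal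
  have hi1c : IntegrableOn (fun σ : ℝ => ((σ ^ (b + 1) * Real.exp (-σ) : ℝ) : ℂ)) (Ioi 0) :=
    hi1.ofReal
  have key : ∀ (g : ℝ → ℂ) (M : ℝ) (k : ℕ),
      (∀ σ ∈ Ioi (0 : ℝ), ‖g σ‖ ≤ (σ ^ b * Real.exp (-σ)) * (M * (1 + σ) ^ k)) →
      ‖∫ σ in Ioi (0 : ℝ), g σ‖ ≤ M * J k := by
    intro g M k hg
    rw [← integral_const_mul]
    refine norm_integral_le_of_norm_le
      ((integrableOn_rpow_mul_exp_neg_mul_one_add_pow hb k).const_mul M) ?_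
    filter_upwards [ae_restrict_mem measurableSet_Ioi] with σ hσ
    exact (hg σ hσ).trans_eq (by ring)
  have e0 : (Real.Gamma (b + 1) : ℂ) = ∫ σ in Ioi (0 : ℝ), ((σ ^ b * Real.exp (-σ) : ℝ) : ℂ) := by
    rw [integral_complex_ofReal, integral_rpow_mul_exp_neg hb]
  have e1 : (q * Real.Gamma (b + 2) / ζ : ℂ) =
      ∫ σ in Ioi (0 : ℝ), ((σ ^ (b + 1) * Real.exp (-σ) : ℝ) : ℂ) * (q / ζ) := by
    rw [integral_mul_const, integral_complex_ofReal, integral_rpow_mul_exp_neg (by linarith),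
      add_assoc, one_add_one_eq_two]
    ring
  have d0 : conflInt b q ζ - Real.Gamma (b + 1) = ∫ σ in Ioi (0 : ℝ),
      ((σ ^ b * Real.exp (-σ) : ℝ) : ℂ) * ((1 + σ / ζ) ^ (q : ℂ) - 1) := by
    rw [e0, conflInt, ← integral_sub hint hi0c]
    simp only [mul_sub, mul_one]
  have hpos : ∀ σ ∈ Ioi (0 : ℝ), 0 ≤ σ ^ b * Real.exp (-σ) := fun σ hσ => by
    have : (0 : ℝ) < σ := hσ
    positivity
  have hpw : (4 / s) ^ N = 4 ^ N * (1 / s) ^ N := by rw [← mul_pow]; ring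
  have hsN : 0 < (1 / s) ^ N := by positivity
  have hzi : 0 ≤ ‖ζ‖⁻¹ := by positivity
  have j1 := hJ (N + 1)
  have j2 := hJ (N + 2)
  constructor
  · rw [d0]
    refine (key _ (|q| * (4 / s) ^ N * ‖ζ‖⁻¹) (N + 1) fun σ hσ => ?_).trans ?_
    · rw [norm_mul, Complex.norm_real, Real.norm_of_nonneg (hpos σ hσ)]
      exact mul_le_mul_of_nonneg_left
        (norm_cpow_one_add_div_sub_le hζ h1 hs0 hs1 hs hN (le_of_lt hσ)).1 (hpos σ hσ)
    · calc _ = (|q| * 4 ^ N * J (N + 1)) * (1 / s) ^ N * ‖ζ‖⁻¹ := by rw [hpw]; ring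
        _ ≤ _ := by
          gcongr
          have : 0 ≤ |q| * |q - 1| * 4 ^ N * J (N + 2) := by positivity
          linarith
  · have hi2 : IntegrableOn (fun σ : ℝ => ((σ ^ b * Real.exp (-σ) : ℝ) : ℂ) *
        ((1 + σ / ζ) ^ (q : ℂ) - 1)) (Ioi 0) := by
      refine (hint.sub hi0c).congr (Eventually.of_forall fun σ => ?_)
      simp [mul_sub]
    have d1 : conflInt b q ζ - Real.Gamma (b + 1) - q * Real.Gamma (b + 2) / ζ =
        ∫ σ in Ioi (0 : ℝ), (((σ ^ b * Real.exp (-σ) : ℝ) : ℂ) * ((1 + σ / ζ) ^ (q : ℂ) - 1) -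
          ((σ ^ (b + 1) * Real.exp (-σ) : ℝ) : ℂ) * (q / ζ)) := by
      rw [d0, e1, ← integral_sub hi2 (hi1c.mul_const _)]
    rw [d1]
    refine (key _ (|q| * |q - 1| * (4 / s) ^ N * ‖ζ‖⁻¹ ^ 2) (N + 2) fun σ hσ => ?_).trans ?_
    · have e : ((σ ^ b * Real.exp (-σ) : ℝ) : ℂ) * ((1 + σ / ζ) ^ (q : ℂ) - 1) -
          ((σ ^ (b + 1) * Real.exp (-σ) : ℝ) : ℂ) * (q / ζ) =
          ((σ ^ b * Real.exp (-σ) : ℝ) : ℂ) * ((1 + σ / ζ) ^ (q : ℂ) - 1 - q * (σ / ζ)) := by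
        rw [Real.rpow_add_one (ne_of_gt hσ)]
        push_cast
        ring
      rw [e, norm_mul, Complex.norm_real, Real.norm_of_nonneg (hpos σ hσ)]
      exact mul_le_mul_of_nonneg_left
        (norm_cpow_one_add_div_sub_le hζ h1 hs0 hs1 hs hN (le_of_lt hσ)).2 (hpos σ hσ)
    · calc _ = (|q| * |q - 1| * 4 ^ N * J (N + 2)) * (1 / s) ^ N * ‖ζ‖⁻¹ ^ 2 := by rw [hpw]; ring
        _ ≤ _ := by
          gcongr
          have : 0 ≤ |q| * 4 ^ N * J (N + 1) := by positivity
          linarith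

/-- Growth of `conflInt` at the origin in the right half-plane. -/
theorem exists_norm_conflInt_le {b a : ℝ} (ha : 0 ≤ a) (hab : -1 < b - a) (q : ℝ) :
    ∃ C : ℝ, 0 < C ∧ ∀ ζ : ℂ, 0 ≤ ζ.re → ζ ≠ 0 → ‖ζ‖ ≤ 1 →
      ‖conflInt b q ζ‖ ≤ C * ‖ζ‖ ^ (a - max (q + a) 0) := by
  obtain ⟨N, hN⟩ := exists_nat_ge (max (q + a) 0)
  have hint := integrableOn_rpow_mul_exp_neg_mul_one_add_pow hab N
  set J : ℝ := ∫ σ in Ioi (0 : ℝ), σ ^ (b - a) * Real.exp (-σ) * (1 + σ) ^ N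
  have hJ : 0 ≤ J := setIntegral_nonneg measurableSet_Ioi fun σ hσ => by
    have : (0 : ℝ) < σ := hσ
    positivity
  refine ⟨J + 1, by positivity, fun ζ hre h0 h1 => ?_⟩
  have hz : 0 < ‖ζ‖ := norm_pos_iff.2 h0
  have hs : ζ ∈ Complex.slitPlane := by
    rw [Complex.mem_slitPlane_iff]
    rcases hre.lt_or_eq with h | h
    · exact Or.inl h
    · exact Or.inr fun h' => h0 (Complex.ext h.symm h')
  have hb : ‖conflInt b q ζ‖ ≤ J * ‖ζ‖ ^ (a - max (q + a) 0) := by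
    rw [conflInt, ← integral_mul_const]
    refine norm_integral_le_of_norm_le (hint.mul_const _) ?_
    filter_upwards [ae_restrict_mem measurableSet_Ioi] with σ hσ
    have hσ' : (0 : ℝ) < σ := hσ
    obtain ⟨l1, l2⟩ := one_le_norm_one_add_div h0 hre hσ'.le
    have l3 := norm_one_add_div_le ζ hσ'.le
    rw [norm_mul, Complex.norm_real, Real.norm_of_nonneg (by positivity),
      norm_cpow_one_add_div hs hσ'.le]
    set x := ‖1 + σ / ζ‖
    have hx0 : 0 < x := by linarith
    have e1 : x ^ q = x ^ (-a) * x ^ (q + a) := by rw [← Real.rpow_add hx0]; ring_nf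
    have e2 : x ^ (-a) ≤ σ ^ (-a) * ‖ζ‖ ^ a := by
      refine (Real.rpow_le_rpow_of_nonpos (by positivity) l2 (by linarith)).trans_eq ?_
      rw [Real.div_rpow hσ'.le hz.le, Real.rpow_neg hz.le, div_inv_eq_mul]
    have e3 : x ^ (q + a) ≤ (1 + σ) ^ N * ‖ζ‖ ^ (-max (q + a) 0) := by
      have l4 : x ≤ (1 + σ) / ‖ζ‖ := by
        refine l3.trans ?_
        rw [add_div]
        gcongr
        rwa [one_le_div hz]
      calc x ^ (q + a) ≤ x ^ max (q + a) 0 := Real.rpow_le_rpow_of_exponent_le l1 (le_max_left _ _)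
        _ ≤ ((1 + σ) / ‖ζ‖) ^ max (q + a) 0 := Real.rpow_le_rpow hx0.le l4 (le_max_right _ _)
        _ = (1 + σ) ^ max (q + a) 0 * ‖ζ‖ ^ (-max (q + a) 0) := by
          rw [Real.div_rpow (by positivity) hz.le, Real.rpow_neg hz.le, div_eq_mul_inv]
        _ ≤ _ := by
          gcongr
          rw [← Real.rpow_natCast]
          exact Real.rpow_le_rpow_of_exponent_le (by linarith) hN
    rw [e1, sub_eq_add_neg a, Real.rpow_add hz, sub_eq_add_neg b, Real.rpow_add hσ']
    calc σ ^ b * Real.exp (-σ) * (x ^ (-a) * x ^ (q + a)) ≤ σ ^ b * Real.exp (-σ) *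
        ((σ ^ (-a) * ‖ζ‖ ^ a) * ((1 + σ) ^ N * ‖ζ‖ ^ (-max (q + a) 0))) := by gcongr
      _ = _ := by ring
  refine hb.trans ?_
  gcongr
  linarith

noncomputable def modelP (b : ℝ) (ζ : ℂ) : ℂ :=
  -(b / ζ) * (conflInt b (b - 1) ζ / Real.Gamma (b + 1))

noncomputable def modelQ (b : ℝ) (ζ : ℂ) : ℂ :=
  conflInt b b ζ / Real.Gamma (b + 1) + modelP b ζ

noncomputable def modelU₁ (b : ℝ) (ζ : ℂ) : ℂ :=
  (-ζ) ^ (b : ℂ) * ((2 * b + 1) * eulerInt b ζ + ζ * deriv (eulerInt b) ζ) / Real.Gamma (b + 1)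

noncomputable def modelU₂ (b : ℝ) (ζ : ℂ) : ℂ :=
  modelU₁ b ζ + (-ζ) ^ ((b + 1 : ℝ) : ℂ) * eulerInt b ζ / Real.Gamma (b + 1)

theorem differentiableOn_modelP {b : ℝ} (hb : -1 < b) :
    DifferentiableOn ℂ (modelP b) Complex.slitPlane := by
  have h := differentiableOn_conflInt hb (b - 1)
  refine DifferentiableOn.mul (fun z hz => ?_) (h.div_const _)
  have := Complex.slitPlane_ne_zero hz
  exact DifferentiableAt.differentiableWithinAt (by fun_prop (disch := assumption))

theorem differentiableOn_modelQ {b : ℝ} (hb : -1 < b) :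
    DifferentiableOn ℂ (modelQ b) Complex.slitPlane :=
  ((differentiableOn_conflInt hb b).div_const _).add (differentiableOn_modelP hb)

theorem differentiableAt_neg_cpow {z : ℂ} (hz : -z ∈ Complex.slitPlane) (c : ℂ) :
    DifferentiableAt ℂ (fun z : ℂ => (-z) ^ c) z :=
  DifferentiableAt.cpow_const (f := fun z : ℂ => -z) (by fun_prop) hz

theorem differentiableOn_modelU₁ {b : ℝ} (hb : -1 < b) :
    DifferentiableOn ℂ (modelU₁ b) {z | z.re < 0} := by
  have hd := differentiable_eulerInt hb
  have hd' : Differentiable ℂ (deriv (eulerInt b)) :=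
    differentiableOn_univ.1 (hd.differentiableOn.deriv isOpen_univ)
  refine DifferentiableOn.div_const (DifferentiableOn.mul (fun z hz => ?_) ?_) _
  · exact (differentiableAt_neg_cpow (Or.inl (by simpa using hz)) _).differentiableWithinAt
  · exact Differentiable.differentiableOn (by fun_prop)

theorem differentiableOn_modelU₂ {b : ℝ} (hb : -1 < b) :
    DifferentiableOn ℂ (modelU₂ b) {z | z.re < 0} := by
  have hd := differentiable_eulerInt hb
  refine (differentiableOn_modelU₁ hb).add
    (DifferentiableOn.div_const (DifferentiableOn.mul (fun z hz => ?_) hd.differentiableOn) _)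
  exact (differentiableAt_neg_cpow (Or.inl (by simpa using hz)) _).differentiableWithinAt

theorem modelU_eq_of_connection {b : ℝ} (hb : -1 < b) {S : Set ℂ} (hS : IsOpen S) {κ : ℂ}
    (him : ∀ z ∈ S, z.im ≠ 0) (h : ∀ z ∈ S, (-z) ^ ((b + 1 : ℝ) : ℂ) * eulerInt b z =
      conflInt b b z - κ * Complex.exp z * conflInt b b (-z)) {ζ : ℂ} (hζ : ζ ∈ S) :
    modelU₁ b ζ = modelP b ζ + κ * Complex.exp ζ * modelQ b (-ζ) ∧
    modelU₂ b ζ = modelQ b ζ + κ * Complex.exp ζ * modelP b (-ζ) := by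
  have s1 : ζ ∈ Complex.slitPlane := Or.inr (him ζ hζ)
  have s2 : -ζ ∈ Complex.slitPlane := Or.inr (by simpa using him ζ hζ)
  have h0 : ζ ≠ 0 := Complex.slitPlane_ne_zero s1
  have hG : (Real.Gamma (b + 1) : ℂ) ≠ 0 := by
    exact_mod_cast (Real.Gamma_pos_of_pos (by linarith)).ne'
  have hι := (differentiable_eulerInt hb ζ).hasDerivAt
  have hneg : HasDerivAt (fun z : ℂ => -z) (-1) ζ := hasDerivAt_neg ζ
  have hl := (hneg.cpow_const (c := ((b + 1 : ℝ) : ℂ)) s2).mul hι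
  have hr := (hasDerivAt_conflInt hb b s1).sub (((Complex.hasDerivAt_exp ζ).const_mul κ).mul
    ((hasDerivAt_conflInt hb b s2).comp ζ hneg))
  have he := hl.unique (hr.congr_of_eventuallyEq (by
    filter_upwards [hS.mem_nhds hζ] with z hz using h z hz))
  have hv := h ζ hζ
  have ec : ((b + 1 : ℝ) : ℂ) - 1 = b := by push_cast; ring
  have hpow : (-ζ) ^ ((b + 1 : ℝ) : ℂ) = (-ζ) ^ (b : ℂ) * -ζ := by
    rw [← ec, Complex.cpow_sub _ _ (neg_ne_zero.2 h0), Complex.cpow_one]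
    field_simp
  rw [ec] at he
  simp only [Function.comp] at he
  have hd : modelU₂ b ζ - modelU₁ b ζ = (conflInt b b ζ - κ * Complex.exp ζ * conflInt b b (-ζ)) /
      Real.Gamma (b + 1) := by
    rw [modelU₂, add_sub_cancel_left, hv]
  have h1 : modelU₁ b ζ = modelP b ζ + κ * Complex.exp ζ * modelQ b (-ζ) := by
    rw [hpow] at he hv
    have : modelU₁ b ζ * Real.Gamma (b + 1) = (2 * b + 1) * ((-ζ) ^ (b : ℂ) * eulerInt b ζ) +
      ζ * ((-ζ) ^ (b : ℂ) * deriv (eulerInt b) ζ) := by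
      rw [modelU₁]; field_simp
    have hs : modelU₁ b ζ * Real.Gamma (b + 1) = (modelP b ζ + κ * Complex.exp ζ * modelQ b (-ζ)) *
        Real.Gamma (b + 1) := by
      have hP : modelP b ζ * Real.Gamma (b + 1) = -(b / ζ) * conflInt b (b - 1) ζ := by
        rw [modelP]; field_simp
      have hQ : modelQ b (-ζ) * Real.Gamma (b + 1) =
          conflInt b b (-ζ) + b / ζ * conflInt b (b - 1) (-ζ) := by
        rw [modelQ, modelP, div_neg]; field_simp
      have hr : (b : ℂ) / ζ * ζ = b := div_mul_cancel₀ _ h0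
      rw [div_neg] at he
      push_cast at he
      rw [this]
      generalize (b : ℂ) / ζ = r at *
      linear_combination (-1) * he - r * hv - (-ζ) ^ (b : ℂ) * eulerInt b ζ * hr - hP -
        κ * Complex.exp ζ * hQ
    exact mul_right_cancel₀ hG hs
  refine ⟨h1, ?_⟩
  have h2 : modelU₂ b ζ = modelU₁ b ζ + (conflInt b b ζ - κ * Complex.exp ζ * conflInt b b (-ζ)) /
      Real.Gamma (b + 1) := by rw [← hd]; ring
  rw [h2, h1, modelQ, modelQ, modelP, modelP]
  field_simp
  ring

theorem modelU_eq_of_im_pos {b : ℝ} (hb : -1 < b) {ζ : ℂ} (hζ : 0 < ζ.im) :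
    modelU₁ b ζ = modelP b ζ +
      Complex.exp (-((π * b : ℝ) : ℂ) * Complex.I) * Complex.exp ζ * modelQ b (-ζ) ∧
    modelU₂ b ζ = modelQ b ζ +
      Complex.exp (-((π * b : ℝ) : ℂ) * Complex.I) * Complex.exp ζ * modelP b (-ζ) :=
  modelU_eq_of_connection hb (S := {z | 0 < z.im})
    (isOpen_lt continuous_const Complex.continuous_im) (fun _ hz => ne_of_gt hz)
    (fun _ hz => neg_cpow_mul_eulerInt_of_im_pos hb hz) hζ

theorem modelU_eq_of_im_neg {b : ℝ} (hb : -1 < b) {ζ : ℂ} (hζ : ζ.im < 0) :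
    modelU₁ b ζ = modelP b ζ +
      Complex.exp (((π * b : ℝ) : ℂ) * Complex.I) * Complex.exp ζ * modelQ b (-ζ) ∧
    modelU₂ b ζ = modelQ b ζ +
      Complex.exp (((π * b : ℝ) : ℂ) * Complex.I) * Complex.exp ζ * modelP b (-ζ) :=
  modelU_eq_of_connection hb (S := {z | z.im < 0})
    (isOpen_lt Complex.continuous_im continuous_const) (fun _ hz => ne_of_lt hz)
    (fun _ hz => neg_cpow_mul_eulerInt_of_im_neg hb hz) hζ

theorem exists_norm_modelU_le {b : ℝ} (hb : -1 < b) :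
    ∃ C : ℝ, 0 < C ∧ ∀ ζ : ℂ, ζ ≠ 0 → ‖ζ‖ ≤ 1 →
      ‖modelU₁ b ζ‖ ≤ C * ‖ζ‖ ^ b ∧ ‖modelU₂ b ζ‖ ≤ C * ‖ζ‖ ^ b := by
  have hd := differentiable_eulerInt hb
  have hd' : Continuous (deriv (eulerInt b)) :=
    (differentiableOn_univ.1 (hd.differentiableOn.deriv isOpen_univ)).continuous
  set g : ℂ → ℂ := fun ζ => ((2 * b + 1) * eulerInt b ζ + ζ * deriv (eulerInt b) ζ) /
    Real.Gamma (b + 1)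
  have hg : Continuous g := by
    have := hd.continuous
    fun_prop
  obtain ⟨C₁, hC₁⟩ := (isCompact_closedBall (0 : ℂ) 1).exists_bound_of_continuousOn hg.continuousOn
  obtain ⟨C₂, hC₂⟩ := (isCompact_closedBall (0 : ℂ) 1).exists_bound_of_continuousOn
    (hd.continuous.div_const (Real.Gamma (b + 1) : ℂ)).continuousOn
  have z0 : (0 : ℂ) ∈ closedBall (0 : ℂ) 1 := by simp
  have n1 := (norm_nonneg _).trans (hC₁ 0 z0)
  have n2 := (norm_nonneg _).trans (hC₂ 0 z0)
  refine ⟨C₁ + C₂ + 1, by linarith, fun ζ h0 h1 => ?_⟩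
  have hz : 0 < ‖ζ‖ := norm_pos_iff.2 h0
  have hm : ζ ∈ closedBall (0 : ℂ) 1 := by simpa using h1
  have e1 : ‖modelU₁ b ζ‖ ≤ C₁ * ‖ζ‖ ^ b := by
    rw [modelU₁, mul_div_assoc, norm_mul, Complex.norm_cpow_of_ne_zero (neg_ne_zero.2 h0)]
    simp only [Complex.ofReal_re, Complex.ofReal_im, mul_zero, Real.exp_zero, div_one, norm_neg]
    rw [mul_comm]
    gcongr
    exact hC₁ ζ hm
  have e2 : ‖(-ζ) ^ ((b + 1 : ℝ) : ℂ) * eulerInt b ζ / Real.Gamma (b + 1)‖ ≤ C₂ * ‖ζ‖ ^ b := by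
    rw [mul_div_assoc, norm_mul, Complex.norm_cpow_of_ne_zero (neg_ne_zero.2 h0)]
    simp only [Complex.ofReal_re, Complex.ofReal_im, mul_zero, Real.exp_zero, div_one, norm_neg]
    rw [mul_comm]
    gcongr ?_ * ?_
    · exact hC₂ ζ hm
    · exact Real.rpow_le_rpow_of_exponent_ge hz h1 (by linarith)
  have hp : 0 ≤ ‖ζ‖ ^ b := by positivity
  constructor
  · exact e1.trans (by gcongr; linarith)
  · refine (norm_add_le _ _).trans ((add_le_add e1 e2).trans ?_)
    rw [← add_mul]
    exact mul_le_mul_of_nonneg_right (by linarith) hp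

theorem exists_norm_modelPQ_le {b : ℝ} (hb : -(1 / 2) < b) :
    ∃ C : ℝ, 0 < C ∧ ∀ ζ : ℂ, 0 ≤ ζ.re → ζ ≠ 0 → ‖ζ‖ ≤ 1 →
      ‖modelP b ζ‖ ≤ C * ‖ζ‖ ^ (min (b + 1 / 2) (1 / 2) - b - 1) ∧
      ‖modelQ b ζ‖ ≤ C * ‖ζ‖ ^ (min (b + 1 / 2) (1 / 2) - b - 1) := by
  obtain ⟨C₁, h1, hC₁⟩ := exists_norm_conflInt_le (b := b) (a := 1 / 2) (by norm_num) (by linarith)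
    (b - 1)
  obtain ⟨C₂, h2, hC₂⟩ := exists_norm_conflInt_le (b := b) (a := 0) le_rfl (by linarith) b
  have hG : 0 < Real.Gamma (b + 1) := Real.Gamma_pos_of_pos (by linarith)
  set G := Real.Gamma (b + 1)
  refine ⟨|b| * C₁ / G + C₂ / G, by positivity, fun ζ hre h0 hle => ?_⟩
  have hz : 0 < ‖ζ‖ := norm_pos_iff.2 h0
  set e := min (b + 1 / 2) (1 / 2)
  have hmono : ∀ {x y : ℝ}, y ≤ x → ‖ζ‖ ^ x ≤ ‖ζ‖ ^ y := fun h =>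
    Real.rpow_le_rpow_of_exponent_ge hz hle h
  have hP : ‖modelP b ζ‖ ≤ (|b| * C₁ / G) * ‖ζ‖ ^ (e - b - 1) := by
    rw [modelP, norm_mul, norm_neg, norm_div, norm_div, Complex.norm_real, Complex.norm_real,
      Real.norm_of_nonneg hG.le, Real.norm_eq_abs]
    calc |b| / ‖ζ‖ * (‖conflInt b (b - 1) ζ‖ / G)
        ≤ |b| / ‖ζ‖ * (C₁ * ‖ζ‖ ^ (1 / 2 - max (b - 1 + 1 / 2) 0) / G) := by
          gcongr; exact hC₁ ζ hre h0 hle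
      _ = (|b| * C₁ / G) * ‖ζ‖ ^ (1 / 2 - max (b - 1 + 1 / 2) 0 - 1) := by
          rw [Real.rpow_sub_one hz.ne']; ring
      _ ≤ _ := by
          gcongr ?_ * ?_
          refine hmono ?_
          simp only [e]
          rcases le_total (b - 1 + 1 / 2) 0 with h | h
          · rw [max_eq_right h]; linarith [min_le_left (b + 1 / 2) (1 / 2)]
          · rw [max_eq_left h]; linarith [min_le_right (b + 1 / 2) (1 / 2)]
  have hA : ‖conflInt b b ζ / G‖ ≤ (C₂ / G) * ‖ζ‖ ^ (e - b - 1) := by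
    rw [norm_div, Complex.norm_real, Real.norm_of_nonneg hG.le]
    calc ‖conflInt b b ζ‖ / G ≤ C₂ * ‖ζ‖ ^ (0 - max (b + 0) 0) / G := by
          gcongr; exact hC₂ ζ hre h0 hle
      _ = (C₂ / G) * ‖ζ‖ ^ (0 - max (b + 0) 0) := by ring
      _ ≤ _ := by
          gcongr ?_ * ?_
          refine hmono ?_
          simp only [e, add_zero]
          rcases le_total b 0 with h | h
          · rw [max_eq_right h]; linarith [min_le_left (b + 1 / 2) (1 / 2)]
          · rw [max_eq_left h]; linarith [min_le_right (b + 1 / 2) (1 / 2)]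
  have hp : 0 ≤ ‖ζ‖ ^ (e - b - 1) := by positivity
  have c1 : 0 ≤ C₂ / G := by positivity
  constructor
  · refine hP.trans ?_
    gcongr
    linarith
  · rw [modelQ, add_mul, add_comm (_ * _)]
    exact (norm_add_le _ _).trans (add_le_add hA hP)

/-- Asymptotics of the model functions at infinity, with explicit dependence on the distance to
the negative axis. -/
theorem exists_norm_modelPQ_sub_le {b : ℝ} (hb : -1 < b) :
    ∃ C : ℝ, 0 < C ∧ ∃ N : ℕ, ∀ ζ ∈ Complex.slitPlane, 1 / 4 ≤ ‖ζ‖ → ∀ s : ℝ, 0 < s → s ≤ 1 →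
      (∀ σ : ℝ, 0 ≤ σ → s ≤ ‖1 + σ / ζ‖) →
      ‖modelP b ζ + b / ζ‖ ≤ C * (1 / s) ^ N * ‖ζ‖⁻¹ ^ 2 ∧
      ‖modelQ b ζ - 1 - b ^ 2 / ζ‖ ≤ C * (1 / s) ^ N * ‖ζ‖⁻¹ ^ 2 := by
  obtain ⟨C₁, h1, N₁, hC₁⟩ := exists_norm_conflInt_sub_le hb (b - 1)
  obtain ⟨C₂, h2, N₂, hC₂⟩ := exists_norm_conflInt_sub_le hb b
  have hG : 0 < Real.Gamma (b + 1) := Real.Gamma_pos_of_pos (by linarith)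
  have hG2 : Real.Gamma (b + 2) = (b + 1) * Real.Gamma (b + 1) := by
    rw [← Real.Gamma_add_one (by linarith)]; ring_nf
  set G := Real.Gamma (b + 1)
  have hGc : (G : ℂ) ≠ 0 := by exact_mod_cast hG.ne'
  refine ⟨|b| * C₁ / G + C₂ / G, by positivity, max N₁ N₂, fun ζ hζ hz s hs0 hs1 hs => ?_⟩
  have h0 : ζ ≠ 0 := Complex.slitPlane_ne_zero hζ
  have hs' : 1 ≤ 1 / s := by rwa [one_le_div hs0]
  have hP : ‖modelP b ζ + b / ζ‖ ≤ (|b| * C₁ / G) * (1 / s) ^ (max N₁ N₂) * ‖ζ‖⁻¹ ^ 2 := by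
    have e : modelP b ζ + b / ζ = -(b / ζ / G) * (conflInt b (b - 1) ζ - G) := by
      rw [modelP, show Real.Gamma (b + 1) = G from rfl]; field_simp; ring
    rw [e, norm_mul, norm_neg, norm_div, norm_div, Complex.norm_real, Complex.norm_real,
      Real.norm_of_nonneg hG.le, Real.norm_eq_abs]
    calc _ ≤ |b| / ‖ζ‖ / G * (C₁ * (1 / s) ^ N₁ * ‖ζ‖⁻¹) := by
          gcongr; exact (hC₁ ζ hζ hz s hs0 hs1 hs).1
      _ ≤ |b| / ‖ζ‖ / G * (C₁ * (1 / s) ^ (max N₁ N₂) * ‖ζ‖⁻¹) := by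
          gcongr
          exact le_max_left _ _
      _ = _ := by ring
  have hA : ‖conflInt b b ζ / G - 1 - b * (b + 1) / ζ‖ ≤
      (C₂ / G) * (1 / s) ^ (max N₁ N₂) * ‖ζ‖⁻¹ ^ 2 := by
    have e : conflInt b b ζ / G - 1 - b * (b + 1) / ζ =
        (conflInt b b ζ - G - b * Real.Gamma (b + 2) / ζ) / G := by
      rw [hG2]; push_cast; field_simp
    rw [e, norm_div, Complex.norm_real, Real.norm_of_nonneg hG.le]
    calc _ ≤ (C₂ * (1 / s) ^ N₂ * ‖ζ‖⁻¹ ^ 2) / G := by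
          gcongr; exact (hC₂ ζ hζ hz s hs0 hs1 hs).2
      _ ≤ (C₂ * (1 / s) ^ (max N₁ N₂) * ‖ζ‖⁻¹ ^ 2) / G := by
          gcongr
          exact le_max_right _ _
      _ = _ := by ring
  have hp : 0 ≤ (1 / s) ^ (max N₁ N₂) * ‖ζ‖⁻¹ ^ 2 := by positivity
  have c1 : 0 ≤ C₂ / G := by positivity
  constructor
  · refine hP.trans ?_
    rw [mul_assoc, mul_assoc]
    gcongr
    linarith
  · have e : modelQ b ζ - 1 - b ^ 2 / ζ =
        (conflInt b b ζ / G - 1 - b * (b + 1) / ζ) + (modelP b ζ + b / ζ) := by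
      rw [modelQ, show Real.Gamma (b + 1) = G from rfl]; field_simp; ring
    rw [e, add_mul, add_mul, add_comm (_ * _ * _)]
    exact (norm_add_le _ _).trans (add_le_add hA hP)

theorem exp_neg_le_two_mul_inv_sq {x : ℝ} (hx : 0 < x) : Real.exp (-x) ≤ 2 * x⁻¹ ^ 2 := by
  have h := Real.quadratic_le_exp_of_nonneg hx.le
  have h2 : x ^ 2 / 2 ≤ Real.exp x := by linarith
  rw [Real.exp_neg, ← div_le_iff₀' (by norm_num), inv_pow, div_eq_mul_inv, ← mul_inv]
  exact inv_anti₀ (by positivity) (by linarith)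

theorem exists_norm_le_inv_sq_of_norm_mul_abs_im_pow_le {h : ℂ → ℂ} {M : ℝ} {N : ℕ} (hM0 : 0 ≤ M)
    (hd : DifferentiableOn ℂ h {z | z.re < 0})
    (hM : ∀ z : ℂ, z.re < 0 → z.im ≠ 0 → 1 / 4 ≤ ‖z‖ →
      ‖h z‖ ≤ M * (‖z‖ / |z.im|) ^ N * ‖z‖⁻¹ ^ 2 + M * Real.exp z.re) :
    ∃ C : ℝ, 0 < C ∧ ∀ z : ℂ, 1 ≤ ‖z‖ → z.re < 0 → 4 * |z.im| ≤ |z.re| →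
      ‖h z‖ ≤ C * ‖z‖⁻¹ ^ 2 := by
  refine ⟨M * (3 ^ N + 2) * 3 ^ (N + 1) * 9 + 1, by positivity, fun z hz hre him => ?_⟩
  set R := -z.re / 2 with hR
  have hR0 : 0 < R := by rw [hR]; linarith
  have hle : ‖z‖ ≤ 3 * R := by
    have := Complex.norm_le_abs_re_add_abs_im z
    rw [abs_of_neg hre] at *
    linarith
  have key := norm_le_of_norm_mul_abs_im_pow_le (h := h) (c := (z.re : ℂ)) (R := R) (k := N + 1)
    (B := M * (3 ^ N + 2) * R ^ (N + 1) * R⁻¹ ^ 2) hR0 ?_ ?_ z ?_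
  · refine key.trans ?_
    have e : M * (3 ^ N + 2) * R ^ (N + 1) * R⁻¹ ^ 2 * (3 / R) ^ (N + 1) =
        M * (3 ^ N + 2) * 3 ^ (N + 1) * R⁻¹ ^ 2 := by
      have : R ^ (N + 1) * (3 / R) ^ (N + 1) = 3 ^ (N + 1) := by
        rw [← mul_pow, mul_div_cancel₀ _ hR0.ne']
      linear_combination (M * (3 ^ N + 2) * R⁻¹ ^ 2) * this
    rw [e]
    have h3 : R⁻¹ ≤ 3 * ‖z‖⁻¹ := by
      rw [inv_le_iff_one_le_mul₀ hR0]
      have : 1 ≤ ‖z‖⁻¹ * (3 * R) := by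
        rw [inv_mul_eq_div, one_le_div (by linarith)]; exact hle
      linarith
    calc _ ≤ M * (3 ^ N + 2) * 3 ^ (N + 1) * (3 * ‖z‖⁻¹) ^ 2 := by gcongr
      _ = (M * (3 ^ N + 2) * 3 ^ (N + 1) * 9) * ‖z‖⁻¹ ^ 2 := by ring
      _ ≤ _ := by gcongr; linarith
  · refine (hd.mono fun y hy => ?_).diffContOnCl
    rw [closure_ball _ hR0.ne', mem_closedBall, dist_eq_norm] at hy
    have := (Complex.re_le_norm (y - z.re)).trans hy
    simp at this
    show y.re < 0
    linarith
  · intro y hy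
    rw [mem_sphere, dist_eq_norm] at hy
    have r1 := abs_le.1 ((Complex.abs_re_le_norm (y - z.re)).trans hy.le)
    have r2 := (Complex.abs_im_le_norm (y - z.re)).trans hy.le
    simp at r1 r2
    have r3 : y.re ≤ -R := by linarith [r1.2]
    have r4 : R ≤ ‖y‖ := by
      have := Complex.abs_re_le_norm y
      rw [abs_of_neg (by linarith)] at this
      linarith
    have r5 : ‖y‖ ≤ 3 * R := by
      have := norm_add_le (y - z.re) (z.re : ℂ)
      rw [sub_add_cancel, Complex.norm_real, Real.norm_eq_abs, abs_of_neg hre] at this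
      linarith
    rw [Complex.sub_im, Complex.ofReal_im, sub_zero]
    by_cases h0 : y.im = 0
    · rw [h0]; simp; positivity
    have him0 : 0 < |y.im| := abs_pos.2 h0
    have hy0 : 0 < ‖y‖ := by linarith
    calc ‖h y‖ * |y.im| ^ (N + 1)
        ≤ (M * (‖y‖ / |y.im|) ^ N * ‖y‖⁻¹ ^ 2 + M * Real.exp y.re) * |y.im| ^ (N + 1) := by
          gcongr; exact hM y (by linarith) h0 (by linarith)
      _ = M * ‖y‖ ^ N * ‖y‖⁻¹ ^ 2 * |y.im| + M * Real.exp y.re * |y.im| ^ (N + 1) := by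
          have : (‖y‖ / |y.im|) ^ N * |y.im| ^ N = ‖y‖ ^ N := by
            rw [← mul_pow, div_mul_cancel₀ _ him0.ne']
          linear_combination (M * ‖y‖⁻¹ ^ 2 * |y.im|) * this
      _ ≤ M * (3 * R) ^ N * R⁻¹ ^ 2 * R + M * (2 * R⁻¹ ^ 2) * R ^ (N + 1) := by
          have e1 : Real.exp y.re ≤ 2 * R⁻¹ ^ 2 :=
            (Real.exp_le_exp.2 r3).trans (exp_neg_le_two_mul_inv_sq hR0)
          have e2 : ‖y‖⁻¹ ≤ R⁻¹ := inv_anti₀ hR0 r4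
          gcongr
      _ = _ := by ring_nf
  · rw [mem_closedBall, dist_eq_norm]
    have : z - z.re = z.im * Complex.I := by
      apply Complex.ext <;> simp
    rw [this, norm_mul, Complex.norm_I, Complex.norm_real, Real.norm_eq_abs, mul_one]
    rw [abs_of_neg hre] at him
    linarith

theorem exists_norm_modelPQ_sub_le_of_re_nonneg {b : ℝ} (hb : -1 < b) :
    ∃ C : ℝ, 0 < C ∧ ∀ ζ : ℂ, 0 ≤ ζ.re → 1 / 4 ≤ ‖ζ‖ →
      ‖modelP b ζ + b / ζ‖ ≤ C * ‖ζ‖⁻¹ ^ 2 ∧ ‖modelQ b ζ - 1 - b ^ 2 / ζ‖ ≤ C * ‖ζ‖⁻¹ ^ 2 := by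
  obtain ⟨C, hC0, N, hC⟩ := exists_norm_modelPQ_sub_le hb
  refine ⟨C, hC0, fun ζ hre hz => ?_⟩
  have h0 : ζ ≠ 0 := fun h => by rw [h, norm_zero] at hz; norm_num at hz
  have hs : ζ ∈ Complex.slitPlane := by
    rw [Complex.mem_slitPlane_iff]
    rcases hre.lt_or_eq with h | h
    · exact Or.inl h
    · exact Or.inr fun h' => h0 (Complex.ext h.symm h')
  simpa using hC ζ hs hz 1 one_pos le_rfl fun σ hσ => (one_le_norm_one_add_div h0 hre hσ).1

theorem exists_norm_modelPQ_le_of_re_nonneg {b : ℝ} (hb : -1 < b) :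
    ∃ C : ℝ, 0 < C ∧ ∀ ζ : ℂ, 0 ≤ ζ.re → 1 / 4 ≤ ‖ζ‖ →
      ‖modelP b ζ‖ ≤ C ∧ ‖modelQ b ζ‖ ≤ C := by
  obtain ⟨C, hC0, hC⟩ := exists_norm_modelPQ_sub_le_of_re_nonneg hb
  refine ⟨16 * C + 4 * |b| + 4 * b ^ 2 + 1, by positivity, fun ζ hre hz => ?_⟩
  have hinv : ‖ζ‖⁻¹ ≤ 4 := by
    rw [inv_le_comm₀ (by linarith) (by norm_num)]; linarith
  have hsq : C * ‖ζ‖⁻¹ ^ 2 ≤ 16 * C := by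
    calc C * ‖ζ‖⁻¹ ^ 2 ≤ C * 4 ^ 2 := by gcongr
      _ = _ := by ring
  obtain ⟨h1, h2⟩ := hC ζ hre hz
  have hb1 : ‖(b / ζ : ℂ)‖ ≤ 4 * |b| := by
    rw [norm_div, Complex.norm_real, Real.norm_eq_abs, div_eq_mul_inv, mul_comm]
    gcongr
  have hb2 : ‖(b ^ 2 / ζ : ℂ)‖ ≤ 4 * b ^ 2 := by
    rw [norm_div, norm_pow, Complex.norm_real, Real.norm_eq_abs, sq_abs, div_eq_mul_inv, mul_comm]
    gcongr
  constructor
  · have := norm_sub_le (modelP b ζ + b / ζ) (b / ζ)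
    rw [add_sub_cancel_right] at this
    nlinarith [abs_nonneg b]
  · have h3 := norm_add_le (modelQ b ζ - 1 - b ^ 2 / ζ) (1 + b ^ 2 / ζ)
    have h4 := norm_add_le (1 : ℂ) (b ^ 2 / ζ)
    rw [show modelQ b ζ - 1 - b ^ 2 / ζ + (1 + b ^ 2 / ζ) = modelQ b ζ by ring] at h3
    rw [norm_one] at h4
    linarith [abs_nonneg b]

theorem norm_exp_ofReal_mul_I_mul (t : ℝ) (x y : ℂ) :
    ‖Complex.exp (t * Complex.I) * x * y‖ = ‖x‖ * ‖y‖ := by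
  rw [norm_mul, norm_mul, Complex.norm_exp_ofReal_mul_I, one_mul]

theorem exists_modelU_eq {b : ℝ} (hb : -1 < b) {ζ : ℂ} (hζ : ζ.im ≠ 0) : ∃ t : ℝ,
    modelU₁ b ζ = modelP b ζ + Complex.exp (t * Complex.I) * Complex.exp ζ * modelQ b (-ζ) ∧
    modelU₂ b ζ = modelQ b ζ + Complex.exp (t * Complex.I) * Complex.exp ζ * modelP b (-ζ) := by
  rcases hζ.lt_or_gt with h | h
  · exact ⟨π * b, modelU_eq_of_im_neg hb h⟩
  · refine ⟨-(π * b), ?_⟩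
    have := modelU_eq_of_im_pos hb h
    rwa [← Complex.ofReal_neg] at this

/-- Asymptotics of the model functions off the real axis. -/
theorem exists_norm_modelPQ_sub_le_of_im_ne_zero {b : ℝ} (hb : -1 < b) :
    ∃ C : ℝ, 0 < C ∧ ∀ ζ : ℂ, ζ.im ≠ 0 → 1 ≤ ‖ζ‖ →
      ‖modelP b ζ + b / ζ‖ ≤ C * ‖ζ‖⁻¹ ^ 2 ∧ ‖modelQ b ζ - 1 - b ^ 2 / ζ‖ ≤ C * ‖ζ‖⁻¹ ^ 2 := by
  obtain ⟨C₁, h1, N, hC₁⟩ := exists_norm_modelPQ_sub_le hb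
  obtain ⟨C₂, h2, hC₂⟩ := exists_norm_modelPQ_sub_le_of_re_nonneg hb
  obtain ⟨C₃, h3, hC₃⟩ := exists_norm_modelPQ_le_of_re_nonneg hb
  have hsec : ∀ z : ℂ, z.im ≠ 0 → 1 / 4 ≤ ‖z‖ →
      ‖modelP b z + b / z‖ ≤ C₁ * (‖z‖ / |z.im|) ^ N * ‖z‖⁻¹ ^ 2 ∧
      ‖modelQ b z - 1 - b ^ 2 / z‖ ≤ C₁ * (‖z‖ / |z.im|) ^ N * ‖z‖⁻¹ ^ 2 := by
    intro z him hz
    have hz0 : 0 < ‖z‖ := by linarith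
    have := hC₁ z (Or.inr him) hz (|z.im| / ‖z‖) (div_pos (abs_pos.2 him) hz0)
      ((div_le_one hz0).2 (Complex.abs_im_le_norm z))
      (fun σ _ => norm_one_add_div_ge (norm_pos_iff.1 hz0) σ)
    rwa [one_div_div] at this
  have hne : ∀ z : ℂ, z.re < 0 → z ≠ 0 := fun z hz h => by simp [h] at hz
  have hexpl : ∀ z : ℂ, z.re < 0 → 1 / 4 ≤ ‖z‖ →
      ‖modelP b (-z)‖ ≤ C₃ ∧ ‖modelQ b (-z)‖ ≤ C₃ := fun z hre hz =>
    hC₃ (-z) (by simpa using hre.le) (by simpa using hz)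
  obtain ⟨C₄, h4, hC₄⟩ := exists_norm_le_inv_sq_of_norm_mul_abs_im_pow_le (N := N)
    (h := fun z => modelU₁ b z + b / z) (M := C₁ + C₃) (by positivity)
    ((differentiableOn_modelU₁ hb).add fun z hz => by
      have := hne z hz
      exact DifferentiableAt.differentiableWithinAt (by fun_prop (disch := assumption)))
    (fun z hre him hz => by
      obtain ⟨t, ht, -⟩ := exists_modelU_eq hb him
      obtain ⟨s1, -⟩ := hsec z him hz
      obtain ⟨-, s2⟩ := hexpl z hre hz
      have e : modelU₁ b z + b / z = (modelP b z + b / z) +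
        Complex.exp (t * Complex.I) * Complex.exp z * modelQ b (-z) := by rw [ht]; ring
      rw [e]
      refine (norm_add_le _ _).trans ?_
      rw [norm_exp_ofReal_mul_I_mul, Complex.norm_exp, mul_comm (Real.exp _)]
      refine add_le_add (s1.trans ?_) ?_
      · gcongr; linarith
      · gcongr; linarith)
  obtain ⟨C₅, h5, hC₅⟩ := exists_norm_le_inv_sq_of_norm_mul_abs_im_pow_le (N := N)
    (h := fun z => modelU₂ b z - 1 - b ^ 2 / z) (M := C₁ + C₃) (by positivity)
    (((differentiableOn_modelU₂ hb).sub_const 1).sub fun z hz => by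
      have := hne z hz
      exact DifferentiableAt.differentiableWithinAt (by fun_prop (disch := assumption)))
    (fun z hre him hz => by
      obtain ⟨t, -, ht⟩ := exists_modelU_eq hb him
      obtain ⟨-, s1⟩ := hsec z him hz
      obtain ⟨s2, -⟩ := hexpl z hre hz
      have e : modelU₂ b z - 1 - b ^ 2 / z = (modelQ b z - 1 - b ^ 2 / z) +
        Complex.exp (t * Complex.I) * Complex.exp z * modelP b (-z) := by rw [ht]; ring
      rw [e]
      refine (norm_add_le _ _).trans ?_
      rw [norm_exp_ofReal_mul_I_mul, Complex.norm_exp, mul_comm (Real.exp _)]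
      refine add_le_add (s1.trans ?_) ?_
      · gcongr; linarith
      · gcongr; linarith)
  refine ⟨C₁ * 5 ^ N + C₂ + C₄ + C₅ + 8 * C₃, by positivity, fun ζ him hz => ?_⟩
  have hz0 : 0 < ‖ζ‖ := by linarith
  have hpos : 0 ≤ ‖ζ‖⁻¹ ^ 2 := by positivity
  have c1 : 0 < C₁ * 5 ^ N := by positivity
  rcases le_or_gt 0 ζ.re with hre | hre
  · obtain ⟨a1, a2⟩ := hC₂ ζ hre (by linarith)
    exact ⟨a1.trans (by gcongr; linarith), a2.trans (by gcongr; linarith)⟩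
  rcases le_or_gt (4 * |ζ.im|) |ζ.re| with hs | hs
  · have hre' : ‖ζ‖ / 2 ≤ -ζ.re := by
      have := Complex.norm_le_abs_re_add_abs_im ζ
      rw [abs_of_neg hre] at *
      linarith
    have hE : ‖Complex.exp ζ‖ ≤ 8 * ‖ζ‖⁻¹ ^ 2 := by
      rw [Complex.norm_exp]
      have := exp_neg_le_two_mul_inv_sq (x := ‖ζ‖ / 2) (by linarith)
      refine (Real.exp_le_exp.2 (by linarith : ζ.re ≤ -(‖ζ‖ / 2))).trans (this.trans_eq ?_)
      rw [inv_div]; ring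
    obtain ⟨t, t1, t2⟩ := exists_modelU_eq hb him
    obtain ⟨s1, s2⟩ := hexpl ζ hre (by linarith)
    have a1 := hC₄ ζ hz hre hs
    have a2 := hC₅ ζ hz hre hs
    have m1 : ‖Complex.exp (t * Complex.I) * Complex.exp ζ * modelQ b (-ζ)‖ ≤
        (8 * C₃) * ‖ζ‖⁻¹ ^ 2 := by
      rw [norm_exp_ofReal_mul_I_mul]
      calc _ ≤ (8 * ‖ζ‖⁻¹ ^ 2) * C₃ := by gcongr
        _ = _ := by ring
    have m2 : ‖Complex.exp (t * Complex.I) * Complex.exp ζ * modelP b (-ζ)‖ ≤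
        (8 * C₃) * ‖ζ‖⁻¹ ^ 2 := by
      rw [norm_exp_ofReal_mul_I_mul]
      calc _ ≤ (8 * ‖ζ‖⁻¹ ^ 2) * C₃ := by gcongr
        _ = _ := by ring
    constructor
    · have e : modelP b ζ + b / ζ = (modelU₁ b ζ + b / ζ) -
        Complex.exp (t * Complex.I) * Complex.exp ζ * modelQ b (-ζ) := by rw [t1]; ring
      rw [e]
      refine (norm_sub_le _ _).trans ((add_le_add a1 m1).trans ?_)
      rw [← add_mul]
      exact mul_le_mul_of_nonneg_right (by linarith) hpos
    · have e : modelQ b ζ - 1 - b ^ 2 / ζ = (modelU₂ b ζ - 1 - b ^ 2 / ζ) -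
        Complex.exp (t * Complex.I) * Complex.exp ζ * modelP b (-ζ) := by rw [t2]; ring
      rw [e]
      refine (norm_sub_le _ _).trans ((add_le_add a2 m2).trans ?_)
      rw [← add_mul]
      exact mul_le_mul_of_nonneg_right (by linarith) hpos
  · obtain ⟨a1, a2⟩ := hsec ζ him (by linarith)
    have h5' : ‖ζ‖ / |ζ.im| ≤ 5 := by
      rw [div_le_iff₀ (abs_pos.2 him)]
      have := Complex.norm_le_abs_re_add_abs_im ζ
      linarith
    have hpw : C₁ * (‖ζ‖ / |ζ.im|) ^ N * ‖ζ‖⁻¹ ^ 2 ≤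
        (C₁ * 5 ^ N + C₂ + C₄ + C₅ + 8 * C₃) * ‖ζ‖⁻¹ ^ 2 := by
      refine mul_le_mul_of_nonneg_right ?_ hpos
      have : C₁ * (‖ζ‖ / |ζ.im|) ^ N ≤ C₁ * 5 ^ N := by gcongr
      linarith
    exact ⟨a1.trans hpw, a2.trans hpw⟩

/-- Gluing of holomorphic functions. -/
theorem exists_differentiableOn_iUnion {ι : Type*} {U : ι → Set ℂ} (hU : ∀ i, IsOpen (U i))
    {f : ι → ℂ → ℂ} (hf : ∀ i, DifferentiableOn ℂ (f i) (U i))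
    (hagree : ∀ i j, ∀ z ∈ U i ∩ U j, f i z = f j z) :
    ∃ F : ℂ → ℂ, DifferentiableOn ℂ F (⋃ i, U i) ∧ ∀ i, ∀ z ∈ U i, F z = f i z := by
  classical
  set F : ℂ → ℂ := fun z => if h : ∃ i, z ∈ U i then f h.choose z else 0
  have hF : ∀ i, ∀ z ∈ U i, F z = f i z := by
    intro i z hz
    have h : ∃ i, z ∈ U i := ⟨i, hz⟩
    simp only [F, dif_pos h]
    exact hagree _ _ z ⟨h.choose_spec, hz⟩
  refine ⟨F, fun z hz => ?_, hF⟩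
  obtain ⟨i, hi⟩ := mem_iUnion.1 hz
  have hnhds := (hU i).mem_nhds hi
  refine (((hf i z hi).differentiableAt hnhds).congr_of_eventuallyEq ?_).differentiableWithinAt
  filter_upwards [hnhds] with y hy using hF i y hy

theorem norm_le_of_dense {f : ℂ → ℂ} {U D : Set ℂ} (hU : IsOpen U) (hf : ContinuousOn f U)
    (hD : Dense D) {M : ℝ} (h : ∀ z ∈ U ∩ D, ‖f z‖ ≤ M) : ∀ z ∈ U, ‖f z‖ ≤ M := by
  intro z hz
  by_contra! hlt
  have ho : IsOpen (U ∩ {y | M < ‖f y‖}) :=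
    hf.norm.isOpen_inter_preimage hU isOpen_Ioi
  obtain ⟨y, ⟨hyU, hyM⟩, hyD⟩ := hD.inter_open_nonempty _ ho ⟨z, hz, hlt⟩
  exact absurd (h y ⟨hyU, hyD⟩) (not_le.2 hyM)

theorem dense_setOf_im_ne_zero : Dense {z : ℂ | z.im ≠ 0} := by
  have : {z : ℂ | z.im ≠ 0} = (Complex.im ⁻¹' {0})ᶜ := rfl
  rw [this, ← interior_eq_empty_iff_dense_compl, Complex.interior_preimage_im]
  simp

theorem exists_differentiable_modelPQ_det {b : ℝ} (hb : -(1 / 2) < b) :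
    ∃ F : ℂ → ℂ, DifferentiableOn ℂ F {0}ᶜ ∧ (∀ ζ : ℂ, ζ.im ≠ 0 →
      F ζ = modelQ b (-ζ) * modelQ b ζ - modelP b (-ζ) * modelP b ζ) ∧
      (∀ ζ : ℂ, ζ.re < 0 → F ζ = modelQ b (-ζ) * modelU₂ b ζ - modelP b (-ζ) * modelU₁ b ζ) ∧
      ∀ ζ : ℂ, 0 < ζ.re →
        F ζ = modelQ b ζ * modelU₂ b (-ζ) - modelP b ζ * modelU₁ b (-ζ) := by
  have hb1 : -1 < b := by linarith
  let U : Fin 3 → Set ℂ := ![{z | z.im ≠ 0}, {z | z.re < 0}, {z | 0 < z.re}]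
  let f : Fin 3 → ℂ → ℂ := ![fun ζ => modelQ b (-ζ) * modelQ b ζ - modelP b (-ζ) * modelP b ζ,
    fun ζ => modelQ b (-ζ) * modelU₂ b ζ - modelP b (-ζ) * modelU₁ b ζ,
    fun ζ => modelQ b ζ * modelU₂ b (-ζ) - modelP b ζ * modelU₁ b (-ζ)]
  have h01 : ∀ ζ : ℂ, ζ.im ≠ 0 → f 0 ζ = f 1 ζ := by
    intro ζ hζ
    obtain ⟨t, h1, h2⟩ := exists_modelU_eq hb1 hζ
    simp only [f, Matrix.cons_val]
    rw [h1, h2]; ring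
  have h02 : ∀ ζ : ℂ, ζ.im ≠ 0 → f 0 ζ = f 2 ζ := by
    intro ζ hζ
    have := h01 (-ζ) (by simpa using hζ)
    simp only [f, Matrix.cons_val, neg_neg] at this ⊢
    rw [← this]; ring
  have hneg : ∀ (s : Set ℂ) (g : ℂ → ℂ), DifferentiableOn ℂ g s →
      DifferentiableOn ℂ (fun z => g (-z)) {z | -z ∈ s} := fun s g hg =>
    hg.comp (differentiable_neg.differentiableOn) fun z hz => hz
  have hQ := differentiableOn_modelQ hb1
  have hP := differentiableOn_modelP hb1
  have hU₁ := differentiableOn_modelU₁ hb1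
  have hU₂ := differentiableOn_modelU₂ hb1
  have hUo : ∀ i, IsOpen (U i) := by
    intro i
    fin_cases i
    · exact isOpen_ne_fun Complex.continuous_im continuous_const
    · exact isOpen_lt Complex.continuous_re continuous_const
    · exact isOpen_lt continuous_const Complex.continuous_re
  have hf : ∀ i, DifferentiableOn ℂ (f i) (U i) := by
    intro i
    fin_cases i
    · have s1 : {z : ℂ | z.im ≠ 0} ⊆ Complex.slitPlane := fun z hz => Or.inr hz
      have s2 : {z : ℂ | z.im ≠ 0} ⊆ {z | -z ∈ Complex.slitPlane} := fun z hz =>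
        Or.inr (by simpa using hz)
      exact (((hneg _ _ hQ).mono s2).mul (hQ.mono s1)).sub (((hneg _ _ hP).mono s2).mul (hP.mono s1))
    · have s2 : {z : ℂ | z.re < 0} ⊆ {z | -z ∈ Complex.slitPlane} := fun z hz =>
        Or.inl (by simpa using hz)
      exact (((hneg _ _ hQ).mono s2).mul hU₂).sub (((hneg _ _ hP).mono s2).mul hU₁)
    · have s1 : {z : ℂ | 0 < z.re} ⊆ Complex.slitPlane := fun z hz => Or.inl hz
      have s2 : {z : ℂ | 0 < z.re} ⊆ {z | -z ∈ {z : ℂ | z.re < 0}} := fun z hz => by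
        simpa using hz
      exact ((hQ.mono s1).mul ((hneg _ _ hU₂).mono s2)).sub
        ((hP.mono s1).mul ((hneg _ _ hU₁).mono s2))
  have hag : ∀ i j, ∀ z ∈ U i ∩ U j, f i z = f j z := by
    intro i j z hz
    fin_cases i <;> fin_cases j
    · rfl
    · exact h01 z hz.1
    · exact h02 z hz.1
    · exact (h01 z hz.2).symm
    · rfl
    · exact absurd (show z.re < 0 from hz.1) (not_lt.2 (show 0 < z.re from hz.2).le)
    · exact (h02 z hz.2).symm
    · exact absurd (show z.re < 0 from hz.2) (not_lt.2 (show 0 < z.re from hz.1).le)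
    · rfl
  obtain ⟨F, hF, hFe⟩ := exists_differentiableOn_iUnion hUo hf hag
  refine ⟨F, hF.mono fun z hz => ?_, fun ζ h => hFe 0 ζ h, fun ζ h => hFe 1 ζ h,
    fun ζ h => hFe 2 ζ h⟩
  rw [mem_iUnion]
  by_cases him : z.im = 0
  · have : z.re ≠ 0 := fun h => hz (Complex.ext h him)
    rcases this.lt_or_gt with h | h
    · exact ⟨1, h⟩
    · exact ⟨2, h⟩
  · exact ⟨0, him⟩

/-- Determinant identity for the model functions. -/
theorem modelPQ_det {b : ℝ} (hb : -(1 / 2) < b) {ζ : ℂ} (hζ : ζ.im ≠ 0) :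
    modelQ b (-ζ) * modelQ b ζ - modelP b (-ζ) * modelP b ζ = 1 := by
  have hb1 : -1 < b := by linarith
  obtain ⟨F, hF, hF0, hF1, hF2⟩ := exists_differentiable_modelPQ_det hb
  obtain ⟨A, hA0, hA⟩ := exists_norm_modelU_le hb1
  obtain ⟨B, hB0, hB⟩ := exists_norm_modelPQ_le hb
  set e := min (b + 1 / 2) (1 / 2) with he
  have he0 : 0 < e := lt_min (by linarith) (by norm_num)
  have hsmall : ∀ z : ℂ, z.re ≠ 0 → ‖z‖ ≤ 1 → ‖F z‖ * |z.re| ≤ 2 * A * B * ‖z‖ ^ e := by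
    have key : ∀ z : ℂ, z.re < 0 → ‖z‖ ≤ 1 →
        ‖modelQ b (-z) * modelU₂ b z - modelP b (-z) * modelU₁ b z‖ * |z.re| ≤
          2 * A * B * ‖z‖ ^ e := by
      intro z hz hz1
      have hz0 : z ≠ 0 := by rintro rfl; simp at hz
      have hzp : 0 < ‖z‖ := norm_pos_iff.2 hz0
      obtain ⟨u1, u2⟩ := hA z hz0 hz1
      obtain ⟨p1, p2⟩ := hB (-z) (by simpa using hz.le) (by simpa using hz0) (by simpa using hz1)
      rw [norm_neg] at p1 p2
      calc _ ≤ (B * ‖z‖ ^ (e - b - 1) * (A * ‖z‖ ^ b) + B * ‖z‖ ^ (e - b - 1) * (A * ‖z‖ ^ b)) *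
            ‖z‖ := by
            gcongr
            · refine (norm_sub_le _ _).trans ?_
              rw [norm_mul, norm_mul]
              gcongr
            · exact Complex.abs_re_le_norm z
        _ = 2 * A * B * (‖z‖ ^ (e - b - 1) * ‖z‖ ^ b * ‖z‖ ^ (1 : ℝ)) := by
            rw [Real.rpow_one]; ring
        _ = 2 * A * B * ‖z‖ ^ e := by
            rw [← Real.rpow_add hzp, ← Real.rpow_add hzp]; ring_nf
    intro z hz hz1
    rcases hz.lt_or_gt with h | h
    · rw [hF1 z h]; exact key z h hz1
    · have := key (-z) (by simpa using h) (by simpa using hz1)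
      rw [hF2 z h]
      simpa using this
  obtain ⟨g, hg, hgF⟩ := exists_differentiableOn_ball_of_norm_mul_abs_re_lt one_pos
    (hF.mono fun z hz => hz.2) (by
      intro ε hε
      have ht : Tendsto (fun x : ℝ => 2 * A * B * x ^ e) (nhds 0) (nhds 0) := by
        have := ((Real.continuousAt_rpow_const 0 e (Or.inr he0.le)).tendsto).const_mul (2 * A * B)
        rwa [Real.zero_rpow he0.ne', mul_zero] at this
      obtain ⟨s, hs, h⟩ := Metric.eventually_nhds_iff.1 (ht.eventually (ge_mem_nhds hε))
      refine ⟨min s 1, by positivity, fun z hz hzs => ?_⟩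
      refine (hsmall z hz (hzs.le.trans (min_le_right _ _))).trans (h ?_)
      rw [dist_zero_right, norm_norm]
      exact hzs.trans_le (min_le_left _ _))
  obtain ⟨G, hG, hGe⟩ := exists_differentiableOn_iUnion (U := fun i : Bool => cond i {0}ᶜ (ball 0 1))
    (f := fun i : Bool => cond i F g) (by
      rintro (_ | _)
      · exact isOpen_ball
      · exact isOpen_compl_singleton) (by
      rintro (_ | _)
      · exact hg
      · exact hF) (by
      rintro (_ | _) (_ | _) z hz
      · rfl
      · exact hgF z hz
      · exact (hgF z ⟨hz.2, hz.1⟩).symm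
      · rfl)
  have hGd : Differentiable ℂ G := by
    rw [← differentiableOn_univ]
    refine hG.mono fun z _ => mem_iUnion.2 ?_
    by_cases h : z = 0
    · exact ⟨false, by simp [h]⟩
    · exact ⟨true, h⟩
  obtain ⟨C, hC0, hC⟩ := exists_norm_modelPQ_sub_le_of_im_ne_zero hb1
  have hbig : ∀ z : ℂ, z.im ≠ 0 → 1 ≤ ‖z‖ →
      ‖G z - 1‖ ≤ ((1 + b ^ 2 + C) * (b ^ 2 + C) + (b ^ 2 + C) + (|b| + C) ^ 2) * ‖z‖⁻¹ := by
    intro z him hz1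
    have hz0 : z ≠ 0 := by rintro rfl; simp at him
    have hi1 : ‖z‖⁻¹ ≤ 1 := inv_le_one_of_one_le₀ hz1
    have hi0 : 0 ≤ ‖z‖⁻¹ := by positivity
    have hsq : ‖z‖⁻¹ ^ 2 ≤ ‖z‖⁻¹ := by nlinarith
    have hp : ∀ y : ℂ, y.im ≠ 0 → ‖y‖ = ‖z‖ → ‖modelP b y‖ ≤ (|b| + C) * ‖z‖⁻¹ ∧
        ‖modelQ b y - 1‖ ≤ (b ^ 2 + C) * ‖z‖⁻¹ := by
      intro y hy hyz
      obtain ⟨c1, c2⟩ := hC y hy (hyz ▸ hz1)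
      rw [hyz] at c1 c2
      constructor
      · have : modelP b y = (modelP b y + b / y) - b / y := by ring
        rw [this]
        refine (norm_sub_le _ _).trans ((add_le_add c1 le_rfl).trans ?_)
        rw [norm_div, Complex.norm_real, Real.norm_eq_abs, hyz, div_eq_mul_inv]
        nlinarith
      · have : modelQ b y - 1 = (modelQ b y - 1 - b ^ 2 / y) + b ^ 2 / y := by ring
        rw [this]
        refine (norm_add_le _ _).trans ((add_le_add c2 le_rfl).trans ?_)
        rw [norm_div, norm_pow, Complex.norm_real, Real.norm_eq_abs, hyz, div_eq_mul_inv, sq_abs]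
        nlinarith
    obtain ⟨a1, a2⟩ := hp z him rfl
    obtain ⟨b1, b2⟩ := hp (-z) (by simpa using him) (norm_neg z)
    rw [show G z = F z from hGe true z hz0, hF0 z him]
    have e : modelQ b (-z) * modelQ b z - modelP b (-z) * modelP b z - 1 =
        (1 + (modelQ b (-z) - 1)) * (modelQ b z - 1) + (modelQ b (-z) - 1) -
          modelP b (-z) * modelP b z := by ring
    rw [e]
    have hbC : 0 ≤ b ^ 2 + C := by positivity
    calc _ ≤ (1 + (b ^ 2 + C) * 1) * ((b ^ 2 + C) * ‖z‖⁻¹) + (b ^ 2 + C) * ‖z‖⁻¹ +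
          ((|b| + C) * 1) * ((|b| + C) * ‖z‖⁻¹) := by
          refine (norm_sub_le _ _).trans (add_le_add ((norm_add_le _ _).trans
            (add_le_add ?_ b2)) ?_)
          · rw [norm_mul]
            gcongr
            refine (norm_add_le _ _).trans ?_
            rw [norm_one]
            gcongr
            exact b2.trans (by gcongr)
          · rw [norm_mul]
            gcongr
            exact b1.trans (by gcongr)
      _ = _ := by ring
  have hlim : Tendsto G (cocompact ℂ) (nhds 1) := by
    set K := (1 + b ^ 2 + C) * (b ^ 2 + C) + (b ^ 2 + C) + (|b| + C) ^ 2
    have hK : 0 < K := by positivity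
    rw [← Metric.cobounded_eq_cocompact, Metric.tendsto_nhds]
    intro ε hε
    have hR : ∀ z ∈ (closedBall (0 : ℂ) (max 1 (2 * K / ε)))ᶜ, ‖G z - 1‖ ≤ ε / 2 := by
      refine norm_le_of_dense isClosed_closedBall.isOpen_compl
        (hGd.continuous.sub continuous_const).continuousOn dense_setOf_im_ne_zero fun z hz => ?_
      have h1 : max 1 (2 * K / ε) < ‖z‖ := by simpa using hz.1
      have h2 := (le_max_left _ _).trans_lt h1
      have h3 := (le_max_right _ _).trans_lt h1
      refine (hbig z hz.2 h2.le).trans ?_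
      rw [div_lt_iff₀ hε] at h3
      rw [← div_eq_mul_inv, div_le_iff₀ (by linarith)]
      linarith
    rw [← comap_norm_atTop]
    filter_upwards [preimage_mem_comap (Ioi_mem_atTop (max 1 (2 * K / ε)))] with z hz
    rw [dist_eq_norm]
    exact (hR z (by simpa using hz)).trans_lt (by linarith)
  have hζ0 : ζ ≠ 0 := by rintro rfl; simp at hζ
  rw [← hF0 ζ hζ, ← hGd.apply_eq_of_tendsto_cocompact ζ hlim]
  exact (hGe true ζ hζ0).symm

/-- The unimodular factor relating the scattering function to its local continuation. -/
noncomputable def jumpPhase (b : ℝ) (l : ℂ) : ℂ :=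
  Complex.exp (((-(Real.sign l.im * (π * b)) : ℝ) : ℂ) * Complex.I)

theorem norm_jumpPhase (b : ℝ) (l : ℂ) : ‖jumpPhase b l‖ = 1 :=
  Complex.norm_exp_ofReal_mul_I _

theorem jumpPhase_neg_mul (b : ℝ) (l : ℂ) : jumpPhase b (-l) * jumpPhase b l = 1 := by
  rw [jumpPhase, jumpPhase, ← Complex.exp_add, Complex.neg_im, Real.sign_neg]
  push_cast
  ring_nf
  simp

theorem jumpPhase_ofReal_mul (b : ℝ) {n : ℝ} (hn : 0 < n) (l : ℂ) :
    jumpPhase b (n * l) = jumpPhase b l := by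
  have : Real.sign (n * l.im) = Real.sign l.im := by
    rcases lt_trichotomy l.im 0 with h | h | h
    · rw [Real.sign_of_neg h, Real.sign_of_neg (mul_neg_of_pos_of_neg hn h)]
    · rw [h, mul_zero]
    · rw [Real.sign_of_pos h, Real.sign_of_pos (mul_pos hn h)]
  rw [jumpPhase, jumpPhase, Complex.im_ofReal_mul, this]

theorem modelU_eq {b : ℝ} (hb : -1 < b) {ζ : ℂ} (hζ : ζ.im ≠ 0) :
    modelU₁ b ζ = modelP b ζ + jumpPhase b ζ * Complex.exp ζ * modelQ b (-ζ) ∧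
    modelU₂ b ζ = modelQ b ζ + jumpPhase b ζ * Complex.exp ζ * modelP b (-ζ) := by
  rcases hζ.lt_or_gt with h | h
  · have := modelU_eq_of_im_neg hb h
    rw [jumpPhase, Real.sign_of_neg h]
    simpa using this
  · have := modelU_eq_of_im_pos hb h
    rw [jumpPhase, Real.sign_of_pos h]
    simpa using this

/-- Solutions of the scattering problem near a singular point, in a logarithmic coordinate. -/
structure IsLocalSolution (b n r : ℝ) (x y u v : ℂ → ℂ) : Prop where
  diff_x : DifferentiableOn ℂ x (ball 0 r ∩ {l | -l ∈ Complex.slitPlane})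
  diff_y : DifferentiableOn ℂ y (ball 0 r ∩ Complex.slitPlane)
  diff_u : DifferentiableOn ℂ u (ball 0 r ∩ {l | l.re < 0})
  diff_v : DifferentiableOn ℂ v (ball 0 r ∩ {l | 0 < l.re})
  eq_u : ∀ l ∈ ball (0 : ℂ) r, l.re < 0 → l.im ≠ 0 →
    u l = y l + jumpPhase b l * Complex.exp (n * l) * x l
  eq_v : ∀ l ∈ ball (0 : ℂ) r, 0 < l.re → l.im ≠ 0 →
    v l = x l + jumpPhase b (-l) * Complex.exp (-(n * l)) * y l
  bound_u : ∃ M, ∃ s > 0, ∀ l : ℂ, l.re < 0 → ‖l‖ < s → ‖u l‖ ≤ M * ‖l‖ ^ b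
  bound_v : ∃ M, ∃ s > 0, ∀ l : ℂ, 0 < l.re → ‖l‖ < s → ‖v l‖ ≤ M * ‖l‖ ^ b
  lim_x : ∀ ε > 0, ∃ s > 0, ∀ l : ℂ, l.re < 0 → ‖l‖ < s → ‖x l‖ * ‖l‖ ^ b * |l.re| ≤ ε
  lim_y : ∀ ε > 0, ∃ s > 0, ∀ l : ℂ, 0 < l.re → ‖l‖ < s → ‖y l‖ * ‖l‖ ^ b * |l.re| ≤ ε

theorem IsLocalSolution.neg {b n r : ℝ} {x y u v : ℂ → ℂ} (h : IsLocalSolution b n r x y u v) :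
    IsLocalSolution b n r (fun l => y (-l)) (fun l => x (-l)) (fun l => v (-l))
      (fun l => u (-l)) where
  diff_x := h.diff_y.comp differentiable_neg.differentiableOn fun l hl => by
    simpa using hl
  diff_y := h.diff_x.comp differentiable_neg.differentiableOn fun l hl => by
    simpa using hl
  diff_u := h.diff_v.comp differentiable_neg.differentiableOn fun l hl => by
    simpa using hl
  diff_v := h.diff_u.comp differentiable_neg.differentiableOn fun l hl => by
    simpa using hl
  eq_u l hl hre him := by
    have := h.eq_v (-l) (by simpa using hl) (by simpa using hre) (by simpa using him)
    simpa using this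
  eq_v l hl hre him := by
    have := h.eq_u (-l) (by simpa using hl) (by simpa using hre) (by simpa using him)
    simpa using this
  bound_u := by
    obtain ⟨M, s, hs, h⟩ := h.bound_v
    refine ⟨M, s, hs, fun l hre hl => ?_⟩
    simpa using h (-l) (by simpa using hre) (by simpa using hl)
  bound_v := by
    obtain ⟨M, s, hs, h⟩ := h.bound_u
    refine ⟨M, s, hs, fun l hre hl => ?_⟩
    simpa using h (-l) (by simpa using hre) (by simpa using hl)
  lim_x ε hε := by
    obtain ⟨s, hs, h⟩ := h.lim_y ε hε
    refine ⟨s, hs, fun l hre hl => ?_⟩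
    simpa using h (-l) (by simpa using hre) (by simpa using hl)
  lim_y ε hε := by
    obtain ⟨s, hs, h⟩ := h.lim_x ε hε
    refine ⟨s, hs, fun l hre hl => ?_⟩
    simpa using h (-l) (by simpa using hre) (by simpa using hl)

theorem IsLocalSolution.exists_glue {b n r : ℝ} {x y u v : ℂ → ℂ} (hb : -(1 / 2) < b)
    (hn : 0 < n) (h : IsLocalSolution b n r x y u v) :
    ∃ F : ℂ → ℂ, DifferentiableOn ℂ F (ball 0 r \ {0}) ∧
      (∀ l ∈ ball (0 : ℂ) r, l.im ≠ 0 →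
        F l = modelQ b (n * l) * x l - modelP b (-(n * l)) * y l) ∧
      (∀ l ∈ ball (0 : ℂ) r, l.re < 0 →
        F l = modelU₂ b (n * l) * x l - modelP b (-(n * l)) * u l) ∧
      (∀ l ∈ ball (0 : ℂ) r, 0 < l.re →
        F l = modelQ b (n * l) * v l - modelU₁ b (-(n * l)) * y l) := by
  have hb1 : -1 < b := by linarith
  let U : Fin 3 → Set ℂ := ![ball 0 r ∩ {z | z.im ≠ 0}, ball 0 r ∩ {z | z.re < 0},
    ball 0 r ∩ {z | 0 < z.re}]
  let f : Fin 3 → ℂ → ℂ := ![fun l => modelQ b (n * l) * x l - modelP b (-(n * l)) * y l,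
    fun l => modelU₂ b (n * l) * x l - modelP b (-(n * l)) * u l,
    fun l => modelQ b (n * l) * v l - modelU₁ b (-(n * l)) * y l]
  have him : ∀ l : ℂ, l.im ≠ 0 → ((n : ℂ) * l).im ≠ 0 := fun l hl => by
    rw [Complex.im_ofReal_mul]; exact mul_ne_zero hn.ne' hl
  have h01 : ∀ l ∈ ball (0 : ℂ) r ∩ {z | z.im ≠ 0}, l.re < 0 → f 0 l = f 1 l := by
    intro l hl hre
    simp only [f, Matrix.cons_val]
    rw [h.eq_u l hl.1 hre hl.2, (modelU_eq hb1 (him l hl.2)).2, jumpPhase_ofReal_mul b hn]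
    ring
  have h02 : ∀ l ∈ ball (0 : ℂ) r ∩ {z | z.im ≠ 0}, 0 < l.re → f 0 l = f 2 l := by
    intro l hl hre
    have e := (modelU_eq hb1 (ζ := -(n * l)) (by simpa using him l hl.2)).1
    rw [neg_neg, ← mul_neg, jumpPhase_ofReal_mul b hn, mul_neg] at e
    simp only [f, Matrix.cons_val]
    rw [h.eq_v l hl.1 hre hl.2, e]
    ring
  have hmul : ∀ (c : ℝ) (s t : Set ℂ) (g : ℂ → ℂ), DifferentiableOn ℂ g s →
      (∀ z ∈ t, (c : ℂ) * z ∈ s) → DifferentiableOn ℂ (fun z => g (c * z)) t :=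
    fun c s t g hg hst => hg.comp (by fun_prop) hst
  have hneg : ∀ (s t : Set ℂ) (g : ℂ → ℂ), DifferentiableOn ℂ g s →
      (∀ z ∈ t, -((n : ℂ) * z) ∈ s) → DifferentiableOn ℂ (fun z => g (-(n * z))) t :=
    fun s t g hg hst => hg.comp (by fun_prop) hst
  have hQ := differentiableOn_modelQ hb1
  have hP := differentiableOn_modelP hb1
  have hU₁ := differentiableOn_modelU₁ hb1
  have hU₂ := differentiableOn_modelU₂ hb1
  have hUo : ∀ i, IsOpen (U i) := by
    intro i
    fin_cases i
    · exact isOpen_ball.inter (isOpen_ne_fun Complex.continuous_im continuous_const)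
    · exact isOpen_ball.inter (isOpen_lt Complex.continuous_re continuous_const)
    · exact isOpen_ball.inter (isOpen_lt continuous_const Complex.continuous_re)
  have hf : ∀ i, DifferentiableOn ℂ (f i) (U i) := by
    intro i
    fin_cases i
    · refine ((hmul n _ _ _ hQ fun z hz => Or.inr (him z hz.2)).mul (h.diff_x.mono ?_)).sub
        ((hneg _ _ _ hP fun z hz => Or.inr ?_).mul (h.diff_y.mono ?_))
      · exact fun z hz => ⟨hz.1, Or.inr (by simpa using hz.2)⟩
      · simpa using him z hz.2
      · exact fun z hz => ⟨hz.1, Or.inr hz.2⟩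
    · refine ((hmul n _ _ _ hU₂ fun z hz => ?_).mul (h.diff_x.mono ?_)).sub
        ((hneg _ _ _ hP fun z hz => Or.inl ?_).mul h.diff_u)
      · simpa using mul_neg_of_pos_of_neg hn hz.2
      · exact fun z hz => ⟨hz.1, Or.inl (by simpa using hz.2)⟩
      · simpa using mul_neg_of_pos_of_neg hn hz.2
    · refine ((hmul n _ _ _ hQ fun z hz => Or.inl ?_).mul h.diff_v).sub
        ((hneg _ _ _ hU₁ fun z hz => ?_).mul (h.diff_y.mono ?_))
      · simpa using mul_pos hn hz.2
      · simpa using mul_pos hn hz.2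
      · exact fun z hz => ⟨hz.1, Or.inl hz.2⟩
  have hag : ∀ i j, ∀ z ∈ U i ∩ U j, f i z = f j z := by
    intro i j z hz
    fin_cases i <;> fin_cases j
    · rfl
    · exact h01 z hz.1 hz.2.2
    · exact h02 z hz.1 hz.2.2
    · exact (h01 z hz.2 hz.1.2).symm
    · rfl
    · exact absurd (show z.re < 0 from hz.1.2) (not_lt.2 (show 0 < z.re from hz.2.2).le)
    · exact (h02 z hz.2 hz.1.2).symm
    · exact absurd (show z.re < 0 from hz.2.2) (not_lt.2 (show 0 < z.re from hz.1.2).le)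
    · rfl
  obtain ⟨F, hF, hFe⟩ := exists_differentiableOn_iUnion hUo hf hag
  refine ⟨F, hF.mono fun z hz => ?_, fun l hl h => hFe 0 l ⟨hl, h⟩, fun l hl h => hFe 1 l ⟨hl, h⟩,
    fun l hl h => hFe 2 l ⟨hl, h⟩⟩
  rw [mem_iUnion]
  by_cases him : z.im = 0
  · have : z.re ≠ 0 := fun h => hz.2 (Complex.ext h him)
    rcases this.lt_or_gt with h | h
    · exact ⟨1, hz.1, h⟩
    · exact ⟨2, hz.1, h⟩
  · exact ⟨0, hz.1, him⟩

theorem exists_forall_mul_rpow_le {e : ℝ} (he : 0 < e) (K : ℝ) {ε : ℝ} (hε : 0 < ε) :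
    ∃ s > 0, ∀ t : ℝ, 0 ≤ t → t < s → K * t ^ e ≤ ε := by
  have ht : Tendsto (fun x : ℝ => K * x ^ e) (nhds 0) (nhds 0) := by
    have := ((Real.continuousAt_rpow_const 0 e (Or.inr he.le)).tendsto).const_mul K
    rwa [Real.zero_rpow he.ne', mul_zero] at this
  obtain ⟨s, hs, h⟩ := Metric.eventually_nhds_iff.1 (ht.eventually (ge_mem_nhds hε))
  exact ⟨s, hs, fun t ht0 hts => h (by rwa [dist_zero_right, Real.norm_of_nonneg ht0])⟩

theorem norm_model_combination_le {b n e A B M : ℝ} (hn : 0 < n) (hB : 0 ≤ B)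
    {l U X P V : ℂ} (hl : l ≠ 0) (hU : ‖U‖ ≤ A * ‖n * l‖ ^ b)
    (hP : ‖P‖ ≤ B * ‖n * l‖ ^ (e - b - 1)) (hV : ‖V‖ ≤ M * ‖l‖ ^ b) :
    ‖U‖ * ‖X‖ * |l.re| + ‖P‖ * ‖V‖ * |l.re| ≤
      A * n ^ b * (‖X‖ * ‖l‖ ^ b * |l.re|) + B * M * n ^ (e - b - 1) * ‖l‖ ^ e := by
  have hlp : 0 < ‖l‖ := norm_pos_iff.2 hl
  have hM : 0 ≤ M * ‖l‖ ^ b := (norm_nonneg _).trans hV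
  rw [norm_mul, Complex.norm_real, Real.norm_of_nonneg hn.le,
    Real.mul_rpow hn.le hlp.le] at hU hP
  have h1 : ‖l‖ ^ (e - b - 1) * ‖l‖ ^ b * ‖l‖ = ‖l‖ ^ e := by
    conv_lhs => rw [← Real.rpow_add hlp]
    rw [← Real.rpow_add_one hlp.ne']
    ring_nf
  refine add_le_add ?_ ?_
  · calc ‖U‖ * ‖X‖ * |l.re| ≤ A * (n ^ b * ‖l‖ ^ b) * ‖X‖ * |l.re| := by gcongr
      _ = _ := by ring
  · calc ‖P‖ * ‖V‖ * |l.re| ≤ (B * (n ^ (e - b - 1) * ‖l‖ ^ (e - b - 1))) * (M * ‖l‖ ^ b) *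
          ‖l‖ := by
          gcongr
          exact Complex.abs_re_le_norm l
      _ = B * M * n ^ (e - b - 1) * (‖l‖ ^ (e - b - 1) * ‖l‖ ^ b * ‖l‖) := by ring
      _ = _ := by rw [h1]

theorem IsLocalSolution.exists_coefficient {b n r : ℝ} {x y u v : ℂ → ℂ} (hb : -(1 / 2) < b)
    (hn : 0 < n) (hr : 0 < r) (h : IsLocalSolution b n r x y u v) :
    ∃ F : ℂ → ℂ, DifferentiableOn ℂ F (ball 0 r) ∧ ∀ l ∈ ball (0 : ℂ) r, l.im ≠ 0 →
      F l = modelQ b (n * l) * x l - modelP b (-(n * l)) * y l := by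
  have hb1 : -1 < b := by linarith
  obtain ⟨F, hF, hF0, hF1, hF2⟩ := h.exists_glue hb hn
  obtain ⟨A, hA0, hA⟩ := exists_norm_modelU_le hb1
  obtain ⟨B, hB0, hB⟩ := exists_norm_modelPQ_le hb
  obtain ⟨M₁, s₅, hs₅, hM₁⟩ := h.bound_u
  obtain ⟨M₂, s₆, hs₆, hM₂⟩ := h.bound_v
  set e := min (b + 1 / 2) (1 / 2)
  have he0 : 0 < e := lt_min (by linarith) (by norm_num)
  have hn0 : (n : ℂ) ≠ 0 := by exact_mod_cast hn.ne'
  obtain ⟨g, hg, hgF⟩ := exists_differentiableOn_ball_of_norm_mul_abs_re_lt hr hF (by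
    intro ε hε
    have hAn : 0 < A * n ^ b := by positivity
    obtain ⟨s₁, hs₁, h₁⟩ := h.lim_x (ε / (2 * (A * n ^ b))) (by positivity)
    obtain ⟨s₂, hs₂, h₂⟩ := h.lim_y (ε / (2 * (A * n ^ b))) (by positivity)
    obtain ⟨s₃, hs₃, h₃⟩ := exists_forall_mul_rpow_le he0 (B * M₁ * n ^ (e - b - 1)) (half_pos hε)
    obtain ⟨s₄, hs₄, h₄⟩ := exists_forall_mul_rpow_le he0 (B * M₂ * n ^ (e - b - 1)) (half_pos hε)
    refine ⟨min (min (min s₁ s₂) (min s₃ s₄)) (min (min s₅ s₆) (min r (1 / n))), by positivity, fun l hl hls => ?_⟩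
    simp only [lt_min_iff] at hls
    obtain ⟨⟨⟨k1, k2⟩, k3, k4⟩, ⟨k7, k8⟩, k5, k6⟩ := hls
    have hl0 : l ≠ 0 := by rintro rfl; simp at hl
    have hnl0 : (n : ℂ) * l ≠ 0 := mul_ne_zero hn0 hl0
    have hball : l ∈ ball (0 : ℂ) r := by simpa using k5
    have hnl1 : ‖(n : ℂ) * l‖ ≤ 1 := by
      rw [norm_mul, Complex.norm_real, Real.norm_of_nonneg hn.le]
      rw [lt_div_iff₀ hn] at k6
      linarith
    have hfin : ∀ t : ℝ, t ≤ ε / (2 * (A * n ^ b)) → A * n ^ b * t ≤ ε / 2 := fun t ht => by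
      rw [le_div_iff₀ (by positivity)] at ht
      linarith
    rcases hl.lt_or_gt with hre | hre
    · rw [hF1 l hball hre]
      have c1 := (hA _ hnl0 hnl1).2
      have c2 := (hB (-(n * l)) (by simpa using (mul_neg_of_pos_of_neg hn hre).le)
        (neg_ne_zero.2 hnl0) (by rwa [norm_neg])).1
      rw [norm_neg] at c2
      have c3 := norm_model_combination_le (X := x l) hn hB0.le hl0 c1 c2 (hM₁ l hre k7)
      refine (mul_le_mul_of_nonneg_right (norm_sub_le _ _) (abs_nonneg _)).trans ?_
      rw [norm_mul, norm_mul, add_mul]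
      linarith [hfin _ (h₁ l hre k1), h₃ _ (norm_nonneg l) k3]
    · rw [hF2 l hball hre]
      have c1 := (hA (-(n * l)) (neg_ne_zero.2 hnl0) (by rwa [norm_neg])).1
      have c2 := (hB _ (by simpa using (mul_pos hn hre).le) hnl0 hnl1).2
      rw [norm_neg] at c1
      have c3 := norm_model_combination_le (X := y l) hn hB0.le hl0 c1 c2 (hM₂ l hre k8)
      refine (mul_le_mul_of_nonneg_right (norm_sub_le _ _) (abs_nonneg _)).trans ?_
      rw [norm_mul, norm_mul, add_mul]
      linarith [hfin _ (h₂ l hre k2), h₄ _ (norm_nonneg l) k4])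
  refine ⟨g, hg, fun l hl him => ?_⟩
  have hl0 : l ≠ 0 := by rintro rfl; simp at him
  rw [hgF l ⟨hl, hl0⟩, hF0 l hl him]

/-- Near a singular point, every solution is a holomorphic combination of the model ones. -/
theorem IsLocalSolution.exists_coefficients {b n r : ℝ} {x y u v : ℂ → ℂ} (hb : -(1 / 2) < b)
    (hn : 0 < n) (hr : 0 < r) (h : IsLocalSolution b n r x y u v) :
    ∃ F G : ℂ → ℂ, DifferentiableOn ℂ F (ball 0 r) ∧ DifferentiableOn ℂ G (ball 0 r) ∧
      (∀ l ∈ ball (0 : ℂ) r, l.im ≠ 0 →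
        F l = modelQ b (n * l) * x l - modelP b (-(n * l)) * y l ∧
        G l = modelQ b (-(n * l)) * y l - modelP b (n * l) * x l) ∧
      ∀ l ∈ ball (0 : ℂ) r, l.im ≠ 0 →
        x l = F l * modelQ b (-(n * l)) + G l * modelP b (-(n * l)) ∧
        y l = F l * modelP b (n * l) + G l * modelQ b (n * l) := by
  obtain ⟨F, hF, hFe⟩ := h.exists_coefficient hb hn hr
  obtain ⟨G, hG, hGe⟩ := h.neg.exists_coefficient hb hn hr
  have hGe' : ∀ l ∈ ball (0 : ℂ) r, l.im ≠ 0 →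
      G (-l) = modelQ b (-(n * l)) * y l - modelP b (n * l) * x l := fun l hl him => by
    simpa using hGe (-l) (by simpa using hl) (by simpa using him)
  refine ⟨F, fun l => G (-l), hF, hG.comp differentiable_neg.differentiableOn fun l hl => by
    simpa using hl, fun l hl him => ⟨hFe l hl him, hGe' l hl him⟩, fun l hl him => ?_⟩
  have hdet := modelPQ_det hb (ζ := n * l) (by
    rw [Complex.im_ofReal_mul]; exact mul_ne_zero hn.ne' him)
  beta_reduce
  rw [hGe' l hl him, hFe l hl him]
  constructor
  · linear_combination (-x l) * hdet
  · linear_combination (-y l) * hdet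

/-- A uniform bound on an annulus bounds the coefficients on the inner disc. -/
theorem norm_coefficient_le {F : ℂ → ℂ} {r r₁ r₂ M : ℝ} (h1 : 0 < r₁) (h2 : r₁ < r₂) (h3 : r₂ ≤ r)
    (hF : DifferentiableOn ℂ F (ball 0 r))
    (hM : ∀ l : ℂ, r₁ < ‖l‖ → ‖l‖ < r₂ → l.im ≠ 0 → ‖F l‖ ≤ M) :
    ∀ l ∈ closedBall (0 : ℂ) r₁, ‖F l‖ ≤ M := by
  have hopen : IsOpen {l : ℂ | r₁ < ‖l‖ ∧ ‖l‖ < r₂} :=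
    (isOpen_lt continuous_const continuous_norm).inter (isOpen_lt continuous_norm continuous_const)
  have key := norm_le_of_dense (f := F) hopen (hF.continuousOn.mono fun l hl => by
    simpa using hl.2.trans_le h3) dense_setOf_im_ne_zero fun z hz => hM z hz.1.1 hz.1.2 hz.2
  intro l hl
  have hR : (r₁ + r₂) / 2 ≠ 0 := by linarith
  refine Complex.norm_le_of_forall_mem_frontier_norm_le (U := ball 0 ((r₁ + r₂) / 2))
    isBounded_ball (hF.diffContOnCl_ball (closedBall_subset_ball (by linarith))) ?_ ?_
  · intro z hz
    rw [frontier_ball _ hR] at hz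
    have hz : ‖z‖ = (r₁ + r₂) / 2 := by simpa using hz
    exact key z ⟨by linarith, by linarith⟩
  · rw [closure_ball _ hR]
    exact closedBall_subset_closedBall (by linarith) hl

theorem dense_setOf_forall_div_im_ne_zero {m : ℕ} {a : Fin m → ℂ} (ha : ∀ k, a k ≠ 0) :
    Dense {z : ℂ | ∀ k, (z / a k).im ≠ 0} := by
  have : {z : ℂ | ∀ k, (z / a k).im ≠ 0} = ⋂ k, {z : ℂ | (z / a k).im ≠ 0} := by
    ext z; simp
  rw [this]
  refine dense_iInter_of_isOpen (fun k => isOpen_ne_fun (by fun_prop) continuous_const) fun k => ?_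
  have := dense_setOf_im_ne_zero.preimage
    (Homeomorph.mulRight₀ (a k)⁻¹ (inv_ne_zero (ha k))).isOpenMap
  simpa [div_eq_mul_inv] using this

theorem mul_exp_div_im_ne_zero {a l : ℂ} (ha : a ≠ 0) (hl : (a * Complex.exp l / a).im ≠ 0) :
    l.im ≠ 0 := by
  rw [mul_div_cancel_left₀ _ ha, Complex.exp_im] at hl
  intro h
  simp [h] at hl

/-- Approximate Liouville theorem for a cover by two open sets `B`, `E` and small logarithmic discs
around the points `a k`. -/
theorem exists_norm_sub_le_of_log_cover {m : ℕ} {a : Fin m → ℂ} (ha : ∀ k, ‖a k‖ = 1)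
    {η : ℝ} (hη1 : η ≤ 1)
    (hdisj : ∀ j k, j ≠ k → ∀ l l' : ℂ, ‖l‖ < η → ‖l'‖ < η →
      a j * Complex.exp l ≠ a k * Complex.exp l')
    {B E : Set ℂ} (hB : IsOpen B) (hE : IsOpen E) (t : Bool) {R₀ : ℝ} (hR₀ : 3 ≤ R₀)
    (hbd : cond t E B ⊆ ball 0 R₀)
    (hcov : ∀ z, z ∈ B ∨ z ∈ E ∨ ∃ k, ∃ l : ℂ, ‖l‖ < η ∧ z = a k * Complex.exp l)
    (hBr : ∀ k, ∀ l : ℂ, ‖l‖ < η → a k * Complex.exp l ∈ B ∪ E → η / 4 < ‖l‖)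
    (hBE : B ∩ E ⊆ {z | Real.exp (-η) < ‖z‖ ∧ ‖z‖ < Real.exp η}) :
    ∃ C : ℝ, 0 < C ∧ ∀ ε : ℝ, 0 ≤ ε → ∀ (f g : ℂ → ℂ) (r : Fin m → ℂ → ℂ) (c : ℂ),
      DifferentiableOn ℂ f B → DifferentiableOn ℂ g E →
      (∀ k, DifferentiableOn ℂ (r k) (ball 0 η)) →
      (∀ k, ∀ l : ℂ, η / 4 < ‖l‖ → ‖l‖ < η → l.im ≠ 0 →
        ‖f (a k * Complex.exp l) - r k l‖ ≤ ε) →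
      (∀ z ∈ E, Real.exp (-η) < ‖z‖ → ‖z‖ < Real.exp η → (∀ k, (z / a k).im ≠ 0) →
        ‖g z - f z‖ ≤ ε) →
      Tendsto (cond t f g) (Bornology.cobounded ℂ) (nhds c) →
      (∀ z ∈ B, ‖z‖ < R₀ → ‖f z - c‖ ≤ C * ε) ∧ (∀ z ∈ E, ‖z‖ < R₀ → ‖g z - c‖ ≤ C * ε) ∧
        ∀ k, ∀ l : ℂ, ‖l‖ < η → ‖r k l - c‖ ≤ C * ε := by
  have ha0 : ∀ k, a k ≠ 0 := fun k => norm_ne_zero_iff.1 (by rw [ha k]; norm_num)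
  have hnorm : ∀ k (l : ℂ), ‖a k * Complex.exp l‖ = Real.exp l.re := fun k l => by
    rw [norm_mul, ha k, one_mul, Complex.norm_exp]
  have hlR : ∀ k (l : ℂ), ‖l‖ < η → ‖a k * Complex.exp l‖ < R₀ := fun k l hl => by
    rw [hnorm]
    have h1 : l.re ≤ 1 := ((Complex.re_le_norm l).trans hl.le).trans hη1
    have := Real.exp_le_exp.2 h1
    linarith [Real.exp_one_lt_three]
  have hlog : ∀ l : ℂ, ‖l‖ < η → Complex.log (Complex.exp l) = l := fun l hl => by
    have h1 := abs_lt.1 ((Complex.abs_im_le_norm l).trans_lt (hl.trans_le hη1))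
    exact Complex.log_exp (by linarith [Real.pi_gt_three]) (by linarith [Real.pi_gt_three])
  have hexpl : ∀ l : ℂ, ‖l‖ < η → Complex.exp l ∈ Complex.slitPlane := fun l hl => by
    rw [Complex.mem_slitPlane_iff_arg, ← Complex.log_im, hlog l hl]
    have h1 := abs_lt.1 ((Complex.abs_im_le_norm l).trans_lt (hl.trans_le hη1))
    exact ⟨by linarith [Real.pi_gt_three], Complex.exp_ne_zero l⟩
  set Lk : Fin m → ℂ → ℂ := fun k z => Complex.log (z / a k) with hLk
  let U : Bool ⊕ Fin m → Set ℂ := Sum.elim (fun s => cond s B E)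
    fun k => {z | z / a k ∈ Complex.slitPlane} ∩ Lk k ⁻¹' ball 0 η
  have hLd : ∀ k, DifferentiableOn ℂ (Lk k) {z | z / a k ∈ Complex.slitPlane} := fun k =>
    DifferentiableOn.clog (by fun_prop) fun z hz => hz
  have hUk : ∀ k z, z ∈ U (Sum.inr k) → ∃ l : ℂ, ‖l‖ < η ∧ z = a k * Complex.exp l ∧ Lk k z = l := by
    intro k z hz
    refine ⟨Lk k z, by simpa using hz.2, ?_, rfl⟩
    rw [Complex.exp_log (Complex.slitPlane_ne_zero hz.1), mul_div_cancel₀ _ (ha0 k)]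
  have hUk' : ∀ k (l : ℂ), ‖l‖ < η → a k * Complex.exp l ∈ U (Sum.inr k) ∧
      Lk k (a k * Complex.exp l) = l := by
    intro k l hl
    have e : Lk k (a k * Complex.exp l) = l := by
      simp only [hLk]
      rw [mul_div_cancel_left₀ _ (ha0 k), hlog l hl]
    refine ⟨⟨?_, ?_⟩, e⟩
    · show a k * Complex.exp l / a k ∈ Complex.slitPlane
      rw [mul_div_cancel_left₀ _ (ha0 k)]
      exact hexpl l hl
    · rw [mem_preimage, e]; simpa using hl
  have hU : ∀ i, IsOpen (U i) := by
    rintro ((_ | _) | k)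
    · exact hE
    · exact hB
    · exact (hLd k).continuousOn.isOpen_inter_preimage
        (Complex.isOpen_slitPlane.preimage (by fun_prop)) isOpen_ball
  obtain ⟨C, hC0, hC⟩ := exists_norm_sub_le_of_cover hU (by
    intro z
    rcases hcov z with h | h | ⟨k, l, hl, rfl⟩
    · exact ⟨Sum.inl true, h⟩
    · exact ⟨Sum.inl false, h⟩
    · exact ⟨Sum.inr k, (hUk' k l hl).1⟩) (Sum.inl t) (by linarith : 0 < R₀) (by
    rintro ((_ | _) | k) hne
    · cases t
      · exact absurd rfl hne
      · exact hbd
    · cases t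
      · exact hbd
      · exact absurd rfl hne
    · intro z hz
      obtain ⟨l, hl, rfl, -⟩ := hUk k z hz
      simpa using hlR k l hl) (dense_setOf_forall_div_im_ne_zero ha0)
  refine ⟨C * 2, by positivity, fun ε hε f g r c hf hg hr hfr hgf hlim => ?_⟩
  let F : Bool ⊕ Fin m → ℂ → ℂ := Sum.elim (fun s => cond s f g) fun k z => r k (Lk k z)
  have hmem : ∀ k (l : ℂ), ‖l‖ < η → Real.exp (-η) < ‖a k * Complex.exp l‖ ∧
      ‖a k * Complex.exp l‖ < Real.exp η := fun k l hl => by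
    have := abs_lt.1 ((Complex.abs_re_le_norm l).trans_lt hl)
    rw [hnorm, Real.exp_lt_exp, Real.exp_lt_exp]
    exact this
  have hBk : ∀ k z, z ∈ B → z ∈ U (Sum.inr k) → (∀ k, (z / a k).im ≠ 0) →
      ‖f z - r k (Lk k z)‖ ≤ 2 * ε := by
    intro k z hz hzk him
    obtain ⟨l, hl, rfl, hl'⟩ := hUk k z hzk
    rw [hl']
    have := hfr k l (hBr k l hl (Or.inl hz)) hl (mul_exp_div_im_ne_zero (ha0 k) (him k))
    linarith
  have hEk : ∀ k z, z ∈ E → z ∈ U (Sum.inr k) → (∀ k, (z / a k).im ≠ 0) →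
      ‖g z - r k (Lk k z)‖ ≤ 2 * ε := by
    intro k z hz hzk him
    obtain ⟨l, hl, rfl, hl'⟩ := hUk k z hzk
    rw [hl']
    have h1 := hfr k l (hBr k l hl (Or.inr hz)) hl (mul_exp_div_im_ne_zero (ha0 k) (him k))
    have h2 := hgf _ hz (hmem k l hl).1 (hmem k l hl).2 him
    have := norm_add_le (g (a k * Complex.exp l) - f (a k * Complex.exp l))
      (f (a k * Complex.exp l) - r k l)
    rw [sub_add_sub_cancel] at this
    linarith
  have hEB : ∀ z, z ∈ E → z ∈ B → (∀ k, (z / a k).im ≠ 0) → ‖g z - f z‖ ≤ 2 * ε := by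
    intro z hzE hzB him
    have := hgf z hzE (hBE ⟨hzB, hzE⟩).1 (hBE ⟨hzB, hzE⟩).2 him
    linarith
  have key := hC (2 * ε) (by linarith) F (by
      rintro ((_ | _) | k)
      · exact hg
      · exact hf
      · exact (hr k).comp ((hLd k).mono inter_subset_left) fun z hz => hz.2) (by
      rintro ((_ | _) | j) ((_ | _) | k) z ⟨⟨h1, h2⟩, h3⟩
      · simp only [sub_self, norm_zero]; linarith
      · exact hEB z h1 h2 h3
      · exact hEk k z h1 h2 h3
      · rw [norm_sub_rev]; exact hEB z h2 h1 h3
      · simp only [sub_self, norm_zero]; linarith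
      · exact hBk k z h1 h2 h3
      · rw [norm_sub_rev]; exact hEk j z h2 h1 h3
      · rw [norm_sub_rev]; exact hBk j z h2 h1 h3
      · by_cases hjk : j = k
        · subst hjk
          simp only [sub_self, norm_zero]; linarith
        · obtain ⟨l, hl, e, -⟩ := hUk j z h1
          obtain ⟨l', hl', e', -⟩ := hUk k z h2
          exact absurd (e.symm.trans e') (hdisj j k hjk l l' hl hl')) c (by
      cases t <;> exact hlim)
  simp only [← mul_assoc] at key
  refine ⟨fun z hz hzR => key (Sum.inl true) z hz hzR, fun z hz hzR => key (Sum.inl false) z hz hzR,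
    fun k l hl => ?_⟩
  have := key (Sum.inr k) _ (hUk' k l hl).1 (hlR k l hl)
  simp only [F, Sum.elim_inr, (hUk' k l hl).2] at this
  exact this

/-- The part of the rays through the points `a k` with radial coordinate in `s`. -/
def slits {m : ℕ} (a : Fin m → ℂ) (s : Set ℝ) : Set ℂ :=
  ⋃ k, (fun t : ℝ => (t : ℂ) * a k) '' s

/-- Small closed logarithmic discs around the points `a k`. -/
def logDiscs {m : ℕ} (a : Fin m → ℂ) (r : ℝ) : Set ℂ :=
  ⋃ k, (fun l : ℂ => a k * Complex.exp l) '' closedBall 0 r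

section
variable {m : ℕ} {a : Fin m → ℂ}

theorem mem_slits {s : Set ℝ} {z : ℂ} : z ∈ slits a s ↔ ∃ k, ∃ t ∈ s, (t : ℂ) * a k = z := by
  simp [slits]

theorem slits_mono {s t : Set ℝ} (h : s ⊆ t) : slits a s ⊆ slits a t :=
  iUnion_mono fun _ => image_mono h

theorem isClosed_slits (ha : ∀ k, ‖a k‖ = 1) {s : Set ℝ} (hs : IsClosed s) :
    IsClosed (slits a s) := by
  refine isClosed_iUnion_of_finite fun k => ?_
  have : Isometry (fun t : ℝ => (t : ℂ) * a k) := Isometry.of_dist_eq fun x y => by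
    rw [dist_eq_norm, ← sub_mul, norm_mul, ha k, mul_one, ← Complex.ofReal_sub, Complex.norm_real,
      dist_eq_norm]
  exact this.isClosedEmbedding.isClosedMap _ hs

theorem isClosed_logDiscs (r : ℝ) : IsClosed (logDiscs a r) :=
  isClosed_iUnion_of_finite fun k =>
    ((isCompact_closedBall _ _).image (by fun_prop)).isClosed

theorem mem_logDiscs {r : ℝ} {z : ℂ} :
    z ∈ logDiscs a r ↔ ∃ k, ∃ l : ℂ, ‖l‖ ≤ r ∧ a k * Complex.exp l = z := by
  simp [logDiscs]

theorem notMem_slits_of_div_im_ne_zero (ha : ∀ k, ‖a k‖ = 1) {s : Set ℝ} {z : ℂ}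
    (hz : ∀ k, (z / a k).im ≠ 0) : z ∉ slits a s := by
  rw [mem_slits]
  rintro ⟨k, t, -, rfl⟩
  have : a k ≠ 0 := norm_ne_zero_iff.1 (by rw [ha k]; norm_num)
  have := hz k
  rw [mul_div_cancel_right₀ _ ‹_›] at this
  simp at this

theorem norm_mul_exp (ha : ∀ k, ‖a k‖ = 1) (k : Fin m) (l : ℂ) :
    ‖a k * Complex.exp l‖ = Real.exp l.re := by
  rw [norm_mul, ha k, one_mul, Complex.norm_exp]

theorem ofReal_mul_eq_mul_exp_log (k : Fin m) {t : ℝ} (ht : 0 < t) :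
    (t : ℂ) * a k = a k * Complex.exp (Real.log t : ℝ) := by
  rw [← Complex.ofReal_exp, Real.exp_log ht, mul_comm]

theorem notMem_slits_of_im_ne_zero (ha : ∀ k, ‖a k‖ = 1) {r : ℝ} (hr1 : r ≤ 1)
    (hdisj : ∀ j k, j ≠ k → ∀ l l' : ℂ, ‖l‖ < r → ‖l'‖ < r →
      a j * Complex.exp l ≠ a k * Complex.exp l') {k : Fin m} {l : ℂ} (hl : ‖l‖ < r)
    (him : l.im ≠ 0) : a k * Complex.exp l ∉ slits a (Ici 0) := by
  rw [mem_slits]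
  rintro ⟨j, t, ht, h⟩
  have hn := congrArg norm h
  rw [norm_mul_exp ha, norm_mul, ha j, mul_one, Complex.norm_real, Real.norm_of_nonneg ht] at hn
  have ht0 : 0 < t := hn ▸ Real.exp_pos _
  have hlog : Real.log t = l.re := by rw [hn, Real.log_exp]
  rw [ofReal_mul_eq_mul_exp_log j ht0, hlog] at h
  have hre : ‖((l.re : ℝ) : ℂ)‖ < r := by
    rw [Complex.norm_real]; exact (Complex.abs_re_le_norm l).trans_lt hl
  by_cases hjk : j = k
  · subst hjk
    have h2 := mul_left_cancel₀ (norm_ne_zero_iff.1 (by rw [ha j]; norm_num)) h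
    have h1 := abs_lt.1 ((Complex.abs_im_le_norm l).trans_lt (hl.trans_le hr1))
    have := Complex.exp_inj_of_neg_pi_lt_of_le_pi (x := ((l.re : ℝ) : ℂ)) (y := l)
      (by simpa using Real.pi_pos) (by simpa using Real.pi_pos.le)
      (by linarith [Real.pi_gt_three]) (by linarith [Real.pi_gt_three]) h2
    exact him (by simpa using (congrArg Complex.im this).symm)
  · exact hdisj j k hjk _ _ hre hl h

/-- The domain on which the first component of a scattering solution is controlled. -/
def outerCutDisc {m : ℕ} (a : Fin m → ℂ) (η : ℝ) : Set ℂ :=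
  {z | ‖z‖ < Real.exp (3 * η / 4)} \ (slits a (Ici 1) ∪ logDiscs a (η / 4))

/-- The domain on which the second component of a scattering solution is controlled. -/
def innerCutExterior {m : ℕ} (a : Fin m → ℂ) (η : ℝ) : Set ℂ :=
  {z | Real.exp (-(3 * η / 4)) < ‖z‖} \ (slits a (Icc 0 1) ∪ logDiscs a (η / 4))

theorem isOpen_outerCutDisc (ha : ∀ k, ‖a k‖ = 1) (η : ℝ) : IsOpen (outerCutDisc a η) :=
  (isOpen_lt continuous_norm continuous_const).sdiff
    ((isClosed_slits ha isClosed_Ici).union (isClosed_logDiscs _))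

theorem isOpen_innerCutExterior (ha : ∀ k, ‖a k‖ = 1) (η : ℝ) : IsOpen (innerCutExterior a η) :=
  (isOpen_lt continuous_const continuous_norm).sdiff
    ((isClosed_slits ha isClosed_Icc).union (isClosed_logDiscs _))

theorem exists_norm_sub_le_outer (ha : ∀ k, ‖a k‖ = 1) {η : ℝ} (hη : 0 < η) (hη1 : η ≤ 1)
    (hdisj : ∀ j k, j ≠ k → ∀ l l' : ℂ, ‖l‖ < η → ‖l'‖ < η →
      a j * Complex.exp l ≠ a k * Complex.exp l') {R₀ : ℝ} (hR₀ : 3 ≤ R₀) :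
    ∃ C : ℝ, 0 < C ∧ ∀ ε : ℝ, 0 ≤ ε → ∀ (f g : ℂ → ℂ) (r : Fin m → ℂ → ℂ) (c : ℂ),
      DifferentiableOn ℂ f (outerCutDisc a η) →
      DifferentiableOn ℂ g {z | Real.exp (η / 2) < ‖z‖} →
      (∀ k, DifferentiableOn ℂ (r k) (ball 0 η)) →
      (∀ k, ∀ l : ℂ, η / 4 < ‖l‖ → ‖l‖ < η → l.im ≠ 0 →
        ‖f (a k * Complex.exp l) - r k l‖ ≤ ε) →
      (∀ z, Real.exp (η / 2) < ‖z‖ → ‖z‖ < Real.exp η → (∀ k, (z / a k).im ≠ 0) →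
        ‖g z - f z‖ ≤ ε) →
      Tendsto g (Bornology.cobounded ℂ) (nhds c) →
      (∀ z ∈ outerCutDisc a η, ‖f z - c‖ ≤ C * ε) ∧
        (∀ z, Real.exp (η / 2) < ‖z‖ → ‖z‖ < R₀ → ‖g z - c‖ ≤ C * ε) ∧
        ∀ k, ∀ l : ℂ, ‖l‖ < η → ‖r k l - c‖ ≤ C * ε := by
  have hB3 : ∀ z ∈ outerCutDisc a η, ‖z‖ < R₀ := fun z hz =>
    (show ‖z‖ < _ from hz.1).trans_le <| by
      have := Real.exp_le_exp.2 (show 3 * η / 4 ≤ 1 by linarith)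
      linarith [Real.exp_one_lt_three]
  obtain ⟨C, hC0, hC⟩ := exists_norm_sub_le_of_log_cover ha hη1 hdisj (isOpen_outerCutDisc ha η)
    (isOpen_lt continuous_const continuous_norm : IsOpen {z : ℂ | Real.exp (η / 2) < ‖z‖}) false
    hR₀ (fun z hz => by simpa using hB3 z hz) (fun z => by
      by_cases h1 : Real.exp (η / 2) < ‖z‖
      · exact Or.inr (Or.inl h1)
      by_cases h2 : z ∈ slits a (Ici 1)
      · obtain ⟨k, t, ht, rfl⟩ := mem_slits.1 h2
        have ht1 : (1 : ℝ) ≤ t := ht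
        rw [norm_mul, ha k, mul_one, Complex.norm_real, Real.norm_of_nonneg (by linarith),
          not_lt, ← Real.log_le_iff_le_exp (by linarith)] at h1
        refine Or.inr (Or.inr ⟨k, _, ?_, ofReal_mul_eq_mul_exp_log k (by linarith)⟩)
        rw [Complex.norm_real, Real.norm_of_nonneg (Real.log_nonneg ht1)]
        linarith
      by_cases h3 : z ∈ logDiscs a (η / 4)
      · obtain ⟨k, l, hl, rfl⟩ := mem_logDiscs.1 h3
        exact Or.inr (Or.inr ⟨k, l, by linarith, rfl⟩)
      · refine Or.inl ⟨?_, fun h => h.elim h2 h3⟩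
        exact (not_lt.1 h1).trans_lt (Real.exp_lt_exp.2 (by linarith))) (fun k l hl h => by
      rcases h with h | h
      · by_contra hle
        exact h.2 (Or.inr (mem_logDiscs.2 ⟨k, l, not_lt.1 hle, rfl⟩))
      · have h : Real.exp (η / 2) < ‖a k * Complex.exp l‖ := h
        rw [norm_mul_exp ha, Real.exp_lt_exp] at h
        linarith [Complex.re_le_norm l]) (fun z hz =>
      ⟨(Real.exp_lt_exp.2 (by linarith)).trans hz.2,
        (show ‖z‖ < _ from hz.1.1).trans (Real.exp_lt_exp.2 (by linarith))⟩)
  refine ⟨C, hC0, fun ε hε f g r c hf hg hr h1 h2 h3 => ?_⟩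
  obtain ⟨k1, k2, k3⟩ := hC ε hε f g r c hf hg hr h1 (fun z hz _ hz' him => h2 z hz hz' him) h3
  exact ⟨fun z hz => k1 z hz (hB3 z hz), fun z hz => k2 z hz, k3⟩

theorem exists_norm_sub_le_inner (ha : ∀ k, ‖a k‖ = 1) {η : ℝ} (hη : 0 < η) (hη1 : η ≤ 1)
    (hdisj : ∀ j k, j ≠ k → ∀ l l' : ℂ, ‖l‖ < η → ‖l'‖ < η →
      a j * Complex.exp l ≠ a k * Complex.exp l') {R₀ : ℝ} (hR₀ : 3 ≤ R₀) :
    ∃ C : ℝ, 0 < C ∧ ∀ ε : ℝ, 0 ≤ ε → ∀ (f g : ℂ → ℂ) (r : Fin m → ℂ → ℂ) (c : ℂ),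
      DifferentiableOn ℂ f (innerCutExterior a η) →
      DifferentiableOn ℂ g {z | ‖z‖ < Real.exp (-(η / 2))} →
      (∀ k, DifferentiableOn ℂ (r k) (ball 0 η)) →
      (∀ k, ∀ l : ℂ, η / 4 < ‖l‖ → ‖l‖ < η → l.im ≠ 0 →
        ‖f (a k * Complex.exp l) - r k l‖ ≤ ε) →
      (∀ z, Real.exp (-η) < ‖z‖ → ‖z‖ < Real.exp (-(η / 2)) → (∀ k, (z / a k).im ≠ 0) →
        ‖g z - f z‖ ≤ ε) →
      Tendsto f (Bornology.cobounded ℂ) (nhds c) →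
      (∀ z ∈ innerCutExterior a η, ‖z‖ < R₀ → ‖f z - c‖ ≤ C * ε) ∧
        (∀ z, ‖z‖ < Real.exp (-(η / 2)) → ‖g z - c‖ ≤ C * ε) ∧
        ∀ k, ∀ l : ℂ, ‖l‖ < η → ‖r k l - c‖ ≤ C * ε := by
  have hE3 : ∀ z : ℂ, ‖z‖ < Real.exp (-(η / 2)) → ‖z‖ < R₀ := fun z hz =>
    hz.trans_le <| by
      have := Real.exp_le_one_iff.2 (show -(η / 2) ≤ 0 by linarith)
      linarith
  obtain ⟨C, hC0, hC⟩ := exists_norm_sub_le_of_log_cover ha hη1 hdisj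
    (isOpen_innerCutExterior ha η)
    (isOpen_lt continuous_norm continuous_const : IsOpen {z : ℂ | ‖z‖ < Real.exp (-(η / 2))}) true
    hR₀ (fun z hz => by simpa using hE3 z hz) (fun z => by
      by_cases h1 : ‖z‖ < Real.exp (-(η / 2))
      · exact Or.inr (Or.inl h1)
      by_cases h2 : z ∈ slits a (Icc 0 1)
      · obtain ⟨k, t, ht, rfl⟩ := mem_slits.1 h2
        rw [norm_mul, ha k, mul_one, Complex.norm_real, Real.norm_of_nonneg ht.1, not_lt] at h1
        have ht0 : 0 < t := (Real.exp_pos _).trans_le h1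
        rw [← Real.le_log_iff_exp_le ht0] at h1
        refine Or.inr (Or.inr ⟨k, _, ?_, ofReal_mul_eq_mul_exp_log k ht0⟩)
        rw [Complex.norm_real, Real.norm_of_nonpos (Real.log_nonpos ht.1 ht.2)]
        linarith
      by_cases h3 : z ∈ logDiscs a (η / 4)
      · obtain ⟨k, l, hl, rfl⟩ := mem_logDiscs.1 h3
        exact Or.inr (Or.inr ⟨k, l, by linarith, rfl⟩)
      · refine Or.inl ⟨?_, fun h => h.elim h2 h3⟩
        exact (Real.exp_lt_exp.2 (by linarith)).trans_le (not_lt.1 h1)) (fun k l hl h => by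
      rcases h with h | h
      · by_contra hle
        exact h.2 (Or.inr (mem_logDiscs.2 ⟨k, l, not_lt.1 hle, rfl⟩))
      · have h : ‖a k * Complex.exp l‖ < Real.exp (-(η / 2)) := h
        rw [norm_mul_exp ha, Real.exp_lt_exp] at h
        linarith [neg_abs_le l.re, Complex.abs_re_le_norm l]) (fun z hz =>
      ⟨(Real.exp_lt_exp.2 (by linarith)).trans (show _ < ‖z‖ from hz.1.1),
        (show ‖z‖ < _ from hz.2).trans (Real.exp_lt_exp.2 (by linarith))⟩)
  refine ⟨C, hC0, fun ε hε f g r c hf hg hr h1 h2 h3 => ?_⟩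
  obtain ⟨k1, k2, k3⟩ := hC ε hε f g r c hf hg hr h1 (fun z hz hz' _ him => h2 z hz' hz him) h3
  exact ⟨fun z hz hz' => k1 z hz hz', fun z hz => k2 z hz (hE3 z hz), k3⟩

end

/-- Coefficients of a scattering problem on the unit circle with singular points `a k`: the jump
function `S`, and its holomorphic local continuations `T k` in logarithmic coordinates. -/
structure IsScatteringData {m : ℕ} (r : ℝ) (a : Fin m → ℂ) (β : Fin m → ℝ) (S : ℂ → ℂ)
    (T : Fin m → ℂ → ℂ) : Prop where
  norm_eq_one : ∀ k, ‖a k‖ = 1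
  exponent : ∀ k, -(1 / 2) < β k
  pos : 0 < r
  le_one : r ≤ 1
  disj : ∀ j k, j ≠ k → ∀ l l' : ℂ, ‖l‖ < r → ‖l'‖ < r →
    a j * Complex.exp l ≠ a k * Complex.exp l'
  diff_T : ∀ k, DifferentiableOn ℂ (T k) (ball 0 r)
  T_ne : ∀ k, ∀ l ∈ ball (0 : ℂ) r, T k l ≠ 0
  S_eq : ∀ k, ∀ l : ℂ, ‖l‖ < r → l.im ≠ 0 →
    S (a k * Complex.exp l) = jumpPhase (β k) l * T k l
  S_bdd : ∃ c₀ > 0, ∃ C₀, ∀ z, z ∉ slits a (Ici 0) → r / 4 ≤ |Real.log ‖z‖| →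
    |Real.log ‖z‖| ≤ r / 2 → c₀ ≤ ‖S z‖ ∧ ‖S z‖ ≤ C₀

/-- Solutions of the scattering problem on the unit circle. -/
structure IsScatteringSolution {m : ℕ} (r : ℝ) (a : Fin m → ℂ) (β : Fin m → ℝ) (S : ℂ → ℂ)
    (c : ℂ) (n : ℕ) (X Y U V : ℂ → ℂ) : Prop where
  diff_X : DifferentiableOn ℂ X ({z | ‖z‖ < Real.exp r} \ slits a (Ici 1))
  diff_Y : DifferentiableOn ℂ Y ({z | Real.exp (-r) < ‖z‖} \ slits a (Icc 0 1))
  diff_U : DifferentiableOn ℂ U (ball 0 1)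
  diff_V : DifferentiableOn ℂ V {z | 1 < ‖z‖}
  eq_U : ∀ z, Real.exp (-r) < ‖z‖ → ‖z‖ < 1 → z ∉ slits a (Ici 0) →
    U z = Y z + z ^ n * S z * X z
  eq_V : ∀ z, 1 < ‖z‖ → ‖z‖ < Real.exp r → z ∉ slits a (Ici 0) →
    V z = X z + (z ^ n * S z)⁻¹ * Y z
  lim_V : Tendsto V (Bornology.cobounded ℂ) (nhds c)
  lim_Y : Tendsto Y (Bornology.cobounded ℂ) (nhds 0)
  bound_U : ∀ k, ∃ M, ∃ s > 0, ∀ l : ℂ, l.re < 0 → ‖l‖ < s →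
    ‖U (a k * Complex.exp l)‖ ≤ M * ‖l‖ ^ β k
  bound_V : ∀ k, ∃ M, ∃ s > 0, ∀ l : ℂ, 0 < l.re → ‖l‖ < s →
    ‖V (a k * Complex.exp l)‖ ≤ M * ‖l‖ ^ β k
  small_X : ∀ k, ∀ ε > 0, ∃ s > 0, ∀ l : ℂ, l.re < 0 → ‖l‖ < s →
    ‖X (a k * Complex.exp l)‖ * ‖l‖ ^ β k * |l.re| ≤ ε
  small_Y : ∀ k, ∀ ε > 0, ∃ s > 0, ∀ l : ℂ, 0 < l.re → ‖l‖ < s →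
    ‖Y (a k * Complex.exp l)‖ * ‖l‖ ^ β k * |l.re| ≤ ε

section
variable {m : ℕ} {r : ℝ} {a : Fin m → ℂ} {β : Fin m → ℝ} {S : ℂ → ℂ} {T : Fin m → ℂ → ℂ}

theorem IsScatteringData.ne_zero (hD : IsScatteringData r a β S T) (k : Fin m) : a k ≠ 0 :=
  norm_ne_zero_iff.1 (by rw [hD.norm_eq_one k]; norm_num)

theorem norm_of_mem_slits (ha : ∀ k, ‖a k‖ = 1) {s : Set ℝ} {z : ℂ} (h : z ∈ slits a s) :
    ∃ t ∈ s, ‖z‖ = |t| := by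
  obtain ⟨k, t, ht, rfl⟩ := mem_slits.1 h
  exact ⟨t, ht, by rw [norm_mul, ha k, mul_one, Complex.norm_real, Real.norm_eq_abs]⟩

theorem notMem_slits_Ici_one (hD : IsScatteringData r a β S T) (k : Fin m) {l : ℂ} (hl : ‖l‖ < r)
    (h : -l ∈ Complex.slitPlane) : a k * Complex.exp l ∉ slits a (Ici 1) := by
  intro hz
  rcases h with h | h
  · obtain ⟨t, ht, e⟩ := norm_of_mem_slits hD.norm_eq_one hz
    rw [norm_mul_exp hD.norm_eq_one] at e
    have h1 : Real.exp l.re < 1 := Real.exp_lt_one_iff.2 (by simpa using h)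
    have := le_abs_self t
    have ht1 : 1 ≤ t := ht
    linarith
  · exact notMem_slits_of_im_ne_zero hD.norm_eq_one hD.le_one hD.disj hl (by simpa using h)
      (slits_mono (Ici_subset_Ici.2 zero_le_one) hz)

theorem notMem_slits_Icc_zero_one (hD : IsScatteringData r a β S T) (k : Fin m) {l : ℂ}
    (hl : ‖l‖ < r) (h : l ∈ Complex.slitPlane) : a k * Complex.exp l ∉ slits a (Icc 0 1) := by
  intro hz
  rcases h with h | h
  · obtain ⟨t, ht, e⟩ := norm_of_mem_slits hD.norm_eq_one hz
    rw [norm_mul_exp hD.norm_eq_one, abs_of_nonneg ht.1] at e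
    have h1 : 1 < Real.exp l.re := Real.one_lt_exp_iff.2 h
    linarith [ht.2]
  · exact notMem_slits_of_im_ne_zero hD.norm_eq_one hD.le_one hD.disj hl h
      (slits_mono Icc_subset_Ici_self hz)

theorem exp_lt_norm_lt (ha : ∀ k, ‖a k‖ = 1) {s : ℝ} (k : Fin m) {l : ℂ} (hl : ‖l‖ < s) :
    Real.exp (-s) < ‖a k * Complex.exp l‖ ∧ ‖a k * Complex.exp l‖ < Real.exp s := by
  have := abs_lt.1 ((Complex.abs_re_le_norm l).trans_lt hl)
  rw [norm_mul_exp ha, Real.exp_lt_exp, Real.exp_lt_exp]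
  exact this

/-- In logarithmic coordinates around a singular point, a scattering solution is a local one. -/
theorem IsScatteringSolution.isLocalSolution (hD : IsScatteringData r a β S T) {c : ℂ} {n : ℕ}
    {X Y U V : ℂ → ℂ} (h : IsScatteringSolution r a β S c n X Y U V) (k : Fin m) :
    IsLocalSolution (β k) n r (fun l => X (a k * Complex.exp l))
      (fun l => (a k ^ n * T k l)⁻¹ * Y (a k * Complex.exp l))
      (fun l => (a k ^ n * T k l)⁻¹ * U (a k * Complex.exp l))
      (fun l => V (a k * Complex.exp l)) := by
  have ha := hD.norm_eq_one
  have hak := hD.ne_zero k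
  have hE : Differentiable ℂ fun l : ℂ => a k * Complex.exp l := by fun_prop
  have hT : DifferentiableOn ℂ (fun l => (a k ^ n * T k l)⁻¹) (ball 0 r) :=
    ((hD.diff_T k).const_mul _).inv fun l hl => mul_ne_zero (pow_ne_zero _ hak) (hD.T_ne k l hl)
  obtain ⟨K, s₀, hK, hs₀, hTb⟩ : ∃ K s₀ : ℝ, 0 < K ∧ 0 < s₀ ∧ ∀ l : ℂ, ‖l‖ < s₀ →
      ‖(a k ^ n * T k l)⁻¹‖ ≤ K := by
    have hc := (hT.continuousOn.continuousAt (isOpen_ball.mem_nhds (mem_ball_self hD.pos))).norm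
    obtain ⟨s, hs, h⟩ := Metric.eventually_nhds_iff.1
      (hc.eventually_le_const (lt_add_one ‖(a k ^ n * T k 0)⁻¹‖))
    exact ⟨_, s, by positivity, hs, fun l hl => h (by simpa using hl)⟩
  have hpow : ∀ l : ℂ, (a k * Complex.exp l) ^ n = a k ^ n * Complex.exp (n * l) := fun l => by
    rw [mul_pow, Complex.exp_nat_mul]
  have hn1 : ∀ l : ℂ, l.re < 0 → ‖a k * Complex.exp l‖ < 1 := fun l hl => by
    rw [norm_mul_exp ha]; exact Real.exp_lt_one_iff.2 hl
  have hn2 : ∀ l : ℂ, 0 < l.re → 1 < ‖a k * Complex.exp l‖ := fun l hl => by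
    rw [norm_mul_exp ha]; exact Real.one_lt_exp_iff.2 hl
  constructor
  · refine h.diff_X.comp hE.differentiableOn fun l hl => ?_
    have hl1 : ‖l‖ < r := by simpa using hl.1
    exact ⟨(exp_lt_norm_lt ha k hl1).2, notMem_slits_Ici_one hD k hl1 hl.2⟩
  · refine (hT.mono inter_subset_left).mul (h.diff_Y.comp hE.differentiableOn fun l hl => ?_)
    have hl1 : ‖l‖ < r := by simpa using hl.1
    exact ⟨(exp_lt_norm_lt ha k hl1).1, notMem_slits_Icc_zero_one hD k hl1 hl.2⟩
  · refine (hT.mono inter_subset_left).mul (h.diff_U.comp hE.differentiableOn fun l hl => ?_)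
    simpa only [mem_ball_zero_iff] using hn1 l hl.2
  · exact h.diff_V.comp hE.differentiableOn fun l hl => hn2 l hl.2
  · intro l hl hre him
    have hl1 : ‖l‖ < r := by simpa using hl
    rw [h.eq_U _ (exp_lt_norm_lt ha k hl1).1 (hn1 l hre)
      (notMem_slits_of_im_ne_zero ha hD.le_one hD.disj hl1 him), hD.S_eq k l hl1 him, hpow]
    have := hD.T_ne k l hl
    push_cast
    field_simp
  · intro l hl hre him
    have hl1 : ‖l‖ < r := by simpa using hl
    rw [h.eq_V _ (hn2 l hre) (exp_lt_norm_lt ha k hl1).2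
      (notMem_slits_of_im_ne_zero ha hD.le_one hD.disj hl1 him), hD.S_eq k l hl1 him, hpow]
    have := hD.T_ne k l hl
    have hj := jumpPhase_neg_mul (β k) l
    rw [eq_inv_of_mul_eq_one_left hj, Complex.exp_neg]
    push_cast
    simp only [mul_inv]
    ring
  · obtain ⟨M, s, hs, hM⟩ := h.bound_U k
    refine ⟨K * M, min s s₀, by positivity, fun l hre hl => ?_⟩
    rw [norm_mul, mul_assoc]
    exact mul_le_mul (hTb l (hl.trans_le (min_le_right _ _)))
      (hM l hre (hl.trans_le (min_le_left _ _))) (norm_nonneg _) hK.le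
  · exact h.bound_V k
  · exact h.small_X k
  · intro ε hε
    obtain ⟨s, hs, hM⟩ := h.small_Y k (ε / K) (by positivity)
    refine ⟨min s s₀, by positivity, fun l hre hl => ?_⟩
    have h1 := hM l hre (hl.trans_le (min_le_left _ _))
    have h2 := hTb l (hl.trans_le (min_le_right _ _))
    rw [norm_mul, mul_assoc, mul_assoc, ← mul_assoc ‖Y _‖]
    calc _ ≤ K * (ε / K) := mul_le_mul h2 h1 (by positivity) hK.le
      _ = ε := by field_simp

end

theorem exists_common_bound {ι : Type*} [Finite ι] {P : ι → ℝ → Prop}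
    (hmono : ∀ i x y, x ≤ y → P i x → P i y) (h : ∀ i, ∃ C, P i C) : ∃ C > 0, ∀ i, P i C := by
  choose C hC using h
  obtain ⟨B, hB⟩ := (Set.finite_range C).bddAbove
  exact ⟨max B 1, by positivity, fun i =>
    hmono i _ _ ((hB (mem_range_self i)).trans (le_max_left _ _)) (hC i)⟩

theorem exists_norm_modelPQ_le_of_im_ne_zero {b : ℝ} (hb : -1 < b) : ∃ C, ∀ ζ : ℂ, ζ.im ≠ 0 →
    1 ≤ ‖ζ‖ → ‖modelP b ζ‖ ≤ C * ‖ζ‖⁻¹ ∧ ‖modelQ b ζ - 1‖ ≤ C * ‖ζ‖⁻¹ ∧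
      ‖modelP b ζ + b / ζ‖ ≤ C * ‖ζ‖⁻¹ ^ 2 ∧ ‖modelQ b ζ - 1 - b ^ 2 / ζ‖ ≤ C * ‖ζ‖⁻¹ ^ 2 := by
  obtain ⟨C, hC0, hC⟩ := exists_norm_modelPQ_sub_le_of_im_ne_zero hb
  refine ⟨C + |b| + b ^ 2, fun ζ him h1 => ?_⟩
  obtain ⟨h2, h3⟩ := hC ζ him h1
  have hi : ‖ζ‖⁻¹ ≤ 1 := inv_le_one_of_one_le₀ h1
  have hi0 : 0 ≤ ‖ζ‖⁻¹ := by positivity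
  have hi2 : ‖ζ‖⁻¹ ^ 2 ≤ ‖ζ‖⁻¹ := by nlinarith
  have hCi : C * ‖ζ‖⁻¹ ^ 2 ≤ C * ‖ζ‖⁻¹ := mul_le_mul_of_nonneg_left hi2 hC0.le
  have e1 : ‖(b : ℂ) / ζ‖ = |b| * ‖ζ‖⁻¹ := by
    rw [norm_div, Complex.norm_real, Real.norm_eq_abs, div_eq_mul_inv]
  have e2 : ‖(b : ℂ) ^ 2 / ζ‖ = b ^ 2 * ‖ζ‖⁻¹ := by
    rw [norm_div, norm_pow, Complex.norm_real, Real.norm_eq_abs, sq_abs, div_eq_mul_inv]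
  have p1 : 0 ≤ |b| * ‖ζ‖⁻¹ := by positivity
  have p2 : 0 ≤ b ^ 2 * ‖ζ‖⁻¹ := by positivity
  have p3 : 0 ≤ |b| * ‖ζ‖⁻¹ ^ 2 := by positivity
  have p4 : 0 ≤ b ^ 2 * ‖ζ‖⁻¹ ^ 2 := by positivity
  refine ⟨?_, ?_, by linarith, by linarith⟩
  · have := norm_sub_le (modelP b ζ + b / ζ) (b / ζ)
    rw [add_sub_cancel_right, e1] at this
    linarith
  · have := norm_add_le (modelQ b ζ - 1 - (b : ℂ) ^ 2 / ζ) ((b : ℂ) ^ 2 / ζ)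
    rw [sub_add_cancel, e2] at this
    linarith

/-- A family of scattering solutions, locally bounded uniformly in the index. -/
structure IsScatteringFamily {m : ℕ} (r : ℝ) (a : Fin m → ℂ) (β : Fin m → ℝ) (S : ℂ → ℂ)
    (T : Fin m → ℂ → ℂ) (c : ℂ) (X Y U V : ℕ → ℂ → ℂ) : Prop where
  data : IsScatteringData r a β S T
  sol : ∀ n, IsScatteringSolution r a β S c n (X n) (Y n) (U n) (V n)
  bdd : ∀ z₀, Real.exp (-r) < ‖z₀‖ → ‖z₀‖ < Real.exp r → (∀ k, z₀ ≠ a k) →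
    ∃ M, ∀ᶠ z in nhds z₀, ∀ n, z ∉ slits a (Ici 0) → ‖X n z‖ ≤ M ∧ ‖Y n z‖ ≤ M

section
variable {m : ℕ} {r : ℝ} {a : Fin m → ℂ} {β : Fin m → ℝ} {S : ℂ → ℂ} {T : Fin m → ℂ → ℂ} {c : ℂ}
  {X Y U V : ℕ → ℂ → ℂ}

theorem IsScatteringFamily.exists_bound (h : IsScatteringFamily r a β S T c X Y U V) {K : Set ℂ}
    (hK : IsCompact K) (hKr : ∀ z ∈ K, Real.exp (-r) < ‖z‖ ∧ ‖z‖ < Real.exp r ∧ ∀ k, z ≠ a k) :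
    ∃ M > 0, ∀ z ∈ K, ∀ n, z ∉ slits a (Ici 0) → ‖X n z‖ ≤ M ∧ ‖Y n z‖ ≤ M := by
  have : ∃ M, ∀ z ∈ K, ∀ n, z ∉ slits a (Ici 0) → ‖X n z‖ ≤ M ∧ ‖Y n z‖ ≤ M := by
    refine hK.induction_on (p := fun s => ∃ M, ∀ z ∈ s, ∀ n, z ∉ slits a (Ici 0) →
      ‖X n z‖ ≤ M ∧ ‖Y n z‖ ≤ M) ⟨0, by simp⟩ ?_ ?_ ?_
    · exact fun s t hst ⟨M, hM⟩ => ⟨M, fun z hz => hM z (hst hz)⟩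
    · rintro s t ⟨M, hM⟩ ⟨M', hM'⟩
      refine ⟨max M M', ?_⟩
      rintro z (hz | hz) n hzs
      · exact ⟨((hM z hz n hzs).1).trans (le_max_left _ _),
          ((hM z hz n hzs).2).trans (le_max_left _ _)⟩
      · exact ⟨((hM' z hz n hzs).1).trans (le_max_right _ _),
          ((hM' z hz n hzs).2).trans (le_max_right _ _)⟩
    · intro z hz
      obtain ⟨M, hM⟩ := h.bdd z (hKr z hz).1 (hKr z hz).2.1 (hKr z hz).2.2
      exact ⟨_, mem_nhdsWithin_of_mem_nhds hM, M, fun z hz => hz⟩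
  obtain ⟨M, hM⟩ := this
  exact ⟨max M 1, by positivity, fun z hz n hzs => ⟨((hM z hz n hzs).1).trans (le_max_left _ _),
    ((hM z hz n hzs).2).trans (le_max_left _ _)⟩⟩

theorem mul_exp_ne (hD : IsScatteringData r a β S T) (k j : Fin m) {l : ℂ} (hl0 : l ≠ 0)
    (hl : ‖l‖ < r) : a k * Complex.exp l ≠ a j := by
  intro e
  by_cases hjk : k = j
  · subst hjk
    rw [mul_eq_left₀ (hD.ne_zero k), ← Complex.exp_zero] at e
    have h1 := abs_lt.1 ((Complex.abs_im_le_norm l).trans_lt (hl.trans_le hD.le_one))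
    exact hl0 (Complex.exp_inj_of_neg_pi_lt_of_le_pi (by linarith [Real.pi_gt_three])
      (by linarith [Real.pi_gt_three]) (by simpa using Real.pi_pos) (by simpa using Real.pi_pos.le)
      e)
  · exact hD.disj k j hjk l 0 hl (by simpa using hD.pos) (by simpa using e)

theorem IsScatteringData.exists_norm_T_le (hD : IsScatteringData r a β S T) {s : ℝ} (hs : s < r) :
    ∃ C > 0, ∀ k, ∀ l : ℂ, ‖l‖ ≤ s → ‖T k l‖ ≤ C ∧ ‖(T k l)⁻¹‖ ≤ C := by
  refine exists_common_bound (fun i x y hxy h l hl => ⟨(h l hl).1.trans hxy, (h l hl).2.trans hxy⟩)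
    fun k => ?_
  have hsub : closedBall (0 : ℂ) s ⊆ ball 0 r := closedBall_subset_ball hs
  have h1 := (hD.diff_T k).continuousOn.mono hsub
  have h2 := h1.inv₀ fun l hl => hD.T_ne k l (hsub hl)
  obtain ⟨C₁, hC₁⟩ := (isCompact_closedBall (0 : ℂ) s).exists_bound_of_continuousOn h1
  obtain ⟨C₂, hC₂⟩ := (isCompact_closedBall (0 : ℂ) s).exists_bound_of_continuousOn h2
  exact ⟨max C₁ C₂, fun l hl => ⟨(hC₁ l (by simpa using hl)).trans (le_max_left _ _),
    (hC₂ l (by simpa using hl)).trans (le_max_right _ _)⟩⟩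

/-- The coefficients with respect to the model solutions near the singular points, with bounds
uniform in the index. -/
theorem IsScatteringFamily.exists_coefficients (h : IsScatteringFamily r a β S T c X Y U V) :
    ∃ F G : ℕ → Fin m → ℂ → ℂ, ∃ C > 0, ∃ N : ℕ, ∀ n ≥ N, 0 < n ∧ 1 ≤ n * (r / 8) ∧ ∀ k,
      DifferentiableOn ℂ (F n k) (ball 0 (r / 2)) ∧ DifferentiableOn ℂ (G n k) (ball 0 (r / 2)) ∧
      (∀ l : ℂ, ‖l‖ < r / 2 → ‖F n k l‖ ≤ C ∧ ‖G n k l‖ ≤ C) ∧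
      ∀ l : ℂ, ‖l‖ < r / 2 → l.im ≠ 0 →
        X n (a k * Complex.exp l) = F n k l * modelQ (β k) (-(n * l)) +
          G n k l * modelP (β k) (-(n * l)) ∧
        Y n (a k * Complex.exp l) = a k ^ n * T k l * (F n k l * modelP (β k) (n * l) +
          G n k l * modelQ (β k) (n * l)) := by
  have hD := h.data
  have hr := hD.pos
  have ha := hD.norm_eq_one
  have hb1 : ∀ k, -1 < β k := fun k => by linarith [hD.exponent k]
  have hex : ∀ n : ℕ, ∀ k, ∃ F G : ℂ → ℂ, 0 < n → DifferentiableOn ℂ F (ball 0 r) ∧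
      DifferentiableOn ℂ G (ball 0 r) ∧ _ := fun n k => by
    by_cases hn : 0 < n
    · obtain ⟨F, G, hFG⟩ := ((h.sol n).isLocalSolution hD k).exists_coefficients (hD.exponent k)
        (by exact_mod_cast hn) hr
      exact ⟨F, G, fun _ => hFG⟩
    · exact ⟨0, 0, fun hn' => absurd hn' hn⟩
  choose F G hFG using hex
  obtain ⟨M, hM0, hM⟩ := h.exists_bound (K := logDiscs a (3 * r / 4) \
      ⋃ k, (fun l : ℂ => a k * Complex.exp l) '' ball 0 (r / 2)) (by
    refine IsCompact.diff ?_ (isOpen_iUnion fun k => ?_)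
    · exact isCompact_iUnion fun k => (isCompact_closedBall _ _).image (by fun_prop)
    · rw [isOpen_iff_mem_nhds]
      rintro _ ⟨l, hl, rfl⟩
      have hd : HasStrictDerivAt (fun l : ℂ => a k * Complex.exp l) (a k * Complex.exp l) l :=
        (Complex.hasStrictDerivAt_exp l).const_mul _
      have := hd.map_nhds_eq (mul_ne_zero (hD.ne_zero k) (Complex.exp_ne_zero l))
      rw [← this]
      exact image_mem_map (isOpen_ball.mem_nhds hl)) (by
    rintro z ⟨hz, hz'⟩
    obtain ⟨k, l, hl, rfl⟩ := mem_logDiscs.1 hz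
    have hlr : ‖l‖ < r := by linarith
    refine ⟨(exp_lt_norm_lt ha k hlr).1, (exp_lt_norm_lt ha k hlr).2, fun j => ?_⟩
    refine mul_exp_ne hD k j ?_ hlr
    rintro rfl
    exact hz' (mem_iUnion.2 ⟨k, 0, by simpa using hr, rfl⟩))
  obtain ⟨CT, hCT0, hCT⟩ := hD.exists_norm_T_le (show 3 * r / 4 < r by linarith)
  obtain ⟨Cm, hCm0, hCm⟩ := exists_common_bound (P := fun k C => ∀ ζ : ℂ, ζ.im ≠ 0 →
      1 ≤ ‖ζ‖ → ‖modelP (β k) ζ‖ ≤ C ∧ ‖modelQ (β k) ζ‖ ≤ C)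
    (fun i x y hxy h ζ h1 h2 => ⟨(h ζ h1 h2).1.trans hxy, (h ζ h1 h2).2.trans hxy⟩) fun k => by
      obtain ⟨C, hC⟩ := exists_norm_modelPQ_le_of_im_ne_zero (hb1 k)
      refine ⟨|C| + 1, fun ζ h1 h2 => ?_⟩
      obtain ⟨k1, k2, -⟩ := hC ζ h1 h2
      have hi : ‖ζ‖⁻¹ ≤ 1 := inv_le_one_of_one_le₀ h2
      have : C * ‖ζ‖⁻¹ ≤ |C| * 1 := mul_le_mul (le_abs_self C) hi (by positivity) (abs_nonneg _)
      refine ⟨by linarith, ?_⟩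
      have := norm_add_le (modelQ (β k) ζ - 1) 1
      rw [sub_add_cancel, norm_one] at this
      linarith
  obtain ⟨N, hN⟩ := exists_nat_ge (8 / r)
  refine ⟨F, G, Cm * M + Cm * (CT * M), by positivity, N + 1, fun n hn => ?_⟩
  have hn0 : 0 < n := by omega
  have hn0' : (0 : ℝ) < n := by exact_mod_cast hn0
  have hnr : 1 ≤ n * (r / 8) := by
    have : (8 / r : ℝ) ≤ n := hN.trans (by exact_mod_cast (by omega : N ≤ n))
    rw [div_le_iff₀ hr] at this
    linarith
  refine ⟨hn0, hnr, fun k => ?_⟩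
  obtain ⟨hF, hG, hFG1, hFG2⟩ := hFG n k hn0
  have hsub : ball (0 : ℂ) (r / 2) ⊆ ball 0 r := ball_subset_ball (by linarith)
  have hpt : ∀ l : ℂ, r / 2 < ‖l‖ → ‖l‖ < 3 * r / 4 → l.im ≠ 0 →
      ‖F n k l‖ ≤ Cm * M + Cm * (CT * M) ∧ ‖G n k l‖ ≤ Cm * M + Cm * (CT * M) := by
    intro l hl1 hl2 him
    have hlr : ‖l‖ < r := by linarith
    obtain ⟨e1, e2⟩ := hFG1 l (by simpa using hlr) him
    have hz : a k * Complex.exp l ∈ logDiscs a (3 * r / 4) \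
        ⋃ k, (fun l : ℂ => a k * Complex.exp l) '' ball 0 (r / 2) := by
      refine ⟨mem_logDiscs.2 ⟨k, l, hl2.le, rfl⟩, fun hz => ?_⟩
      obtain ⟨j, l', hl', e⟩ := mem_iUnion.1 hz
      have hl' : ‖l'‖ < r / 2 := by simpa using hl'
      by_cases hjk : j = k
      · subst hjk
        have e := mul_left_cancel₀ (hD.ne_zero j) e
        have h1 := abs_lt.1 ((Complex.abs_im_le_norm l).trans_lt (hlr.trans_le hD.le_one))
        have h2 := abs_lt.1 ((Complex.abs_im_le_norm l').trans_lt
          (hl'.trans_le (by linarith [hD.le_one] : r / 2 ≤ 1)))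
        have := Complex.exp_inj_of_neg_pi_lt_of_le_pi (by linarith [Real.pi_gt_three])
          (by linarith [Real.pi_gt_three]) (by linarith [Real.pi_gt_three])
          (by linarith [Real.pi_gt_three]) e
        rw [this] at hl'
        linarith
      · exact hD.disj j k hjk l' l (by linarith) hlr e
    obtain ⟨m1, m2⟩ := hM _ hz n (notMem_slits_of_im_ne_zero ha hD.le_one hD.disj hlr him)
    have m3 : ‖(a k ^ n * T k l)⁻¹ * Y n (a k * Complex.exp l)‖ ≤ CT * M := by
      rw [norm_mul, mul_inv, norm_mul, norm_inv, norm_pow, ha k, one_pow, inv_one, one_mul]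
      exact mul_le_mul (hCT k l hl2.le).2 m2 (norm_nonneg _) hCT0.le
    have hnl : 1 ≤ ‖(n : ℂ) * l‖ := by
      rw [norm_mul, Complex.norm_natCast]
      nlinarith
    have himn : ((n : ℂ) * l).im ≠ 0 := by
      rw [← Complex.ofReal_natCast, Complex.im_ofReal_mul]
      exact mul_ne_zero hn0'.ne' him
    have q1 := hCm k _ himn hnl
    have q2 := hCm k (-(n * l)) (by simpa using himn) (by simpa using hnl)
    simp only [Complex.ofReal_natCast] at e1 e2
    rw [e1, e2]
    constructor
    · refine (norm_sub_le _ _).trans ?_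
      rw [norm_mul, norm_mul]
      exact add_le_add (mul_le_mul q1.2 m1 (norm_nonneg _) hCm0.le)
        (mul_le_mul q2.1 m3 (norm_nonneg _) hCm0.le)
    · refine (norm_sub_le _ _).trans ?_
      rw [norm_mul (modelQ _ _), norm_mul (modelP _ _), add_comm]
      exact add_le_add (mul_le_mul q1.1 m1 (norm_nonneg _) hCm0.le)
        (mul_le_mul q2.2 m3 (norm_nonneg _) hCm0.le)
  refine ⟨hF.mono hsub, hG.mono hsub, fun l hl => ⟨?_, ?_⟩, fun l hl him => ?_⟩
  · exact norm_coefficient_le (by linarith) (by linarith) (by linarith) hF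
      (fun l h1 h2 h3 => (hpt l h1 h2 h3).1) l (by simpa using hl.le)
  · exact norm_coefficient_le (by linarith) (by linarith) (by linarith) hG
      (fun l h1 h2 h3 => (hpt l h1 h2 h3).2) l (by simpa using hl.le)
  · have hlr : ‖l‖ < r := by linarith
    obtain ⟨e1, e2⟩ := hFG2 l (by simpa using hlr) him
    simp only [Complex.ofReal_natCast] at e1 e2
    refine ⟨e1, ?_⟩
    rw [← e2, ← mul_assoc, mul_inv_cancel₀, one_mul]
    exact mul_ne_zero (pow_ne_zero _ (hD.ne_zero k)) (hD.T_ne k l (by simpa using hlr))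

/-- A rational function with simple poles at the points `a k`. -/
noncomputable def poleSum {m : ℕ} (a d : Fin m → ℂ) (z : ℂ) : ℂ := ∑ j, d j * a j / (a j - z)

theorem differentiableOn_poleSum (d : Fin m → ℂ) :
    DifferentiableOn ℂ (poleSum a d) {z | ∀ k, z ≠ a k} := by
  unfold poleSum
  refine DifferentiableOn.fun_sum fun j _ => DifferentiableOn.div (by fun_prop) (by fun_prop)
    fun z hz => sub_ne_zero.2 (hz j).symm

theorem tendsto_poleSum (d : Fin m → ℂ) :
    Tendsto (poleSum a d) (Bornology.cobounded ℂ) (nhds 0) := by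
  have : Tendsto (fun z => ∑ j, d j * a j * (a j - z)⁻¹) (Bornology.cobounded ℂ)
      (nhds (∑ j : Fin m, d j * a j * 0)) := by
    refine tendsto_finsetSum _ fun j _ => Tendsto.const_mul _ ?_
    refine tendsto_inv₀_cobounded.comp ?_
    exact ((tendsto_const_add_cobounded (a j)).comp tendsto_neg_cobounded).congr fun z =>
      (sub_eq_add_neg _ _).symm
  have e : poleSum a d = fun z => ∑ j, d j * a j * (a j - z)⁻¹ := by
    funext z; simp only [poleSum, div_eq_mul_inv]
  rw [e]
  simpa using this

theorem exists_poleSum_extension (hD : IsScatteringData r a β S T) (k : Fin m) {t : ℂ → ℂ}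
    (ht : DifferentiableOn ℂ t (ball 0 r)) (d : Fin m → ℂ) (e : ℂ) (hd : d k = e * t 0) :
    ∃ g : ℂ → ℂ, DifferentiableOn ℂ g (ball 0 r) ∧ ∀ l : ℂ, l ≠ 0 → ‖l‖ < r →
      g l = poleSum a d (a k * Complex.exp l) + e * t l / l := by
  have hr := hD.pos
  have hak := hD.ne_zero k
  obtain ⟨g, hg, hge⟩ := exists_differentiableOn_ball_of_norm_mul_abs_re_lt
    (h := fun l => poleSum a d (a k * Complex.exp l) + e * t l / l) hr (by
    refine DifferentiableOn.add ?_ ?_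
    · refine (differentiableOn_poleSum d).comp (by fun_prop) fun l hl j => ?_
      exact mul_exp_ne hD k j hl.2 (by simpa using hl.1)
    · exact ((ht.const_mul e).mono sdiff_subset).div differentiableOn_id fun l hl => hl.2) (by
    have h0 : Tendsto (fun l : ℂ => l * (∑ j ∈ Finset.univ.erase k,
        d j * a j / (a j - a k * Complex.exp l)) + (e * t l - d k * ((Complex.exp l - 1) / l)⁻¹))
        (nhdsWithin 0 {0}ᶜ) (nhds 0) := by
      have h1 : Tendsto (fun l : ℂ => l * ∑ j ∈ Finset.univ.erase k,
          d j * a j / (a j - a k * Complex.exp l)) (nhds 0) (nhds (0 * ∑ j ∈ Finset.univ.erase k,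
          d j * a j / (a j - a k * Complex.exp 0))) := by
        refine ContinuousAt.tendsto (f := fun l : ℂ => l * ∑ j ∈ Finset.univ.erase k,
          d j * a j / (a j - a k * Complex.exp l)) (continuousAt_id.mul ?_)
        refine tendsto_finsetSum _ fun j hj => ?_
        refine ContinuousAt.div (by fun_prop) (by fun_prop) ?_
        have := hD.disj k j (Finset.ne_of_mem_erase hj).symm 0 0 (by simpa using hr)
          (by simpa using hr)
        rw [Complex.exp_zero, mul_one, mul_one] at this
        rw [Complex.exp_zero, mul_one]
        exact sub_ne_zero.2 this.symm
      have h2 : Tendsto t (nhds 0) (nhds (t 0)) :=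
        ht.continuousOn.continuousAt (isOpen_ball.mem_nhds (mem_ball_self hr))
      have h3 : Tendsto (fun l : ℂ => (Complex.exp l - 1) / l) (nhdsWithin 0 {0}ᶜ) (nhds 1) := by
        have := (Complex.hasDerivAt_exp 0).tendsto_slope
        simp only [slope_fun_def_field, Complex.exp_zero, sub_zero] at this
        exact this
      have := (h1.mono_left (nhdsWithin_le_nhds (s := {0}ᶜ))).add
        (((h2.mono_left (nhdsWithin_le_nhds (s := {0}ᶜ))).const_mul e).sub
          ((h3.inv₀ one_ne_zero).const_mul (d k)))
      rw [zero_mul, inv_one, mul_one, hd, sub_self, add_zero] at this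
      rw [hd]
      exact this
    intro ε hε
    have h1 := (h0.norm.eventually_le_const (u := ε) (by simpa using hε))
    obtain ⟨s, hs, hs'⟩ := Metric.eventually_nhds_iff.1 (eventually_nhdsWithin_iff.1 h1)
    refine ⟨min s r, by positivity, fun l hre hl => ?_⟩
    have hl0 : l ≠ 0 := by rintro rfl; simp at hre
    have hlr : ‖l‖ < r := hl.trans_le (min_le_right _ _)
    have key := hs' (y := l) (by simpa using hl.trans_le (min_le_left _ _)) hl0
    refine le_trans ?_ key
    refine (mul_le_mul_of_nonneg_left (Complex.abs_re_le_norm l) (norm_nonneg _)).trans ?_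
    rw [← norm_mul]
    refine le_of_eq (congrArg norm ?_)
    have hex : Complex.exp l - 1 ≠ 0 := by
      intro h0
      apply mul_exp_ne hD k k hl0 hlr
      rw [sub_eq_zero.1 h0, mul_one]
    unfold poleSum
    rw [← Finset.add_sum_erase _ _ (Finset.mem_univ k)]
    have e1 : d k * a k / (a k - a k * Complex.exp l) = - (d k / (Complex.exp l - 1)) := by
      rw [show a k - a k * Complex.exp l = -(a k * (Complex.exp l - 1)) by ring, div_neg,
        mul_comm (d k), mul_div_mul_left _ _ hak]
    rw [e1, inv_div]
    field_simp
    ring)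
  exact ⟨g, hg, fun l hl0 hl => hge l ⟨by simpa using hl, hl0⟩⟩

theorem IsScatteringFamily.exists_norm_sub_le (h : IsScatteringFamily r a β S T c X Y U V) :
    ∃ C > 0, ∀ n : ℕ, 0 < n →
      (∀ z, Real.exp (r / 2 / 2) < ‖z‖ → ‖z‖ < Real.exp (r / 2) → (∀ k, (z / a k).im ≠ 0) →
        ‖V n z - X n z‖ ≤ C * (n : ℝ)⁻¹ ^ 2) ∧
      ∀ z, Real.exp (-(r / 2)) < ‖z‖ → ‖z‖ < Real.exp (-(r / 2 / 2)) → (∀ k, (z / a k).im ≠ 0) →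
        ‖U n z - Y n z‖ ≤ C * (n : ℝ)⁻¹ ^ 2 := by
  have hD := h.data
  have hr := hD.pos
  have ha := hD.norm_eq_one
  obtain ⟨c₀, hc₀, C₀, hS⟩ := hD.S_bdd
  have hcpt : ∀ s t : ℝ, IsCompact {z : ℂ | s ≤ ‖z‖ ∧ ‖z‖ ≤ t} := fun s t =>
    Metric.isCompact_of_isClosed_isBounded
      ((isClosed_le continuous_const continuous_norm).inter
        (isClosed_le continuous_norm continuous_const))
      ((isBounded_closedBall (x := (0 : ℂ)) (r := t)).subset fun z hz => by simpa using hz.2)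
  obtain ⟨M, hM0, hM⟩ := h.exists_bound ((hcpt (Real.exp (r / 2 / 2)) (Real.exp (r / 2))).union
    (hcpt (Real.exp (-(r / 2))) (Real.exp (-(r / 2 / 2))))) (by
    rintro z (⟨h1, h2⟩ | ⟨h1, h2⟩)
    · refine ⟨(Real.exp_lt_exp.2 (by linarith)).trans_le h1,
        h2.trans_lt (Real.exp_lt_exp.2 (by linarith)), ?_⟩
      rintro k rfl
      rw [ha k] at h1
      linarith [Real.one_lt_exp_iff.2 (show 0 < r / 2 / 2 by linarith)]
    · refine ⟨(Real.exp_lt_exp.2 (by linarith)).trans_le h1,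
        h2.trans_lt (Real.exp_lt_exp.2 (by linarith)), ?_⟩
      rintro k rfl
      rw [ha k] at h2
      linarith [Real.exp_lt_one_iff.2 (show -(r / 2 / 2) < 0 by linarith)])
  have hexp : ∀ n : ℕ, 0 < n → Real.exp (-(n * (r / 2 / 2))) ≤ 2 * (4 / r) ^ 2 * (n : ℝ)⁻¹ ^ 2 := by
    intro n hn
    have hn' : (0 : ℝ) < n := by exact_mod_cast hn
    refine (exp_neg_le_two_mul_inv_sq (by positivity)).trans (le_of_eq ?_)
    field_simp
    ring
  refine ⟨(c₀⁻¹ + |C₀|) * M * (2 * (4 / r) ^ 2), by positivity, fun n hn =>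
    ⟨fun z h1 h2 him => ?_, fun z h1 h2 him => ?_⟩⟩
  · have hz := notMem_slits_of_div_im_ne_zero (s := Ici 0) ha him
    have h0 : 0 < ‖z‖ := (Real.exp_pos _).trans h1
    have l1 := (Real.lt_log_iff_exp_lt h0).2 h1
    have l2 := (Real.log_lt_iff_lt_exp h0).2 h2
    have hlog : |Real.log ‖z‖| = Real.log ‖z‖ := abs_of_nonneg (by linarith)
    have hs := (hS z hz (by rw [hlog]; linarith) (by rw [hlog]; linarith)).1
    have hy := (hM z (Or.inl ⟨h1.le, h2.le⟩) n hz).2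
    rw [(h.sol n).eq_V z ((Real.one_lt_exp_iff.2 (by linarith)).trans h1)
      (h2.trans (Real.exp_lt_exp.2 (by linarith))) hz, add_sub_cancel_left, norm_mul, norm_inv,
      norm_mul, norm_pow, mul_inv, ← inv_pow]
    have hzi : ‖z‖⁻¹ ^ n ≤ Real.exp (-(n * (r / 2 / 2))) := by
      rw [← mul_neg, Real.exp_nat_mul, Real.exp_neg]
      gcongr
    have hsi : ‖S z‖⁻¹ ≤ c₀⁻¹ := by gcongr
    calc ‖z‖⁻¹ ^ n * ‖S z‖⁻¹ * ‖Y n z‖ ≤ (2 * (4 / r) ^ 2 * (n : ℝ)⁻¹ ^ 2) * c₀⁻¹ * M := by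
          gcongr
          exact hzi.trans (hexp n hn)
      _ ≤ (2 * (4 / r) ^ 2 * (n : ℝ)⁻¹ ^ 2) * (c₀⁻¹ + |C₀|) * M := by
          gcongr
          linarith [abs_nonneg C₀]
      _ = _ := by ring
  · have hz := notMem_slits_of_div_im_ne_zero (s := Ici 0) ha him
    have h0 : 0 < ‖z‖ := (Real.exp_pos _).trans h1
    have l1 := (Real.lt_log_iff_exp_lt h0).2 h1
    have l2 := (Real.log_lt_iff_lt_exp h0).2 h2
    have hlog : |Real.log ‖z‖| = -Real.log ‖z‖ := abs_of_nonpos (by linarith)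
    have hs := (hS z hz (by rw [hlog]; linarith) (by rw [hlog]; linarith)).2
    have hy := (hM z (Or.inr ⟨h1.le, h2.le⟩) n hz).1
    rw [(h.sol n).eq_U z ((Real.exp_lt_exp.2 (by linarith)).trans h1)
      (h2.trans (Real.exp_lt_one_iff.2 (by linarith))) hz, add_sub_cancel_left, norm_mul,
      norm_mul, norm_pow]
    have hzi : ‖z‖ ^ n ≤ Real.exp (-(n * (r / 2 / 2))) := by
      rw [← mul_neg, Real.exp_nat_mul]
      gcongr
    calc ‖z‖ ^ n * ‖S z‖ * ‖X n z‖ ≤ (2 * (4 / r) ^ 2 * (n : ℝ)⁻¹ ^ 2) * |C₀| * M := by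
          gcongr
          · exact hzi.trans (hexp n hn)
          · exact hs.trans (le_abs_self _)
      _ ≤ (2 * (4 / r) ^ 2 * (n : ℝ)⁻¹ ^ 2) * (c₀⁻¹ + |C₀|) * M := by
          gcongr
          linarith [inv_pos.2 hc₀]
      _ = _ := by ring

theorem norm_combination_le {F G u v : ℂ} {C D t : ℝ} (hC : 0 ≤ C) (hF : ‖F‖ ≤ C) (hG : ‖G‖ ≤ C)
    (hu : ‖u‖ ≤ D * t) (hv : ‖v‖ ≤ D * t) : ‖F * u + G * v‖ ≤ 2 * C * D * t := by
  refine (norm_add_le _ _).trans ?_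
  rw [norm_mul, norm_mul]
  have h1 := mul_le_mul hF hu (norm_nonneg _) hC
  have h2 := mul_le_mul hG hv (norm_nonneg _) hC
  linarith

theorem norm_combination_sub_le {F G u v s c : ℂ} {B C D ε t : ℝ} (hC : 0 ≤ C) (hε : 0 ≤ ε)
    (hF : ‖F‖ ≤ C) (hFc : ‖F - c‖ ≤ ε) (hG : ‖G‖ ≤ ε) (hu : ‖u - s‖ ≤ D * t ^ 2)
    (hs : ‖s‖ ≤ B * t) (hv : ‖v‖ ≤ D * t) :
    ‖F * u + G * v - c * s‖ ≤ C * D * t ^ 2 + ε * (B + D) * t := by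
  rw [show F * u + G * v - c * s = F * (u - s) + (F - c) * s + G * v by ring]
  refine (norm_add₃_le).trans ?_
  rw [norm_mul, norm_mul, norm_mul]
  have h1 := mul_le_mul hF hu (norm_nonneg _) hC
  have h2 := mul_le_mul hFc hs (norm_nonneg _) hε
  have h3 := mul_le_mul hG hv (norm_nonneg _) hε
  linarith

theorem natCast_mul_bounds {n : ℕ} {l : ℂ} (hr : 0 < r) (hn : 1 ≤ n * (r / 8))
    (hl : r / 2 / 4 < ‖l‖) (him : l.im ≠ 0) : 1 ≤ ‖(n : ℂ) * l‖ ∧ ((n : ℂ) * l).im ≠ 0 ∧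
      ‖(n : ℂ) * l‖⁻¹ ≤ 8 / r * (n : ℝ)⁻¹ := by
  have hn0 : (0 : ℝ) < n := by
    by_contra! h
    nlinarith
  have e : ‖(n : ℂ) * l‖ = n * ‖l‖ := by rw [norm_mul, Complex.norm_natCast]
  refine ⟨by rw [e]; nlinarith, ?_, ?_⟩
  · rw [← Complex.ofReal_natCast, Complex.im_ofReal_mul]
    exact mul_ne_zero hn0.ne' him
  · rw [e, mul_inv, mul_comm]
    gcongr
    rw [← inv_div]
    exact inv_anti₀ (by positivity) (by linarith)

theorem one_lt_norm_of_exp_lt (hr : 0 < r) :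
    {z : ℂ | Real.exp (r / 2 / 2) < ‖z‖} ⊆ {z | 1 < ‖z‖} := fun _ hz =>
  (Real.one_lt_exp_iff.2 (by linarith)).trans hz

theorem norm_lt_exp_subset_ball (hr : 0 < r) :
    {z : ℂ | ‖z‖ < Real.exp (-(r / 2 / 2))} ⊆ ball 0 1 := fun z hz => by
  simpa using (show ‖z‖ < _ from hz).trans (Real.exp_lt_one_iff.2 (by linarith))

theorem IsScatteringData.disj_half (h : IsScatteringData r a β S T) : ∀ j k, j ≠ k →
    ∀ l l' : ℂ, ‖l‖ < r / 2 → ‖l'‖ < r / 2 → a j * Complex.exp l ≠ a k * Complex.exp l' :=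
  fun j k hjk l l' hl hl' =>
    h.disj j k hjk l l' (by linarith [h.pos]) (by linarith [h.pos])

theorem outerCutDisc_subset (hr : 0 < r) : outerCutDisc a (r / 2) ⊆
    {z | ‖z‖ < Real.exp r} \ slits a (Ici 1) := fun z hz =>
  ⟨(show ‖z‖ < _ from hz.1).trans (Real.exp_lt_exp.2 (by linarith)), fun h => hz.2 (Or.inl h)⟩

theorem innerCutExterior_subset (hr : 0 < r) : innerCutExterior a (r / 2) ⊆
    {z | Real.exp (-r) < ‖z‖} \ slits a (Icc 0 1) := fun z hz =>
  ⟨(Real.exp_lt_exp.2 (by linarith)).trans (show _ < ‖z‖ from hz.1), fun h => hz.2 (Or.inl h)⟩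

theorem ne_of_notMem_logDiscs {z : ℂ} {s : ℝ} (hs : 0 ≤ s) (hz : z ∉ logDiscs a s) (k : Fin m) :
    z ≠ a k := by
  rintro rfl
  exact hz (mem_logDiscs.2 ⟨k, 0, by simpa using hs, by simp⟩)

/-- The coefficients near the singular points converge. -/
theorem IsScatteringFamily.exists_coefficients_asymptotics
    (h : IsScatteringFamily r a β S T c X Y U V) :
    ∃ F G : ℕ → Fin m → ℂ → ℂ, ∃ C > 0, ∃ N : ℕ, ∀ n ≥ N, 0 < n ∧ 1 ≤ n * (r / 8) ∧ ∀ k,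
      DifferentiableOn ℂ (F n k) (ball 0 (r / 2)) ∧ DifferentiableOn ℂ (G n k) (ball 0 (r / 2)) ∧
      (∀ l : ℂ, ‖l‖ < r / 2 → ‖F n k l‖ ≤ C ∧ ‖F n k l - c‖ ≤ C * (n : ℝ)⁻¹ ∧
        ‖G n k l‖ ≤ C * (n : ℝ)⁻¹) ∧
      ∀ l : ℂ, ‖l‖ < r / 2 → l.im ≠ 0 →
        X n (a k * Complex.exp l) = F n k l * modelQ (β k) (-(n * l)) +
          G n k l * modelP (β k) (-(n * l)) ∧
        Y n (a k * Complex.exp l) = a k ^ n * T k l * (F n k l * modelP (β k) (n * l) +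
          G n k l * modelQ (β k) (n * l)) := by
  have hD := h.data
  have hr := hD.pos
  have ha := hD.norm_eq_one
  have hr1 := hD.le_one
  have hb1 : ∀ k, -1 < β k := fun k => by linarith [hD.exponent k]
  obtain ⟨F, G, C, hC0, N, hFG⟩ := h.exists_coefficients
  obtain ⟨Cj, hCj0, hCj⟩ := h.exists_norm_sub_le
  obtain ⟨CT, hCT0, hCT⟩ := hD.exists_norm_T_le (show r / 2 < r by linarith)
  obtain ⟨Cm, hCm0, hCm⟩ := exists_common_bound (P := fun k C => ∀ ζ : ℂ, ζ.im ≠ 0 →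
      1 ≤ ‖ζ‖ → ‖modelP (β k) ζ‖ ≤ C * ‖ζ‖⁻¹ ∧ ‖modelQ (β k) ζ - 1‖ ≤ C * ‖ζ‖⁻¹)
    (fun i x y hxy h ζ h1 h2 => ⟨(h ζ h1 h2).1.trans (by gcongr),
      (h ζ h1 h2).2.trans (by gcongr)⟩) fun k => by
      obtain ⟨C, hC⟩ := exists_norm_modelPQ_le_of_im_ne_zero (hb1 k)
      exact ⟨C, fun ζ h1 h2 => ⟨(hC ζ h1 h2).1, (hC ζ h1 h2).2.1⟩⟩
  obtain ⟨A₁, hA₁0, hA₁⟩ := exists_norm_sub_le_outer ha (half_pos hr) (by linarith) hD.disj_half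
    (le_refl (3 : ℝ))
  obtain ⟨A₂, hA₂0, hA₂⟩ := exists_norm_sub_le_inner ha (half_pos hr) (by linarith) hD.disj_half
    (le_refl (3 : ℝ))
  set K := 2 * C * Cm * (8 / r) * (1 + CT) + Cj with hK
  have hK0 : 0 < K := by positivity
  refine ⟨F, G, C + A₁ * K + CT * (A₂ * K), by positivity, N, fun n hn => ?_⟩
  obtain ⟨hn0, hn1, hFGn⟩ := hFG n hn
  have hni : (n : ℝ)⁻¹ ^ 2 ≤ (n : ℝ)⁻¹ := by
    have : (n : ℝ)⁻¹ ≤ 1 := inv_le_one_of_one_le₀ (by exact_mod_cast hn0)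
    nlinarith [show 0 ≤ (n : ℝ)⁻¹ by positivity]
  have hni0 : 0 ≤ (n : ℝ)⁻¹ := by positivity
  have est : ∀ k, ∀ l : ℂ, r / 2 / 4 < ‖l‖ → ‖l‖ < r / 2 → l.im ≠ 0 →
      ‖F n k l * (modelQ (β k) (-(n * l)) - 1) + G n k l * modelP (β k) (-(n * l))‖ ≤
        2 * C * Cm * (8 / r) * (n : ℝ)⁻¹ ∧
      ‖F n k l * modelP (β k) (n * l) + G n k l * (modelQ (β k) (n * l) - 1)‖ ≤
        2 * C * Cm * (8 / r) * (n : ℝ)⁻¹ := by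
    intro k l hl1 hl2 him
    obtain ⟨z1, z2, z3⟩ := natCast_mul_bounds hr hn1 hl1 him
    obtain ⟨f1, f2⟩ := (hFGn k).2.2.1 l hl2
    obtain ⟨m1, m2⟩ := hCm k _ z2 z1
    obtain ⟨m3, m4⟩ := hCm k (-(n * l)) (by simpa using z2) (by simpa using z1)
    rw [norm_neg] at m3 m4
    have hfin : 2 * C * Cm * ‖(n : ℂ) * l‖⁻¹ ≤ 2 * C * Cm * (8 / r) * (n : ℝ)⁻¹ := by
      rw [mul_assoc _ (8 / r)]; gcongr
    exact ⟨(norm_combination_le hC0.le f1 f2 m4 m3).trans hfin,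
      (norm_combination_le hC0.le f1 f2 m1 m2).trans hfin⟩
  have hsol := h.sol n
  have hKn : 2 * C * Cm * (8 / r) * (n : ℝ)⁻¹ ≤ K * (n : ℝ)⁻¹ := by
    refine mul_le_mul_of_nonneg_right ?_ hni0
    have : 0 ≤ 2 * C * Cm * (8 / r) * CT := by positivity
    linarith
  have hKj : Cj * (n : ℝ)⁻¹ ^ 2 ≤ K * (n : ℝ)⁻¹ := by
    refine (mul_le_mul_of_nonneg_left hni hCj0.le).trans (mul_le_mul_of_nonneg_right ?_ hni0)
    have : 0 ≤ 2 * C * Cm * (8 / r) * (1 + CT) := by positivity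
    linarith
  have s1 := (hA₁ (K * (n : ℝ)⁻¹) (by positivity) (X n) (V n) (F n) c
    (hsol.diff_X.mono (outerCutDisc_subset hr)) (hsol.diff_V.mono (one_lt_norm_of_exp_lt hr))
    (fun k => (hFGn k).1) (fun k l hl1 hl2 him => by
      rw [((hFGn k).2.2.2 l hl2 him).1]
      refine le_trans (le_of_eq ?_) ((est k l hl1 hl2 him).1.trans hKn)
      congr 1; ring)
    (fun z h1 h2 him => ((hCj n hn0).1 z h1 h2 him).trans hKj) hsol.lim_V).2.2
  have s2 := (hA₂ (K * (n : ℝ)⁻¹) (by positivity) (Y n) (U n)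
    (fun k l => a k ^ n * T k l * G n k l) 0
    (hsol.diff_Y.mono (innerCutExterior_subset hr)) (hsol.diff_U.mono (norm_lt_exp_subset_ball hr))
    (fun k => (((hD.diff_T k).mono (ball_subset_ball (by linarith))).const_mul _).mul (hFGn k).2.1)
    (fun k l hl1 hl2 him => by
      rw [((hFGn k).2.2.2 l hl2 him).2, ← mul_sub, norm_mul, norm_mul, norm_pow, ha k, one_pow,
        one_mul]
      have e : F n k l * modelP (β k) (n * l) + G n k l * modelQ (β k) (n * l) - G n k l =
        F n k l * modelP (β k) (n * l) + G n k l * (modelQ (β k) (n * l) - 1) := by ring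
      rw [e]
      refine (mul_le_mul (hCT k l hl2.le).1 (est k l hl1 hl2 him).2 (norm_nonneg _) hCT0.le).trans ?_
      rw [← mul_assoc]
      refine mul_le_mul_of_nonneg_right ?_ hni0
      have : 0 ≤ 2 * C * Cm * (8 / r) := by positivity
      linarith)
    (fun z h1 h2 him => ((hCj n hn0).2 z h1 h2 him).trans hKj) hsol.lim_Y).2.2
  refine ⟨hn0, hn1, fun k => ⟨(hFGn k).1, (hFGn k).2.1, fun l hl => ⟨?_, ?_, ?_⟩, (hFGn k).2.2.2⟩⟩
  · have := ((hFGn k).2.2.1 l hl).1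
    have : 0 ≤ A₁ * K + CT * (A₂ * K) := by positivity
    linarith
  · refine (s1 k l hl).trans ?_
    rw [← mul_assoc]
    refine mul_le_mul_of_nonneg_right ?_ hni0
    have : 0 ≤ C + CT * (A₂ * K) := by positivity
    linarith
  · have h2 := s2 k l hl
    rw [sub_zero] at h2
    have hT := hD.T_ne k l (by simpa using hl.trans (by linarith))
    have e : G n k l = (a k ^ n)⁻¹ * (T k l)⁻¹ * (a k ^ n * T k l * G n k l) := by
      have := pow_ne_zero n (hD.ne_zero k)
      field_simp
    rw [e, norm_mul, norm_mul, norm_inv, norm_pow, ha k, one_pow, inv_one, one_mul]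
    refine (mul_le_mul (hCT k l hl.le).2 h2 (norm_nonneg _) hCT0.le).trans ?_
    rw [← mul_assoc, ← mul_assoc]
    refine mul_le_mul_of_nonneg_right ?_ hni0
    have : 0 ≤ C + A₁ * K := by positivity
    linarith

/-- Asymptotics of a family of scattering solutions up to second order. -/
theorem IsScatteringFamily.exists_asymptotics (h : IsScatteringFamily r a β S T c X Y U V)
    (R : ℝ) : ∃ C > 0, ∃ N : ℕ, ∀ n ≥ N, 0 < n ∧
      (∀ z ∈ outerCutDisc a (r / 2),
        ‖X n z - c - c * (n : ℂ)⁻¹ * poleSum a (fun j => (β j : ℂ) ^ 2) z‖ ≤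
          C * (n : ℝ)⁻¹ ^ 2) ∧
      (∀ z, Real.exp (r / 2 / 2) < ‖z‖ → ‖z‖ < R →
        ‖V n z - c - c * (n : ℂ)⁻¹ * poleSum a (fun j => (β j : ℂ) ^ 2) z‖ ≤
          C * (n : ℝ)⁻¹ ^ 2) ∧
      (∀ z ∈ innerCutExterior a (r / 2), ‖z‖ < R →
        ‖Y n z - c * (n : ℂ)⁻¹ * poleSum a (fun j => β j * T j 0 * a j ^ n) z‖ ≤
          C * (n : ℝ)⁻¹ ^ 2) ∧
      ∀ z, ‖z‖ < Real.exp (-(r / 2 / 2)) →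
        ‖U n z - c * (n : ℂ)⁻¹ * poleSum a (fun j => β j * T j 0 * a j ^ n) z‖ ≤
          C * (n : ℝ)⁻¹ ^ 2 := by
  have hD := h.data
  have hr := hD.pos
  have ha := hD.norm_eq_one
  have hr1 := hD.le_one
  have hb1 : ∀ k, -1 < β k := fun k => by linarith [hD.exponent k]
  obtain ⟨F, G, C, hC0, N, hFG⟩ := h.exists_coefficients_asymptotics
  obtain ⟨Cj, hCj0, hCj⟩ := h.exists_norm_sub_le
  obtain ⟨CT, hCT0, hCT⟩ := hD.exists_norm_T_le (show r / 2 < r by linarith)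
  obtain ⟨Cm, hCm0, hCm⟩ := exists_common_bound (P := fun k C => ∀ ζ : ℂ, ζ.im ≠ 0 →
      1 ≤ ‖ζ‖ → ‖modelP (β k) ζ‖ ≤ C * ‖ζ‖⁻¹ ∧ ‖modelQ (β k) ζ - 1‖ ≤ C * ‖ζ‖⁻¹ ∧
      ‖modelP (β k) ζ + β k / ζ‖ ≤ C * ‖ζ‖⁻¹ ^ 2 ∧
      ‖modelQ (β k) ζ - 1 - (β k : ℂ) ^ 2 / ζ‖ ≤ C * ‖ζ‖⁻¹ ^ 2)
    (fun i x y hxy h ζ h1 h2 => ⟨(h ζ h1 h2).1.trans (by gcongr),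
      (h ζ h1 h2).2.1.trans (by gcongr), (h ζ h1 h2).2.2.1.trans (by gcongr),
      (h ζ h1 h2).2.2.2.trans (by gcongr)⟩) fun k => exists_norm_modelPQ_le_of_im_ne_zero (hb1 k)
  obtain ⟨Cb, hCb0, hCb⟩ := exists_common_bound (P := fun k C => |β k| ≤ C ∧ β k ^ 2 ≤ C)
    (fun i x y hxy h => ⟨h.1.trans hxy, h.2.trans hxy⟩)
    fun k => ⟨max |β k| (β k ^ 2), le_max_left _ _, le_max_right _ _⟩
  obtain ⟨A₁, hA₁0, hA₁⟩ := exists_norm_sub_le_outer ha (half_pos hr) (by linarith) hD.disj_half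
    (le_max_left (3 : ℝ) R)
  obtain ⟨A₂, hA₂0, hA₂⟩ := exists_norm_sub_le_inner ha (half_pos hr) (by linarith) hD.disj_half
    (le_max_left (3 : ℝ) R)
  choose g₁ hg₁ hg₁e using fun k => exists_poleSum_extension hD k (t := fun _ => 1)
    (differentiableOn_const 1) (fun j => (β j : ℂ) ^ 2) ((β k : ℂ) ^ 2) (mul_one _).symm
  choose g₂ hg₂ hg₂e using fun (n : ℕ) k => exists_poleSum_extension hD k (hD.diff_T k)
    (fun j => β j * T j 0 * a j ^ n) (β k * a k ^ n) (by ring)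
  set K₀ := C * Cm * (8 / r) ^ 2 + C * (Cb + Cm) * (8 / r) with hK₀
  set K := K₀ * (1 + CT) + Cj with hK
  have hK₀0 : 0 < K₀ := by positivity
  have hK0 : 0 < K := by positivity
  refine ⟨A₁ * K + A₂ * K, by positivity, N, fun n hn => ?_⟩
  obtain ⟨hn0, hn1, hFGn⟩ := hFG n hn
  have hni0 : 0 ≤ (n : ℝ)⁻¹ := by positivity
  have hnc : (n : ℂ) ≠ 0 := by exact_mod_cast hn0.ne'
  have est : ∀ k, ∀ l : ℂ, r / 2 / 4 < ‖l‖ → ‖l‖ < r / 2 → l.im ≠ 0 →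
      ‖F n k l * (modelQ (β k) (-(n * l)) - 1) + G n k l * modelP (β k) (-(n * l)) -
        c * ((β k : ℂ) ^ 2 / -(n * l))‖ ≤ K₀ * (n : ℝ)⁻¹ ^ 2 ∧
      ‖F n k l * modelP (β k) (n * l) + G n k l * (modelQ (β k) (n * l) - 1) -
        c * (-(β k / (n * l)))‖ ≤ K₀ * (n : ℝ)⁻¹ ^ 2 := by
    intro k l hl1 hl2 him
    obtain ⟨z1, z2, z3⟩ := natCast_mul_bounds hr hn1 hl1 him
    obtain ⟨f1, f2, f3⟩ := (hFGn k).2.2.1 l hl2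
    obtain ⟨m1, m2, m3, m4⟩ := hCm k _ z2 z1
    obtain ⟨m5, m6, m7, m8⟩ := hCm k (-(n * l)) (by simpa using z2) (by simpa using z1)
    rw [norm_neg] at m5 m6 m7 m8
    have hε : 0 ≤ C * (n : ℝ)⁻¹ := by positivity
    have hfin : C * Cm * ‖(n : ℂ) * l‖⁻¹ ^ 2 + C * (n : ℝ)⁻¹ * (Cb + Cm) * ‖(n : ℂ) * l‖⁻¹ ≤
        K₀ * (n : ℝ)⁻¹ ^ 2 := by
      calc _ ≤ C * Cm * (8 / r * (n : ℝ)⁻¹) ^ 2 +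
          C * (n : ℝ)⁻¹ * (Cb + Cm) * (8 / r * (n : ℝ)⁻¹) := by gcongr
        _ = _ := by rw [hK₀]; ring
    have b1 : ‖(β k : ℂ) ^ 2 / -(n * l)‖ ≤ Cb * ‖(n : ℂ) * l‖⁻¹ := by
      rw [norm_div, norm_neg, norm_pow, Complex.norm_real, Real.norm_eq_abs, sq_abs,
        div_eq_mul_inv]
      gcongr
      exact (hCb k).2
    have b2 : ‖-((β k : ℂ) / (n * l))‖ ≤ Cb * ‖(n : ℂ) * l‖⁻¹ := by
      rw [norm_neg, norm_div, Complex.norm_real, Real.norm_eq_abs, div_eq_mul_inv]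
      gcongr
      exact (hCb k).1
    exact ⟨(norm_combination_sub_le hC0.le hε f1 f2 f3 m8 b1 m5).trans hfin,
      (norm_combination_sub_le hC0.le hε f1 f2 f3 (by rwa [sub_neg_eq_add]) b2 m2).trans hfin⟩
  have hsol := h.sol n
  have hKj : Cj * (n : ℝ)⁻¹ ^ 2 ≤ K * (n : ℝ)⁻¹ ^ 2 := by
    refine mul_le_mul_of_nonneg_right ?_ (by positivity)
    have : 0 ≤ K₀ * (1 + CT) := by positivity
    linarith
  have hK₀K : K₀ * (n : ℝ)⁻¹ ^ 2 ≤ K * (n : ℝ)⁻¹ ^ 2 := by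
    refine mul_le_mul_of_nonneg_right ?_ (by positivity)
    have : 0 ≤ K₀ * CT := by positivity
    linarith
  have hps : ∀ (d : Fin m → ℂ) (s : Set ℂ), (∀ z ∈ s, ∀ k, z ≠ a k) →
      DifferentiableOn ℂ (fun z => c * (n : ℂ)⁻¹ * poleSum a d z) s := fun d s hs =>
    ((differentiableOn_poleSum d).mono hs).const_mul _
  have hlim : ∀ d : Fin m → ℂ, Tendsto (fun z => c * (n : ℂ)⁻¹ * poleSum a d z)
      (Bornology.cobounded ℂ) (nhds 0) := fun d => by
    simpa using (tendsto_poleSum d).const_mul (c * (n : ℂ)⁻¹)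
  have hne1 : ∀ z ∈ outerCutDisc a (r / 2), ∀ k, z ≠ a k := fun z hz =>
    ne_of_notMem_logDiscs (by positivity) fun h => hz.2 (Or.inr h)
  have hne2 : ∀ z ∈ innerCutExterior a (r / 2), ∀ k, z ≠ a k := fun z hz =>
    ne_of_notMem_logDiscs (by positivity) fun h => hz.2 (Or.inr h)
  have hne3 : ∀ z ∈ {z : ℂ | Real.exp (r / 2 / 2) < ‖z‖}, ∀ k, z ≠ a k := by
    rintro _ hz k rfl
    have := one_lt_norm_of_exp_lt hr hz
    simp [ha k] at this
  have hne4 : ∀ z ∈ {z : ℂ | ‖z‖ < Real.exp (-(r / 2 / 2))}, ∀ k, z ≠ a k := by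
    rintro _ hz k rfl
    have := norm_lt_exp_subset_ball hr hz
    simp [ha k] at this
  have hl0 : ∀ l : ℂ, l.im ≠ 0 → l ≠ 0 := by rintro l hl rfl; simp at hl
  have hsubr : ball (0 : ℂ) (r / 2) ⊆ ball 0 r := ball_subset_ball (by linarith)
  obtain ⟨s1, s2, -⟩ := hA₁ (K * (n : ℝ)⁻¹ ^ 2) (by positivity)
    (fun z => X n z - c - c * (n : ℂ)⁻¹ * poleSum a (fun j => (β j : ℂ) ^ 2) z)
    (fun z => V n z - c - c * (n : ℂ)⁻¹ * poleSum a (fun j => (β j : ℂ) ^ 2) z)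
    (fun k l => F n k l - c - c * (n : ℂ)⁻¹ * g₁ k l) 0
    (((hsol.diff_X.mono (outerCutDisc_subset hr)).sub_const _).sub (hps _ _ hne1))
    (((hsol.diff_V.mono (one_lt_norm_of_exp_lt hr)).sub_const _).sub (hps _ _ hne3))
    (fun k => ((hFGn k).1.sub_const _).sub (((hg₁ k).mono hsubr).const_mul _))
    (fun k l hl1 hl2 him => by
      have hl := hl0 l him
      rw [((hFGn k).2.2.2 l hl2 him).1, hg₁e k l hl (by linarith)]
      refine le_trans (le_of_eq ?_) ((est k l hl1 hl2 him).1.trans hK₀K)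
      congr 1
      field_simp
      ring)
    (fun z h1 h2 him => by
      rw [sub_sub_sub_cancel_right, sub_sub_sub_cancel_right]
      exact ((hCj n hn0).1 z h1 h2 him).trans hKj)
    (by simpa using (hsol.lim_V.sub_const c).sub (hlim fun j => (β j : ℂ) ^ 2))
  obtain ⟨s3, s4, -⟩ := hA₂ (K * (n : ℝ)⁻¹ ^ 2) (by positivity)
    (fun z => Y n z - c * (n : ℂ)⁻¹ * poleSum a (fun j => β j * T j 0 * a j ^ n) z)
    (fun z => U n z - c * (n : ℂ)⁻¹ * poleSum a (fun j => β j * T j 0 * a j ^ n) z)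
    (fun k l => a k ^ n * T k l * G n k l - c * (n : ℂ)⁻¹ * g₂ n k l) 0
    ((hsol.diff_Y.mono (innerCutExterior_subset hr)).sub (hps _ _ hne2))
    ((hsol.diff_U.mono (norm_lt_exp_subset_ball hr)).sub (hps _ _ hne4))
    (fun k => ((((hD.diff_T k).mono hsubr).const_mul _).mul (hFGn k).2.1).sub
      (((hg₂ n k).mono hsubr).const_mul _))
    (fun k l hl1 hl2 him => by
      have hl := hl0 l him
      rw [((hFGn k).2.2.2 l hl2 him).2, hg₂e n k l hl (by linarith)]
      have e : ∀ P Q s : ℂ, a k ^ n * T k l * (F n k l * P + G n k l * Q) - c * (n : ℂ)⁻¹ * s -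
          (a k ^ n * T k l * G n k l - c * (n : ℂ)⁻¹ * (s + β k * a k ^ n * T k l / l)) =
          a k ^ n * T k l * (F n k l * P + G n k l * (Q - 1) - c * (-(β k / (n * l)))) := by
        intro P Q s
        field_simp
        ring
      rw [e, norm_mul, norm_mul, norm_pow, ha k, one_pow, one_mul]
      refine (mul_le_mul (hCT k l hl2.le).1 (est k l hl1 hl2 him).2 (norm_nonneg _)
        hCT0.le).trans ?_
      rw [← mul_assoc]
      refine mul_le_mul_of_nonneg_right ?_ (by positivity)
      linarith)
    (fun z h1 h2 him => by
      rw [sub_sub_sub_cancel_right]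
      exact ((hCj n hn0).2 z h1 h2 him).trans hKj)
    (by simpa using hsol.lim_Y.sub (hlim fun j => β j * T j 0 * a j ^ n))
  simp only [sub_zero, ← mul_assoc] at s1 s2 s3 s4
  have hle1 : A₁ * K * (n : ℝ)⁻¹ ^ 2 ≤ (A₁ * K + A₂ * K) * (n : ℝ)⁻¹ ^ 2 :=
    mul_le_mul_of_nonneg_right (le_add_of_nonneg_right (by positivity)) (by positivity)
  have hle2 : A₂ * K * (n : ℝ)⁻¹ ^ 2 ≤ (A₁ * K + A₂ * K) * (n : ℝ)⁻¹ ^ 2 :=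
    mul_le_mul_of_nonneg_right (le_add_of_nonneg_left (by positivity)) (by positivity)
  exact ⟨hn0, fun z hz => (s1 z hz).trans hle1,
    fun z hz hzR => (s2 z hz (hzR.trans_le (le_max_right _ _))).trans hle1,
    fun z hz hzR => (s3 z hz (hzR.trans_le (le_max_right _ _))).trans hle2,
    fun z hz => (s4 z hz).trans hle2⟩

end

/-- The point of the unit circle with the given argument. -/
noncomputable def circlePoint (θ : ℝ) : ℂ := Complex.exp (θ * Complex.I)

theorem norm_circlePoint (θ : ℝ) : ‖circlePoint θ‖ = 1 := Complex.norm_exp_ofReal_mul_I θ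

theorem circlePoint_ne_zero (θ : ℝ) : circlePoint θ ≠ 0 := Complex.exp_ne_zero _

theorem continuous_circlePoint : Continuous circlePoint := by
  unfold circlePoint
  fun_prop

theorem circleMap_zero_one (θ : ℝ) : circleMap 0 1 θ = circlePoint θ := by
  simp [circleMap, circlePoint]

/-- The mean over the unit circle of a function against the Cauchy kernel. -/
noncomputable def cauchyMean (F : ℝ → ℂ) (z : ℂ) : ℂ :=
  (2 * π : ℂ)⁻¹ * ∫ θ in (0 : ℝ)..(2 * π), F θ * (circlePoint θ / (circlePoint θ - z))

theorem abs_one_sub_norm_le (θ : ℝ) (z : ℂ) : |1 - ‖z‖| ≤ ‖circlePoint θ - z‖ := by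
  have := abs_norm_sub_norm_le (circlePoint θ) z
  rwa [norm_circlePoint] at this

theorem circlePoint_sub_ne_zero (θ : ℝ) {z : ℂ} (hz : ‖z‖ ≠ 1) : circlePoint θ - z ≠ 0 := by
  intro h
  rw [sub_eq_zero] at h
  exact hz (h ▸ norm_circlePoint θ)

theorem continuous_cauchyKernel {z : ℂ} (hz : ‖z‖ ≠ 1) :
    Continuous fun θ => circlePoint θ / (circlePoint θ - z) :=
  continuous_circlePoint.div (continuous_circlePoint.sub continuous_const)
    fun θ => circlePoint_sub_ne_zero θ hz

theorem norm_cauchyKernel_le (θ : ℝ) {z : ℂ} {d : ℝ} (hd : 0 < d) (hz : d ≤ |1 - ‖z‖|) :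
    ‖circlePoint θ / (circlePoint θ - z)‖ ≤ d⁻¹ := by
  rw [norm_div, norm_circlePoint, one_div]
  exact inv_anti₀ hd (hz.trans (abs_one_sub_norm_le θ z))

theorem norm_cauchyMean_le {F : ℝ → ℂ} (hF : IntervalIntegrable F volume 0 (2 * π)) {z : ℂ}
    (hz : ‖z‖ ≠ 1) :
    ‖cauchyMean F z‖ * |1 - ‖z‖| ≤ (2 * π)⁻¹ * ∫ θ in (0 : ℝ)..(2 * π), ‖F θ‖ := by
  have hd : 0 < |1 - ‖z‖| := abs_pos.2 (sub_ne_zero.2 hz.symm)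
  have h1 : ‖∫ θ in (0 : ℝ)..(2 * π), F θ * (circlePoint θ / (circlePoint θ - z))‖ ≤
      ∫ θ in (0 : ℝ)..(2 * π), ‖F θ‖ * |1 - ‖z‖|⁻¹ := by
    refine intervalIntegral.norm_integral_le_of_norm_le Real.two_pi_pos.le
      (ae_of_all _ fun θ _ => ?_) (hF.norm.mul_const _)
    rw [norm_mul]
    exact mul_le_mul_of_nonneg_left (norm_cauchyKernel_le θ hd le_rfl) (norm_nonneg _)
  rw [intervalIntegral.integral_mul_const] at h1
  have h2 : ‖(2 * π : ℂ)⁻¹‖ = (2 * π)⁻¹ := by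
    rw [norm_inv, norm_mul, Complex.norm_real, Real.norm_of_nonneg Real.pi_pos.le]
    simp
  rw [cauchyMean, norm_mul, h2, mul_assoc]
  refine mul_le_mul_of_nonneg_left ?_ (by positivity)
  calc _ ≤ _ := mul_le_mul_of_nonneg_right h1 hd.le
    _ = _ := by field_simp

theorem isOpen_norm_ne_one : IsOpen {z : ℂ | ‖z‖ ≠ 1} :=
  isOpen_ne_fun continuous_norm continuous_const

theorem differentiableOn_cauchyMean {F : ℝ → ℂ} (hF : IntervalIntegrable F volume 0 (2 * π)) :
    DifferentiableOn ℂ (cauchyMean F) {z | ‖z‖ ≠ 1} := by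
  have h2 := Real.two_pi_pos.le
  refine DifferentiableOn.const_mul ?_ _
  simp only [intervalIntegral.integral_of_le h2]
  rw [intervalIntegrable_iff_integrableOn_Ioc_of_le h2] at hF
  refine differentiableOn_integral_of_holomorphic isOpen_norm_ne_one ?_ ?_ ?_
  · refine ae_of_all _ fun θ z hz => ?_
    have := circlePoint_sub_ne_zero θ hz
    exact (by fun_prop (disch := assumption) : DifferentiableAt ℂ (fun z =>
      F θ * (circlePoint θ / (circlePoint θ - z))) z).differentiableWithinAt
  · exact fun z hz => hF.aestronglyMeasurable.mul (continuous_cauchyKernel hz).aestronglyMeasurable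
  · intro z hz
    have hd : 0 < |1 - ‖z‖| / 2 := half_pos (abs_pos.2 (sub_ne_zero.2 (Ne.symm hz)))
    have hc : Continuous fun z : ℂ => |1 - ‖z‖| := by fun_prop
    have hV : ∀ᶠ x in nhds z, |1 - ‖z‖| / 2 < |1 - ‖x‖| :=
      (hc.tendsto z).eventually_const_lt (by linarith)
    refine ⟨_, hV, fun θ => ‖F θ‖ * (|1 - ‖z‖| / 2)⁻¹, hF.norm.mul_const _,
      ae_of_all _ fun θ x hx => ?_⟩
    rw [norm_mul]
    exact mul_le_mul_of_nonneg_left (norm_cauchyKernel_le θ hd (le_of_lt hx)) (norm_nonneg _)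

theorem cauchyMean_eq {f : ℂ → ℂ} (z : ℂ) :
    cauchyMean (fun θ => f (circlePoint θ)) z =
      (2 * π * Complex.I)⁻¹ * ∮ ζ in C(0, 1), (ζ - z)⁻¹ * f ζ := by
  rw [cauchyMean, circleIntegral, ← intervalIntegral.integral_const_mul,
    ← intervalIntegral.integral_const_mul]
  refine intervalIntegral.integral_congr fun θ _ => ?_
  simp only [deriv_circleMap, circleMap_zero_one, smul_eq_mul]
  have h0 := Complex.I_ne_zero
  field_simp

theorem cauchyMean_of_norm_lt_one {f : ℂ → ℂ} (hf : DiffContOnCl ℂ f (ball 0 1)) {z : ℂ}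
    (hz : ‖z‖ < 1) : cauchyMean (fun θ => f (circlePoint θ)) z = f z := by
  rw [cauchyMean_eq]
  have := hf.circleIntegral_sub_inv_smul (w := z) (by simpa using hz)
  simp only [smul_eq_mul] at this
  rw [this]
  have h0 := Complex.I_ne_zero
  have h1 : (π : ℂ) ≠ 0 := by exact_mod_cast Real.pi_ne_zero
  field_simp

theorem cauchyMean_of_one_lt_norm {f : ℂ → ℂ} (hf : DiffContOnCl ℂ f (ball 0 1)) {z : ℂ}
    (hz : 1 < ‖z‖) : cauchyMean (fun θ => f (circlePoint θ)) z = 0 := by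
  rw [cauchyMean_eq]
  have hg : DiffContOnCl ℂ (fun ζ => (ζ - z)⁻¹ * f ζ) (ball 0 1) := by
    refine DiffContOnCl.smul (DiffContOnCl.inv
      (Differentiable.diffContOnCl (differentiable_id.sub_const z)) fun ζ hζ => ?_) hf
    have : ‖ζ‖ ≤ 1 := by
      rw [closure_ball _ one_ne_zero] at hζ
      simpa using hζ
    exact sub_ne_zero.2 fun h => hz.not_ge ((congrArg norm h).symm.trans_le this)
  rw [hg.circleIntegral_eq_zero zero_le_one, mul_zero]

theorem cauchyMean_const {c : ℂ} {z : ℂ} (hz : ‖z‖ < 1) : cauchyMean (fun _ => c) z = c :=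
  cauchyMean_of_norm_lt_one (f := fun _ => c) diffContOnCl_const hz

theorem cauchyMean_const_of_one_lt_norm {c : ℂ} {z : ℂ} (hz : 1 < ‖z‖) :
    cauchyMean (fun _ => c) z = 0 :=
  cauchyMean_of_one_lt_norm (f := fun _ => c) diffContOnCl_const hz

theorem cauchyMean_sub {F : ℝ → ℂ} (hF : IntervalIntegrable F volume 0 (2 * π)) (c : ℂ) {z : ℂ}
    (hz : ‖z‖ ≠ 1) :
    cauchyMean (fun θ => F θ - c) z = cauchyMean F z - cauchyMean (fun _ => c) z := by
  have hk := (continuous_cauchyKernel hz).continuousOn (s := uIcc 0 (2 * π))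
  simp only [cauchyMean, sub_mul]
  rw [intervalIntegral.integral_sub (hF.mul_continuousOn hk)
    (intervalIntegrable_const.mul_continuousOn hk), mul_sub]

theorem cauchyMean_sub_of_norm_lt_one {F : ℝ → ℂ} (hF : IntervalIntegrable F volume 0 (2 * π))
    (c : ℂ) {z : ℂ} (hz : ‖z‖ < 1) : cauchyMean (fun θ => F θ - c) z = cauchyMean F z - c := by
  rw [cauchyMean_sub hF c hz.ne, cauchyMean_const hz]

theorem cauchyMean_sub_of_one_lt_norm {F : ℝ → ℂ} (hF : IntervalIntegrable F volume 0 (2 * π))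
    (c : ℂ) {z : ℂ} (hz : 1 < ‖z‖) : cauchyMean (fun θ => F θ - c) z = cauchyMean F z := by
  rw [cauchyMean_sub hF c hz.ne', cauchyMean_const_of_one_lt_norm hz, sub_zero]

theorem tendsto_cauchyMean_cobounded {F : ℝ → ℂ} (hF : IntervalIntegrable F volume 0 (2 * π)) :
    Tendsto (cauchyMean F) (Bornology.cobounded ℂ) (nhds 0) := by
  set M := (2 * π)⁻¹ * ∫ θ in (0 : ℝ)..(2 * π), ‖F θ‖
  have h1 : Tendsto (fun z : ℂ => M / (‖z‖ - 1)) (Bornology.cobounded ℂ) (nhds 0) :=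
    tendsto_const_nhds.div_atTop (tendsto_atTop_add_const_right _ _ tendsto_norm_cobounded_atTop)
  refine squeeze_zero_norm' ?_ h1
  filter_upwards [tendsto_norm_cobounded_atTop.eventually_gt_atTop 1] with z hz
  have := norm_cauchyMean_le hF hz.ne'
  rw [abs_sub_comm, abs_of_pos (by linarith)] at this
  rwa [le_div_iff₀ (by linarith)]

theorem ae_circlePoint_ne (z : ℂ) : ∀ᵐ θ ∂(volume.restrict (Ioc (0 : ℝ) (2 * π))),
    circlePoint θ ≠ z := by
  have : ({θ : ℝ | circlePoint θ = z} ∩ Ioc 0 (2 * π)).Subsingleton := by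
    rintro x ⟨hx, hx'⟩ y ⟨hy, hy'⟩
    have h := injOn_circleMap_of_abs_sub_le (c := 0) (R := 1) (a := 0) (b := 2 * π) one_ne_zero
      (by rw [zero_sub, abs_neg, abs_of_pos Real.two_pi_pos])
    rw [uIoc_of_le Real.two_pi_pos.le] at h
    exact h hx' hy' (by rw [circleMap_zero_one, circleMap_zero_one]; exact hx.trans hy.symm)
  rw [ae_restrict_iff' measurableSet_Ioc, ae_iff]
  refine measure_mono_null ?_ (this.measure_zero volume)
  intro θ hθ
  simp only [mem_ofPred_eq, not_forall, not_not] at hθ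
  exact ⟨hθ.2, hθ.1⟩

/-- The jump of a Cauchy integral: after subtracting a holomorphic extension of the density, the
integral is holomorphic across the circle. -/
theorem differentiableOn_cauchyMean_sub {F : ℝ → ℂ}
    (hF : IntervalIntegrable F volume 0 (2 * π)) {f : ℂ → ℂ} {p : ℂ} {s : ℝ}
    (hf : DifferentiableOn ℂ f (ball p s))
    (hFf : ∀ θ, circlePoint θ ∈ ball p s → F θ = f (circlePoint θ)) :
    DifferentiableOn ℂ (fun z => cauchyMean (fun θ => F θ - f z) z) (ball p (s / 4)) := by
  classical
  rcases le_or_gt s 0 with hs | hs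
  · rw [ball_eq_empty.2 (by linarith)]
    exact differentiableOn_empty
  have h2 := Real.two_pi_pos.le
  rw [intervalIntegrable_iff_integrableOn_Ioc_of_le h2] at hF
  set e := circlePoint with he
  have hcf : ContinuousOn f (closedBall p (s / 2)) :=
    hf.continuousOn.mono (closedBall_subset_ball (by linarith))
  obtain ⟨M, hM⟩ := (isCompact_closedBall p (s / 2)).exists_bound_of_continuousOn hcf
  have hcd : ContinuousOn (deriv f) (closedBall p (s / 2)) :=
    (hf.deriv isOpen_ball).continuousOn.mono (closedBall_subset_ball (by linarith))
  obtain ⟨M', hM'⟩ := (isCompact_closedBall p (s / 2)).exists_bound_of_continuousOn hcd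
  have hM0 : 0 ≤ M := (norm_nonneg _).trans (hM p (mem_closedBall_self (by linarith)))
  have hM0' : 0 ≤ M' := (norm_nonneg _).trans (hM' p (mem_closedBall_self (by linarith)))
  set K : ℝ → ℂ → ℂ := fun θ z => if e θ ∈ ball p (s / 2) then dslope f (e θ) z * e θ else
    (F θ - f z) * (e θ / (e θ - z)) with hK
  have hK_eq : ∀ θ z, e θ ≠ z → K θ z = (F θ - f z) * (e θ / (e θ - z)) := by
    intro θ z hne
    simp only [hK]
    split_ifs with h
    · rw [hFf θ (ball_subset_ball (by linarith) h), dslope_of_ne _ hne.symm, slope_def_field]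
      have h1 := sub_ne_zero.2 hne
      have h3 := sub_ne_zero.2 hne.symm
      rw [← neg_sub (e θ) z]
      field_simp
      ring
    · rfl
  have hball : ball p (s / 4) ⊆ ball p (s / 2) := ball_subset_ball (by linarith)
  have hmain : DifferentiableOn ℂ (fun z => ∫ θ in Ioc 0 (2 * π), K θ z) (ball p (s / 4)) := by
    refine differentiableOn_integral_of_holomorphic isOpen_ball (ae_of_all _ fun θ => ?_)
      (fun z hz => ?_) fun z hz => ⟨_, isOpen_ball.mem_nhds hz, fun θ => M' + (‖F θ‖ + M) * (s / 4)⁻¹,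
      (integrable_const M').add ((hF.norm.add (integrable_const M)).mul_const _),
      ae_of_all _ fun θ x hx => ?_⟩
    · by_cases h : e θ ∈ ball p (s / 2)
      · simp only [hK, if_pos h]
        refine DifferentiableOn.mul_const ?_ _
        exact ((Complex.differentiableOn_dslope (isOpen_ball.mem_nhds h)).2
          (hf.mono (ball_subset_ball (by linarith)))).mono hball
      · simp only [hK, if_neg h]
        intro z hz
        have hne : e θ - z ≠ 0 := sub_ne_zero.2 fun h' => h (h' ▸ hball hz)
        have hfz : DifferentiableAt ℂ f z :=
          hf.differentiableAt (isOpen_ball.mem_nhds (ball_subset_ball (by linarith) hz))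
        exact (by fun_prop (disch := assumption) : DifferentiableAt ℂ (fun z =>
          (F θ - f z) * (e θ / (e θ - z))) z).differentiableWithinAt
    · have hm : AEStronglyMeasurable (fun θ => (F θ - f z) * (e θ / (e θ - z)))
          (volume.restrict (Ioc 0 (2 * π))) := by
        refine (hF.aestronglyMeasurable.sub aestronglyMeasurable_const).mul ?_
        have hmc : Measurable e := continuous_circlePoint.measurable
        exact (hmc.div (hmc.sub_const z)).aestronglyMeasurable
      refine hm.congr ?_
      filter_upwards [ae_circlePoint_ne z] with θ hθ
      exact (hK_eq θ z hθ).symm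
    · have hFn : 0 ≤ (‖F θ‖ + M) * (s / 4)⁻¹ := by positivity
      have hx' := hball hx
      by_cases h : e θ ∈ ball p (s / 2)
      · simp only [hK, if_pos h]
        rw [norm_mul, norm_circlePoint, mul_one]
        refine le_trans ?_ (le_add_of_nonneg_right hFn)
        rcases eq_or_ne x (e θ) with hxe | hxe
        · rw [hxe, dslope_same]
          exact hM' _ (ball_subset_closedBall h)
        · rw [dslope_of_ne _ hxe, slope_def_field, norm_div,
            div_le_iff₀ (norm_pos_iff.2 (sub_ne_zero.2 hxe))]
          exact (convex_ball p (s / 2)).norm_image_sub_le_of_norm_deriv_le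
            (fun y hy => hf.differentiableAt (isOpen_ball.mem_nhds
              (ball_subset_ball (by linarith) hy)))
            (fun y hy => hM' _ (ball_subset_closedBall hy)) h hx'
      · simp only [hK, if_neg h]
        refine le_trans ?_ (le_add_of_nonneg_left hM0')
        rw [norm_mul]
        have h1 : ‖F θ - f x‖ ≤ ‖F θ‖ + M :=
          (norm_sub_le _ _).trans (add_le_add_right (hM x (ball_subset_closedBall hx')) _)
        have h3 : s / 4 ≤ ‖e θ - x‖ := by
          rw [mem_ball, not_lt] at h
          rw [mem_ball] at hx
          have := dist_triangle (e θ) x p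
          rw [← dist_eq_norm]
          linarith
        refine mul_le_mul h1 ?_ (norm_nonneg _) (by positivity)
        rw [norm_div, norm_circlePoint, one_div]
        exact inv_anti₀ (by linarith) h3
  refine (hmain.const_mul (2 * π : ℂ)⁻¹).congr fun z _ => ?_
  rw [cauchyMean, intervalIntegral.integral_of_le h2]
  congr 1
  refine integral_congr_ae ?_
  filter_upwards [ae_circlePoint_ne z] with θ hθ
  exact (hK_eq θ z hθ).symm

theorem circlePoint_periodic : Function.Periodic circlePoint (2 * π) := by
  intro θ
  rw [circlePoint, circlePoint]
  push_cast
  rw [add_mul, Complex.exp_add, Complex.exp_two_pi_mul_I, mul_one]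

theorem mul_abs_le_norm_circlePoint_sub_one {θ : ℝ} (hθ : |θ| ≤ π) :
    2 / π * |θ| ≤ ‖circlePoint θ - 1‖ := by
  rw [circlePoint, mul_comm (θ : ℂ), Complex.norm_exp_I_mul_ofReal_sub_one, norm_mul, Real.norm_eq_abs,
    Real.norm_eq_abs, abs_two]
  have h1 : |θ / 2| ≤ π / 2 := by rw [abs_div, abs_two]; linarith
  have := Real.mul_abs_le_abs_sin h1
  rw [abs_div, abs_two] at this
  linarith

theorem intervalIntegrable_norm_circlePoint_sub_rpow {a : ℂ} (ha : ‖a‖ = 1) {s : ℝ}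
    (hs : -1 < s) (b c : ℝ) :
    IntervalIntegrable (fun θ => ‖circlePoint θ - a‖ ^ s) volume b c := by
  obtain ⟨α, hα⟩ : ∃ α, circlePoint α = a := ⟨Complex.arg a, by
    simpa [ha, circlePoint] using Complex.norm_mul_exp_arg_mul_I a⟩
  have hshift : ∀ θ, ‖circlePoint θ - a‖ = ‖circlePoint (θ - α) - 1‖ := by
    intro θ
    have : circlePoint θ - a = a * (circlePoint (θ - α) - 1) := by
      rw [mul_sub, ← hα, circlePoint, circlePoint, circlePoint, ← Complex.exp_add]
      push_cast
      ring_nf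
    rw [this, norm_mul, ha, one_mul]
  rcases le_or_gt 0 s with h0 | h0
  · refine Continuous.intervalIntegrable (Continuous.rpow_const ?_ fun _ => Or.inr h0) _ _
    exact (continuous_circlePoint.sub continuous_const).norm
  simp only [hshift]
  set g : ℝ → ℝ := fun θ => ‖circlePoint θ - 1‖ ^ s with hg
  have hper : Function.Periodic g (2 * π) := fun θ => by
    simp only [hg, circlePoint_periodic θ]
  have hmeas : Measurable g :=
    (continuous_circlePoint.sub continuous_const).norm.measurable.pow_const s
  have hbd : ∀ θ, θ ∈ Ioc 0 π → ‖g θ‖ ≤ ‖(2 / π) ^ s * θ ^ s‖ := by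
    intro θ hθ
    have h1 : 0 < 2 / π * θ := mul_pos (by positivity) hθ.1
    have h2 := mul_abs_le_norm_circlePoint_sub_one (θ := θ) (by rw [abs_of_pos hθ.1]; exact hθ.2)
    rw [abs_of_pos hθ.1] at h2
    have h3 := Real.rpow_le_rpow_of_nonpos h1 h2 h0.le
    rw [Real.mul_rpow (by positivity) hθ.1.le] at h3
    rw [Real.norm_of_nonneg (by positivity), Real.norm_of_nonneg
      (mul_nonneg (by positivity) (Real.rpow_nonneg hθ.1.le _))]
    exact h3
  have hpos : IntervalIntegrable g volume 0 π := by
    refine ((intervalIntegral.intervalIntegrable_rpow' hs).const_mul ((2 / π) ^ s)).mono_fun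
      hmeas.aestronglyMeasurable ?_
    rw [uIoc_of_le Real.pi_pos.le]
    exact (ae_restrict_mem measurableSet_Ioc).mono hbd
  have heven : ∀ θ, g (-θ) = g θ := by
    intro θ
    have h1 : circlePoint (-θ) = (starRingEnd ℂ) (circlePoint θ) := by
      rw [circlePoint, circlePoint, ← Complex.exp_conj]
      simp
    simp only [hg, h1]
    rw [← Complex.norm_conj (circlePoint θ - 1), map_sub, map_one]
  have hneg : IntervalIntegrable g volume (-π) 0 := by
    have h1 := hpos.symm
    rw [IntervalIntegrable.iff_comp_neg] at h1
    simp only [heven, neg_zero] at h1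
    exact h1.symm.symm
  have hall : IntervalIntegrable g volume (b - α) (c - α) :=
    hper.intervalIntegrable (t := -π) Real.two_pi_pos.ne'
      (by rw [show -π + 2 * π = π by ring]; exact hneg.trans hpos) _ _
  have := hall.comp_sub_right α
  simpa using this

theorem intervalIntegrable_log_norm_circlePoint_sub (a : ℂ) :
    IntervalIntegrable (fun θ => Real.log ‖circlePoint θ - a‖) volume 0 (2 * π) := by
  have h : MeromorphicOn (fun z : ℂ => z - a) (sphere 0 |1|) := fun z _ => by fun_prop
  have := h.circleIntegrable_log_norm
  unfold CircleIntegrable at this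
  simpa only [circleMap_zero_one] using this

/-- Powers of distances to distinct points of the circle are integrable. -/
theorem intervalIntegrable_prod_norm_sub_rpow {m : ℕ} {a : Fin m → ℂ} (ha : ∀ k, ‖a k‖ = 1)
    (hinj : Function.Injective a) {s : Fin m → ℝ} (hs : ∀ k, -1 < s k) :
    IntervalIntegrable (fun θ => ∏ k, ‖circlePoint θ - a k‖ ^ s k) volume 0 (2 * π) := by
  obtain ⟨d, hd0, hd⟩ : ∃ d > 0, ∀ i j, i ≠ j → 2 * d ≤ ‖a i - a j‖ := by
    have : ∀ p : Fin m × Fin m, ∃ C > 0, p.1 ≠ p.2 → 2 * C⁻¹ ≤ ‖a p.1 - a p.2‖ := by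
      rintro ⟨i, j⟩
      by_cases hij : i = j
      · exact ⟨1, one_pos, fun h => absurd hij h⟩
      have h0 := norm_pos_iff.2 (sub_ne_zero.2 (hinj.ne hij))
      exact ⟨2 / ‖a i - a j‖, by positivity, fun _ => by
        rw [inv_div, mul_div_cancel₀ _ two_ne_zero]⟩
    choose C hC0 hC using this
    obtain ⟨B, hB0, hB⟩ := exists_common_bound (P := fun p x => C p ≤ x)
      (fun p x y h h' => h'.trans h) fun p => ⟨C p, le_rfl⟩
    refine ⟨B⁻¹, by positivity, fun i j hij => le_trans ?_ (hC (i, j) hij)⟩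
    have := inv_anti₀ (hC0 (i, j)) (hB (i, j))
    linarith
  obtain ⟨M, hM1, hM⟩ : ∃ M ≥ 1, ∀ k, ∀ x : ℝ, d ≤ x → x ≤ 2 → x ^ s k ≤ M := by
    have : ∀ k, ∃ C, ∀ x : ℝ, d ≤ x → x ≤ 2 → x ^ s k ≤ C := by
      intro k
      have hc : ContinuousOn (fun x : ℝ => x ^ s k) (Icc d 2) := fun x hx =>
        (Real.continuousAt_rpow_const x _ (Or.inl (hd0.trans_le hx.1).ne')).continuousWithinAt
      obtain ⟨C, hC⟩ := isCompact_Icc.exists_bound_of_continuousOn hc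
      exact ⟨C, fun x h1 h2 => (le_abs_self _).trans (hC x ⟨h1, h2⟩)⟩
    obtain ⟨M, hM0, hM⟩ := exists_common_bound (P := fun k y => ∀ x : ℝ, d ≤ x → x ≤ 2 → x ^ s k ≤ y)
      (fun k x y h h' t h1 h2 => (h' t h1 h2).trans h) this
    exact ⟨max M 1, le_max_right _ _, fun k x h1 h2 => (hM k x h1 h2).trans (le_max_left _ _)⟩
  have hM0 : 0 ≤ M := by linarith
  have hle : ∀ θ k, ‖circlePoint θ - a k‖ ≤ 2 := fun θ k => by
    have := norm_sub_le (circlePoint θ) (a k)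
    rw [norm_circlePoint, ha k] at this
    linarith
  have hint : IntervalIntegrable (fun θ => M ^ m * (1 + ∑ k, ‖circlePoint θ - a k‖ ^ s k)) volume
      0 (2 * π) := by
    refine IntervalIntegrable.const_mul (intervalIntegrable_const.add ?_) _
    have := IntervalIntegrable.sum Finset.univ fun k _ =>
      intervalIntegrable_norm_circlePoint_sub_rpow (ha k) (hs k) 0 (2 * π)
    refine this.congr fun θ _ => ?_
    simp
  refine hint.mono_fun ?_ (ae_of_all _ fun θ => ?_)
  · refine Measurable.aestronglyMeasurable (Finset.measurable_fun_prod _ fun k _ => ?_)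
    exact (continuous_circlePoint.sub continuous_const).norm.measurable.pow_const _
  have hnn : ∀ k, 0 ≤ ‖circlePoint θ - a k‖ ^ s k := fun k => Real.rpow_nonneg (norm_nonneg _) _
  have hsum : 0 ≤ ∑ k, ‖circlePoint θ - a k‖ ^ s k := Finset.sum_nonneg fun k _ => hnn k
  beta_reduce
  rw [Real.norm_of_nonneg (Finset.prod_nonneg fun k _ => hnn k), Real.norm_of_nonneg (by positivity)]
  by_cases h : ∃ k, ‖circlePoint θ - a k‖ < d
  · obtain ⟨k, hk⟩ := h
    rw [← Finset.mul_prod_erase _ _ (Finset.mem_univ k)]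
    have h1 : ∏ j ∈ Finset.univ.erase k, ‖circlePoint θ - a j‖ ^ s j ≤ M ^ m := by
      calc _ ≤ ∏ j ∈ Finset.univ.erase k, M := by
            refine Finset.prod_le_prod (fun j _ => hnn j) fun j hj => hM j _ ?_ (hle θ j)
            have h2 := hd j k (Finset.ne_of_mem_erase hj)
            have h3 := norm_sub_le (circlePoint θ - a k) (circlePoint θ - a j)
            rw [sub_sub_sub_cancel_left] at h3
            linarith
        _ ≤ M ^ m := by
            rw [Finset.prod_const]
            refine pow_le_pow_right₀ hM1 ?_
            simp
    have h4 : ‖circlePoint θ - a k‖ ^ s k ≤ 1 + ∑ k, ‖circlePoint θ - a k‖ ^ s k := by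
      have := Finset.single_le_sum (fun j _ => hnn j) (Finset.mem_univ k)
      linarith
    rw [mul_comm]
    exact mul_le_mul h1 h4 (hnn k) (by positivity)
  · push Not at h
    calc _ ≤ ∏ _j : Fin m, M := Finset.prod_le_prod (fun j _ => hnn j) fun j _ => hM j _ (h j) (hle θ j)
      _ = M ^ m * 1 := by simp
      _ ≤ _ := mul_le_mul_of_nonneg_left (by linarith) (by positivity)

/-- The quantity `2 - z / a - a / z`, which equals `‖z - a‖ ^ 2` on the unit circle. -/
noncomputable def circleDist (a z : ℂ) : ℂ := 2 - z / a - a / z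

theorem circleDist_eq {a z : ℂ} (ha : a ≠ 0) (hz : z ≠ 0) :
    circleDist a z = -(z - a) ^ 2 / (a * z) := by
  rw [circleDist]
  field_simp
  ring

theorem norm_circleDist {a z : ℂ} (ha : ‖a‖ = 1) (hz : z ≠ 0) :
    ‖circleDist a z‖ = ‖z - a‖ ^ 2 / ‖z‖ := by
  have ha0 : a ≠ 0 := norm_ne_zero_iff.1 (by rw [ha]; norm_num)
  rw [circleDist_eq ha0 hz, norm_div, norm_neg, norm_pow, norm_mul, ha, one_mul]

theorem circleDist_ne_zero {a z : ℂ} (ha : ‖a‖ = 1) (hz : z ≠ 0) (h : z ≠ a) :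
    circleDist a z ≠ 0 := by
  have h1 := norm_pos_iff.2 (sub_ne_zero.2 h)
  have h2 := norm_pos_iff.2 hz
  rw [← norm_pos_iff, norm_circleDist ha hz]
  positivity

theorem circleDist_of_norm_eq_one {a z : ℂ} (ha : ‖a‖ = 1) (hz : ‖z‖ = 1) :
    circleDist a z = ((‖z - a‖ ^ 2 : ℝ) : ℂ) := by
  have ha' : a⁻¹ = (starRingEnd ℂ) a := by rw [Complex.inv_def, Complex.normSq_eq_norm_sq, ha]; simp
  have hz' : z⁻¹ = (starRingEnd ℂ) z := by rw [Complex.inv_def, Complex.normSq_eq_norm_sq, hz]; simp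
  have ha0 : a ≠ 0 := norm_ne_zero_iff.1 (by rw [ha]; norm_num)
  have hz0 : z ≠ 0 := norm_ne_zero_iff.1 (by rw [hz]; norm_num)
  rw [Complex.ofReal_pow, ← Complex.mul_conj', map_sub, ← ha', ← hz', circleDist]
  field_simp
  ring

theorem circleDist_mem_slitPlane {a z : ℂ} (ha : a ≠ 0) (hz : z ≠ 0)
    (h : ∀ t : ℝ, 0 ≤ t → (t : ℂ) * a ≠ z) : circleDist a z ∈ Complex.slitPlane := by
  set u := z / a with hu
  have hu0 : u ≠ 0 := div_ne_zero hz ha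
  have hd : circleDist a z = 2 - u - u⁻¹ := by rw [circleDist, hu, inv_div]
  have hn : 0 < Complex.normSq u := Complex.normSq_pos.2 hu0
  rw [hd, Complex.mem_slitPlane_iff]
  by_contra! hcon
  obtain ⟨h1, h2⟩ := hcon
  simp only [Complex.sub_re, Complex.inv_re, Complex.sub_im, Complex.inv_im, Complex.re_ofNat,
    Complex.im_ofNat] at h1 h2
  have him : u.im = 0 := by
    by_contra hne
    have h3 : Complex.normSq u = 1 := by
      have : u.im * (1 / Complex.normSq u - 1) = 0 := by
        rw [mul_sub, mul_one_div]
        linarith [neg_div (Complex.normSq u) u.im]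
      rcases mul_eq_zero.1 this with h4 | h4
      · exact absurd h4 hne
      · have := sub_eq_zero.1 h4
        rwa [div_eq_one_iff_eq hn.ne', eq_comm] at this
    rw [h3, div_one] at h1
    rw [Complex.normSq_apply] at h3
    have : 0 < u.im * u.im := mul_self_pos.2 hne
    nlinarith
  have hre : 0 ≤ u.re := by
    by_contra! hneg
    have : u.re / Complex.normSq u < 0 := div_neg_of_neg_of_pos hneg hn
    linarith
  refine h u.re hre ?_
  have : ((u.re : ℝ) : ℂ) = u := Complex.ext rfl (by simp [him])
  rw [this, hu, div_mul_cancel₀ _ ha]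

/-- The set where the weight has a holomorphic continuation. -/
def slitAnnulus {m : ℕ} (ρ : ℝ) (a : Fin m → ℂ) : Set ℂ :=
  {z | ρ < ‖z‖ ∧ ‖z‖ < 1 / ρ} \ slits a (Ici 0)

/-- The holomorphic continuation of the weight. -/
noncomputable def weightExt {m : ℕ} (a : Fin m → ℂ) (β : Fin m → ℝ) (w : ℂ → ℂ) (z : ℂ) : ℂ :=
  w z * ∏ k, circleDist (a k) z ^ (β k : ℂ)

/-- The absolute value of the continuation of the weight, which is continuous across the slits. -/
noncomputable def weightAbs {m : ℕ} (a : Fin m → ℂ) (β : Fin m → ℝ) (w : ℂ → ℂ) (z : ℂ) : ℝ :=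
  ‖w z‖ * ∏ k, ‖circleDist (a k) z‖ ^ β k

theorem norm_weightExt {m : ℕ} (a : Fin m → ℂ) (β : Fin m → ℝ) (w : ℂ → ℂ) (z : ℂ) :
    ‖weightExt a β w z‖ = weightAbs a β w z := by
  rw [weightExt, weightAbs, norm_mul, norm_prod]
  congr 1
  exact Finset.prod_congr rfl fun k _ => Complex.norm_cpow_real _ _

/-- A weight on the unit circle with Fisher–Hartwig singularities of root type, and its interior and
exterior Szegő functions. -/
structure IsSzegoData {m : ℕ} (ρ : ℝ) (a : Fin m → ℂ) (β : Fin m → ℝ) (w : ℂ → ℂ) (W : ℂ → ℝ)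
    (Di De : ℂ → ℂ) : Prop where
  pos : 0 < ρ
  lt_one : ρ < 1
  norm_eq_one : ∀ k, ‖a k‖ = 1
  inj : Function.Injective a
  exponent : ∀ k, -(1 / 2) < β k
  diff_w : DifferentiableOn ℂ w {z | ρ < ‖z‖ ∧ ‖z‖ < 1 / ρ}
  w_ne : ∀ z, ρ < ‖z‖ → ‖z‖ < 1 / ρ → w z ≠ 0
  w_pos : ∀ z, ‖z‖ = 1 → 0 < (w z).re ∧ (w z).im = 0
  W_eq : ∀ z, ‖z‖ = 1 → W z = (w z).re * ∏ k, ‖z - a k‖ ^ (2 * β k)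
  Di_eq : ∀ z, ‖z‖ < 1 → Di z = Complex.exp (((4 * π : ℝ)⁻¹ : ℂ) * ∫ θ in (0 : ℝ)..(2 * π),
    (Real.log (W (circlePoint θ)) : ℂ) * ((circlePoint θ + z) / (circlePoint θ - z)))
  De_eq : ∀ z, 1 < ‖z‖ → De z = Complex.exp (((4 * π : ℝ)⁻¹ : ℂ) * ∫ θ in (0 : ℝ)..(2 * π),
    (Real.log (W (circlePoint θ)) : ℂ) * ((circlePoint θ + z) / (circlePoint θ - z)))
  diff_Di : DifferentiableOn ℂ Di ({z | ‖z‖ < 1 / ρ} \ slits a (Ici 1))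
  diff_De : DifferentiableOn ℂ De ({z | ρ < ‖z‖} \ slits a (Icc 0 1))

theorem isOpen_annulus (ρ : ℝ) : IsOpen {z : ℂ | ρ < ‖z‖ ∧ ‖z‖ < 1 / ρ} :=
  (isOpen_lt continuous_const continuous_norm).inter (isOpen_lt continuous_norm continuous_const)

namespace IsSzegoData
variable {m : ℕ} {ρ : ℝ} {a : Fin m → ℂ} {β : Fin m → ℝ} {w : ℂ → ℂ} {W : ℂ → ℝ} {Di De : ℂ → ℂ}

theorem a_ne_zero (h : IsSzegoData ρ a β w W Di De) (k : Fin m) : a k ≠ 0 :=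
  norm_ne_zero_iff.1 (by rw [h.norm_eq_one k]; norm_num)

theorem one_lt_inv (h : IsSzegoData ρ a β w W Di De) : 1 < 1 / ρ :=
  (one_lt_div h.pos).2 h.lt_one

theorem isOpen_slitAnnulus (h : IsSzegoData ρ a β w W Di De) : IsOpen (slitAnnulus ρ a) :=
  (isOpen_annulus ρ).sdiff (isClosed_slits h.norm_eq_one isClosed_Ici)

theorem ne_zero_of_lt (h : IsSzegoData ρ a β w W Di De) {z : ℂ} (hz : ρ < ‖z‖) : z ≠ 0 :=
  norm_pos_iff.1 (h.pos.trans hz)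

theorem circleDist_mem_slitPlane (h : IsSzegoData ρ a β w W Di De) (k : Fin m) {z : ℂ}
    (hz : z ∈ slitAnnulus ρ a) : circleDist (a k) z ∈ Complex.slitPlane :=
  _root_.circleDist_mem_slitPlane (h.a_ne_zero k) (h.ne_zero_of_lt hz.1.1) fun t ht e =>
    hz.2 (mem_slits.2 ⟨k, t, ht, e⟩)

theorem mem_slitAnnulus_of_norm_eq_one (h : IsSzegoData ρ a β w W Di De) {p : ℂ} (hp : ‖p‖ = 1)
    (hpa : ∀ k, p ≠ a k) : p ∈ slitAnnulus ρ a := by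
  refine ⟨⟨by rw [hp]; exact h.lt_one, by rw [hp]; exact h.one_lt_inv⟩, fun hs => ?_⟩
  obtain ⟨k, t, ht, e⟩ := mem_slits.1 hs
  have h1 : ‖p‖ = |t| := by
    rw [← e, norm_mul, h.norm_eq_one, mul_one, Complex.norm_real, Real.norm_eq_abs]
  rw [hp, abs_of_nonneg ht] at h1
  exact hpa k (by rw [← e, ← h1]; simp)

theorem differentiableAt_circleDist {a z : ℂ} (hz : z ≠ 0) :
    DifferentiableAt ℂ (circleDist a) z := by
  unfold circleDist
  fun_prop (disch := assumption)

theorem differentiableOn_weightExt (h : IsSzegoData ρ a β w W Di De) :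
    DifferentiableOn ℂ (weightExt a β w) (slitAnnulus ρ a) := by
  refine (h.diff_w.mono Set.sdiff_subset).mul ?_
  refine DifferentiableOn.fun_finsetProd fun k _ z hz => ?_
  exact ((differentiableAt_circleDist (h.ne_zero_of_lt hz.1.1)).cpow_const
    (h.circleDist_mem_slitPlane k hz)).differentiableWithinAt

theorem weightExt_ne_zero (h : IsSzegoData ρ a β w W Di De) {z : ℂ}
    (hz : z ∈ slitAnnulus ρ a) : weightExt a β w z ≠ 0 := by
  refine mul_ne_zero (h.w_ne z hz.1.1 hz.1.2) (Finset.prod_ne_zero_iff.2 fun k _ => ?_)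
  exact Complex.cpow_ne_zero_iff.2 (Or.inl (Complex.slitPlane_ne_zero (h.circleDist_mem_slitPlane k hz)))

theorem weightAbs_pos (h : IsSzegoData ρ a β w W Di De) {z : ℂ} (h1 : ρ < ‖z‖) (h2 : ‖z‖ < 1 / ρ)
    (hza : ∀ k, z ≠ a k) : 0 < weightAbs a β w z := by
  refine mul_pos (norm_pos_iff.2 (h.w_ne z h1 h2)) (Finset.prod_pos fun k _ => ?_)
  exact Real.rpow_pos_of_pos (norm_pos_iff.2
    (circleDist_ne_zero (h.norm_eq_one k) (h.ne_zero_of_lt h1) (hza k))) _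

theorem continuousAt_weightAbs (h : IsSzegoData ρ a β w W Di De) {z : ℂ} (h1 : ρ < ‖z‖)
    (h2 : ‖z‖ < 1 / ρ) (hza : ∀ k, z ≠ a k) : ContinuousAt (weightAbs a β w) z := by
  have hw : ContinuousAt w z :=
    (h.diff_w.differentiableAt ((isOpen_annulus ρ).mem_nhds ⟨h1, h2⟩)).continuousAt
  refine hw.norm.mul (tendsto_finsetProd _ fun k _ => ?_)
  exact ((differentiableAt_circleDist (h.ne_zero_of_lt h1)).continuousAt.norm).rpow_const
    (Or.inl (norm_ne_zero_iff.2
      (circleDist_ne_zero (h.norm_eq_one k) (h.ne_zero_of_lt h1) (hza k))))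

theorem W_eq_weightAbs (h : IsSzegoData ρ a β w W Di De) {z : ℂ} (hz : ‖z‖ = 1) :
    W z = weightAbs a β w z := by
  obtain ⟨h1, h2⟩ := h.w_pos z hz
  have hw : ((w z).re : ℂ) = w z := Complex.ext rfl (by simp [h2])
  rw [h.W_eq z hz, weightAbs, ← hw, Complex.norm_real, Real.norm_of_nonneg h1.le]
  congr 1
  refine Finset.prod_congr rfl fun k _ => ?_
  have hz0 : z ≠ 0 := norm_ne_zero_iff.1 (by rw [hz]; norm_num)
  rw [norm_circleDist (h.norm_eq_one k) hz0, hz, div_one, Real.rpow_mul (norm_nonneg _)]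
  norm_num

theorem W_nonneg (h : IsSzegoData ρ a β w W Di De) {z : ℂ} (hz : ‖z‖ = 1) : 0 ≤ W z := by
  rw [h.W_eq_weightAbs hz]
  exact mul_nonneg (norm_nonneg _) (Finset.prod_nonneg fun k _ => Real.rpow_nonneg (norm_nonneg _) _)

theorem weightExt_of_norm_eq_one (h : IsSzegoData ρ a β w W Di De) {z : ℂ} (hz : ‖z‖ = 1) :
    weightExt a β w z = W z := by
  obtain ⟨h1, h2⟩ := h.w_pos z hz
  have hw : ((w z).re : ℂ) = w z := Complex.ext rfl (by simp [h2])
  rw [h.W_eq z hz, weightExt, ← hw]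
  push_cast
  congr 1
  refine Finset.prod_congr rfl fun k _ => ?_
  rw [circleDist_of_norm_eq_one (h.norm_eq_one k) hz, ← Complex.ofReal_cpow (by positivity),
    Real.rpow_mul (norm_nonneg _)]
  norm_num

/-- Local logarithms of the weight. -/
theorem exists_log_weightExt (h : IsSzegoData ρ a β w W Di De) {p : ℂ} (hp : ‖p‖ = 1)
    (hpa : ∀ k, p ≠ a k) : ∃ s > 0, ∃ L : ℂ → ℂ, ball p s ⊆ slitAnnulus ρ a ∧
      DifferentiableOn ℂ L (ball p s) ∧ (∀ z ∈ ball p s, Complex.exp (L z) = weightExt a β w z) ∧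
      ∀ z ∈ ball p s, ‖z‖ = 1 → L z = Real.log (W z) := by
  have hp' := h.mem_slitAnnulus_of_norm_eq_one hp hpa
  have hwc : ContinuousAt w p :=
    (h.diff_w.differentiableAt ((isOpen_annulus ρ).mem_nhds hp'.1)).continuousAt
  have hwp : w p ∈ Complex.slitPlane := Or.inl (h.w_pos p hp).1
  obtain ⟨s, hs0, hs⟩ := Metric.eventually_nhds_iff_ball.1
    ((h.isOpen_slitAnnulus.eventually_mem hp').and
      (hwc.eventually (Complex.isOpen_slitPlane.mem_nhds hwp)))
  have hexp : ∀ z ∈ ball p s, Complex.exp (Complex.log (w z) +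
      ∑ k, Complex.log (circleDist (a k) z) * β k) = weightExt a β w z := by
    intro z hz
    obtain ⟨h1, h2⟩ := hs z hz
    rw [Complex.exp_add, Complex.exp_log (Complex.slitPlane_ne_zero h2), Complex.exp_sum, weightExt]
    congr 1
    refine Finset.prod_congr rfl fun k _ => ?_
    rw [Complex.cpow_def_of_ne_zero (Complex.slitPlane_ne_zero (h.circleDist_mem_slitPlane k h1))]
  refine ⟨s, hs0, fun z => Complex.log (w z) + ∑ k, Complex.log (circleDist (a k) z) * β k,
    fun z hz => (hs z hz).1, fun z hz => ?_, hexp, fun z hz hz1 => ?_⟩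
  · obtain ⟨h1, h2⟩ := hs z hz
    refine DifferentiableAt.differentiableWithinAt ?_
    refine ((h.diff_w.differentiableAt ((isOpen_annulus ρ).mem_nhds h1.1)).clog h2).add ?_
    refine DifferentiableAt.fun_sum fun k _ => DifferentiableAt.mul_const ?_ _
    exact (differentiableAt_circleDist (h.ne_zero_of_lt h1.1.1)).clog
      (h.circleDist_mem_slitPlane k h1)
  · obtain ⟨h1, h2⟩ := h.w_pos z hz1
    have hw : ((w z).re : ℂ) = w z := Complex.ext rfl (by simp [h2])
    have hreal : Complex.log (w z) + ∑ k, Complex.log (circleDist (a k) z) * β k =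
        ((Real.log (w z).re + ∑ k, Real.log (‖z - a k‖ ^ 2) * β k : ℝ) : ℂ) := by
      rw [← hw, ← Complex.ofReal_log h1.le]
      push_cast
      congr 1
      refine Finset.sum_congr rfl fun k _ => ?_
      rw [circleDist_of_norm_eq_one (h.norm_eq_one k) hz1, ← Complex.ofReal_log (by positivity)]
    have h3 := hexp z hz
    rw [h.weightExt_of_norm_eq_one hz1, hreal, ← Complex.ofReal_exp, Complex.ofReal_inj] at h3
    beta_reduce
    rw [hreal, ← h3, Real.log_exp]

theorem continuous_w_circlePoint (h : IsSzegoData ρ a β w W Di De) :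
    Continuous fun θ => (w (circlePoint θ)).re := by
  refine Complex.continuous_re.comp (continuous_iff_continuousAt.2 fun θ => ?_)
  have hm : circlePoint θ ∈ {z : ℂ | ρ < ‖z‖ ∧ ‖z‖ < 1 / ρ} := by
    refine ⟨?_, ?_⟩ <;> rw [norm_circlePoint]
    exacts [h.lt_one, h.one_lt_inv]
  exact ContinuousAt.comp
    (h.diff_w.differentiableAt ((isOpen_annulus ρ).mem_nhds hm)).continuousAt
    continuous_circlePoint.continuousAt

theorem ae_circlePoint_ne_a (a : Fin m → ℂ) :
    ∀ᵐ θ ∂(volume.restrict (Ioc (0 : ℝ) (2 * π))), ∀ k, circlePoint θ ≠ a k :=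
  ae_all_iff.2 fun k => ae_circlePoint_ne (a k)

theorem intervalIntegrable_W (h : IsSzegoData ρ a β w W Di De) :
    IntervalIntegrable (fun θ => W (circlePoint θ)) volume 0 (2 * π) := by
  have h1 := intervalIntegrable_prod_norm_sub_rpow h.norm_eq_one h.inj (s := fun k => 2 * β k)
    fun k => by linarith [h.exponent k]
  refine (h1.continuousOn_mul (h.continuous_w_circlePoint.continuousOn)).congr fun θ _ => ?_
  rw [h.W_eq _ (norm_circlePoint θ)]

theorem intervalIntegrable_log_W (h : IsSzegoData ρ a β w W Di De) :
    IntervalIntegrable (fun θ => Real.log (W (circlePoint θ))) volume 0 (2 * π) := by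
  have h1 : IntervalIntegrable (fun θ => Real.log (w (circlePoint θ)).re +
      ∑ k, 2 * β k * Real.log ‖circlePoint θ - a k‖) volume 0 (2 * π) := by
    refine IntervalIntegrable.add ?_ ?_
    · exact (h.continuous_w_circlePoint.log fun θ =>
        (h.w_pos _ (norm_circlePoint θ)).1.ne').intervalIntegrable _ _
    · have := IntervalIntegrable.sum Finset.univ fun k _ =>
        (intervalIntegrable_log_norm_circlePoint_sub (a k)).const_mul (2 * β k)
      refine this.congr fun θ _ => ?_
      simp
  refine h1.congr_ae ?_
  rw [uIoc_of_le Real.two_pi_pos.le]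
  filter_upwards [ae_circlePoint_ne_a a] with θ hθ
  have hpos : ∀ k, 0 < ‖circlePoint θ - a k‖ := fun k => norm_pos_iff.2 (sub_ne_zero.2 (hθ k))
  rw [h.W_eq _ (norm_circlePoint θ), Real.log_mul (h.w_pos _ (norm_circlePoint θ)).1.ne'
    (Finset.prod_ne_zero_iff.2 fun k _ => (Real.rpow_pos_of_pos (hpos k) _).ne'),
    Real.log_prod fun k _ => (Real.rpow_pos_of_pos (hpos k) _).ne']
  congr 1
  exact Finset.sum_congr rfl fun k _ => (Real.log_rpow (hpos k) _).symm

theorem intervalIntegrable_log_W_complex (h : IsSzegoData ρ a β w W Di De) :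
    IntervalIntegrable (fun θ => (Real.log (W (circlePoint θ)) : ℂ)) volume 0 (2 * π) :=
  ⟨h.intervalIntegrable_log_W.1.ofReal, h.intervalIntegrable_log_W.2.ofReal⟩

theorem szego_exponent_eq (h : IsSzegoData ρ a β w W Di De) {z : ℂ} (hz : ‖z‖ ≠ 1) :
    ((4 * π : ℝ)⁻¹ : ℂ) * ∫ θ in (0 : ℝ)..(2 * π), (Real.log (W (circlePoint θ)) : ℂ) *
        ((circlePoint θ + z) / (circlePoint θ - z)) =
      cauchyMean (fun θ => (Real.log (W (circlePoint θ)) : ℂ)) z -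
        ((4 * π : ℝ)⁻¹ : ℂ) * ∫ θ in (0 : ℝ)..(2 * π), (Real.log (W (circlePoint θ)) : ℂ) := by
  have hk := (continuous_cauchyKernel hz).continuousOn (s := uIcc 0 (2 * π))
  have e1 : (2 * π : ℂ)⁻¹ = ((4 * π : ℝ)⁻¹ : ℂ) * 2 := by
    have h1 : (π : ℂ) ≠ 0 := by exact_mod_cast Real.pi_ne_zero
    push_cast
    field_simp
    norm_num
  rw [cauchyMean, e1, mul_assoc, ← mul_sub, ← intervalIntegral.integral_const_mul (2 : ℂ),
    ← intervalIntegral.integral_sub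
      ((h.intervalIntegrable_log_W_complex.mul_continuousOn hk).const_mul _)
      h.intervalIntegrable_log_W_complex]
  congr 1
  refine intervalIntegral.integral_congr fun θ _ => ?_
  have := circlePoint_sub_ne_zero θ hz
  field_simp
  ring

/-- The two Szegő functions near a regular point of the circle. -/
theorem exists_local_factorization (h : IsSzegoData ρ a β w W Di De) {p : ℂ} (hp : ‖p‖ = 1)
    (hpa : ∀ k, p ≠ a k) : ∃ s > 0, ∀ z ∈ ball p s, z ∈ slitAnnulus ρ a ∧
      Di z = weightExt a β w z * De z ∧ De z ≠ 0 := by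
  obtain ⟨s, hs0, L, hsub, hL, hexp, hLW⟩ := h.exists_log_weightExt hp hpa
  have hs4 : ball p (s / 4) ⊆ ball p s := ball_subset_ball (by linarith)
  set F : ℝ → ℂ := fun θ => (Real.log (W (circlePoint θ)) : ℂ) with hF
  have hFi : IntervalIntegrable F volume 0 (2 * π) := h.intervalIntegrable_log_W_complex
  set G : ℂ → ℂ := fun z => cauchyMean (fun θ => F θ - L z) z -
    ((4 * π : ℝ)⁻¹ : ℂ) * ∫ θ in (0 : ℝ)..(2 * π), F θ with hG
  have hGd : DifferentiableOn ℂ G (ball p (s / 4)) :=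
    (differentiableOn_cauchyMean_sub hFi hL fun θ hθ =>
      (hLW _ hθ (norm_circlePoint θ)).symm).sub_const _
  have hp0 : p ≠ 0 := norm_ne_zero_iff.1 (by rw [hp]; norm_num)
  have hray : ∀ t : ℝ, |t - 1| < s / 4 → (t : ℂ) * p ∈ ball p (s / 4) := by
    intro t ht
    rw [mem_ball, dist_eq_norm, show (t : ℂ) * p - p = ((t - 1 : ℝ) : ℂ) * p by push_cast; ring,
      norm_mul, hp, mul_one, Complex.norm_real]
    exact ht
  have key : ∀ D E : ℂ → ℂ, DifferentiableOn ℂ D (ball p (s / 4)) →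
      DifferentiableOn ℂ E (ball p (s / 4)) → ∀ t : ℝ, |t - 1| < s / 4 → ∀ O : Set ℂ, IsOpen O →
      (t : ℂ) * p ∈ O → (∀ z ∈ O, z ∈ ball p (s / 4) → D z = E z) → EqOn D E (ball p (s / 4)) := by
    intro D E hD hE t ht O hO htO heq
    refine (hD.analyticOnNhd isOpen_ball).eqOn_of_preconnected_of_eventuallyEq
      (hE.analyticOnNhd isOpen_ball) (convex_ball _ _).isPreconnected (hray t ht) ?_
    filter_upwards [hO.mem_nhds htO, isOpen_ball.mem_nhds (hray t ht)] with z h1 h2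
    exact heq z h1 h2
  have hslit : ∀ z ∈ ball p (s / 4), z ∈ slitAnnulus ρ a := fun z hz => hsub (hs4 hz)
  obtain ⟨u, hu0, hu⟩ : ∃ u, 0 < u ∧ u < s / 4 ∧ u < 1 :=
    ⟨min (s / 4) 1 / 2, by positivity, by
      constructor
      · linarith [min_le_left (s / 4) 1, (by positivity : 0 < min (s / 4) 1)]
      · linarith [min_le_right (s / 4) 1]⟩
  have hnorm : ∀ t : ℝ, 0 ≤ t → ‖(t : ℂ) * p‖ = t := fun t ht => by
    rw [norm_mul, hp, mul_one, Complex.norm_real, Real.norm_of_nonneg ht]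
  have hDi : EqOn Di (fun z => Complex.exp (G z + L z)) (ball p (s / 4)) := by
    refine key _ _ (h.diff_Di.mono fun z hz => ⟨(hslit z hz).1.2, fun h' =>
      (hslit z hz).2 (slits_mono (Ici_subset_Ici.2 zero_le_one) h')⟩)
      (hGd.add (hL.mono hs4)).cexp (1 - u) (by rw [abs_sub_comm, abs_of_pos] <;> linarith)
      {z | ‖z‖ < 1} (isOpen_lt continuous_norm continuous_const) ?_ fun z hz1 hz => ?_
    · have := hnorm (1 - u) (by linarith)
      rw [mem_ofPred_eq, this]
      linarith
    · have hz1' : ‖z‖ < 1 := hz1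
      rw [h.Di_eq z hz1, h.szego_exponent_eq hz1'.ne]
      simp only [hG]
      rw [cauchyMean_sub_of_norm_lt_one hFi _ hz1]
      congr 1
      ring
  have hDe : EqOn De (fun z => Complex.exp (G z)) (ball p (s / 4)) := by
    refine key _ _ (h.diff_De.mono fun z hz => ⟨(hslit z hz).1.1, fun h' =>
      (hslit z hz).2 (slits_mono Icc_subset_Ici_self h')⟩)
      hGd.cexp (1 + u) (by rw [abs_of_pos] <;> linarith)
      {z | 1 < ‖z‖} (isOpen_lt continuous_const continuous_norm) ?_ fun z hz1 hz => ?_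
    · have := hnorm (1 + u) (by linarith)
      rw [mem_ofPred_eq, this]
      linarith
    · have hz1' : 1 < ‖z‖ := hz1
      rw [h.De_eq z hz1, h.szego_exponent_eq hz1'.ne']
      simp only [hG]
      rw [cauchyMean_sub_of_one_lt_norm hFi _ hz1]
  refine ⟨s / 4, by linarith, fun z hz => ⟨hslit z hz, ?_, ?_⟩⟩
  · rw [hDi hz, hDe hz, ← hexp z (hs4 hz), ← Complex.exp_add, add_comm]
  · rw [hDe hz]
    exact Complex.exp_ne_zero _

theorem differentiableOn_Di (h : IsSzegoData ρ a β w W Di De) :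
    DifferentiableOn ℂ Di (slitAnnulus ρ a) :=
  h.diff_Di.mono fun _ hz => ⟨hz.1.2, fun h' =>
    hz.2 (slits_mono (Ici_subset_Ici.2 zero_le_one) h')⟩

theorem differentiableOn_De (h : IsSzegoData ρ a β w W Di De) :
    DifferentiableOn ℂ De (slitAnnulus ρ a) :=
  h.diff_De.mono fun _ hz => ⟨hz.1.1, fun h' => hz.2 (slits_mono Icc_subset_Ici_self h')⟩

theorem Di_eq_weightExt_mul (h : IsSzegoData ρ a β w W Di De) {z : ℂ}
    (hz : z ∈ slitAnnulus ρ a) : Di z = weightExt a β w z * De z := by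
  have hz0 := h.ne_zero_of_lt hz.1.1
  have hzn : 0 < ‖z‖ := norm_pos_iff.2 hz0
  set p := z / ‖z‖ with hp
  have hzp : (‖z‖ : ℂ) * p = z := by
    rw [hp, mul_div_cancel₀]
    exact_mod_cast hzn.ne'
  have hp1 : ‖p‖ = 1 := by rw [hp, norm_div, Complex.norm_real, norm_norm, div_self hzn.ne']
  have hpa : ∀ k, p ≠ a k := fun k hk => hz.2 (mem_slits.2 ⟨k, ‖z‖, norm_nonneg z, by rw [← hk, hzp]⟩)
  set U : Set ℂ := (fun t : ℝ => (t : ℂ) * p) '' Ioo ρ (1 / ρ)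
  have hU : U ⊆ slitAnnulus ρ a := by
    rintro _ ⟨t, ht, rfl⟩
    have ht0 : 0 < t := h.pos.trans ht.1
    have hn : ‖(t : ℂ) * p‖ = t := by
      rw [norm_mul, hp1, mul_one, Complex.norm_real, Real.norm_of_nonneg ht0.le]
    refine ⟨by rw [mem_ofPred_eq, hn]; exact ht, fun hs => ?_⟩
    obtain ⟨k, t', ht', e⟩ := mem_slits.1 hs
    refine hz.2 (mem_slits.2 ⟨k, ‖z‖ / t * t', by
      have : (0 : ℝ) ≤ t' := ht'
      exact mem_Ici.2 (by positivity), ?_⟩)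
    push_cast
    rw [mul_assoc, e, ← mul_assoc, div_mul_cancel₀ _ (by exact_mod_cast ht0.ne'), hzp]
  have hUc : IsPreconnected U := isPreconnected_Ioo.image _ (by fun_prop)
  have hO := h.isOpen_slitAnnulus
  obtain ⟨s, hs0, hs⟩ := h.exists_local_factorization hp1 hpa
  refine AnalyticOnNhd.eqOn_of_preconnected_of_eventuallyEq (U := U) (z₀ := p)
    (f := Di) (g := fun z => weightExt a β w z * De z)
    ((h.differentiableOn_Di.analyticOnNhd hO).mono hU)
    (((h.differentiableOn_weightExt.mul h.differentiableOn_De).analyticOnNhd hO).mono hU) hUc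
    ⟨1, ⟨h.lt_one, h.one_lt_inv⟩, by simp⟩ ?_ ⟨‖z‖, hz.1, hzp⟩
  filter_upwards [ball_mem_nhds p hs0] with x hx
  exact (hs x hx).2.1

theorem De_ne_zero (h : IsSzegoData ρ a β w W Di De) {z : ℂ} (hz : z ∈ slitAnnulus ρ a) :
    De z ≠ 0 := by
  rcases lt_trichotomy ‖z‖ 1 with h1 | h1 | h1
  · intro h0
    have := h.Di_eq_weightExt_mul hz
    rw [h0, mul_zero, h.Di_eq z h1] at this
    exact Complex.exp_ne_zero _ this
  · have hza : ∀ k, z ≠ a k := fun k hk => hz.2 (mem_slits.2 ⟨k, 1, mem_Ici.2 zero_le_one, by simp [hk]⟩)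
    obtain ⟨s, hs0, hs⟩ := h.exists_local_factorization h1 hza
    exact (hs z (mem_ball_self hs0)).2.2
  · rw [h.De_eq z h1]
    exact Complex.exp_ne_zero _

theorem Di_ne_zero (h : IsSzegoData ρ a β w W Di De) {z : ℂ} (hz : z ∈ slitAnnulus ρ a) :
    Di z ≠ 0 := by
  rw [h.Di_eq_weightExt_mul hz]
  exact mul_ne_zero (h.weightExt_ne_zero hz) (h.De_ne_zero hz)

theorem Di_ne_zero_of_norm_lt_one (h : IsSzegoData ρ a β w W Di De) {z : ℂ} (hz : ‖z‖ < 1) :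
    Di z ≠ 0 := by
  rw [h.Di_eq z hz]
  exact Complex.exp_ne_zero _

theorem De_ne_zero_of_one_lt_norm (h : IsSzegoData ρ a β w W Di De) {z : ℂ} (hz : 1 < ‖z‖) :
    De z ≠ 0 := by
  rw [h.De_eq z hz]
  exact Complex.exp_ne_zero _

/-- The Szegő functions are related by reflection in the circle. -/
theorem Di_mul_conj_De (h : IsSzegoData ρ a β w W Di De) {z : ℂ} (hz0 : z ≠ 0) (hz : ‖z‖ < 1) :
    Di z * (starRingEnd ℂ) (De ((starRingEnd ℂ) z)⁻¹) = 1 := by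
  have h1 : 1 < ‖((starRingEnd ℂ) z)⁻¹‖ := by
    rw [norm_inv, Complex.norm_conj]
    exact (one_lt_inv₀ (norm_pos_iff.2 hz0)).2 hz
  rw [h.Di_eq z hz, h.De_eq _ h1, ← Complex.exp_conj, ← Complex.exp_add, map_mul,
    intervalIntegral.integral_of_le Real.two_pi_pos.le,
    intervalIntegral.integral_of_le Real.two_pi_pos.le, ← integral_conj]
  have e1 : (starRingEnd ℂ) ((4 * π : ℝ)⁻¹ : ℂ) = ((4 * π : ℝ)⁻¹ : ℂ) := by
    rw [map_inv₀, Complex.conj_ofReal]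
  rw [e1, ← mul_add, ← Complex.exp_zero]
  congr 1
  rw [mul_eq_zero]
  right
  rw [add_eq_zero_iff_eq_neg, ← integral_neg]
  refine integral_congr_ae (ae_of_all _ fun θ => ?_)
  have he0 := circlePoint_ne_zero θ
  have hc : (starRingEnd ℂ) (circlePoint θ) = (circlePoint θ)⁻¹ := by
    rw [Complex.inv_def, Complex.normSq_eq_norm_sq, norm_circlePoint]
    simp
  have h2 := circlePoint_sub_ne_zero θ hz.ne
  have h3 : z - circlePoint θ ≠ 0 := fun h' => h2 (by rw [← neg_sub, h', neg_zero])
  beta_reduce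
  rw [map_mul, Complex.conj_ofReal, map_div₀, map_add, map_sub, hc, map_inv₀, Complex.conj_conj,
    ← mul_neg]
  congr 1
  have h4 : (circlePoint θ)⁻¹ - z⁻¹ ≠ 0 := by
    rw [inv_sub_inv he0 hz0]
    exact div_ne_zero h3 (mul_ne_zero he0 hz0)
  rw [div_eq_iff h2, ← neg_div, div_mul_eq_mul_div, eq_div_iff h4]
  field_simp
  ring

end IsSzegoData

/-- The scattering function of a pair of Szegő functions, with its local continuations. -/
structure HasScatteringContinuation {m : ℕ} (δ : ℝ) (a : Fin m → ℂ) (β : Fin m → ℝ)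
    (Di De : ℂ → ℂ) (Sk : Fin m → ℂ → ℂ) : Prop where
  pos : 0 < δ
  sep : ∀ i j, i ≠ j → 3 * δ < ‖a i - a j‖
  diff : ∀ k, DifferentiableOn ℂ (Sk k) (ball (a k) δ)
  plus : ∀ k, ∀ z ∈ ball (a k) δ, 0 < Complex.arg (z / a k) →
    Sk k z = Complex.exp (((π * β k : ℝ) : ℂ) * Complex.I) * (Di z * De z)
  minus : ∀ k, ∀ z ∈ ball (a k) δ, Complex.arg (z / a k) < 0 →
    Sk k z = Complex.exp (-((π * β k : ℝ) : ℂ) * Complex.I) * (Di z * De z)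

theorem HasScatteringContinuation.eq_jumpPhase_mul {m : ℕ} {δ : ℝ} {a : Fin m → ℂ} {β : Fin m → ℝ}
    {Di De : ℂ → ℂ} {Sk : Fin m → ℂ → ℂ} (hS : HasScatteringContinuation δ a β Di De Sk)
    {k : Fin m} (hk : a k ≠ 0) {l : ℂ} (hl : a k * Complex.exp l ∈ ball (a k) δ)
    (h0 : l.im ≠ 0) (hπ : |l.im| < π) :
    Di (a k * Complex.exp l) * De (a k * Complex.exp l) =
      jumpPhase (β k) l * Sk k (a k * Complex.exp l) := by
  have hq : a k * Complex.exp l / a k = Complex.exp l := mul_div_cancel_left₀ _ hk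
  have harg : Complex.arg (a k * Complex.exp l / a k) = l.im := by
    rw [hq, Complex.arg_exp, toIocMod_eq_self]
    constructor
    · linarith [(abs_lt.1 hπ).1]
    · linarith [(abs_lt.1 hπ).2]
  rcases h0.lt_or_gt with h | h
  · rw [hS.minus k _ hl (by rw [harg]; exact h), jumpPhase, Real.sign_of_neg h, ← mul_assoc,
      ← Complex.exp_add]
    push_cast
    ring_nf
    simp
  · rw [hS.plus k _ hl (by rw [harg]; exact h), jumpPhase, Real.sign_of_pos h, ← mul_assoc,
      ← Complex.exp_add]
    push_cast
    ring_nf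
    simp

theorem tendsto_mul_exp (a : ℂ) : Tendsto (fun l => a * Complex.exp l) (nhds 0) (nhds a) := by
  have : Continuous fun l => a * Complex.exp l := by fun_prop
  simpa using this.tendsto 0

theorem tendsto_norm_exp_sub_one_div :
    Tendsto (fun l : ℂ => ‖Complex.exp l - 1‖ / ‖l‖) (nhdsWithin 0 {0}ᶜ) (nhds 1) := by
  have h := (hasDerivAt_iff_tendsto_slope.1 (Complex.hasDerivAt_exp 0)).norm
  rw [Complex.exp_zero, norm_one] at h
  refine h.congr fun l => ?_
  rw [slope_def_field, Complex.exp_zero, sub_zero, norm_div]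

theorem norm_le_mul_rpow_of_im_ne_zero {f : ℂ → ℂ} {U : Set ℂ} {C b : ℝ} (hU : IsOpen U)
    (hU0 : (0 : ℂ) ∉ U) (hf : ContinuousOn f U)
    (h : ∀ l ∈ U, l.im ≠ 0 → ‖f l‖ ≤ C * ‖l‖ ^ b) : ∀ l ∈ U, ‖f l‖ ≤ C * ‖l‖ ^ b := by
  have hpos : ∀ l ∈ U, 0 < ‖l‖ := fun l hl => norm_pos_iff.2 fun e => hU0 (e ▸ hl)
  have hn : ∀ l ∈ U, ‖f l * ((‖l‖ ^ (-b) : ℝ) : ℂ)‖ = ‖f l‖ * (‖l‖ ^ b)⁻¹ := fun l hl => by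
    rw [norm_mul, Complex.norm_real, Real.norm_of_nonneg (by have := hpos l hl; positivity),
      Real.rpow_neg (hpos l hl).le]
  have hc : ContinuousOn (fun l => f l * ((‖l‖ ^ (-b) : ℝ) : ℂ)) U :=
    hf.mul (Complex.continuous_ofReal.comp_continuousOn
      (continuous_norm.continuousOn.rpow_const fun l hl => Or.inl (hpos l hl).ne'))
  intro l hl
  have := norm_le_of_dense hU hc dense_setOf_im_ne_zero (M := C) (fun y hy => by
    rw [hn y hy.1, ← div_eq_mul_inv, div_le_iff₀ (Real.rpow_pos_of_pos (hpos y hy.1) _)]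
    exact h y hy.1 hy.2) l hl
  rwa [hn l hl, ← div_eq_mul_inv, div_le_iff₀ (Real.rpow_pos_of_pos (hpos l hl) _)] at this

theorem exists_forall_norm_mem_Icc {S : ℂ → ℂ} {g : ℂ → ℝ} {K A : Set ℂ} (hK : IsCompact K)
    (hg : ContinuousOn g K) (hg0 : ∀ z ∈ K, 0 < g z) (hS : ∀ z ∈ K ∩ A, ‖S z‖ = g z) :
    ∃ c₀ > 0, ∃ C₀, ∀ z ∈ K ∩ A, c₀ ≤ ‖S z‖ ∧ ‖S z‖ ≤ C₀ := by
  obtain ⟨C, hC⟩ := hK.exists_bound_of_continuousOn hg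
  obtain ⟨D, hD⟩ := hK.exists_bound_of_continuousOn (hg.inv₀ fun z hz => (hg0 z hz).ne')
  refine ⟨(max D 1)⁻¹, by positivity, C, fun z hz => ?_⟩
  have h1 := hC z hz.1
  have h2 := hD z hz.1
  rw [Pi.inv_apply, norm_inv] at h2
  have h0 := hg0 z hz.1
  rw [Real.norm_of_nonneg h0.le] at h1 h2
  rw [hS z hz]
  refine ⟨?_, h1⟩
  rw [inv_le_comm₀ (by positivity) h0]
  exact h2.trans (le_max_left _ _)

namespace IsSzegoData
variable {m : ℕ} {ρ δ : ℝ} {a : Fin m → ℂ} {β : Fin m → ℝ} {w : ℂ → ℂ} {W : ℂ → ℝ}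
  {Di De : ℂ → ℂ} {Sk : Fin m → ℂ → ℂ}

/-- The scattering function is unimodular on the circle. -/
theorem norm_Di_mul_De (h : IsSzegoData ρ a β w W Di De) {p : ℂ} (hp : ‖p‖ = 1)
    (hpa : ∀ k, p ≠ a k) : ‖Di p * De p‖ = 1 := by
  have hpA := h.mem_slitAnnulus_of_norm_eq_one hp hpa
  have hnh := h.isOpen_slitAnnulus.mem_nhds hpA
  have hDi := (h.differentiableOn_Di.differentiableAt hnh).continuousAt
  have hDe := (h.differentiableOn_De.differentiableAt hnh).continuousAt
  have hc : Continuous fun t : ℝ => (t : ℂ) * p := by fun_prop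
  have h1 : Tendsto (fun t : ℝ => (t : ℂ) * p) (nhdsWithin 1 (Iio 1)) (nhds p) := by
    have := (hc.tendsto 1).mono_left (nhdsWithin_le_nhds (s := Iio 1))
    simpa using this
  have h2 : Tendsto (fun t : ℝ => ((t⁻¹ : ℝ) : ℂ) * p) (nhdsWithin 1 (Iio 1)) (nhds p) := by
    have h3 : Tendsto (fun t : ℝ => t⁻¹) (nhds 1) (nhds 1) := by
      simpa using (continuousAt_inv₀ (one_ne_zero (α := ℝ))).tendsto
    have := ((hc.tendsto 1).comp h3).mono_left (nhdsWithin_le_nhds (s := Iio 1))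
    rwa [Complex.ofReal_one, one_mul] at this
  have h4 : Tendsto (fun t : ℝ => ‖Di ((t : ℂ) * p)‖ * ‖De (((t⁻¹ : ℝ) : ℂ) * p)‖)
      (nhdsWithin 1 (Iio 1)) (nhds (‖Di p‖ * ‖De p‖)) :=
    (hDi.tendsto.comp h1).norm.mul (hDe.tendsto.comp h2).norm
  have h5 : ∀ᶠ t : ℝ in nhdsWithin 1 (Iio 1),
      ‖Di ((t : ℂ) * p)‖ * ‖De (((t⁻¹ : ℝ) : ℂ) * p)‖ = 1 := by
    have h6 : ∀ᶠ t : ℝ in nhdsWithin 1 (Iio 1), 0 < t :=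
      nhdsWithin_le_nhds (lt_mem_nhds one_pos)
    filter_upwards [h6, self_mem_nhdsWithin] with t ht0 ht1
    have hn : ‖(t : ℂ) * p‖ = t := by
      rw [norm_mul, hp, mul_one, Complex.norm_real, Real.norm_of_nonneg ht0.le]
    have h7 := h.Di_mul_conj_De (z := (t : ℂ) * p) (norm_pos_iff.1 (by rw [hn]; exact ht0))
      (by rw [hn]; exact ht1)
    have h8 : ((starRingEnd ℂ) ((t : ℂ) * p))⁻¹ = ((t⁻¹ : ℝ) : ℂ) * p := by
      rw [map_mul, Complex.conj_ofReal, mul_inv]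
      congr 1
      · push_cast; rfl
      · rw [← map_inv₀, Complex.inv_def, Complex.normSq_eq_norm_sq, hp]
        simp
    rw [h8] at h7
    rw [← Complex.norm_conj (De _), ← norm_mul, h7, norm_one]
  rw [norm_mul]
  exact tendsto_nhds_unique (h4.congr' h5) tendsto_const_nhds |>.symm ▸ rfl

theorem Di_zero_mul (h : IsSzegoData ρ a β w W Di De) {τ : ℂ}
    (hτ : Tendsto De (Bornology.cobounded ℂ) (nhds τ)) : Di 0 * (starRingEnd ℂ) τ = 1 := by
  have hDi : ContinuousAt Di 0 := by
    refine (h.diff_Di.differentiableAt (IsOpen.mem_nhds ((isOpen_lt continuous_norm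
      continuous_const).sdiff (isClosed_slits h.norm_eq_one isClosed_Ici)) ⟨?_, ?_⟩)).continuousAt
    · rw [mem_ofPred_eq, norm_zero]
      linarith [h.one_lt_inv]
    · intro hs
      obtain ⟨t, ht, e⟩ := norm_of_mem_slits h.norm_eq_one hs
      rw [norm_zero, eq_comm, abs_eq_zero] at e
      have : (1 : ℝ) ≤ t := ht
      linarith
  have h1 : Tendsto (fun z : ℂ => ((starRingEnd ℂ) z)⁻¹) (nhdsWithin 0 {0}ᶜ)
      (Bornology.cobounded ℂ) := by
    have h2 : Tendsto (fun z : ℂ => (starRingEnd ℂ) z) (nhdsWithin 0 {0}ᶜ) (nhdsWithin 0 {0}ᶜ) := by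
      refine tendsto_nhdsWithin_of_tendsto_nhds_of_eventually_within _ ?_ ?_
      · have := (Complex.continuous_conj.tendsto (0 : ℂ)).mono_left
          (nhdsWithin_le_nhds (s := {0}ᶜ))
        rwa [map_zero] at this
      · filter_upwards [self_mem_nhdsWithin] with z hz
        simpa using hz
    exact tendsto_inv₀_nhdsNE_zero.comp h2
  have h3 : Tendsto (fun z => Di z * (starRingEnd ℂ) (De ((starRingEnd ℂ) z)⁻¹))
      (nhdsWithin 0 {0}ᶜ) (nhds (Di 0 * (starRingEnd ℂ) τ)) :=
    (hDi.tendsto.mono_left nhdsWithin_le_nhds).mul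
      ((Complex.continuous_conj.tendsto τ).comp (hτ.comp h1))
  refine tendsto_nhds_unique (h3.congr' ?_) tendsto_const_nhds |>.symm ▸ rfl
  filter_upwards [self_mem_nhdsWithin, nhdsWithin_le_nhds (ball_mem_nhds (0 : ℂ) one_pos)]
    with z hz hz1
  exact h.Di_mul_conj_De hz (by simpa using hz1)

theorem tendsto_weightAbs_mul_rpow (h : IsSzegoData ρ a β w W Di De) (k : Fin m) :
    ∃ κ > 0, Tendsto (fun l => weightAbs a β w (a k * Complex.exp l) * (‖l‖ ^ (-β k)) ^ 2)
      (nhdsWithin 0 {0}ᶜ) (nhds κ) := by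
  have hak : a k ∈ {z : ℂ | ρ < ‖z‖ ∧ ‖z‖ < 1 / ρ} :=
    ⟨by rw [h.norm_eq_one]; exact h.lt_one, by rw [h.norm_eq_one]; exact h.one_lt_inv⟩
  have hw : ContinuousAt w (a k) :=
    (h.diff_w.differentiableAt ((isOpen_annulus ρ).mem_nhds hak)).continuousAt
  set g : ℂ → ℝ := fun z => ‖w z‖ * ∏ j ∈ Finset.univ.erase k, ‖circleDist (a j) z‖ ^ β j with hg
  have hd0 : ∀ j ∈ Finset.univ.erase k, circleDist (a j) (a k) ≠ 0 := fun j hj =>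
    circleDist_ne_zero (h.norm_eq_one j) (h.a_ne_zero k) fun e =>
      (Finset.ne_of_mem_erase hj) (h.inj e).symm
  have hgc : ContinuousAt g (a k) := by
    refine hw.norm.mul (tendsto_finsetProd _ fun j hj => ?_)
    exact ((differentiableAt_circleDist (h.a_ne_zero k)).continuousAt.norm).rpow_const
      (Or.inl (norm_ne_zero_iff.2 (hd0 j hj)))
  have hg0 : 0 < g (a k) := mul_pos (norm_pos_iff.2 (h.w_ne _ hak.1 hak.2))
    (Finset.prod_pos fun j hj => Real.rpow_pos_of_pos (norm_pos_iff.2 (hd0 j hj)) _)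
  refine ⟨g (a k), hg0, ?_⟩
  have h1 : Tendsto (fun l : ℂ => ((‖Complex.exp l - 1‖ / ‖l‖) ^ 2 / ‖Complex.exp l‖) ^ β k)
      (nhdsWithin 0 {0}ᶜ) (nhds 1) := by
    have h2 : Tendsto (fun l : ℂ => ‖Complex.exp l‖) (nhdsWithin 0 {0}ᶜ) (nhds 1) := by
      have := (Complex.continuous_exp.tendsto 0).norm.mono_left (nhdsWithin_le_nhds (s := {0}ᶜ))
      simpa using this
    have h3 := (((tendsto_norm_exp_sub_one_div.pow 2).div h2 one_ne_zero).rpow_const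
      (p := β k) (Or.inl (by norm_num)))
    simpa using h3
  have h4 := ((hgc.tendsto.comp (tendsto_mul_exp (a k))).mono_left
    (nhdsWithin_le_nhds (s := {0}ᶜ))).mul h1
  rw [mul_one] at h4
  refine h4.congr' ?_
  filter_upwards [self_mem_nhdsWithin] with l hl
  have hl0 : 0 < ‖l‖ := norm_pos_iff.2 hl
  have hz0 : a k * Complex.exp l ≠ 0 := mul_ne_zero (h.a_ne_zero k) (Complex.exp_ne_zero l)
  have e1 : ‖circleDist (a k) (a k * Complex.exp l)‖ ^ β k * (‖l‖ ^ (-β k)) ^ 2 =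
      ((‖Complex.exp l - 1‖ / ‖l‖) ^ 2 / ‖Complex.exp l‖) ^ β k := by
    rw [norm_circleDist (h.norm_eq_one k) hz0, ← mul_sub_one, norm_mul, norm_mul, h.norm_eq_one k,
      one_mul, one_mul, ← Real.rpow_natCast (‖l‖ ^ _), ← Real.rpow_mul hl0.le, div_pow,
      div_right_comm, Real.div_rpow (by positivity) (by positivity) (z := β k) (y := ‖l‖ ^ 2),
      ← Real.rpow_natCast ‖l‖, ← Real.rpow_mul hl0.le, div_eq_mul_inv _ (‖l‖ ^ _),
      ← Real.rpow_neg hl0.le]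
    congr 2
    push_cast
    ring
  simp only [Function.comp_apply, hg]
  rw [← e1, weightAbs, ← Finset.mul_prod_erase _ _ (Finset.mem_univ k)]
  ring

theorem eventually_arg_data (hS : HasScatteringContinuation δ a β Di De Sk) (k : Fin m) :
    ∀ᶠ l : ℂ in nhds 0, a k * Complex.exp l ∈ ball (a k) δ ∧ |l.im| < π := by
  refine ((tendsto_mul_exp (a k)).eventually (ball_mem_nhds _ hS.pos)).and ?_
  have : Continuous fun l : ℂ => |l.im| := by fun_prop
  exact (this.tendsto 0).eventually_lt_const (by simpa using Real.pi_pos)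

theorem norm_Sk_eq_one (h : IsSzegoData ρ a β w W Di De)
    (hS : HasScatteringContinuation δ a β Di De Sk) (k : Fin m) : ‖Sk k (a k)‖ = 1 := by
  have hc : ContinuousAt (Sk k) (a k) :=
    ((hS.diff k).differentiableAt (ball_mem_nhds _ hS.pos)).continuousAt
  have h1 : Tendsto (fun t : ℝ => (t : ℂ) * Complex.I) (nhdsWithin 0 (Ioi 0)) (nhds 0) := by
    have : Continuous fun t : ℝ => (t : ℂ) * Complex.I := by fun_prop
    have := (this.tendsto 0).mono_left (nhdsWithin_le_nhds (s := Ioi 0))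
    simpa using this
  have h2 := ((hc.tendsto.comp (tendsto_mul_exp (a k))).comp h1).norm
  refine (tendsto_nhds_unique (h2.congr' ?_) tendsto_const_nhds).symm ▸ rfl
  have hne : ∀ᶠ l : ℂ in nhds 0, ∀ j, j ≠ k → a k * Complex.exp l ≠ a j := by
    refine eventually_all.2 fun j => ?_
    by_cases hj : j = k
    · exact Eventually.of_forall fun _ h' => absurd hj h'
    · exact ((tendsto_mul_exp (a k)).eventually_ne (h.inj.ne (Ne.symm hj))).mono fun _ h' _ => h'
  filter_upwards [h1.eventually (eventually_arg_data hS k), h1.eventually hne, self_mem_nhdsWithin]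
    with t ⟨ht1, ht2⟩ ht3 ht0
  have him : ((t : ℂ) * Complex.I).im = t := by simp
  have ht0' : (0 : ℝ) < t := ht0
  have h3 := hS.eq_jumpPhase_mul (h.a_ne_zero k) ht1 (by rw [him]; exact ht0'.ne') ht2
  have hn : ‖a k * Complex.exp ((t : ℂ) * Complex.I)‖ = 1 := by
    rw [norm_mul, h.norm_eq_one, Complex.norm_exp_ofReal_mul_I, one_mul]
  have h4 := h.norm_Di_mul_De hn fun j hj => by
    by_cases hjk : j = k
    · subst hjk
      have h5 : Complex.exp ((t : ℂ) * Complex.I) = 1 := by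
        have := h.a_ne_zero j
        exact mul_left_cancel₀ this (by rw [hj, mul_one])
      have h6 := congrArg Complex.arg h5
      rw [Complex.arg_exp_mul_I, Complex.arg_one, (toIocMod_eq_self _).2 ⟨by linarith [Real.pi_pos], by
        rw [him, abs_of_pos ht0'] at ht2
        linarith⟩] at h6
      exact ht0'.ne' h6
    · exact ht3 j hjk hj
  rw [h3, norm_mul, norm_jumpPhase, one_mul] at h4
  simpa using h4

/-- Size of the Szegő functions near a singular point. -/
theorem exists_norm_Di_De_bound (h : IsSzegoData ρ a β w W Di De)
    (hS : HasScatteringContinuation δ a β Di De Sk) (k : Fin m) : ∃ C > 0, ∃ s > 0, ∀ l : ℂ,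
      l.im ≠ 0 → ‖l‖ < s → ‖Di (a k * Complex.exp l)‖ ≤ C * ‖l‖ ^ β k ∧
        ‖Di (a k * Complex.exp l)‖⁻¹ ≤ C * ‖l‖ ^ (-β k) ∧
        ‖De (a k * Complex.exp l)‖ ≤ C * ‖l‖ ^ (-β k) ∧
        ‖De (a k * Complex.exp l)‖⁻¹ ≤ C * ‖l‖ ^ β k := by
  obtain ⟨κ, hκ, hlim⟩ := h.tendsto_weightAbs_mul_rpow k
  have hSk : Tendsto (fun l => ‖Sk k (a k * Complex.exp l)‖) (nhdsWithin 0 {0}ᶜ) (nhds 1) := by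
    have hc : ContinuousAt (Sk k) (a k) :=
      ((hS.diff k).differentiableAt (ball_mem_nhds _ hS.pos)).continuousAt
    have := (hc.tendsto.comp (tendsto_mul_exp (a k))).norm.mono_left
      (nhdsWithin_le_nhds (s := {0}ᶜ))
    rwa [h.norm_Sk_eq_one hS k] at this
  have hak : ∀ᶠ l : ℂ in nhds 0, a k * Complex.exp l ∈ {z : ℂ | ρ < ‖z‖ ∧ ‖z‖ < 1 / ρ} :=
    (tendsto_mul_exp (a k)).eventually ((isOpen_annulus ρ).mem_nhds
      ⟨by rw [h.norm_eq_one]; exact h.lt_one, by rw [h.norm_eq_one]; exact h.one_lt_inv⟩)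
  have hsep : ∀ᶠ l : ℂ in nhds 0, l.im ≠ 0 → a k * Complex.exp l ∉ slits a (Ici 0) := by
    have h1 : ∀ᶠ l : ℂ in nhds 0, ∀ j, j ≠ k →
        a k * Complex.exp l ∉ (fun t : ℝ => (t : ℂ) * a j) '' Ici 0 := by
      refine eventually_all.2 fun j => ?_
      by_cases hj : j = k
      · exact Eventually.of_forall fun _ h' => absurd hj h'
      have hcl : IsClosed ((fun t : ℝ => (t : ℂ) * a j) '' Ici 0) := by
        have := isClosed_slits (a := fun _ : Fin 1 => a j) (fun _ => h.norm_eq_one j)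
          (s := Ici 0) isClosed_Ici
        rwa [slits, iUnion_const] at this
      have hmem : a k ∉ (fun t : ℝ => (t : ℂ) * a j) '' Ici 0 := by
        rintro ⟨t, ht, e⟩
        have e' := congrArg norm e
        have ht' : (0 : ℝ) ≤ t := ht
        simp only [norm_mul, h.norm_eq_one, mul_one, Complex.norm_real,
          Real.norm_of_nonneg ht'] at e'
        simp only [e', Complex.ofReal_one, one_mul] at e
        exact hj (h.inj e)
      exact ((tendsto_mul_exp (a k)).eventually (hcl.isOpen_compl.mem_nhds hmem)).mono
        fun _ h' _ => h'
    have hπ : ∀ᶠ l : ℂ in nhds 0, |l.im| < π := (eventually_arg_data hS k).mono fun _ h' => h'.2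
    filter_upwards [h1, hπ] with l h1 hπ him hs
    obtain ⟨j, t, ht, e⟩ := mem_slits.1 hs
    by_cases hj : j = k
    · subst hj
      have h2 : Complex.exp l = t := by
        refine mul_left_cancel₀ (h.a_ne_zero j) ?_
        rw [← e, mul_comm]
      have h3 := congrArg Complex.arg h2
      rw [Complex.arg_exp, Complex.arg_ofReal_of_nonneg ht, (toIocMod_eq_self _).2 ⟨by
        linarith [(abs_lt.1 hπ).1], by linarith [(abs_lt.1 hπ).2]⟩] at h3
      exact him h3
    · exact h1 j hj ⟨t, ht, e⟩
  have hP1 := (hSk.mul hlim)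
  have hP2 := (hSk.div hlim hκ.ne')
  rw [one_mul] at hP1
  obtain ⟨C, hC0, hC1, hC2⟩ : ∃ C > 0, κ < C ^ 2 ∧ κ⁻¹ < C ^ 2 := by
    refine ⟨1 + κ + κ⁻¹, by positivity, ?_, ?_⟩ <;> nlinarith [inv_pos.2 hκ]
  have hC1' : (C ^ 2)⁻¹ < κ := by
    rw [inv_lt_comm₀ (by positivity) hκ]
    exact hC2
  have hC2' : (C ^ 2)⁻¹ < 1 / κ := by
    rw [one_div]
    exact inv_strictAnti₀ hκ hC1
  have hev := (((hP1.eventually_lt_const hC1).and (hP1.eventually_const_lt hC1')).and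
    ((hP2.eventually_lt_const (by rwa [one_div])).and (hP2.eventually_const_lt hC2'))).and
    ((hak.and (hsep.and (eventually_arg_data hS k))).filter_mono nhdsWithin_le_nhds)
  rw [eventually_nhdsWithin_iff] at hev
  obtain ⟨s, hs0, hs⟩ := Metric.eventually_nhds_iff_ball.1 hev
  refine ⟨C, hC0, s, hs0, fun l him hl => ?_⟩
  have hl0 : l ≠ 0 := fun h' => him (by rw [h']; rfl)
  have hln : 0 < ‖l‖ := norm_pos_iff.2 hl0
  obtain ⟨⟨⟨q1, q2⟩, q3, q4⟩, q5, q6, q7, q8⟩ := hs l (by simpa using hl) hl0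
  set z := a k * Complex.exp l
  have hzA : z ∈ slitAnnulus ρ a := ⟨q5, q6 him⟩
  have hSn : ‖Di z‖ * ‖De z‖ = ‖Sk k z‖ := by
    rw [← norm_mul, hS.eq_jumpPhase_mul (h.a_ne_zero k) q7 him q8, norm_mul, norm_jumpPhase,
      one_mul]
  have hω : ‖Di z‖ = weightAbs a β w z * ‖De z‖ := by
    rw [h.Di_eq_weightExt_mul hzA, norm_mul, norm_weightExt]
  set x := ‖l‖ ^ β k with hx
  have hx0 : 0 < x := Real.rpow_pos_of_pos hln _
  have hxn : ‖l‖ ^ (-β k) = x⁻¹ := Real.rpow_neg hln.le _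
  have hDi0 : 0 < ‖Di z‖ := norm_pos_iff.2 (h.Di_ne_zero hzA)
  have hDe0 : 0 < ‖De z‖ := norm_pos_iff.2 (h.De_ne_zero hzA)
  have hω0 : 0 < weightAbs a β w z := by
    rw [← norm_weightExt]
    exact norm_pos_iff.2 (h.weightExt_ne_zero hzA)
  have e1 : ‖Sk k z‖ * (weightAbs a β w z * (‖l‖ ^ (-β k)) ^ 2) = (‖Di z‖ * x⁻¹) ^ 2 := by
    rw [← hSn, hxn]
    calc _ = ‖Di z‖ * (weightAbs a β w z * ‖De z‖) * x⁻¹ ^ 2 := by ring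
      _ = _ := by rw [← hω]; ring
  have e2 : ‖Sk k z‖ / (weightAbs a β w z * (‖l‖ ^ (-β k)) ^ 2) = (‖De z‖ * x) ^ 2 := by
    rw [← hSn, hxn, hω]
    field_simp
  rw [e1] at q1 q2
  simp only [Pi.div_apply] at q3 q4
  rw [e2] at q3 q4
  rw [← inv_pow] at q2 q4
  have r1 := lt_of_pow_lt_pow_left₀ 2 hC0.le q1
  have r2 := lt_of_pow_lt_pow_left₀ 2 (by positivity) q2
  have r3 := lt_of_pow_lt_pow_left₀ 2 hC0.le q3
  have r4 := lt_of_pow_lt_pow_left₀ 2 (by positivity) q4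
  rw [hxn]
  refine ⟨?_, ?_, ?_, ?_⟩
  · rw [← div_eq_mul_inv, div_lt_iff₀ hx0] at r1
    exact r1.le
  · rw [inv_le_comm₀ hDi0 (by positivity), mul_inv, inv_inv]
    rw [← div_eq_mul_inv, lt_div_iff₀ hx0] at r2
    exact r2.le
  · rw [← lt_div_iff₀ hx0, div_eq_mul_inv] at r3
    exact r3.le
  · rw [inv_le_comm₀ hDe0 (by positivity), mul_inv, ← div_eq_mul_inv, div_le_iff₀ hx0]
    exact r4.le

theorem differentiableOn_Di_ball (h : IsSzegoData ρ a β w W Di De) :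
    DifferentiableOn ℂ Di (ball 0 1) := h.diff_Di.mono fun z hz => by
  rw [mem_ball_zero_iff] at hz
  refine ⟨hz.trans h.one_lt_inv, fun hs => ?_⟩
  obtain ⟨t, ht, e⟩ := norm_of_mem_slits h.norm_eq_one hs
  rw [e] at hz
  exact absurd ((le_abs_self t).trans_lt hz) (not_lt.2 ht)

theorem differentiableOn_De_one_lt (h : IsSzegoData ρ a β w W Di De) :
    DifferentiableOn ℂ De {z | 1 < ‖z‖} := h.diff_De.mono fun z hz => by
  rw [mem_ofPred_eq] at hz
  refine ⟨h.lt_one.trans hz, fun hs => ?_⟩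
  obtain ⟨t, ht, e⟩ := norm_of_mem_slits h.norm_eq_one hs
  rw [e, abs_of_nonneg ht.1] at hz
  exact absurd hz (not_lt.2 ht.2)

theorem exists_norm_Di_bound (h : IsSzegoData ρ a β w W Di De)
    (hS : HasScatteringContinuation δ a β Di De Sk) (k : Fin m) : ∃ C > 0, ∃ s > 0, ∀ l : ℂ,
      l.re < 0 → ‖l‖ < s → ‖Di (a k * Complex.exp l)‖ ≤ C * ‖l‖ ^ β k ∧
        ‖Di (a k * Complex.exp l)‖⁻¹ ≤ C * ‖l‖ ^ (-β k) := by
  obtain ⟨C, hC, s, hs, hb⟩ := h.exists_norm_Di_De_bound hS k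
  have hm : ∀ l ∈ {l : ℂ | l.re < 0} ∩ ball 0 s, a k * Complex.exp l ∈ ball (0 : ℂ) 1 :=
    fun l hl => by
      rw [mem_ball_zero_iff, norm_mul_exp h.norm_eq_one]
      exact Real.exp_lt_one_iff.2 hl.1
  have hU : IsOpen ({l : ℂ | l.re < 0} ∩ ball 0 s) :=
    (isOpen_lt Complex.continuous_re continuous_const).inter isOpen_ball
  have hU0 : (0 : ℂ) ∉ {l : ℂ | l.re < 0} ∩ ball 0 s := fun h0 => lt_irrefl (0 : ℝ) h0.1
  have hc : ContinuousOn (fun l => Di (a k * Complex.exp l)) ({l : ℂ | l.re < 0} ∩ ball 0 s) :=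
    h.differentiableOn_Di_ball.continuousOn.comp (by fun_prop) hm
  refine ⟨C, hC, s, hs, fun l h1 h2 => ⟨?_, ?_⟩⟩
  · exact norm_le_mul_rpow_of_im_ne_zero hU hU0 hc (fun l hl him =>
      (hb l him (mem_ball_zero_iff.1 hl.2)).1) l ⟨h1, mem_ball_zero_iff.2 h2⟩
  · rw [← norm_inv]
    refine norm_le_mul_rpow_of_im_ne_zero hU hU0 (hc.inv₀ fun l hl =>
      h.Di_ne_zero_of_norm_lt_one (mem_ball_zero_iff.1 (hm l hl))) (fun l hl him => ?_) l
      ⟨h1, mem_ball_zero_iff.2 h2⟩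
    rw [Pi.inv_apply, norm_inv]
    exact (hb l him (mem_ball_zero_iff.1 hl.2)).2.1

theorem exists_norm_De_bound (h : IsSzegoData ρ a β w W Di De)
    (hS : HasScatteringContinuation δ a β Di De Sk) (k : Fin m) : ∃ C > 0, ∃ s > 0, ∀ l : ℂ,
      0 < l.re → ‖l‖ < s → ‖De (a k * Complex.exp l)‖ ≤ C * ‖l‖ ^ (-β k) ∧
        ‖De (a k * Complex.exp l)‖⁻¹ ≤ C * ‖l‖ ^ β k := by
  obtain ⟨C, hC, s, hs, hb⟩ := h.exists_norm_Di_De_bound hS k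
  have hm : ∀ l ∈ {l : ℂ | 0 < l.re} ∩ ball 0 s, 1 < ‖a k * Complex.exp l‖ :=
    fun l hl => by
      rw [norm_mul_exp h.norm_eq_one]
      exact Real.one_lt_exp_iff.2 hl.1
  have hU : IsOpen ({l : ℂ | 0 < l.re} ∩ ball 0 s) :=
    (isOpen_lt continuous_const Complex.continuous_re).inter isOpen_ball
  have hU0 : (0 : ℂ) ∉ {l : ℂ | 0 < l.re} ∩ ball 0 s := fun h0 => lt_irrefl (0 : ℝ) h0.1
  have hc : ContinuousOn (fun l => De (a k * Complex.exp l)) ({l : ℂ | 0 < l.re} ∩ ball 0 s) :=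
    h.differentiableOn_De_one_lt.continuousOn.comp (by fun_prop) hm
  refine ⟨C, hC, s, hs, fun l h1 h2 => ⟨?_, ?_⟩⟩
  · exact norm_le_mul_rpow_of_im_ne_zero hU hU0 hc (fun l hl him =>
      (hb l him (mem_ball_zero_iff.1 hl.2)).2.2.1) l ⟨h1, mem_ball_zero_iff.2 h2⟩
  · rw [← norm_inv]
    refine norm_le_mul_rpow_of_im_ne_zero hU hU0 (hc.inv₀ fun l hl =>
      h.De_ne_zero_of_one_lt_norm (hm l hl)) (fun l hl him => ?_) l ⟨h1, mem_ball_zero_iff.2 h2⟩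
    rw [Pi.inv_apply, norm_inv]
    exact (hb l him (mem_ball_zero_iff.1 hl.2)).2.2.2

/-- Away from the unit circle the scattering function is bounded above and below. -/
theorem exists_norm_scattering_bound (h : IsSzegoData ρ a β w W Di De) {r : ℝ} (hr : 0 < r)
    (hrρ : Real.exp r ≤ 1 / ρ) : ∃ c₀ > 0, ∃ C₀, ∀ z, z ∉ slits a (Ici 0) →
      r / 4 ≤ |Real.log ‖z‖| → |Real.log ‖z‖| ≤ r / 2 →
        c₀ ≤ ‖Di z * De z‖ ∧ ‖Di z * De z‖ ≤ C₀ := by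
  have hρr : ρ ≤ Real.exp (-r) := by
    rw [Real.exp_neg, le_inv_comm₀ h.pos (Real.exp_pos _), ← one_div]
    exact hrρ
  have hcpt : ∀ p q : ℝ, IsCompact {z : ℂ | p ≤ ‖z‖ ∧ ‖z‖ ≤ q} := fun p q =>
    (isCompact_closedBall (0 : ℂ) q).of_isClosed_subset
      ((isClosed_le continuous_const continuous_norm).inter
        (isClosed_le continuous_norm continuous_const))
      fun z hz => mem_closedBall_zero_iff.2 hz.2
  have hne : ∀ {z : ℂ}, ‖z‖ ≠ 1 → ∀ k, z ≠ a k := fun hz k e => hz (by rw [e, h.norm_eq_one])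
  have hin : ∀ z : ℂ, Real.exp (-(r / 2)) ≤ ‖z‖ ∧ ‖z‖ ≤ Real.exp (-(r / 4)) →
      ‖z‖ < 1 ∧ ρ < ‖z‖ ∧ ‖z‖ < 1 / ρ := fun z hz => by
    have hz1 : ‖z‖ < 1 := hz.2.trans_lt (Real.exp_lt_one_iff.2 (by linarith))
    exact ⟨hz1, hρr.trans_lt ((Real.exp_lt_exp.2 (by linarith)).trans_le hz.1),
      hz1.trans h.one_lt_inv⟩
  have hout : ∀ z : ℂ, Real.exp (r / 4) ≤ ‖z‖ ∧ ‖z‖ ≤ Real.exp (r / 2) →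
      1 < ‖z‖ ∧ ‖z‖ < 1 / ρ := fun z hz =>
    ⟨(Real.one_lt_exp_iff.2 (by linarith)).trans_le hz.1,
      hz.2.trans_lt ((Real.exp_lt_exp.2 (by linarith)).trans_le hrρ)⟩
  obtain ⟨c₁, hc₁, C₁, h₁⟩ := exists_forall_norm_mem_Icc (S := fun z => Di z * De z)
    (g := fun z => ‖Di z‖ ^ 2 / weightAbs a β w z) (A := (slits a (Ici 0))ᶜ)
    (hcpt (Real.exp (-(r / 2))) (Real.exp (-(r / 4))))
    (fun z hz => by
      obtain ⟨hz1, hzρ, hz2⟩ := hin z hz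
      refine ContinuousAt.continuousWithinAt (ContinuousAt.div ?_
        (h.continuousAt_weightAbs hzρ hz2 (hne hz1.ne))
        (h.weightAbs_pos hzρ hz2 (hne hz1.ne)).ne')
      exact ((h.differentiableOn_Di_ball.differentiableAt (isOpen_ball.mem_nhds
        (mem_ball_zero_iff.2 hz1))).continuousAt.norm.pow 2))
    (fun z hz => by
      obtain ⟨hz1, hzρ, hz2⟩ := hin z hz
      have h1 := h.weightAbs_pos hzρ hz2 (hne hz1.ne)
      have h2 := norm_pos_iff.2 (h.Di_ne_zero_of_norm_lt_one hz1)
      positivity)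
    (fun z ⟨hz, hzs⟩ => by
      obtain ⟨hz1, hzρ, hz2⟩ := hin z hz
      have h1 := h.weightAbs_pos hzρ hz2 (hne hz1.ne)
      rw [norm_mul, h.Di_eq_weightExt_mul ⟨⟨hzρ, hz2⟩, hzs⟩, norm_mul, norm_weightExt]
      field_simp)
  obtain ⟨c₂, hc₂, C₂, h₂⟩ := exists_forall_norm_mem_Icc (S := fun z => Di z * De z)
    (g := fun z => weightAbs a β w z * ‖De z‖ ^ 2) (A := (slits a (Ici 0))ᶜ)
    (hcpt (Real.exp (r / 4)) (Real.exp (r / 2)))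
    (fun z hz => by
      obtain ⟨hz1, hz2⟩ := hout z hz
      refine ContinuousAt.continuousWithinAt (ContinuousAt.mul
        (h.continuousAt_weightAbs (h.lt_one.trans hz1) hz2 (hne hz1.ne')) ?_)
      exact ((h.differentiableOn_De_one_lt.differentiableAt ((isOpen_lt continuous_const
        continuous_norm).mem_nhds hz1)).continuousAt.norm.pow 2))
    (fun z hz => by
      obtain ⟨hz1, hz2⟩ := hout z hz
      have h1 := h.weightAbs_pos (h.lt_one.trans hz1) hz2 (hne hz1.ne')
      have h2 := norm_pos_iff.2 (h.De_ne_zero_of_one_lt_norm hz1)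
      positivity)
    (fun z ⟨hz, hzs⟩ => by
      obtain ⟨hz1, hz2⟩ := hout z hz
      rw [norm_mul, h.Di_eq_weightExt_mul ⟨⟨h.lt_one.trans hz1, hz2⟩, hzs⟩, norm_mul,
        norm_weightExt]
      ring)
  refine ⟨min c₁ c₂, lt_min hc₁ hc₂, max C₁ C₂, fun z hzs h3 h4 => ?_⟩
  have hz0 : 0 < ‖z‖ := by
    rcases (norm_nonneg z).eq_or_lt with h0 | h0
    · rw [← h0, Real.log_zero, abs_zero] at h3
      linarith
    · exact h0
  have hx := Real.exp_log hz0
  set x := Real.log ‖z‖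
  rcases le_total x 0 with h0 | h0
  · rw [abs_of_nonpos h0] at h3 h4
    have := h₁ z ⟨⟨hx ▸ Real.exp_le_exp.2 (by linarith), hx ▸ Real.exp_le_exp.2 (by linarith)⟩, hzs⟩
    exact ⟨(min_le_left _ _).trans this.1, this.2.trans (le_max_left _ _)⟩
  · rw [abs_of_nonneg h0] at h3 h4
    have := h₂ z ⟨⟨hx ▸ Real.exp_le_exp.2 (by linarith), hx ▸ Real.exp_le_exp.2 (by linarith)⟩, hzs⟩
    exact ⟨(min_le_right _ _).trans this.1, this.2.trans (le_max_right _ _)⟩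

theorem exists_isScatteringData (h : IsSzegoData ρ a β w W Di De)
    (hS : HasScatteringContinuation δ a β Di De Sk) : ∃ r, Real.exp r ≤ 1 / ρ ∧
      (∀ k l, ‖l‖ < r → a k * Complex.exp l ∈ ball (a k) δ) ∧
      IsScatteringData r a β (fun z => Di z * De z) fun k l => Sk k (a k * Complex.exp l) := by
  have hev : ∀ᶠ l : ℂ in nhds 0, ∀ k, (a k * Complex.exp l ∈ ball (a k) δ ∧ |l.im| < π) ∧
      Sk k (a k * Complex.exp l) ≠ 0 := by
    refine eventually_all.2 fun k => (eventually_arg_data hS k).and ?_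
    have hc : ContinuousAt (Sk k) (a k) :=
      ((hS.diff k).differentiableAt (ball_mem_nhds _ hS.pos)).continuousAt
    refine (hc.tendsto.comp (tendsto_mul_exp (a k))).eventually_ne ?_
    rw [← norm_ne_zero_iff, h.norm_Sk_eq_one hS k]
    exact one_ne_zero
  obtain ⟨s, hs0, hs⟩ := Metric.eventually_nhds_iff_ball.1 hev
  have hlog : 0 < Real.log (1 / ρ) := Real.log_pos h.one_lt_inv
  set r := min s (min 1 (Real.log (1 / ρ))) with hr
  have hr0 : 0 < r := lt_min hs0 (lt_min one_pos hlog)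
  have hrs : ∀ l : ℂ, ‖l‖ < r → l ∈ ball (0 : ℂ) s := fun l hl =>
    mem_ball_zero_iff.2 (hl.trans_le (min_le_left _ _))
  have hrρ : Real.exp r ≤ 1 / ρ := by
    rw [← Real.le_log_iff_exp_le (by have := h.pos; positivity)]
    exact (min_le_right _ _).trans (min_le_right _ _)
  refine ⟨r, hrρ, fun k l hl => (hs l (hrs l hl) k).1.1, ?_⟩
  refine ⟨h.norm_eq_one, h.exponent, hr0, (min_le_right _ _).trans (min_le_left _ _), ?_, ?_, ?_,
    ?_, h.exists_norm_scattering_bound hr0 hrρ⟩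
  · intro j k hjk l l' hl hl' e
    have h1 := mem_ball.1 (hs l (hrs l hl) j).1.1
    have h2 := mem_ball.1 (hs l' (hrs l' hl') k).1.1
    rw [← e] at h2
    have h3 := hS.sep j k hjk
    rw [← dist_eq_norm] at h3
    have := dist_triangle_left (a j) (a k) (a j * Complex.exp l)
    linarith [hS.pos]
  · intro k
    refine (hS.diff k).comp (by fun_prop) fun l hl => ?_
    exact (hs l (hrs l (mem_ball_zero_iff.1 hl)) k).1.1
  · exact fun k l hl => (hs l (hrs l (mem_ball_zero_iff.1 hl)) k).2
  · intro k l hl him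
    obtain ⟨⟨h1, h2⟩, -⟩ := hs l (hrs l hl) k
    exact hS.eq_jumpPhase_mul (h.a_ne_zero k) h1 him h2

end IsSzegoData

theorem eval_reverse_inv (P : ℂ[X]) {z : ℂ} (hz : z ≠ 0) :
    P.reverse.eval z⁻¹ = (z ^ P.natDegree)⁻¹ * P.eval z := by
  have : Invertible z := invertibleOfNonzero hz
  have h := eval₂_reverse_mul_pow (RingHom.id ℂ) z P
  rw [invOf_eq_inv] at h
  simp only [eval₂_id] at h
  rw [← h]
  field_simp

theorem eval_map_conj (P : ℂ[X]) (z : ℂ) :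
    (P.map (starRingEnd ℂ)).eval ((starRingEnd ℂ) z) = (starRingEnd ℂ) (P.eval z) :=
  eval_map_apply _ _

theorem tendsto_eval_reverse_inv {P : ℂ[X]} (hP : P.Monic) :
    Tendsto (fun z : ℂ => P.reverse.eval z⁻¹) (Bornology.cobounded ℂ) (nhds 1) := by
  have h1 : Tendsto (fun z : ℂ => P.reverse.eval z) (nhds 0) (nhds (P.reverse.eval 0)) :=
    P.reverse.continuous.tendsto 0
  rw [← coeff_zero_eq_eval_zero, coeff_zero_reverse, hP.leadingCoeff] at h1
  exact h1.comp tendsto_inv₀_cobounded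

theorem conj_circlePoint (θ : ℝ) : (starRingEnd ℂ) (circlePoint θ) = (circlePoint θ)⁻¹ := by
  rw [Complex.inv_def, Complex.normSq_eq_norm_sq, norm_circlePoint]
  simp

/-- The monic orthogonal polynomials of a weight on the unit circle. -/
structure IsOrthogonalFamily (W : ℂ → ℝ) (Φ : ℕ → ℂ[X]) : Prop where
  monic : ∀ n, (Φ n).Monic
  natDegree_eq : ∀ n, (Φ n).natDegree = n
  orth : ∀ n, ∀ j < n, (∫ θ in (0 : ℝ)..(2 * π), (Φ n).eval (circlePoint θ) *
    (starRingEnd ℂ) (circlePoint θ) ^ j * (W (circlePoint θ) : ℂ)) = 0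

namespace IsOrthogonalFamily
variable {W : ℂ → ℝ} {Φ : ℕ → ℂ[X]}

theorem continuous_eval_circlePoint (P : ℂ[X]) : Continuous fun θ => P.eval (circlePoint θ) :=
  P.continuous.comp continuous_circlePoint

theorem intervalIntegrable_mul {g : ℝ → ℂ} (hg : Continuous g)
    (hW : IntervalIntegrable (fun θ => W (circlePoint θ)) volume 0 (2 * π)) :
    IntervalIntegrable (fun θ => g θ * (W (circlePoint θ) : ℂ)) volume 0 (2 * π) :=
  IntervalIntegrable.continuousOn_mul ⟨hW.1.ofReal, hW.2.ofReal⟩ hg.continuousOn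

theorem intervalIntegrable_real_mul {g : ℝ → ℝ} (hg : Continuous g)
    (hW : IntervalIntegrable (fun θ => W (circlePoint θ)) volume 0 (2 * π)) :
    IntervalIntegrable (fun θ => g θ * W (circlePoint θ)) volume 0 (2 * π) :=
  hW.continuousOn_mul hg.continuousOn

theorem integral_sum_eq_zero (h : IsOrthogonalFamily W Φ)
    (hW : IntervalIntegrable (fun θ => W (circlePoint θ)) volume 0 (2 * π)) (n : ℕ) (c : ℕ → ℂ) :
    ∫ θ in (0 : ℝ)..(2 * π), ∑ i ∈ Finset.range n, c i * ((Φ n).eval (circlePoint θ) *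
      (starRingEnd ℂ) (circlePoint θ) ^ i * (W (circlePoint θ) : ℂ)) = 0 := by
  have hi : ∀ i, IntervalIntegrable (fun θ => c i * ((Φ n).eval (circlePoint θ) *
      (starRingEnd ℂ) (circlePoint θ) ^ i * (W (circlePoint θ) : ℂ))) volume 0 (2 * π) :=
    fun i => (intervalIntegrable_mul ((continuous_eval_circlePoint _).mul
      ((Complex.continuous_conj.comp continuous_circlePoint).pow i)) hW).const_mul _
  rw [intervalIntegral.integral_finsetSum fun i _ => hi i]
  refine Finset.sum_eq_zero fun i hi => ?_
  rw [intervalIntegral.integral_const_mul, h.orth n i (Finset.mem_range.1 hi), mul_zero]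

theorem integral_norm_sq_le (h : IsOrthogonalFamily W Φ)
    (hW : IntervalIntegrable (fun θ => W (circlePoint θ)) volume 0 (2 * π))
    (hW0 : ∀ θ, 0 ≤ W (circlePoint θ)) (n : ℕ) :
    ∫ θ in (0 : ℝ)..(2 * π), ‖(Φ n).eval (circlePoint θ)‖ ^ 2 * W (circlePoint θ) ≤
      ∫ θ in (0 : ℝ)..(2 * π), W (circlePoint θ) := by
  set g : ℝ → ℂ := fun θ => (Φ n).eval (circlePoint θ) *
    (starRingEnd ℂ) ((Φ n).eval (circlePoint θ) - circlePoint θ ^ n) with hg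
  have hgc : Continuous g := (continuous_eval_circlePoint _).mul
    (Complex.continuous_conj.comp ((continuous_eval_circlePoint _).sub
      (continuous_circlePoint.pow n)))
  have hq : ∀ θ, (Φ n).eval (circlePoint θ) - circlePoint θ ^ n =
      ∑ i ∈ Finset.range n, (Φ n).coeff i * circlePoint θ ^ i := fun θ => by
    have hc : (Φ n).coeff n = 1 := by
      have := (h.monic n).coeff_natDegree
      rwa [h.natDegree_eq] at this
    rw [eval_eq_sum_range, h.natDegree_eq, Finset.sum_range_succ, hc, one_mul, add_sub_cancel_right]
  have hzero : ∫ θ in (0 : ℝ)..(2 * π), g θ * (W (circlePoint θ) : ℂ) = 0 := by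
    have e : ∀ θ, g θ * (W (circlePoint θ) : ℂ) = ∑ i ∈ Finset.range n,
        (starRingEnd ℂ) ((Φ n).coeff i) * ((Φ n).eval (circlePoint θ) *
          (starRingEnd ℂ) (circlePoint θ) ^ i * (W (circlePoint θ) : ℂ)) := fun θ => by
      rw [hg]
      simp only [hq, map_sum, map_mul, map_pow, Finset.mul_sum, Finset.sum_mul]
      exact Finset.sum_congr rfl fun i _ => by ring
    simp only [e]
    exact h.integral_sum_eq_zero hW n _
  have hre : ∫ θ in (0 : ℝ)..(2 * π), (g θ).re * W (circlePoint θ) = 0 := by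
    have := Complex.reCLM.intervalIntegral_comp_comm (intervalIntegrable_mul hgc hW)
    rw [hzero, map_zero] at this
    rw [← this]
    congr 1
    ext θ
    simp
  have hgr : IntervalIntegrable (fun θ => (g θ).re * W (circlePoint θ)) volume 0 (2 * π) :=
    intervalIntegrable_real_mul (Complex.continuous_re.comp hgc) hW
  have hsum : ∫ θ in (0 : ℝ)..(2 * π), W (circlePoint θ) =
      ∫ θ in (0 : ℝ)..(2 * π), (W (circlePoint θ) + 2 * ((g θ).re * W (circlePoint θ))) := by
    rw [intervalIntegral.integral_add hW (hgr.const_mul 2), intervalIntegral.integral_const_mul, hre]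
    simp
  rw [hsum]
  refine intervalIntegral.integral_mono_on (by positivity)
    (intervalIntegrable_real_mul ((continuous_eval_circlePoint _).norm.pow 2) hW)
    (hW.add (hgr.const_mul 2))
    fun θ _ => ?_
  set p := (Φ n).eval (circlePoint θ)
  set u := circlePoint θ ^ n with hu
  have hu1 : Complex.normSq u = 1 := by
    rw [Complex.normSq_eq_norm_sq, hu, norm_pow, norm_circlePoint]
    simp
  have h1 : ‖p‖ ^ 2 ≤ 1 + 2 * (g θ).re := by
    have h2 : (g θ).re = p.re * (p.re - u.re) + p.im * (p.im - u.im) := by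
      change (p * (starRingEnd ℂ) (p - u)).re = _
      simp only [Complex.mul_re, Complex.conj_re, Complex.conj_im, Complex.sub_re, Complex.sub_im]
      ring
    rw [Complex.normSq_apply] at hu1
    rw [h2, ← Complex.normSq_eq_norm_sq, Complex.normSq_apply]
    nlinarith [sq_nonneg (p.re - u.re), sq_nonneg (p.im - u.im)]
  nlinarith [hW0 θ, mul_le_mul_of_nonneg_right h1 (hW0 θ)]

theorem integral_norm_le (h : IsOrthogonalFamily W Φ)
    (hW : IntervalIntegrable (fun θ => W (circlePoint θ)) volume 0 (2 * π))
    (hW0 : ∀ θ, 0 ≤ W (circlePoint θ)) (n : ℕ) :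
    ∫ θ in (0 : ℝ)..(2 * π), ‖(Φ n).eval (circlePoint θ)‖ * W (circlePoint θ) ≤
      ∫ θ in (0 : ℝ)..(2 * π), W (circlePoint θ) := by
  have h1 := h.integral_norm_sq_le hW hW0 n
  have hsq : IntervalIntegrable (fun θ => ‖(Φ n).eval (circlePoint θ)‖ ^ 2 * W (circlePoint θ))
      volume 0 (2 * π) :=
    intervalIntegrable_real_mul ((continuous_eval_circlePoint (Φ n)).norm.pow 2) hW
  have h2 : ∫ θ in (0 : ℝ)..(2 * π), ‖(Φ n).eval (circlePoint θ)‖ * W (circlePoint θ) ≤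
      ∫ θ in (0 : ℝ)..(2 * π), 2⁻¹ *
        (‖(Φ n).eval (circlePoint θ)‖ ^ 2 * W (circlePoint θ) + W (circlePoint θ)) := by
    refine intervalIntegral.integral_mono_on (by positivity)
      (intervalIntegrable_real_mul (continuous_eval_circlePoint _).norm hW)
      ((hsq.add hW).const_mul _) fun θ _ => ?_
    nlinarith [mul_nonneg (sq_nonneg (‖(Φ n).eval (circlePoint θ)‖ - 1)) (hW0 θ)]
  rw [intervalIntegral.integral_const_mul, intervalIntegral.integral_add hsq hW] at h2
  linarith

/-- Orthogonality lets a power of `z` pass through the Cauchy kernel. -/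
theorem pow_mul_cauchyMean (h : IsOrthogonalFamily W Φ)
    (hW : IntervalIntegrable (fun θ => W (circlePoint θ)) volume 0 (2 * π)) (n : ℕ) {z : ℂ}
    (hz : ‖z‖ ≠ 1) :
    z ^ n * cauchyMean (fun θ => (circlePoint θ ^ n)⁻¹ * (Φ n).eval (circlePoint θ) *
      (W (circlePoint θ) : ℂ)) z =
      cauchyMean (fun θ => (Φ n).eval (circlePoint θ) * (W (circlePoint θ) : ℂ)) z := by
  have hpc : ∀ i : ℕ, Continuous fun θ => (circlePoint θ ^ i)⁻¹ := fun i =>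
    (continuous_circlePoint.pow i).inv₀ fun θ => pow_ne_zero _ (circlePoint_ne_zero θ)
  have hk : Continuous fun θ => circlePoint θ / (circlePoint θ - z) :=
    continuous_circlePoint.div (continuous_circlePoint.sub continuous_const)
      fun θ => circlePoint_sub_ne_zero θ hz
  have hcont : ∀ g : ℝ → ℂ, Continuous g → IntervalIntegrable (fun θ => g θ *
      (W (circlePoint θ) : ℂ) * (circlePoint θ / (circlePoint θ - z))) volume 0 (2 * π) :=
    fun g hg => (intervalIntegrable_mul hg hW).mul_continuousOn hk.continuousOn
  rw [cauchyMean, cauchyMean, mul_left_comm]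
  congr 1
  rw [← intervalIntegral.integral_const_mul, ← sub_eq_zero,
    ← intervalIntegral.integral_sub ((hcont (fun θ => (circlePoint θ ^ n)⁻¹ *
      (Φ n).eval (circlePoint θ)) ((hpc n).mul (continuous_eval_circlePoint _))).const_mul _)
      (hcont _ (continuous_eval_circlePoint _))]
  have e : ∀ θ, z ^ n * ((circlePoint θ ^ n)⁻¹ * (Φ n).eval (circlePoint θ) *
      (W (circlePoint θ) : ℂ) * (circlePoint θ / (circlePoint θ - z))) -
      (Φ n).eval (circlePoint θ) * (W (circlePoint θ) : ℂ) *
        (circlePoint θ / (circlePoint θ - z)) =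
      ∑ i ∈ Finset.range n, -z ^ i * ((Φ n).eval (circlePoint θ) *
        (starRingEnd ℂ) (circlePoint θ) ^ i * (W (circlePoint θ) : ℂ)) := fun θ => by
    have hx := circlePoint_ne_zero θ
    have hxz := circlePoint_sub_ne_zero θ hz
    have hgeom : ∑ i ∈ Finset.range n, z ^ i * (starRingEnd ℂ) (circlePoint θ) ^ i =
        (1 - z ^ n * (circlePoint θ ^ n)⁻¹) * (circlePoint θ / (circlePoint θ - z)) := by
      have h1 : z * (circlePoint θ)⁻¹ - 1 ≠ 0 := fun h0 => hxz (by
        field_simp at h0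
        rw [← neg_sub, h0, mul_zero, neg_zero])
      simp only [conj_circlePoint, ← mul_pow]
      rw [geom_sum_eq fun h0 => h1 (sub_eq_zero.2 h0), ← inv_pow, ← mul_pow, div_eq_iff h1]
      field_simp
      ring
    calc _ = -((1 - z ^ n * (circlePoint θ ^ n)⁻¹) * (circlePoint θ / (circlePoint θ - z))) *
          ((Φ n).eval (circlePoint θ) * (W (circlePoint θ) : ℂ)) := by ring
      _ = _ := by
        rw [← hgeom, ← Finset.sum_neg_distrib, Finset.sum_mul]
        exact Finset.sum_congr rfl fun i _ => by ring
  simp only [e]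
  exact h.integral_sum_eq_zero hW n _

end IsOrthogonalFamily

/-- The Cauchy integral of an integrable function is `o(1 / (1 - ‖z‖))` at each boundary point. -/
theorem tendsto_norm_cauchyMean_mul {F : ℝ → ℂ} (hF : IntervalIntegrable F volume 0 (2 * π))
    {p : ℂ} (hp : ‖p‖ = 1) :
    Tendsto (fun z => ‖cauchyMean F z‖ * |1 - ‖z‖|) (nhds p) (nhds 0) := by
  have hπ : (0 : ℝ) ≤ 2 * π := by positivity
  set K : ℂ → ℝ → ℂ := fun z θ => ((|1 - ‖z‖| : ℝ) : ℂ) * (circlePoint θ / (circlePoint θ - z))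
  have hKn : ∀ z θ, ‖K z θ‖ = |1 - ‖z‖| * ‖circlePoint θ - z‖⁻¹ := fun z θ => by
    simp only [K]
    rw [norm_mul, norm_div, norm_circlePoint, one_div, Complex.norm_real, Real.norm_eq_abs, abs_abs]
  have hK1 : ∀ z θ, ‖K z θ‖ ≤ 1 := fun z θ => by
    rw [hKn, ← div_eq_mul_inv]
    exact div_le_one_of_le₀ (abs_one_sub_norm_le θ z) (norm_nonneg _)
  have hKc : ∀ z, Continuous (K z) := fun z => by
    by_cases hz : ‖z‖ = 1
    · have : K z = fun _ => 0 := by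
        ext θ
        simp [K, hz]
      rw [this]
      exact continuous_const
    · exact continuous_const.mul (continuous_cauchyKernel hz)
  have hlim : Tendsto (fun z => ∫ θ in (0 : ℝ)..(2 * π), F θ * K z θ) (nhds p)
      (nhds (∫ _ in (0 : ℝ)..(2 * π), (0 : ℂ))) := by
    refine intervalIntegral.tendsto_integral_filter_of_dominated_convergence (fun θ => ‖F θ‖) ?_ ?_
      hF.norm ?_
    · refine Eventually.of_forall fun z => ?_
      rw [uIoc_of_le hπ]
      exact hF.1.aestronglyMeasurable.mul (hKc z).aestronglyMeasurable
    · refine Eventually.of_forall fun z => ae_of_all _ fun θ _ => ?_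
      rw [norm_mul]
      exact mul_le_of_le_one_right (norm_nonneg _) (hK1 z θ)
    · rw [uIoc_of_le hπ]
      have := (ae_restrict_iff' measurableSet_Ioc).1 (ae_circlePoint_ne p)
      filter_upwards [this] with θ hθ hmem
      have h0 : circlePoint θ - p ≠ 0 := sub_ne_zero.2 (hθ hmem)
      have hc : ContinuousAt (fun z => K z θ) p := by
        refine ContinuousAt.mul (by fun_prop) (ContinuousAt.div (by fun_prop) (by fun_prop) h0)
      have h1 : K p θ = 0 := by simp [K, hp]
      have h2 := (hc.tendsto.const_mul (F θ))
      rwa [h1, mul_zero] at h2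
  have h3 := (hlim.const_mul (2 * π : ℂ)⁻¹).norm
  rw [intervalIntegral.integral_zero, mul_zero, norm_zero] at h3
  refine h3.congr fun z => ?_
  have h4 : ∀ θ, F θ * K z θ = ((|1 - ‖z‖| : ℝ) : ℂ) *
      (F θ * (circlePoint θ / (circlePoint θ - z))) := fun θ => by
    simp only [K]
    ring
  simp only [h4]
  rw [intervalIntegral.integral_const_mul, mul_left_comm, ← cauchyMean, norm_mul,
    Complex.norm_real, Real.norm_eq_abs, abs_abs, mul_comm]

namespace IsSzegoData
variable {m : ℕ} {ρ δ : ℝ} {a : Fin m → ℂ} {β : Fin m → ℝ} {w : ℂ → ℂ} {W : ℂ → ℝ}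
  {Di De : ℂ → ℂ} {Sk : Fin m → ℂ → ℂ} {Φ : ℕ → ℂ[X]}

/-- A polynomial whose weighted mean square is bounded is bounded inside the disc. -/
theorem exists_norm_eval_bound (h : IsSzegoData ρ a β w W Di De) : ∃ N : ℕ, ∃ C, ∀ P : ℂ[X],
    (∫ θ in (0 : ℝ)..(2 * π), ‖P.eval (circlePoint θ)‖ ^ 2 * W (circlePoint θ) ≤
      ∫ θ in (0 : ℝ)..(2 * π), W (circlePoint θ)) →
    ∀ z, ‖z‖ < 1 → ‖P.eval z‖ * (∏ k, ‖z - a k‖) ^ N * |1 - ‖z‖| ≤ C := by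
  obtain ⟨N, hN1, hN⟩ : ∃ N : ℕ, 1 ≤ N ∧ ∀ k, β k ≤ N := by
    obtain ⟨b, hb⟩ := (Set.finite_range β).bddAbove
    obtain ⟨N, hN⟩ := exists_nat_ge (max b 1)
    exact ⟨N, by exact_mod_cast (le_max_right b 1).trans hN,
      fun k => (hb (mem_range_self k)).trans ((le_max_left _ _).trans hN)⟩
  have hWi := h.intervalIntegrable_W
  have hW0 : ∀ θ, 0 ≤ W (circlePoint θ) := fun θ => h.W_nonneg (norm_circlePoint θ)
  set B : ℝ → ℝ := fun θ => (w (circlePoint θ)).re⁻¹ *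
    ∏ k, ‖circlePoint θ - a k‖ ^ (2 * (N - β k)) with hB
  have hwpos : ∀ θ, 0 < (w (circlePoint θ)).re := fun θ => (h.w_pos _ (norm_circlePoint θ)).1
  have hBc : Continuous B := by
    refine (h.continuous_w_circlePoint.inv₀ fun θ => (hwpos θ).ne').mul
      (continuous_finsetProd _ fun k _ => ?_)
    exact (continuous_circlePoint.sub continuous_const).norm.rpow_const
      fun θ => Or.inr (by linarith [hN k])
  have hB0 : ∀ θ, 0 ≤ B θ := fun θ => mul_nonneg (inv_nonneg.2 (hwpos θ).le)
    (Finset.prod_nonneg fun k _ => Real.rpow_nonneg (norm_nonneg _) _)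
  have hBW : ∀ θ, ((∏ k, ‖circlePoint θ - a k‖) ^ N) ^ 2 ≤ B θ * W (circlePoint θ) := fun θ => by
    by_cases hz : ∃ k, circlePoint θ = a k
    · obtain ⟨k, hk⟩ := hz
      rw [Finset.prod_eq_zero (Finset.mem_univ k) (by rw [hk, sub_self, norm_zero]),
        zero_pow (by omega), zero_pow two_ne_zero]
      exact mul_nonneg (hB0 θ) (hW0 θ)
    · push Not at hz
      refine le_of_eq ?_
      rw [h.W_eq _ (norm_circlePoint θ), hB]
      have := (hwpos θ).ne'
      calc _ = (∏ k, ‖circlePoint θ - a k‖ ^ (2 * (N - β k))) *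
            ∏ k, ‖circlePoint θ - a k‖ ^ (2 * β k) := by
            rw [← Finset.prod_mul_distrib, ← pow_mul, ← Finset.prod_pow]
            refine Finset.prod_congr rfl fun k _ => ?_
            rw [← Real.rpow_add (norm_pos_iff.2 (sub_ne_zero.2 (hz k))), ← Real.rpow_natCast]
            congr 1
            push_cast
            ring
        _ = _ := by
            field_simp
  refine ⟨N, (2 * π)⁻¹ * ((∫ θ in (0 : ℝ)..(2 * π), W (circlePoint θ)) +
    ∫ θ in (0 : ℝ)..(2 * π), B θ), fun P hP z hz => ?_⟩
  set H : ℂ[X] := (∏ k, (X - C (a k))) ^ N with hH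
  have hHn : ∀ z, ‖(P * H).eval z‖ = ‖P.eval z‖ * (∏ k, ‖z - a k‖) ^ N := fun z => by
    rw [hH, eval_mul, norm_mul, eval_pow, eval_prod, norm_pow, norm_prod]
    simp
  have hF : Continuous fun θ => (P * H).eval (circlePoint θ) :=
    IsOrthogonalFamily.continuous_eval_circlePoint _
  have h1 := norm_cauchyMean_le (hF.intervalIntegrable 0 (2 * π)) hz.ne
  rw [cauchyMean_of_norm_lt_one (f := fun z => (P * H).eval z)
    (P * H).differentiable.diffContOnCl hz, hHn] at h1
  have hsq : IntervalIntegrable (fun θ => ‖P.eval (circlePoint θ)‖ ^ 2 * W (circlePoint θ))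
      volume 0 (2 * π) := IsOrthogonalFamily.intervalIntegrable_real_mul
        ((IsOrthogonalFamily.continuous_eval_circlePoint P).norm.pow 2) hWi
  have hBi := hBc.intervalIntegrable (μ := volume) 0 (2 * π)
  have h2 : ∫ θ in (0 : ℝ)..(2 * π), ‖(P * H).eval (circlePoint θ)‖ ≤
      ∫ θ in (0 : ℝ)..(2 * π), (‖P.eval (circlePoint θ)‖ ^ 2 * W (circlePoint θ) + B θ) := by
    refine intervalIntegral.integral_mono_on (by positivity) (hF.norm.intervalIntegrable _ _)
      (hsq.add hBi) fun θ _ => ?_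
    rw [hHn]
    set x := ‖P.eval (circlePoint θ)‖
    have h3 := hBW θ
    set y := (∏ k, ‖circlePoint θ - a k‖) ^ N
    have hs : 0 ≤ x ^ 2 * W (circlePoint θ) := mul_nonneg (sq_nonneg _) (hW0 θ)
    refine abs_le_of_sq_le_sq' ?_ (add_nonneg hs (hB0 θ)) |>.2
    have h4 := mul_le_mul_of_nonneg_left h3 (sq_nonneg x)
    nlinarith [mul_nonneg hs (hB0 θ), sq_nonneg (x ^ 2 * W (circlePoint θ)), sq_nonneg (B θ)]
  rw [intervalIntegral.integral_add hsq hBi] at h2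
  refine h1.trans ?_
  gcongr
  linarith

theorem exists_norm_Di_eq (h : IsSzegoData ρ a β w W Di De) {z₀ : ℂ} (h1 : ρ < ‖z₀‖)
    (h2 : ‖z₀‖ < 1 / ρ) (hz : ∀ k, z₀ ≠ a k) : ∃ g : ℂ → ℝ, ContinuousAt g z₀ ∧ 0 < g z₀ ∧
      ∀ᶠ z in nhds z₀, z ∉ slits a (Ici 0) → ‖Di z‖ = g z := by
  rcases lt_trichotomy ‖z₀‖ 1 with h3 | h3 | h3
  · exact ⟨fun z => ‖Di z‖, (h.differentiableOn_Di_ball.differentiableAt (isOpen_ball.mem_nhds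
      (mem_ball_zero_iff.2 h3))).continuousAt.norm,
      norm_pos_iff.2 (h.Di_ne_zero_of_norm_lt_one h3), Eventually.of_forall fun _ _ => rfl⟩
  · have hs := h.mem_slitAnnulus_of_norm_eq_one h3 hz
    exact ⟨fun z => ‖Di z‖, (h.differentiableOn_Di.differentiableAt
      (h.isOpen_slitAnnulus.mem_nhds hs)).continuousAt.norm,
      norm_pos_iff.2 (h.Di_ne_zero hs), Eventually.of_forall fun _ _ => rfl⟩
  · refine ⟨fun z => weightAbs a β w z * ‖De z‖, (h.continuousAt_weightAbs h1 h2 hz).mul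
      (h.differentiableOn_De_one_lt.differentiableAt ((isOpen_lt continuous_const
        continuous_norm).mem_nhds h3)).continuousAt.norm,
      mul_pos (h.weightAbs_pos h1 h2 hz) (norm_pos_iff.2 (h.De_ne_zero_of_one_lt_norm h3)), ?_⟩
    filter_upwards [(isOpen_annulus ρ).mem_nhds ⟨h1, h2⟩] with z hz hzs
    rw [h.Di_eq_weightExt_mul ⟨hz, hzs⟩, norm_mul, norm_weightExt]

theorem exists_local_bound (h : IsSzegoData ρ a β w W Di De) {z₀ : ℂ} (h1 : ρ < ‖z₀‖)
    (h2 : ‖z₀‖ < 1 / ρ) (hz : ∀ k, z₀ ≠ a k) : ∃ M, ∀ᶠ z in nhds z₀, z ∉ slits a (Ici 0) →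
      ‖Di z‖ ≤ M ∧ ‖Di z‖⁻¹ ≤ M ∧ ‖De z‖ ≤ M ∧ ‖De z‖⁻¹ ≤ M := by
  obtain ⟨g, hgc, hg0, hg⟩ := h.exists_norm_Di_eq h1 h2 hz
  have hωc := h.continuousAt_weightAbs h1 h2 hz
  have hω0 := h.weightAbs_pos h1 h2 hz
  set e := fun z => g z / weightAbs a β w z
  have hec : ContinuousAt e z₀ := hgc.div hωc hω0.ne'
  have he0 : 0 < e z₀ := div_pos hg0 hω0
  refine ⟨max (max (g z₀ + 1) ((g z₀)⁻¹ + 1)) (max (e z₀ + 1) ((e z₀)⁻¹ + 1)), ?_⟩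
  filter_upwards [hg, (isOpen_annulus ρ).mem_nhds ⟨h1, h2⟩,
    hgc.eventually_lt_const (lt_add_one (g z₀)), (hgc.inv₀ hg0.ne').eventually_lt_const
      (lt_add_one (g z₀)⁻¹), hec.eventually_lt_const (lt_add_one (e z₀)),
    (hec.inv₀ he0.ne').eventually_lt_const (lt_add_one (e z₀)⁻¹),
    hωc.eventually_const_lt hω0] with z q1 q2 q3 q4 q5 q6 q7 hzs
  have hDe : ‖De z‖ = e z := by
    rw [eq_div_iff q7.ne', ← q1 hzs, h.Di_eq_weightExt_mul ⟨q2, hzs⟩, norm_mul, norm_weightExt,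
      mul_comm]
  rw [q1 hzs, hDe]
  exact ⟨q3.le.trans ((le_max_left _ _).trans (le_max_left _ _)),
    q4.le.trans ((le_max_right _ _).trans (le_max_left _ _)),
    q5.le.trans ((le_max_left _ _).trans (le_max_right _ _)),
    q6.le.trans ((le_max_right _ _).trans (le_max_right _ _))⟩

theorem exists_local_norm_eval_bound (h : IsSzegoData ρ a β w W Di De)
    (hΦ : IsOrthogonalFamily W Φ) {z₀ : ℂ} (hz₀ : z₀ ≠ 0) (hz : ∀ k, z₀ ≠ a k) :
    ∃ M, ∀ᶠ z in nhds z₀, ∀ n, (‖z‖ < 1 → ‖(Φ n).eval z‖ * |1 - ‖z‖| ≤ M) ∧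
      (1 < ‖z‖ → ‖(z ^ n)⁻¹ * (Φ n).eval z‖ * |1 - ‖z‖| ≤ M) := by
  obtain ⟨N, C, hC⟩ := h.exists_norm_eval_bound
  have hint := hΦ.integral_norm_sq_le h.intervalIntegrable_W
    fun θ => h.W_nonneg (norm_circlePoint θ)
  set p : ℂ → ℝ := fun z => (∏ k, ‖z - a k‖) ^ N with hp
  have hpc : Continuous p := by fun_prop
  have hp0 : ∀ z, (∀ k, z ≠ a k) → 0 < p z := fun z hz =>
    pow_pos (Finset.prod_pos fun k _ => norm_pos_iff.2 (sub_ne_zero.2 (hz k))) _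
  set q : ℂ → ℝ := fun z => p ((starRingEnd ℂ) z⁻¹) * ‖z‖⁻¹ with hq
  have hqc : ContinuousAt q z₀ := (hpc.continuousAt.comp (Complex.continuous_conj.continuousAt.comp
    (continuousAt_inv₀ hz₀))).mul (continuous_norm.continuousAt.inv₀ (norm_ne_zero_iff.2 hz₀))
  have hq0 : 0 < q z₀ := by
    refine mul_pos (hp0 _ fun k e => hz k ?_) (inv_pos.2 (norm_pos_iff.2 hz₀))
    have e2 := congrArg (fun u => (starRingEnd ℂ) u⁻¹) e
    simp only [map_inv₀, inv_inv, Complex.conj_conj] at e2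
    rw [e2, Complex.inv_def, Complex.normSq_conj, Complex.normSq_eq_norm_sq, h.norm_eq_one]
    simp
  have hM : ∀ {x y s t : ℝ}, 0 < s → s < t → 0 ≤ x → 0 ≤ y → x * t * y ≤ C → x * y ≤ C / s :=
    fun hs hst hx hy hC => by
      rw [le_div_iff₀ hs]
      nlinarith [mul_le_mul_of_nonneg_left hst.le (mul_nonneg hx hy)]
  refine ⟨max (C / (p z₀ / 2)) (C / (q z₀ / 2)), ?_⟩
  filter_upwards [hpc.continuousAt.eventually_const_lt (half_lt_self (hp0 _ hz)),
    hqc.eventually_const_lt (half_lt_self hq0)] with z h3 h4 n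
  constructor
  · intro hz1
    exact (hM (half_pos (hp0 _ hz)) h3 (norm_nonneg _) (abs_nonneg _)
      (hC _ (hint n) z hz1)).trans (le_max_left _ _)
  · intro hz1
    have hz0 : z ≠ 0 := norm_pos_iff.1 (one_pos.trans hz1)
    have hev : ∀ z : ℂ, z ≠ 0 → ‖((Φ n).reverse.map (starRingEnd ℂ)).eval ((starRingEnd ℂ) z⁻¹)‖ =
        ‖(z ^ n)⁻¹ * (Φ n).eval z‖ := fun z hz0 => by
      rw [eval_map_conj, Complex.norm_conj, eval_reverse_inv _ hz0, hΦ.natDegree_eq]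
    have h5 := hC ((Φ n).reverse.map (starRingEnd ℂ)) (by
      refine le_of_eq_of_le ?_ (hint n)
      congr 1
      ext θ
      have := hev _ (circlePoint_ne_zero θ)
      rw [map_inv₀, conj_circlePoint, inv_inv] at this
      rw [this, norm_mul, norm_inv, norm_pow, norm_circlePoint, one_pow, inv_one, one_mul])
      ((starRingEnd ℂ) z⁻¹) (by
        rw [Complex.norm_conj, norm_inv]
        exact inv_lt_one_of_one_lt₀ hz1)
    rw [hev z hz0, Complex.norm_conj, norm_inv] at h5
    have h6 : |1 - ‖z‖⁻¹| = ‖z‖⁻¹ * |1 - ‖z‖| := by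
      have hzn : 0 < ‖z‖ := one_pos.trans hz1
      rw [← abs_of_pos (inv_pos.2 hzn), ← abs_mul, abs_of_pos (inv_pos.2 hzn), mul_sub,
        inv_mul_cancel₀ hzn.ne', mul_one, abs_sub_comm]
    rw [h6] at h5
    refine (hM (half_pos hq0) h4 (norm_nonneg _) (abs_nonneg _) ?_).trans (le_max_right _ _)
    refine le_of_eq_of_le ?_ h5
    rw [hq]
    ring

end IsSzegoData

/-- The density `z ^ (-n) P(z) W(z)` on the unit circle. -/
noncomputable def circleDensity (W : ℂ → ℝ) (P : ℂ[X]) (n : ℕ) (θ : ℝ) : ℂ :=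
  (circlePoint θ ^ n)⁻¹ * P.eval (circlePoint θ) * (W (circlePoint θ) : ℂ)

/-- The continuation of `circleDensity` to the slit annulus. -/
noncomputable def densityExt {m : ℕ} (a : Fin m → ℂ) (β : Fin m → ℝ) (w : ℂ → ℂ) (P : ℂ[X]) (n : ℕ)
    (z : ℂ) : ℂ :=
  (z ^ n)⁻¹ * P.eval z * weightExt a β w z

/-- The Cauchy integral of `circleDensity`, regularized so as to be continuous across the circle. -/
noncomputable def densityDefect {m : ℕ} (a : Fin m → ℂ) (β : Fin m → ℝ) (w : ℂ → ℂ) (W : ℂ → ℝ)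
    (P : ℂ[X]) (n : ℕ) (z : ℂ) : ℂ :=
  cauchyMean (fun θ => circleDensity W P n θ - densityExt a β w P n z) z

/-- The component of the scattering solution that is holomorphic across the circle from inside. -/
noncomputable def solutionX {m : ℕ} (a : Fin m → ℂ) (β : Fin m → ℝ) (w : ℂ → ℂ) (W : ℂ → ℝ)
    (Di : ℂ → ℂ) (P : ℂ[X]) (n : ℕ) (z : ℂ) : ℂ :=
  (densityDefect a β w W P n z + densityExt a β w P n z) / Di z

/-- The component of the scattering solution that is holomorphic across the circle from outside. -/
noncomputable def solutionY {m : ℕ} (a : Fin m → ℂ) (β : Fin m → ℝ) (w : ℂ → ℂ) (W : ℂ → ℝ)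
    (De : ℂ → ℂ) (P : ℂ[X]) (n : ℕ) (z : ℂ) : ℂ :=
  -(z ^ n * De z * densityDefect a β w W P n z)

namespace IsSzegoData
variable {m : ℕ} {ρ δ : ℝ} {a : Fin m → ℂ} {β : Fin m → ℝ} {w : ℂ → ℂ} {W : ℂ → ℝ}
  {Di De : ℂ → ℂ} {Sk : Fin m → ℂ → ℂ} {Φ : ℕ → ℂ[X]} {z : ℂ}

theorem intervalIntegrable_circleDensity (h : IsSzegoData ρ a β w W Di De) (P : ℂ[X]) (n : ℕ) :
    IntervalIntegrable (circleDensity W P n) volume 0 (2 * π) :=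
  IsOrthogonalFamily.intervalIntegrable_mul (((continuous_circlePoint.pow n).inv₀
    fun θ => pow_ne_zero _ (circlePoint_ne_zero θ)).mul
      (IsOrthogonalFamily.continuous_eval_circlePoint P)) h.intervalIntegrable_W

theorem intervalIntegrable_eval_mul (h : IsSzegoData ρ a β w W Di De) (P : ℂ[X]) :
    IntervalIntegrable (fun θ => P.eval (circlePoint θ) * (W (circlePoint θ) : ℂ)) volume 0
      (2 * π) :=
  IsOrthogonalFamily.intervalIntegrable_mul
    (IsOrthogonalFamily.continuous_eval_circlePoint P) h.intervalIntegrable_W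

theorem densityDefect_of_norm_lt_one (h : IsSzegoData ρ a β w W Di De) (P : ℂ[X]) (n : ℕ)
    (hz : ‖z‖ < 1) : densityDefect a β w W P n z =
      cauchyMean (circleDensity W P n) z - densityExt a β w P n z :=
  cauchyMean_sub_of_norm_lt_one (h.intervalIntegrable_circleDensity P n) _ hz

theorem densityDefect_of_one_lt_norm (h : IsSzegoData ρ a β w W Di De) (P : ℂ[X]) (n : ℕ)
    (hz : 1 < ‖z‖) : densityDefect a β w W P n z = cauchyMean (circleDensity W P n) z :=
  cauchyMean_sub_of_one_lt_norm (h.intervalIntegrable_circleDensity P n) _ hz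

theorem solutionX_of_norm_lt_one (h : IsSzegoData ρ a β w W Di De) (P : ℂ[X]) (n : ℕ)
    (hz : ‖z‖ < 1) : solutionX a β w W Di P n z = cauchyMean (circleDensity W P n) z / Di z := by
  rw [solutionX, h.densityDefect_of_norm_lt_one P n hz, sub_add_cancel]

theorem densityExt_div (h : IsSzegoData ρ a β w W Di De) (P : ℂ[X]) (n : ℕ)
    (hz : z ∈ slitAnnulus ρ a) : densityExt a β w P n z / Di z = (z ^ n)⁻¹ * P.eval z / De z := by
  have h1 := h.weightExt_ne_zero hz
  have h2 := h.De_ne_zero hz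
  rw [h.Di_eq_weightExt_mul hz, densityExt]
  field_simp

theorem solutionX_of_one_lt_norm (h : IsSzegoData ρ a β w W Di De) (P : ℂ[X]) (n : ℕ)
    (hz : z ∈ slitAnnulus ρ a) (hz1 : 1 < ‖z‖) : solutionX a β w W Di P n z =
      cauchyMean (circleDensity W P n) z / Di z + (z ^ n)⁻¹ * P.eval z / De z := by
  rw [solutionX, h.densityDefect_of_one_lt_norm P n hz1, add_div, h.densityExt_div P n hz]

theorem solutionY_of_norm_lt_one (h : IsSzegoData ρ a β w W Di De) (P : ℂ[X]) (n : ℕ)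
    (hz : z ∈ slitAnnulus ρ a) (hz1 : ‖z‖ < 1) : solutionY a β w W De P n z =
      -(z ^ n * De z * cauchyMean (circleDensity W P n) z) + P.eval z * Di z := by
  have h0 := pow_ne_zero n (h.ne_zero_of_lt hz.1.1)
  rw [solutionY, h.densityDefect_of_norm_lt_one P n hz1, h.Di_eq_weightExt_mul hz, densityExt]
  field_simp
  ring

theorem solutionY_of_one_lt_norm (h : IsSzegoData ρ a β w W Di De) (hΦ : IsOrthogonalFamily W Φ)
    (n : ℕ) (hz1 : 1 < ‖z‖) : solutionY a β w W De (Φ n) n z =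
      -(De z * cauchyMean (fun θ => (Φ n).eval (circlePoint θ) * (W (circlePoint θ) : ℂ)) z) := by
  rw [solutionY, h.densityDefect_of_one_lt_norm _ n hz1,
    ← hΦ.pow_mul_cauchyMean h.intervalIntegrable_W n hz1.ne', mul_comm (z ^ n), mul_assoc]
  rfl

theorem eval_eq_solution (h : IsSzegoData ρ a β w W Di De) (P : ℂ[X]) (n : ℕ)
    (hz : z ∈ slitAnnulus ρ a) : P.eval z = z ^ n * De z * solutionX a β w W Di P n z +
      solutionY a β w W De P n z / Di z := by
  have h0 := pow_ne_zero n (h.ne_zero_of_lt hz.1.1)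
  have h1 := h.weightExt_ne_zero hz
  have h2 := h.De_ne_zero hz
  rw [solutionX, solutionY, h.Di_eq_weightExt_mul hz, densityExt]
  field_simp
  ring

theorem mem_slitAnnulus_of_one_le (h : IsSzegoData ρ a β w W Di De) (h1 : 1 ≤ ‖z‖)
    (h2 : ‖z‖ < 1 / ρ) (hz : z ∉ slits a (Ici 1)) : z ∈ slitAnnulus ρ a := by
  refine ⟨⟨h.lt_one.trans_le h1, h2⟩, fun hs => hz ?_⟩
  obtain ⟨k, t, ht, e⟩ := mem_slits.1 hs
  refine mem_slits.2 ⟨k, t, ?_, e⟩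
  rwa [← e, norm_mul, h.norm_eq_one, mul_one, Complex.norm_real, Real.norm_of_nonneg ht] at h1

theorem mem_slitAnnulus_of_le_one (h : IsSzegoData ρ a β w W Di De) (h1 : ρ < ‖z‖)
    (h2 : ‖z‖ ≤ 1) (hz : z ∉ slits a (Icc 0 1)) : z ∈ slitAnnulus ρ a := by
  refine ⟨⟨h1, h2.trans_lt h.one_lt_inv⟩, fun hs => hz ?_⟩
  obtain ⟨k, t, ht, e⟩ := mem_slits.1 hs
  refine mem_slits.2 ⟨k, t, ⟨ht, ?_⟩, e⟩
  rwa [← e, norm_mul, h.norm_eq_one, mul_one, Complex.norm_real, Real.norm_of_nonneg ht] at h2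

theorem differentiableOn_densityExt (h : IsSzegoData ρ a β w W Di De) (P : ℂ[X]) (n : ℕ) :
    DifferentiableOn ℂ (densityExt a β w P n) (slitAnnulus ρ a) := by
  refine (DifferentiableOn.mul ?_ P.differentiable.differentiableOn).mul h.differentiableOn_weightExt
  exact (differentiableOn_id.pow n).inv fun z hz => pow_ne_zero n (h.ne_zero_of_lt hz.1.1)

theorem differentiableAt_densityDefect (h : IsSzegoData ρ a β w W Di De) (P : ℂ[X]) (n : ℕ)
    (hz : z ∈ slitAnnulus ρ a ∨ 1 < ‖z‖) : DifferentiableAt ℂ (densityDefect a β w W P n) z := by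
  have hG : ‖z‖ ≠ 1 → DifferentiableAt ℂ (cauchyMean (circleDensity W P n)) z := fun hz1 =>
    (differentiableOn_cauchyMean (h.intervalIntegrable_circleDensity P n)).differentiableAt
      (isOpen_norm_ne_one.mem_nhds hz1)
  by_cases h1 : 1 < ‖z‖
  · refine (hG h1.ne').congr_of_eventuallyEq ?_
    filter_upwards [(isOpen_lt continuous_const continuous_norm).mem_nhds h1] with y hy
    exact h.densityDefect_of_one_lt_norm P n hy
  · have hs := hz.resolve_right h1
    rcases (not_lt.1 h1).lt_or_eq with h2 | h2
    · refine ((hG h2.ne).sub ((h.differentiableOn_densityExt P n).differentiableAt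
        (h.isOpen_slitAnnulus.mem_nhds hs))).congr_of_eventuallyEq ?_
      filter_upwards [(isOpen_lt continuous_norm continuous_const).mem_nhds h2] with y hy
      exact h.densityDefect_of_norm_lt_one P n hy
    · obtain ⟨s, hs0, hsub⟩ := Metric.isOpen_iff.1 h.isOpen_slitAnnulus z hs
      refine (differentiableOn_cauchyMean_sub (h.intervalIntegrable_circleDensity P n)
        ((h.differentiableOn_densityExt P n).mono hsub) fun θ _ => ?_).differentiableAt
        (ball_mem_nhds z (by positivity))
      rw [circleDensity, densityExt, h.weightExt_of_norm_eq_one (norm_circlePoint θ)]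

theorem differentiableOn_solutionX (h : IsSzegoData ρ a β w W Di De) (P : ℂ[X]) (n : ℕ) :
    DifferentiableOn ℂ (solutionX a β w W Di P n) ({z | ‖z‖ < 1 / ρ} \ slits a (Ici 1)) := by
  intro z hz
  refine DifferentiableAt.differentiableWithinAt ?_
  rcases lt_or_ge ‖z‖ 1 with h1 | h1
  · have hG : DifferentiableAt ℂ (fun z => cauchyMean (circleDensity W P n) z / Di z) z :=
      ((differentiableOn_cauchyMean (h.intervalIntegrable_circleDensity P n)).differentiableAt
        (isOpen_norm_ne_one.mem_nhds h1.ne)).div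
        (h.differentiableOn_Di_ball.differentiableAt (isOpen_ball.mem_nhds
          (mem_ball_zero_iff.2 h1))) (h.Di_ne_zero_of_norm_lt_one h1)
    refine hG.congr_of_eventuallyEq ?_
    filter_upwards [(isOpen_lt continuous_norm continuous_const).mem_nhds h1] with y hy
    exact h.solutionX_of_norm_lt_one P n hy
  · have hs := h.mem_slitAnnulus_of_one_le h1 hz.1 hz.2
    have hn := h.isOpen_slitAnnulus.mem_nhds hs
    exact ((h.differentiableAt_densityDefect P n (Or.inl hs)).add
      ((h.differentiableOn_densityExt P n).differentiableAt hn)).div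
      (h.differentiableOn_Di.differentiableAt hn) (h.Di_ne_zero hs)

theorem differentiableOn_solutionY (h : IsSzegoData ρ a β w W Di De) (P : ℂ[X]) (n : ℕ) :
    DifferentiableOn ℂ (solutionY a β w W De P n) ({z | ρ < ‖z‖} \ slits a (Icc 0 1)) := by
  intro z hz
  have hD : DifferentiableAt ℂ De z ∧ (z ∈ slitAnnulus ρ a ∨ 1 < ‖z‖) := by
    rcases lt_or_ge 1 ‖z‖ with h1 | h1
    · exact ⟨h.differentiableOn_De_one_lt.differentiableAt
        ((isOpen_lt continuous_const continuous_norm).mem_nhds h1), Or.inr h1⟩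
    · have hs := h.mem_slitAnnulus_of_le_one hz.1 h1 hz.2
      exact ⟨h.differentiableOn_De.differentiableAt (h.isOpen_slitAnnulus.mem_nhds hs), Or.inl hs⟩
  exact ((((differentiableAt_id.pow n).mul hD.1).mul
    (h.differentiableAt_densityDefect P n hD.2)).neg).differentiableWithinAt

theorem norm_cauchyMean_circleDensity_le (h : IsSzegoData ρ a β w W Di De)
    (hΦ : IsOrthogonalFamily W Φ) (n : ℕ) (hz : ‖z‖ ≠ 1) :
    ‖cauchyMean (circleDensity W (Φ n) n) z‖ * |1 - ‖z‖| ≤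
        (2 * π)⁻¹ * ∫ θ in (0 : ℝ)..(2 * π), W (circlePoint θ) ∧
      ‖cauchyMean (fun θ => (Φ n).eval (circlePoint θ) * (W (circlePoint θ) : ℂ)) z‖ *
        |1 - ‖z‖| ≤ (2 * π)⁻¹ * ∫ θ in (0 : ℝ)..(2 * π), W (circlePoint θ) := by
  have hW0 : ∀ θ, 0 ≤ W (circlePoint θ) := fun θ => h.W_nonneg (norm_circlePoint θ)
  have h1 := hΦ.integral_norm_le h.intervalIntegrable_W hW0 n
  have h2 : ∀ θ, ‖(Φ n).eval (circlePoint θ) * (W (circlePoint θ) : ℂ)‖ =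
      ‖(Φ n).eval (circlePoint θ)‖ * W (circlePoint θ) := fun θ => by
    rw [norm_mul, Complex.norm_real, Real.norm_of_nonneg (hW0 θ)]
  have h3 : ∀ θ, ‖circleDensity W (Φ n) n θ‖ =
      ‖(Φ n).eval (circlePoint θ)‖ * W (circlePoint θ) := fun θ => by
    rw [circleDensity, mul_assoc, norm_mul, h2, norm_inv, norm_pow, norm_circlePoint, one_pow,
      inv_one, one_mul]
  have h4 := norm_cauchyMean_le (h.intervalIntegrable_circleDensity (Φ n) n) hz
  have h5 := norm_cauchyMean_le (h.intervalIntegrable_eval_mul (Φ n)) hz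
  simp only [h3] at h4
  simp only [h2] at h5
  have h6 := mul_le_mul_of_nonneg_left h1 (by positivity : (0 : ℝ) ≤ (2 * π)⁻¹)
  exact ⟨h4.trans h6, h5.trans h6⟩

end IsSzegoData

theorem abs_le_two_mul_abs_one_sub_exp {x : ℝ} (hx : |x| ≤ 1) : |x| ≤ 2 * |1 - Real.exp x| := by
  obtain ⟨h1, h2⟩ := abs_le.1 hx
  rcases le_total 0 x with h | h
  · rw [abs_of_nonneg h, abs_sub_comm, abs_of_nonneg (by linarith [Real.add_one_le_exp x])]
    linarith [Real.add_one_le_exp x]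
  · rw [abs_of_nonpos h, abs_of_nonneg (by linarith [Real.exp_le_one_iff.2 h])]
    have h4 : Real.exp x * (1 - x) ≤ 1 := by
      have := Real.add_one_le_exp (-x)
      calc Real.exp x * (1 - x) ≤ Real.exp x * Real.exp (-x) := by gcongr; linarith
        _ = 1 := by rw [← Real.exp_add]; simp
    have := Real.exp_pos x
    nlinarith

/-- Holomorphic functions near a point of the unit circle that are `O(|1 - ‖z‖|⁻¹)` are locally
bounded, uniformly in the function. -/
theorem exists_eventually_norm_le_of_norm_mul_le {z₀ : ℂ} (hz₀ : ‖z₀‖ = 1) {s : Set ℂ}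
    (hs : s ∈ nhds z₀) {M : ℝ} (hM : 0 ≤ M) : ∃ M', ∀ᶠ z in nhds z₀, ∀ f : ℂ → ℂ,
      DifferentiableOn ℂ f s → (∀ z ∈ s, ‖z‖ ≠ 1 → ‖f z‖ * |1 - ‖z‖| ≤ M) → ‖f z‖ ≤ M' := by
  have hz0 : z₀ ≠ 0 := norm_ne_zero_iff.1 (by simp [hz₀])
  have hE : Differentiable ℂ fun l : ℂ => z₀ * Complex.exp l := by fun_prop
  obtain ⟨R', hR', hb⟩ := Metric.eventually_nhds_iff.1 ((tendsto_mul_exp z₀).eventually hs)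
  obtain ⟨R, hR, hRR⟩ : ∃ R : ℝ, 0 < R ∧ R < min R' 1 := exists_between (by positivity)
  have hin : MapsTo (fun l : ℂ => z₀ * Complex.exp l) (closedBall 0 R) s := fun l hl => by
    refine hb ((mem_closedBall.1 hl).trans_lt (hRR.trans_le (min_le_left _ _)))
  refine ⟨2 * M * (3 / R) ^ 1, ?_⟩
  have hlog : Tendsto (fun z => Complex.log (z / z₀)) (nhds z₀) (nhds 0) := by
    have : ContinuousAt (fun z => Complex.log (z / z₀)) z₀ :=
      (continuousAt_id.div_const z₀).clog (by simp [div_self hz0])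
    simpa [ContinuousAt, div_self hz0] using this
  filter_upwards [hlog.eventually (closedBall_mem_nhds 0 (half_pos hR)),
    isOpen_ne.mem_nhds hz0] with z hz hzne f hf hfb
  have hexp : z₀ * Complex.exp (Complex.log (z / z₀)) = z := by
    rw [Complex.exp_log (div_ne_zero hzne hz0), mul_div_cancel₀ _ hz0]
  have hnorm : ∀ l : ℂ, ‖z₀ * Complex.exp l‖ = Real.exp l.re := fun l => by
    rw [norm_mul, hz₀, one_mul, Complex.norm_exp]
  have hd : DiffContOnCl ℂ (fun l => f (z₀ * Complex.exp l)) (ball 0 R) := by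
    refine DifferentiableOn.diffContOnCl ?_
    rw [closure_ball 0 hR.ne']
    exact hf.comp hE.differentiableOn hin
  have := norm_le_of_norm_mul_abs_re_pow_le hR hd (k := 1) (B := 2 * M) (fun l hl => ?_) _ hz
  · simpa only [hexp] using this
  · have hl1 : |l.re| ≤ 1 := (Complex.abs_re_le_norm l).trans
      ((mem_sphere_zero_iff_norm.1 hl).le.trans (hRR.le.trans (min_le_right _ _)))
    rw [sub_zero, pow_one]
    by_cases h0 : l.re = 0
    · rw [h0, abs_zero, mul_zero]; positivity
    have h1 := hfb _ (hin (sphere_subset_closedBall hl)) (by rw [hnorm]; simpa using h0)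
    rw [hnorm] at h1
    calc _ ≤ ‖f (z₀ * Complex.exp l)‖ * (2 * |1 - Real.exp l.re|) := by
          gcongr; exact abs_le_two_mul_abs_one_sub_exp hl1
      _ ≤ 2 * M := by linarith

namespace IsSzegoData
variable {m : ℕ} {ρ δ r : ℝ} {a : Fin m → ℂ} {β : Fin m → ℝ} {w : ℂ → ℂ} {W : ℂ → ℝ}
  {Di De : ℂ → ℂ} {Sk : Fin m → ℂ → ℂ} {Φ : ℕ → ℂ[X]} {τ : ℂ}

/-- Cauchy means of integrable densities are `o(|1 - ‖z‖|⁻¹)` in logarithmic coordinates. -/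
theorem exists_cauchyMean_mul_le (h : IsSzegoData ρ a β w W Di De) {F : ℝ → ℂ}
    (hF : IntervalIntegrable F volume 0 (2 * π)) (k : Fin m) {ε : ℝ} (hε : 0 < ε) :
    ∃ s > 0, ∀ l : ℂ, ‖l‖ < s → ‖cauchyMean F (a k * Complex.exp l)‖ * |l.re| ≤ ε := by
  have hl := (tendsto_norm_cauchyMean_mul hF (h.norm_eq_one k)).comp (tendsto_mul_exp (a k))
  obtain ⟨s, hs, hb⟩ := Metric.eventually_nhds_iff.1 (hl.eventually_le_const (half_pos hε))
  refine ⟨min s 1, by positivity, fun l hl => ?_⟩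
  have h1 := hb (by simpa using hl.trans_le (min_le_left _ _))
  simp only [Function.comp, norm_mul_exp h.norm_eq_one] at h1
  have h2 := abs_le_two_mul_abs_one_sub_exp
    ((Complex.abs_re_le_norm l).trans (hl.le.trans (min_le_right _ _)))
  calc _ ≤ ‖cauchyMean F (a k * Complex.exp l)‖ * (2 * |1 - Real.exp l.re|) := by gcongr
    _ ≤ ε := by linarith

theorem exists_norm_eval_mul_exp_le (P : ℂ[X]) {b : ℂ} (hb : b ≠ 0) (n : ℕ) :
    ∃ M > 0, ∃ s > 0, ∀ l : ℂ, ‖l‖ < s → ‖P.eval (b * Complex.exp l)‖ ≤ M ∧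
      ‖((b * Complex.exp l) ^ n)⁻¹ * P.eval (b * Complex.exp l)‖ ≤ M := by
  have h0 : b * Complex.exp 0 ≠ 0 := by simpa using hb
  have hc : ContinuousAt (fun l => P.eval (b * Complex.exp l)) 0 := by
    exact (P.continuous.comp (by fun_prop : Continuous fun l => b * Complex.exp l)).continuousAt
  have hc' : ContinuousAt (fun l => ((b * Complex.exp l) ^ n)⁻¹ * P.eval (b * Complex.exp l)) 0 :=
    ((by fun_prop : ContinuousAt (fun l => (b * Complex.exp l) ^ n) 0).inv₀
      (pow_ne_zero n h0)).mul hc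
  obtain ⟨s, hs, h⟩ := Metric.eventually_nhds_iff.1
    ((hc.norm.eventually_le_const (lt_add_one _)).and
      (hc'.norm.eventually_le_const (lt_add_one _)))
  set M := ‖P.eval (b * Complex.exp 0)‖ + 1
  set M' := ‖((b * Complex.exp 0) ^ n)⁻¹ * P.eval (b * Complex.exp 0)‖ + 1
  refine ⟨max M M', lt_max_of_lt_left (by positivity), s, hs, fun l hl => ?_⟩
  have := h (by simpa using hl : dist l 0 < s)
  exact ⟨this.1.trans (le_max_left _ _), this.2.trans (le_max_right _ _)⟩

theorem isScatteringSolution (h : IsSzegoData ρ a β w W Di De)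
    (hS : HasScatteringContinuation δ a β Di De Sk) (hΦ : IsOrthogonalFamily W Φ)
    (hτ : Tendsto De (Bornology.cobounded ℂ) (nhds τ)) (hτ0 : τ ≠ 0) (hr : Real.exp r ≤ 1 / ρ)
    (n : ℕ) :
    IsScatteringSolution r a β (fun z => Di z * De z) τ⁻¹ n (solutionX a β w W Di (Φ n) n)
      (solutionY a β w W De (Φ n) n) (fun z => (Φ n).eval z * Di z)
      (fun z => (z ^ n)⁻¹ * (Φ n).eval z / De z) := by
  have hr' : ρ ≤ Real.exp (-r) := by
    rw [Real.exp_neg]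
    exact (le_inv_comm₀ h.pos (Real.exp_pos r)).2 (by rwa [one_div] at hr)
  have hlt : ∀ k, ∀ l : ℂ, l.re < 0 → ‖a k * Complex.exp l‖ < 1 := fun k l hl => by
    rw [norm_mul_exp h.norm_eq_one]; exact Real.exp_lt_one_iff.2 hl
  have hgt : ∀ k, ∀ l : ℂ, 0 < l.re → 1 < ‖a k * Complex.exp l‖ := fun k l hl => by
    rw [norm_mul_exp h.norm_eq_one]; exact Real.one_lt_exp_iff.2 hl
  have hpow : ∀ (l : ℂ) (b : ℝ), 0 < ‖l‖ → ‖l‖ ^ (-b) * ‖l‖ ^ b = 1 := fun l b hl => by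
    rw [← Real.rpow_add hl]; simp
  have hcob : ∀ᶠ z : ℂ in Bornology.cobounded ℂ, 1 < ‖z‖ :=
    tendsto_norm_cobounded_atTop.eventually_gt_atTop 1
  constructor
  · exact (h.differentiableOn_solutionX _ n).mono
      (sdiff_subset_sdiff_left fun z hz => lt_of_lt_of_le hz hr)
  · exact (h.differentiableOn_solutionY _ n).mono
      (sdiff_subset_sdiff_left fun z hz => lt_of_le_of_lt hr' hz)
  · exact (Φ n).differentiable.differentiableOn.mul h.differentiableOn_Di_ball
  · refine DifferentiableOn.div (DifferentiableOn.mul ?_ (Φ n).differentiable.differentiableOn)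
      h.differentiableOn_De_one_lt fun z hz => h.De_ne_zero_of_one_lt_norm hz
    exact (differentiableOn_id.pow n).inv fun z hz =>
      pow_ne_zero n (norm_pos_iff.1 (one_pos.trans hz))
  · intro z h1 h2 h3
    have hz : z ∈ slitAnnulus ρ a := ⟨⟨hr'.trans_lt h1, h2.trans h.one_lt_inv⟩, h3⟩
    have := h.Di_ne_zero hz
    simp only [h.eval_eq_solution (Φ n) n hz]
    field_simp
    ring
  · intro z h1 h2 h3
    have hz : z ∈ slitAnnulus ρ a := ⟨⟨h.lt_one.trans h1, h2.trans_le hr⟩, h3⟩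
    have := h.Di_ne_zero hz
    have := h.De_ne_zero hz
    have := pow_ne_zero n (h.ne_zero_of_lt hz.1.1)
    simp only [h.eval_eq_solution (Φ n) n hz]
    field_simp
  · have h1 := (tendsto_eval_reverse_inv (hΦ.monic n)).div hτ hτ0
    rw [one_div] at h1
    refine h1.congr' ?_
    filter_upwards [hcob] with z hz
    simp only [Pi.div_apply]
    rw [eval_reverse_inv _ (norm_pos_iff.1 (one_pos.trans hz)), hΦ.natDegree_eq]
  · have h1 := (hτ.mul (tendsto_cauchyMean_cobounded (h.intervalIntegrable_eval_mul (Φ n)))).neg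
    rw [mul_zero, neg_zero] at h1
    refine h1.congr' ?_
    filter_upwards [hcob] with z hz
    rw [h.solutionY_of_one_lt_norm hΦ n hz]
  · intro k
    obtain ⟨C, hC, s, hs, hb⟩ := h.exists_norm_Di_bound hS k
    obtain ⟨M, hM, s', hs', hb'⟩ := exists_norm_eval_mul_exp_le (Φ n) (h.a_ne_zero k) n
    refine ⟨M * C, min s s', lt_min hs hs', fun l hl hls => ?_⟩
    rw [norm_mul, mul_assoc]
    exact mul_le_mul (hb' l (hls.trans_le (min_le_right _ _))).1
      (hb l hl (hls.trans_le (min_le_left _ _))).1 (norm_nonneg _) hM.le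
  · intro k
    obtain ⟨C, hC, s, hs, hb⟩ := h.exists_norm_De_bound hS k
    obtain ⟨M, hM, s', hs', hb'⟩ := exists_norm_eval_mul_exp_le (Φ n) (h.a_ne_zero k) n
    refine ⟨M * C, min s s', lt_min hs hs', fun l hl hls => ?_⟩
    rw [norm_div, div_eq_mul_inv, mul_assoc]
    exact mul_le_mul (hb' l (hls.trans_le (min_le_right _ _))).2
      (hb l hl (hls.trans_le (min_le_left _ _))).2 (by positivity) hM.le
  · intro k ε hε
    obtain ⟨C, hC, s, hs, hb⟩ := h.exists_norm_Di_bound hS k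
    obtain ⟨s', hs', hb'⟩ := h.exists_cauchyMean_mul_le
      (h.intervalIntegrable_circleDensity (Φ n) n) k (div_pos hε hC)
    refine ⟨min s s', lt_min hs hs', fun l hl hls => ?_⟩
    have hl0 : 0 < ‖l‖ := norm_pos_iff.2 (by rintro rfl; simp at hl)
    have h1 := (hb l hl (hls.trans_le (min_le_left _ _))).2
    have h2 := hb' l (hls.trans_le (min_le_right _ _))
    rw [h.solutionX_of_norm_lt_one _ n (hlt k l hl), norm_div, div_eq_mul_inv]
    set G := ‖cauchyMean (circleDensity W (Φ n) n) (a k * Complex.exp l)‖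
    calc _ ≤ G * (C * ‖l‖ ^ (-β k)) * ‖l‖ ^ β k * |l.re| := by gcongr
      _ = (‖l‖ ^ (-β k) * ‖l‖ ^ β k) * C * (G * |l.re|) := by ring
      _ ≤ C * (ε / C) := by rw [hpow l _ hl0, one_mul]; gcongr
      _ = ε := by field_simp
  · intro k ε hε
    obtain ⟨C, hC, s, hs, hb⟩ := h.exists_norm_De_bound hS k
    obtain ⟨s', hs', hb'⟩ := h.exists_cauchyMean_mul_le
      (h.intervalIntegrable_eval_mul (Φ n)) k (div_pos hε hC)
    refine ⟨min s s', lt_min hs hs', fun l hl hls => ?_⟩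
    have hl0 : 0 < ‖l‖ := norm_pos_iff.2 (by rintro rfl; simp at hl)
    have h1 := (hb l hl (hls.trans_le (min_le_left _ _))).1
    have h2 := hb' l (hls.trans_le (min_le_right _ _))
    rw [h.solutionY_of_one_lt_norm hΦ n (hgt k l hl), norm_neg, norm_mul]
    set G := ‖cauchyMean (fun θ => (Φ n).eval (circlePoint θ) * (W (circlePoint θ) : ℂ))
      (a k * Complex.exp l)‖
    calc _ ≤ C * ‖l‖ ^ (-β k) * G * ‖l‖ ^ β k * |l.re| := by gcongr
      _ = (‖l‖ ^ (-β k) * ‖l‖ ^ β k) * C * (G * |l.re|) := by ring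
      _ ≤ C * (ε / C) := by rw [hpow l _ hl0, one_mul]; gcongr
      _ = ε := by field_simp

theorem exists_local_solution_mul_bound (h : IsSzegoData ρ a β w W Di De)
    (hΦ : IsOrthogonalFamily W Φ) {z₀ : ℂ} (h1 : ρ < ‖z₀‖) (h2 : ‖z₀‖ < 1 / ρ)
    (hz : ∀ k, z₀ ≠ a k) : ∃ M, 0 ≤ M ∧ ∀ᶠ z in nhds z₀, ∀ n, z ∉ slits a (Ici 0) → ‖z‖ ≠ 1 →
      ‖solutionX a β w W Di (Φ n) n z‖ * |1 - ‖z‖| ≤ M ∧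
      ‖solutionY a β w W De (Φ n) n z‖ * |1 - ‖z‖| ≤ M := by
  obtain ⟨A, hA⟩ := h.exists_local_bound h1 h2 hz
  obtain ⟨E, hE⟩ := h.exists_local_norm_eval_bound hΦ (h.ne_zero_of_lt h1) hz
  set I := (2 * π)⁻¹ * ∫ θ in (0 : ℝ)..(2 * π), W (circlePoint θ)
  refine ⟨|A| * (|I| + |E|), by positivity, ?_⟩
  filter_upwards [hA, hE, (isOpen_annulus ρ).mem_nhds ⟨h1, h2⟩] with z hA hE hann n hzs hz1
  obtain ⟨hA1, hA2, hA3, hA4⟩ := hA hzs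
  have hs : z ∈ slitAnnulus ρ a := ⟨hann, hzs⟩
  obtain ⟨hG, hH⟩ := h.norm_cauchyMean_circleDensity_le hΦ n hz1
  replace hG := hG.trans (le_abs_self I)
  replace hH := hH.trans (le_abs_self I)
  replace hA1 := hA1.trans (le_abs_self A)
  replace hA2 := hA2.trans (le_abs_self A)
  replace hA3 := hA3.trans (le_abs_self A)
  replace hA4 := hA4.trans (le_abs_self A)
  have hAI : |A| * |I| ≤ |A| * (|I| + |E|) := by gcongr; linarith [abs_nonneg E]
  rcases lt_or_gt_of_ne hz1 with hlt | hgt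
  · have hP := ((hE n).1 hlt).trans (le_abs_self E)
    rw [h.solutionX_of_norm_lt_one _ n hlt, h.solutionY_of_norm_lt_one _ n hs hlt]
    set G := cauchyMean (circleDensity W (Φ n) n) z
    constructor
    · refine le_trans ?_ hAI
      rw [norm_div, div_eq_inv_mul, mul_assoc]
      gcongr
    · calc _ ≤ (‖z ^ n * De z * G‖ + ‖(Φ n).eval z * Di z‖) * |1 - ‖z‖| := by
            gcongr; exact (norm_add_le _ _).trans_eq (by rw [norm_neg])
        _ = ‖z‖ ^ n * ‖De z‖ * (‖G‖ * |1 - ‖z‖|) +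
            ‖Di z‖ * (‖(Φ n).eval z‖ * |1 - ‖z‖|) := by
            rw [norm_mul, norm_mul, norm_mul, norm_pow]; ring
        _ ≤ 1 * |A| * |I| + |A| * |E| := by
            gcongr; exact pow_le_one₀ (norm_nonneg z) hlt.le
        _ = _ := by ring
  · have hP := ((hE n).2 hgt).trans (le_abs_self E)
    rw [h.solutionX_of_one_lt_norm _ n hs hgt, h.solutionY_of_one_lt_norm hΦ n hgt]
    constructor
    · set G := cauchyMean (circleDensity W (Φ n) n) z
      set Q := (z ^ n)⁻¹ * (Φ n).eval z
      calc _ ≤ (‖G / Di z‖ + ‖Q / De z‖) * |1 - ‖z‖| := by gcongr; exact norm_add_le _ _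
        _ = ‖Di z‖⁻¹ * (‖G‖ * |1 - ‖z‖|) + ‖De z‖⁻¹ * (‖Q‖ * |1 - ‖z‖|) := by
            rw [norm_div, norm_div]; ring
        _ ≤ |A| * |I| + |A| * |E| := by gcongr
        _ = _ := by ring
    · refine le_trans ?_ hAI
      rw [norm_neg, norm_mul, mul_assoc]
      gcongr

theorem exists_local_solution_bound (h : IsSzegoData ρ a β w W Di De)
    (hΦ : IsOrthogonalFamily W Φ) {z₀ : ℂ} (h1 : ρ < ‖z₀‖) (h2 : ‖z₀‖ < 1 / ρ)
    (hz : ∀ k, z₀ ≠ a k) : ∃ M, ∀ᶠ z in nhds z₀, ∀ n, z ∉ slits a (Ici 0) →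
      ‖solutionX a β w W Di (Φ n) n z‖ ≤ M ∧ ‖solutionY a β w W De (Φ n) n z‖ ≤ M := by
  obtain ⟨M, hM, hev⟩ := h.exists_local_solution_mul_bound hΦ h1 h2 hz
  by_cases hz1 : ‖z₀‖ = 1
  · have hs := (hev.and (h.isOpen_slitAnnulus.mem_nhds (h.mem_slitAnnulus_of_norm_eq_one hz1 hz)))
    obtain ⟨M', hM'⟩ := exists_eventually_norm_le_of_norm_mul_le hz1 hs hM
    refine ⟨M', hM'.mono fun z hz n _ => ⟨hz _ ?_ fun y hy hy1 => (hy.1 n hy.2.2 hy1).1,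
      hz _ ?_ fun y hy hy1 => (hy.1 n hy.2.2 hy1).2⟩⟩
    · exact (h.differentiableOn_solutionX _ n).mono fun y hy =>
        ⟨hy.2.1.2, fun hs => hy.2.2 (slits_mono (Ici_subset_Ici.2 zero_le_one) hs)⟩
    · exact (h.differentiableOn_solutionY _ n).mono fun y hy =>
        ⟨hy.2.1.1, fun hs => hy.2.2 (slits_mono Icc_subset_Ici_self hs)⟩
  · obtain ⟨d, hd, hlt⟩ := exists_between (abs_pos.2 (sub_ne_zero.2 (Ne.symm hz1)))
    have hc : Continuous fun z : ℂ => |1 - ‖z‖| := by fun_prop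
    refine ⟨M / d, ?_⟩
    filter_upwards [hev, hc.continuousAt.eventually (lt_mem_nhds hlt)] with z hz hdz n hzs
    have h0 : ‖z‖ ≠ 1 := fun h0 => by simp [h0] at hdz; linarith
    obtain ⟨hX, hY⟩ := hz n hzs h0
    constructor <;> rw [le_div_iff₀ hd]
    · exact le_trans (by gcongr) hX
    · exact le_trans (by gcongr) hY

theorem isScatteringFamily (h : IsSzegoData ρ a β w W Di De)
    (hS : HasScatteringContinuation δ a β Di De Sk) (hΦ : IsOrthogonalFamily W Φ)
    (hτ : Tendsto De (Bornology.cobounded ℂ) (nhds τ)) (hτ0 : τ ≠ 0) (hr : Real.exp r ≤ 1 / ρ)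
    (hD : IsScatteringData r a β (fun z => Di z * De z) fun k l => Sk k (a k * Complex.exp l)) :
    IsScatteringFamily r a β (fun z => Di z * De z) (fun k l => Sk k (a k * Complex.exp l)) τ⁻¹
      (fun n => solutionX a β w W Di (Φ n) n) (fun n => solutionY a β w W De (Φ n) n)
      (fun n z => (Φ n).eval z * Di z) (fun n z => (z ^ n)⁻¹ * (Φ n).eval z / De z) where
  data := hD
  sol n := h.isScatteringSolution hS hΦ hτ hτ0 hr n
  bdd z₀ h1 h2 hz := h.exists_local_solution_bound hΦ (lt_of_le_of_lt (by
    rw [Real.exp_neg]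
    exact (le_inv_comm₀ h.pos (Real.exp_pos r)).2 (by rwa [one_div] at hr)) h1)
    (h2.trans_le hr) hz

end IsSzegoData

theorem norm_poleSum_le {m : ℕ} {a d : Fin m → ℂ} {z : ℂ} {δ B : ℝ} (hδ : 0 < δ)
    (ha : ∀ k, ‖a k‖ = 1) (hz : ∀ k, δ ≤ ‖a k - z‖) (hB : ∑ k, ‖d k‖ ≤ B) :
    ‖poleSum a d z‖ ≤ B / δ := by
  calc ‖poleSum a d z‖ ≤ ∑ k, ‖d k‖ / δ := by
        refine (norm_sum_le _ _).trans (Finset.sum_le_sum fun k _ => ?_)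
        rw [norm_div, norm_mul, ha, mul_one]
        exact div_le_div_of_nonneg_left (norm_nonneg _) hδ (hz k)
    _ ≤ B / δ := by rw [← Finset.sum_div]; gcongr

theorem pow_le_of_le_exp_neg {x s : ℝ} (hx : 0 ≤ x) (hs : 0 < s) (hxs : x ≤ Real.exp (-s)) {n : ℕ}
    (hn : 0 < n) : x ^ n ≤ 2 * s⁻¹ ^ 2 * (n : ℝ)⁻¹ ^ 2 := by
  have hn' : (0 : ℝ) < n := Nat.cast_pos.2 hn
  calc x ^ n ≤ Real.exp (-s) ^ n := by gcongr
    _ = Real.exp (-(n * s)) := by rw [← Real.exp_nat_mul]; ring_nf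
    _ ≤ 2 * (n * s)⁻¹ ^ 2 := exp_neg_le_two_mul_inv_sq (by positivity)
    _ = _ := by rw [mul_inv]; ring

theorem IsSzegoData.exists_asymptotics {m : ℕ} {ρ δ : ℝ} {a : Fin m → ℂ} {β : Fin m → ℝ}
    {w : ℂ → ℂ} {W : ℂ → ℝ} {Di De : ℂ → ℂ} {Sk : Fin m → ℂ → ℂ} {Φ : ℕ → ℂ[X]} {τ : ℂ}
    (h : IsSzegoData ρ a β w W Di De) (hS : HasScatteringContinuation δ a β Di De Sk)
    (hΦ : IsOrthogonalFamily W Φ) (hτ : Tendsto De (Bornology.cobounded ℂ) (nhds τ))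
    (hτ0 : τ ≠ 0) (hτ1 : Di 0 = τ⁻¹) {K : Set ℂ} (hK : IsCompact K) (hKs : K ⊆ slitAnnulus ρ a)
    (hKb : ∀ z ∈ K, ∀ k, z ∉ ball (a k) δ) :
    ∃ C, 0 < C ∧ ∃ N : ℕ, ∀ (n : ℕ) (z : ℂ), N ≤ n → z ∈ K → ∃ e₁ e₂ : ℂ,
      ‖e₁‖ ≤ C / (n : ℝ) ^ 2 ∧ ‖e₂‖ ≤ C / (n : ℝ) ^ 2 ∧ (Φ n).eval z =
        z ^ n * (De z / τ) * (1 + (n : ℂ)⁻¹ * poleSum a (fun j => (β j : ℂ) ^ 2) z + e₁) +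
          (Di 0 / Di z) * ((n : ℂ)⁻¹ * poleSum a (fun j => β j * Sk j (a j) * a j ^ n) z + e₂) := by
  obtain ⟨r, hr, hball, hD⟩ := h.exists_isScatteringData hS
  have hr0 := hD.pos
  obtain ⟨C, hC, N, hN⟩ := (h.isScatteringFamily hS hΦ hτ hτ0 hr hD).exists_asymptotics (1 / ρ)
  simp only [Complex.exp_zero, mul_one] at hN
  have hQc : ContinuousOn (fun z => Di z * De z) K :=
    (h.differentiableOn_Di.mul h.differentiableOn_De).continuousOn.mono hKs
  obtain ⟨M₁, hM₁⟩ := hK.exists_bound_of_continuousOn hQc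
  obtain ⟨M₂, hM₂⟩ := hK.exists_bound_of_continuousOn (hQc.inv₀ fun z hz =>
    mul_ne_zero (h.Di_ne_zero (hKs hz)) (h.De_ne_zero (hKs hz)))
  set B₁ := (∑ k, ‖(β k : ℂ) ^ 2‖) / δ
  set B₂ := (∑ k, ‖(β k : ℂ) * Sk k (a k)‖) / δ
  have hδ := hS.pos
  have hB₁ : 0 ≤ B₁ := by positivity
  have hB₂ : 0 ≤ B₂ := by positivity
  set s := 3 * (r / 2) / 4 with hs
  have hs0 : 0 < s := by positivity
  set C' := ‖τ‖ * C + 2 * s⁻¹ ^ 2 * ((|M₁| + |M₂|) * (1 + B₁ + B₂)) with hC'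
  have hτC : ‖τ‖ * C ≤ C' := by rw [hC']; linarith [show 0 ≤ 2 * s⁻¹ ^ 2 *
    ((|M₁| + |M₂|) * (1 + B₁ + B₂)) by positivity]
  refine ⟨C', by have := norm_pos_iff.2 hτ0; positivity, N, fun n z hn hz => ?_⟩
  obtain ⟨hn0, hX, hV, hY, hU⟩ := hN n hn
  have hsA := hKs hz
  have hDi := h.Di_ne_zero hsA
  have hDe := h.De_ne_zero hsA
  have hzn := pow_ne_zero n (h.ne_zero_of_lt hsA.1.1)
  have hzb : ∀ k, δ ≤ ‖a k - z‖ := fun k => by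
    rw [norm_sub_rev, ← dist_eq_norm]; exact not_lt.1 (hKb z hz k)
  have hlog : z ∉ logDiscs a (r / 2 / 4) := fun hzl => by
    obtain ⟨k, l, hl, e⟩ := mem_logDiscs.1 hzl
    exact hKb z hz k (e ▸ hball k l (by linarith))
  have hinv : ‖(n : ℂ)⁻¹‖ ≤ 1 := by
    rw [norm_inv, Complex.norm_natCast]
    exact inv_le_one_of_one_le₀ (by exact_mod_cast hn0)
  have hn' : (0 : ℝ) < n := Nat.cast_pos.2 hn0
  set p := poleSum a (fun j => (β j : ℂ) ^ 2) z
  set q := poleSum a (fun j => β j * Sk j (a j) * a j ^ n) z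
  have hpB : ‖(n : ℂ)⁻¹ * p‖ ≤ B₁ := by
    rw [norm_mul]
    exact (mul_le_of_le_one_left (norm_nonneg _) hinv).trans
      (norm_poleSum_le hδ h.norm_eq_one hzb le_rfl)
  have hqB : ‖(n : ℂ)⁻¹ * q‖ ≤ B₂ := by
    rw [norm_mul]
    refine (mul_le_of_le_one_left (norm_nonneg _) hinv).trans
      (norm_poleSum_le hδ h.norm_eq_one hzb (Finset.sum_le_sum fun k _ => ?_))
    rw [norm_mul, norm_pow, h.norm_eq_one, one_pow, mul_one]
  have hCn : C' / (n : ℝ) ^ 2 = C' * (n : ℝ)⁻¹ ^ 2 := by rw [inv_pow, div_eq_mul_inv]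
  have hC0 : 0 ≤ C' := (by positivity : 0 ≤ ‖τ‖ * C).trans hτC
  have hmain : ∀ f : ℂ, ‖f‖ ≤ C * (n : ℝ)⁻¹ ^ 2 → ‖τ * f‖ ≤ ‖τ‖ * C * (n : ℝ)⁻¹ ^ 2 :=
    fun f hf => by rw [norm_mul, mul_assoc]; gcongr
  have hrem : ∀ x f : ℂ, ∀ A : ℝ, ‖x‖ ≤ Real.exp (-s) → ‖f‖ ≤ A →
      A ≤ (|M₁| + |M₂|) * (1 + B₁ + B₂) →
      ‖x ^ n * f‖ ≤ 2 * s⁻¹ ^ 2 * ((|M₁| + |M₂|) * (1 + B₁ + B₂)) * (n : ℝ)⁻¹ ^ 2 := by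
    intro x f A hx hf hA
    have := pow_le_of_le_exp_neg (norm_nonneg x) hs0 hx hn0
    rw [norm_mul, norm_pow]
    calc _ ≤ (2 * s⁻¹ ^ 2 * (n : ℝ)⁻¹ ^ 2) * ((|M₁| + |M₂|) * (1 + B₁ + B₂)) := by
          gcongr; exact hf.trans hA
      _ = _ := by ring
  have h0 : ‖(0 : ℂ)‖ ≤ C' / (n : ℝ) ^ 2 := by rw [norm_zero]; positivity
  rw [hτ1]
  rcases lt_or_ge ‖z‖ (Real.exp s) with hlt | hge
  · rcases lt_or_ge (Real.exp (-s)) ‖z‖ with hgt | hle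
    · refine ⟨τ * (solutionX a β w W Di (Φ n) n z - τ⁻¹ - τ⁻¹ * (n : ℂ)⁻¹ * p),
        τ * (solutionY a β w W De (Φ n) n z - τ⁻¹ * (n : ℂ)⁻¹ * q), ?_, ?_, ?_⟩
      · rw [hCn]
        refine (hmain _ (hX z ⟨hlt, ?_⟩)).trans (by gcongr)
        rintro (hz1 | hz1)
        · exact hsA.2 (slits_mono (Ici_subset_Ici.2 zero_le_one) hz1)
        · exact hlog hz1
      · rw [hCn]
        refine (hmain _ (hY z ⟨hgt, ?_⟩ hsA.1.2)).trans (by gcongr)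
        rintro (hz1 | hz1)
        · exact hsA.2 (slits_mono Icc_subset_Ici_self hz1)
        · exact hlog hz1
      · rw [h.eval_eq_solution (Φ n) n hsA]
        field_simp
        ring
    · refine ⟨0, τ * ((Φ n).eval z * Di z - τ⁻¹ * (n : ℂ)⁻¹ * q) -
        z ^ n * (Di z * De z * (1 + (n : ℂ)⁻¹ * p)), h0, ?_, ?_⟩
      · rw [hCn, hC', add_mul]
        refine (norm_sub_le _ _).trans (add_le_add (hmain _ (hU z (hle.trans_lt ?_)))
          (hrem z _ (|M₁| * (1 + B₁)) hle ?_ ?_))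
        · rw [Real.exp_lt_exp]; linarith
        · rw [norm_mul]
          refine mul_le_mul ((hM₁ z hz).trans (le_abs_self _)) ((norm_add_le _ _).trans ?_)
            (norm_nonneg _) (abs_nonneg _)
          rw [norm_one]; gcongr
        · exact mul_le_mul (by linarith [abs_nonneg M₂]) (by linarith) (by positivity)
            (by positivity)
      · field_simp
        ring
  · refine ⟨τ * ((z ^ n)⁻¹ * (Φ n).eval z / De z - τ⁻¹ - τ⁻¹ * (n : ℂ)⁻¹ * p) -
      z⁻¹ ^ n * ((Di z * De z)⁻¹ * ((n : ℂ)⁻¹ * q)), 0, ?_, h0, ?_⟩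
    · rw [hCn, hC', add_mul]
      refine (norm_sub_le _ _).trans (add_le_add (hmain _ (hV z (hge.trans_lt' ?_) hsA.1.2))
        (hrem z⁻¹ _ (|M₂| * B₂) ?_ ?_ ?_))
      · rw [Real.exp_lt_exp]; linarith
      · rw [norm_inv, Real.exp_neg]; gcongr
      · rw [norm_mul]
        exact mul_le_mul ((hM₂ z hz).trans (le_abs_self _)) hqB (norm_nonneg _) (abs_nonneg _)
      · exact mul_le_mul (by linarith [abs_nonneg M₁]) (by linarith) (by positivity)
          (by positivity)
    · rw [inv_pow]
      field_simp
      ring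

theorem stmt1
    (ρ : ℝ) (hρ0 : 0 < ρ) (hρ1 : ρ < 1)
    (m : ℕ) (hm : 0 < m)
    (a : Fin m → ℂ) (ha : ∀ k, ‖a k‖ = 1) (ha' : Function.Injective a)
    (β : Fin m → ℝ) (hβ : ∀ k, -(1/2 : ℝ) < β k)
    (w : ℂ → ℂ)
    (hw_an : AnalyticOn ℂ w {z : ℂ | ρ < ‖z‖ ∧ ‖z‖ < 1/ρ})
    (hw_ne : ∀ z : ℂ, ρ < ‖z‖ → ‖z‖ < 1/ρ → w z ≠ 0)
    (hw_pos : ∀ z : ℂ, ‖z‖ = 1 → 0 < (w z).re ∧ (w z).im = 0)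
    (W : ℂ → ℝ)
    (hW : ∀ z : ℂ, ‖z‖ = 1 → W z = (w z).re * ∏ k, ‖z - a k‖ ^ (2 * β k))
    (Φ : ℕ → Polynomial ℂ)
    (hΦmonic : ∀ n, (Φ n).Monic) (hΦdeg : ∀ n, (Φ n).natDegree = n)
    (hΦorth : ∀ n : ℕ, ∀ j < n,
      (∫ θ in (0:ℝ)..(2 * π),
        (Φ n).eval (Complex.exp (θ * Complex.I)) *
          (starRingEnd ℂ) (Complex.exp (θ * Complex.I)) ^ j *
          (W (Complex.exp (θ * Complex.I)) : ℂ)) = 0)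
    (Di De : ℂ → ℂ)
    (hDi_def : ∀ z : ℂ, ‖z‖ < 1 → Di z =
      Complex.exp (((4 * π : ℝ)⁻¹ : ℂ) * ∫ θ in (0:ℝ)..(2 * π),
        (Real.log (W (Complex.exp (θ * Complex.I))) : ℂ) *
          ((Complex.exp (θ * Complex.I) + z) / (Complex.exp (θ * Complex.I) - z))))
    (hDe_def : ∀ z : ℂ, 1 < ‖z‖ → De z =
      Complex.exp (((4 * π : ℝ)⁻¹ : ℂ) * ∫ θ in (0:ℝ)..(2 * π),
        (Real.log (W (Complex.exp (θ * Complex.I))) : ℂ) *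
          ((Complex.exp (θ * Complex.I) + z) / (Complex.exp (θ * Complex.I) - z))))
    (hDi_an : AnalyticOn ℂ Di
      ({z : ℂ | ‖z‖ < 1/ρ} \ ⋃ k, (fun t : ℝ => (t : ℂ) * a k) '' Set.Ico 1 (1/ρ)))
    (hDe_an : AnalyticOn ℂ De
      ({z : ℂ | ρ < ‖z‖} \ ⋃ k, (fun t : ℝ => (t : ℂ) * a k) '' Set.Ioc ρ 1))
    (δ : ℝ) (hδ0 : 0 < δ) (hδρ : δ < 1 - ρ)
    (hδa : ∀ i j : Fin m, i ≠ j → 3 * δ < ‖a i - a j‖)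
    (Sk : Fin m → ℂ → ℂ)
    (hSk_an : ∀ k, AnalyticOn ℂ (Sk k) (Metric.ball (a k) δ))
    (hSk_plus : ∀ k, ∀ z ∈ Metric.ball (a k) δ, 0 < Complex.arg (z / a k) →
      Sk k z = Complex.exp (((π * β k : ℝ) : ℂ) * Complex.I) * (Di z * De z))
    (hSk_minus : ∀ k, ∀ z ∈ Metric.ball (a k) δ, Complex.arg (z / a k) < 0 →
      Sk k z = Complex.exp (-((π * β k : ℝ) : ℂ) * Complex.I) * (Di z * De z))
    (ϑ : Fin m → ℂ) (hϑ : ∀ k, ϑ k = Sk k (a k))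
    (τ : ℂ) (hτ : Filter.Tendsto De (Bornology.cobounded ℂ) (nhds τ))
    (hτ_pos : 0 < τ.re ∧ τ.im = 0)
    :
    ∀ K : Set ℂ, IsCompact K →
      K ⊆ ({z : ℂ | ρ < ‖z‖ ∧ ‖z‖ < 1/ρ} \
        ((⋃ k, Metric.ball (a k) δ) ∪
          ⋃ k, (fun t : ℝ => (t : ℂ) * a k) '' Set.Ioo ρ (1/ρ))) →
      ∃ C : ℝ, 0 < C ∧ ∃ N : ℕ, ∃ E₁ E₂ : ℕ → ℂ → ℂ,
        (∀ n : ℕ, N ≤ n → ∀ z ∈ K,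
          ‖E₁ n z‖ ≤ C / (n : ℝ) ^ 2 ∧ ‖E₂ n z‖ ≤ C / (n : ℝ) ^ 2) ∧
        (∀ n : ℕ, N ≤ n → ∀ z ∈ K,
          (Φ n).eval z =
            z ^ n * (De z / τ) *
              (1 + ((n : ℂ))⁻¹ * (∑ k, (a k) * (β k : ℂ) ^ 2 / (a k - z)) + E₁ n z) +
            (Di 0 / Di z) *
              (((n : ℂ))⁻¹ * (∑ k, (β k : ℂ) * ϑ k * (a k) ^ (n + 1) / (a k - z)) + E₂ n z)) := by
  have hdata : IsSzegoData ρ a β w W Di De :=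
    { pos := hρ0
      lt_one := hρ1
      norm_eq_one := ha
      inj := ha'
      exponent := hβ
      diff_w := hw_an.differentiableOn
      w_ne := hw_ne
      w_pos := hw_pos
      W_eq := hW
      Di_eq := hDi_def
      De_eq := hDe_def
      diff_Di := hDi_an.differentiableOn.mono
        (sdiff_subset_sdiff_right (slits_mono fun t ht => ht.1))
      diff_De := hDe_an.differentiableOn.mono
        (sdiff_subset_sdiff_right (slits_mono fun t ht => ⟨(hρ0.trans ht.1).le, ht.2⟩)) }
  have hcont : HasScatteringContinuation δ a β Di De Sk :=
    ⟨hδ0, hδa, fun k => (hSk_an k).differentiableOn, hSk_plus, hSk_minus⟩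
  have hτ0 : τ ≠ 0 := fun h0 => by simp [h0] at hτ_pos
  have hDi0 : Di 0 = τ⁻¹ := by
    refine eq_inv_of_mul_eq_one_left ?_
    rw [← hdata.Di_zero_mul hτ, Complex.conj_eq_iff_im.2 hτ_pos.2]
  intro K hK hKs
  have hKA : K ⊆ slitAnnulus ρ a := fun z hz => ⟨(hKs hz).1, fun hzs => by
    obtain ⟨k, t, ht, rfl⟩ := mem_slits.1 hzs
    have hn : ‖(t : ℂ) * a k‖ = t := by
      rw [norm_mul, ha, mul_one, Complex.norm_real, Real.norm_of_nonneg ht]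
    have hz' := (hKs hz).1
    rw [mem_ofPred_eq, hn] at hz'
    exact (hKs hz).2 (Or.inr (mem_slits.2 ⟨k, t, hz', rfl⟩))⟩
  obtain ⟨C, hC, N, hN⟩ := hdata.exists_asymptotics hcont ⟨hΦmonic, hΦdeg, hΦorth⟩ hτ hτ0 hDi0 hK
    hKA fun z hz k hk => (hKs hz).2 (Or.inl (mem_iUnion.2 ⟨k, hk⟩))
  choose! E₁ E₂ h₁ h₂ hE using hN
  refine ⟨C, hC, N, E₁, E₂, fun n hn z hz => ⟨h₁ n z hn hz, h₂ n z hn hz⟩, fun n hn z hz => ?_⟩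
  have e₁ : ∑ k, a k * (β k : ℂ) ^ 2 / (a k - z) = poleSum a (fun j => (β j : ℂ) ^ 2) z :=
    Finset.sum_congr rfl fun k _ => by rw [mul_comm]
  have e₂ : ∑ k, (β k : ℂ) * ϑ k * a k ^ (n + 1) / (a k - z) =
      poleSum a (fun j => β j * Sk j (a j) * a j ^ n) z :=
    Finset.sum_congr rfl fun k _ => by rw [hϑ, pow_succ, mul_assoc _ (a k ^ n)]
  rw [e₁, e₂]
  exact hE n z hn hz
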